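/- Let β ∈ ℝ \ {0,1}, let 1 < p₂, p₃ ≤ ∞ and 2/3 < r < ∞ with 1/p₂ + 1/p₃ = 1/r. Then there exists a constant C (depending on β, p₂, p₃) such that for all Schwartz functions f₂, f₃ on ℝ, the principal value lim_{ε→0⁺} ∫_{|t|>ε} f₂(x+βt) f₃(x+t) (1/t) dt exists for every x and ‖BHT_β(f₂,f₃)‖_{L^r(ℝ)} ≤ C ‖f₂‖_{L^{p₂}} ‖f₃‖_{L^{p₃}}. -/

import Mathlib

open MeasureTheory Filter Set
open scoped Topology ENNReal



namespace BHT

/-! ## Part A: dyadic intervals and weights -/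

/-- dyadic interval -/
def dy (I : ℤ × ℤ) : Set ℝ := Ico ((2:ℝ)^I.1 * I.2) ((2:ℝ)^I.1 * (I.2+1))

/-- length of a dyadic interval -/
noncomputable def ln (I : ℤ × ℤ) : ℝ := (2:ℝ)^I.1

/-- weight of a dyadic interval -/
noncomputable def w (I : ℤ × ℤ) (x : ℝ) : ℝ := (1 + |x / (2:ℝ)^I.1 - I.2|)⁻¹

lemma p2pos (k : ℤ) : (0:ℝ) < (2:ℝ)^k := zpow_pos (by norm_num) k

lemma ln_pos (I : ℤ × ℤ) : 0 < ln I := p2pos _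

lemma mem_dy {I : ℤ × ℤ} {x : ℝ} : x ∈ dy I ↔ ⌊x / (2:ℝ)^I.1⌋ = I.2 := by
  have := p2pos I.1
  rw [Int.floor_eq_iff, dy, mem_Ico, le_div_iff₀ this, div_lt_iff₀ this, mul_comm, mul_comm (_ + 1)]

lemma dy_mem_left (I : ℤ × ℤ) : (2:ℝ)^I.1 * I.2 ∈ dy I := by
  have := p2pos I.1
  refine ⟨le_rfl, ?_⟩
  nlinarith

lemma dy_nonempty (I : ℤ × ℤ) : (dy I).Nonempty := ⟨_, dy_mem_left I⟩

lemma floor_scale {k k' : ℤ} (h : k' ≤ k) (x : ℝ) :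
    ⌊x / (2:ℝ)^k⌋ = ⌊x / (2:ℝ)^k'⌋ / (((2:ℕ)^(k-k').toNat : ℕ) : ℤ) := by
  rw [← Int.floor_div_natCast]
  congr 1
  rw [div_div]
  congr 1
  obtain ⟨n, rfl⟩ : ∃ n : ℕ, k = k' + n := ⟨(k-k').toNat, by omega⟩
  simp
  rw [zpow_add₀ (by norm_num)]; simp

lemma dy_subset_of_mem {I J : ℤ × ℤ} (h : I.1 ≤ J.1) {x : ℝ} (hx : x ∈ dy I) (hx' : x ∈ dy J) :
    dy I ⊆ dy J := by
  intro y hy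
  rw [mem_dy] at *
  rw [floor_scale h] at *
  rw [hy, ← hx, hx']

/-- ancestor at scale `k` -/
noncomputable def anc (k : ℤ) (I : ℤ × ℤ) : ℤ × ℤ := (k, ⌊(2:ℝ)^I.1 * I.2 / (2:ℝ)^k⌋)

lemma subset_anc {k : ℤ} {I : ℤ × ℤ} (h : I.1 ≤ k) : dy I ⊆ dy (anc k I) :=
  dy_subset_of_mem (J := anc k I) h (dy_mem_left I) (mem_dy.2 rfl)

lemma measurableSet_dy (I : ℤ × ℤ) : MeasurableSet (dy I) := measurableSet_Ico

lemma volume_dy (I : ℤ × ℤ) : volume (dy I) = ENNReal.ofReal (ln I) := by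
  rw [dy, Real.volume_Ico]; congr 1; rw [ln]; ring

lemma volume_real_dy (I : ℤ × ℤ) : volume.real (dy I) = ln I := by
  rw [Measure.real, volume_dy, ENNReal.toReal_ofReal (ln_pos I).le]

lemma ln_le_of_subset {I J : ℤ × ℤ} (h : dy I ⊆ dy J) : ln I ≤ ln J := by
  have := measure_mono (μ := volume) h
  rw [volume_dy, volume_dy] at this
  exact (ENNReal.ofReal_le_ofReal_iff (ln_pos J).le).1 this

lemma scale_le_of_subset {I J : ℤ × ℤ} (h : dy I ⊆ dy J) : I.1 ≤ J.1 :=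
  (zpow_le_zpow_iff_right₀ (by norm_num : (1:ℝ) < 2)).1 (ln_le_of_subset h)

lemma dy_inj {I J : ℤ × ℤ} (h : I.1 = J.1) {x : ℝ} (hx : x ∈ dy I) (hx' : x ∈ dy J) : I = J := by
  rw [mem_dy] at *
  rw [h] at hx
  exact Prod.ext h (hx.symm.trans hx')

/-- two dyadic intervals sharing a point are nested -/
lemma dy_nested {I J : ℤ × ℤ} {x : ℝ} (hx : x ∈ dy I) (hx' : x ∈ dy J) : dy I ⊆ dy J ∨ dy J ⊆ dy I := by
  rcases le_total I.1 J.1 with h | h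
  · exact .inl (dy_subset_of_mem h hx hx')
  · exact .inr (dy_subset_of_mem h hx' hx)

lemma w_pos (I : ℤ × ℤ) (x : ℝ) : 0 < w I x := by unfold w; positivity

lemma w_le_one (I : ℤ × ℤ) (x : ℝ) : w I x ≤ 1 := by
  unfold w; exact inv_le_one_of_one_le₀ (by linarith [abs_nonneg (x / (2:ℝ)^I.1 - I.2)])

lemma w_continuous (I : ℤ × ℤ) : Continuous (w I) := by
  unfold w
  refine Continuous.inv₀ (by fun_prop) fun x => ?_
  positivity

lemma winv (I : ℤ × ℤ) (x : ℝ) : (w I x)⁻¹ = 1 + |x / (2:ℝ)^I.1 - I.2| := by unfold w; rw [inv_inv]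

/-- moving the point -/
lemma w_move (I : ℤ × ℤ) (x y : ℝ) : w I x ≤ (1 + |x - y| / ln I) * w I y := by
  have h := w_pos I x
  have h' := w_pos I y
  have e : (w I y)⁻¹ ≤ (1 + |x - y| / ln I) * (w I x)⁻¹ := by
    rw [winv, winv]
    have : |x - y| / ln I = |x/(2:ℝ)^I.1 - y / (2:ℝ)^I.1| := by
      rw [← sub_div, abs_div, abs_of_pos (p2pos _)]; rfl
    rw [this]
    set a := x/(2:ℝ)^I.1
    set b := y/(2:ℝ)^I.1
    have h1 : |b - I.2| ≤ |a - b| + |a - I.2| := by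
      have := abs_sub_le b a I.2; rw [abs_sub_comm b a] at this; exact this
    have h2 := mul_nonneg (abs_nonneg (a-b)) (abs_nonneg (a - I.2))
    nlinarith
  have h3 := mul_le_mul_of_nonneg_right e (mul_pos h h').le
  have e1 : (w I y)⁻¹ * (w I x * w I y) = w I x := by field_simp
  have e2 : (1 + |x - y| / ln I) * (w I x)⁻¹ * (w I x * w I y) = (1 + |x - y| / ln I) * w I y := by
    field_simp
  linarith

noncomputable def cW : ℝ := ∫ x : ℝ, ((1 + |x|)⁻¹)^2

lemma integrable_base : Integrable (fun x : ℝ => ((1 + |x|)⁻¹)^2) := by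
  have := integrable_one_add_norm (E := ℝ) (μ := volume) (r := 2) (by simp)
  refine this.congr (Eventually.of_forall fun x => ?_)
  have h : 0 < 1 + |x| := by positivity
  simp only [Real.norm_eq_abs]
  rw [Real.rpow_neg h.le, inv_pow]
  norm_cast

lemma integrable_w2 (I : ℤ × ℤ) : Integrable (fun x => (w I x)^2) := by
  have h := (integrable_base.comp_sub_right (I.2:ℝ)).comp_div (p2pos I.1).ne'
  exact h

lemma integral_w2 (I : ℤ × ℤ) : ∫ x, (w I x)^2 = cW * ln I := by
  have h1 := Measure.integral_comp_div (fun y : ℝ => ((1 + |y - I.2|)⁻¹)^2) ((2:ℝ)^I.1)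
  have h2 := integral_sub_right_eq_self (μ := volume) (fun y : ℝ => ((1 + |y|)⁻¹)^2) (I.2:ℝ)
  rw [h2, abs_of_pos (p2pos _)] at h1
  rw [mul_comm]
  exact h1

lemma cW_nonneg : 0 ≤ cW := integral_nonneg fun x => by positivity

lemma w_pow_le {N M : ℕ} (h : N ≤ M) (I : ℤ × ℤ) (x : ℝ) : w I x ^ M ≤ w I x ^ N :=
  pow_le_pow_of_le_one (w_pos I x).le (w_le_one I x) h

lemma integrable_wN {N : ℕ} (hN : 2 ≤ N) (I : ℤ × ℤ) : Integrable (fun x => (w I x)^N) := by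
  refine (integrable_w2 I).mono' ((w_continuous I).pow N).aestronglyMeasurable (Eventually.of_forall fun x => ?_)
  rw [Real.norm_of_nonneg (pow_nonneg (w_pos I x).le _)]
  exact w_pow_le hN I x

lemma integral_wN_le {N : ℕ} (hN : 2 ≤ N) (I : ℤ × ℤ) : ∫ x, (w I x)^N ≤ cW * ln I := by
  rw [← integral_w2]
  exact integral_mono (integrable_wN hN I) (integrable_w2 I) fun x => w_pow_le hN I x

/-- base sum constant -/
noncomputable def cS : ℝ := 4 * ∑' n : ℤ, ((1 + |(n:ℝ)|)⁻¹)^2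

lemma summable_base : Summable (fun n : ℤ => ((1 + |(n:ℝ)|)⁻¹)^2) := by
  have h : Summable (fun n : ℕ => ((1 + (n:ℝ))⁻¹)^2) := by
    have := (summable_nat_add_iff 1).2 (Real.summable_nat_pow_inv (p := 2) |>.2 (by norm_num))
    refine this.congr fun n => ?_
    push_cast; rw [add_comm, inv_pow]
  refine Summable.of_nat_of_neg (h.congr fun n => ?_) (h.congr fun n => ?_)
  · simp
  · simp

lemma sum_base_le (s : Finset ℤ) (y : ℝ) : ∑ m ∈ s, ((1 + |y - m|)⁻¹)^2 ≤ cS := by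
  have h1 : ∀ m : ℤ, ((1 + |y - m|)⁻¹)^2 ≤ 4 * ((1 + |((m - ⌊y⌋ : ℤ):ℝ)|)⁻¹)^2 := by
    intro m
    have hy := Int.floor_le y
    have hy' := Int.lt_floor_add_one y
    have a0 : (1 + |((m - ⌊y⌋ : ℤ):ℝ)|) ≤ 2 * (1 + |y - m|) := by
      push_cast
      have : |(m:ℝ) - ⌊y⌋| ≤ |y - m| + 1 := by
        rw [abs_le]; constructor <;> cases abs_cases (y - m) <;> linarith
      linarith [abs_nonneg (y - m)]
    have : (1 + |y - m|)⁻¹ ≤ 2 * (1 + |((m - ⌊y⌋ : ℤ):ℝ)|)⁻¹ := by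
      rw [← div_eq_mul_inv, inv_eq_one_div, div_le_div_iff₀ (by positivity) (by positivity)]
      linarith
    calc ((1 + |y - m|)⁻¹)^2 ≤ (2 * (1 + |((m - ⌊y⌋ : ℤ):ℝ)|)⁻¹)^2 := by gcongr
      _ = _ := by ring
  have h2 : Summable (fun m : ℤ => 4 * ((1 + |((m - ⌊y⌋ : ℤ):ℝ)|)⁻¹)^2) :=
    ((Equiv.subRight ⌊y⌋).summable_iff.2 summable_base).mul_left 4
  calc _ ≤ ∑ m ∈ s, 4 * ((1 + |((m - ⌊y⌋ : ℤ):ℝ)|)⁻¹)^2 := Finset.sum_le_sum fun m _ => h1 m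
    _ ≤ ∑' m : ℤ, 4 * ((1 + |((m - ⌊y⌋ : ℤ):ℝ)|)⁻¹)^2 :=
        h2.sum_le_tsum s fun m _ => by positivity
    _ = cS := by
        rw [tsum_mul_left, cS]
        congr 1
        exact (Equiv.subRight ⌊y⌋).tsum_eq (fun n : ℤ => ((1 + |(n:ℝ)|)⁻¹)^2)

lemma sum_w_le (s : Finset ℤ) (k : ℤ) (x : ℝ) : ∑ m ∈ s, w (k, m) x ^ 2 ≤ cS := by
  have h := sum_base_le s (x / (2:ℝ)^k)
  exact h

lemma cS_nonneg : 0 ≤ cS := by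
  have := sum_base_le ∅ 0; simpa using this

/-- distance factor `(1 + |x_I - x_J|/2^k)⁻¹` is `w I (left J)`. -/
lemma w_mul_le {I J : ℤ × ℤ} (h : J.1 ≤ I.1) (x : ℝ) : w I x * w J x ≤ w I ((2:ℝ)^J.1 * J.2) := by
  have hm := w_move I x ((2:ℝ)^J.1 * J.2)
  have hJ : (w J x)⁻¹ = 1 + |x - (2:ℝ)^J.1 * J.2| / ln J := by
    rw [winv, ln]
    congr 1
    rw [← abs_of_pos (p2pos J.1), ← abs_div, abs_of_pos (p2pos J.1), sub_div, mul_div_cancel_left₀ _ (p2pos _).ne']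
  have hl : ln J ≤ ln I := zpow_le_zpow_right₀ (by norm_num) h
  have h2 : 1 + |x - (2:ℝ)^J.1 * J.2| / ln I ≤ (w J x)⁻¹ := by
    rw [hJ]
    have := ln_pos J
    gcongr
  have hJp := w_pos J x
  calc w I x * w J x ≤ ((1 + |x - (2:ℝ)^J.1 * J.2| / ln I) * w I ((2:ℝ)^J.1 * J.2)) * w J x := by gcongr
    _ ≤ ((w J x)⁻¹ * w I ((2:ℝ)^J.1 * J.2)) * w J x := by
        have := w_pos I ((2:ℝ)^J.1 * J.2)
        gcongr
    _ = _ := by field_simp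

lemma integrable_ww {N : ℕ} (hN : 2 ≤ N) (I J : ℤ × ℤ) : Integrable (fun x => w I x ^ N * w J x ^ N) := by
  refine (integrable_wN hN I).mono' (((w_continuous I).pow N).mul ((w_continuous J).pow N)).aestronglyMeasurable
    (Eventually.of_forall fun x => ?_)
  have h1 := pow_nonneg (w_pos I x).le N
  have h2 := pow_nonneg (w_pos J x).le N
  rw [Real.norm_of_nonneg (mul_nonneg h1 h2)]
  exact mul_le_of_le_one_right h1 (pow_le_one₀ (w_pos J x).le (w_le_one J x))

lemma integral_ww_le {M : ℕ} {I J : ℤ × ℤ} (h : J.1 ≤ I.1) :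
    ∫ x, w I x ^ (M+2) * w J x ^ (M+2) ≤ cW * ln J * w I ((2:ℝ)^J.1 * J.2) ^ M := by
  rw [← integral_w2, ← integral_mul_const]
  refine integral_mono (integrable_ww (by omega) I J) ((integrable_w2 J).mul_const _) fun x => ?_
  have h1 := w_pos I x
  have h2 := w_pos J x
  calc w I x ^ (M+2) * w J x ^ (M+2) = w I x ^ 2 * (w J x ^ 2 * (w I x * w J x)^M) := by ring
    _ ≤ 1 * (w J x ^ 2 * w I ((2:ℝ)^J.1 * J.2) ^ M) := by
        gcongr
        · exact pow_le_one₀ h1.le (w_le_one I x)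
        · exact w_mul_le h x
    _ = _ := by ring

/-- fibre counting -/
lemma sum_fiber_le {ι κ : Type*} [DecidableEq κ] (s : Finset ι) (t : Finset κ) (g : ι → κ)
    (h : ∀ i ∈ s, g i ∈ t) (f : ι → ℝ) (B : ℝ) (hB : ∀ j ∈ t, ∑ i ∈ s with g i = j, f i ≤ B) :
    ∑ i ∈ s, f i ≤ t.card * B := by
  rw [← Finset.sum_fiberwise_of_maps_to h, ← nsmul_eq_mul]
  exact Finset.sum_le_card_nsmul _ _ _ hB

/-- integers in a bounded interval -/
lemma card_int_le (a b L : ℝ) (h : b - a ≤ L) (hL : 0 ≤ L) : ((Finset.Icc ⌈a⌉ ⌊b⌋).card : ℝ) ≤ L + 1 := by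
  rw [Int.card_Icc]
  have h1 := Int.le_ceil a
  have h2 := Int.floor_le b
  rcases le_or_gt 0 (⌊b⌋ + 1 - ⌈a⌉) with h0 | h0
  · have : (((⌊b⌋ + 1 - ⌈a⌉).toNat : ℤ) : ℝ) = ((⌊b⌋ + 1 - ⌈a⌉ : ℤ) : ℝ) := by
      rw [Int.toNat_of_nonneg h0]
    rw [Int.cast_natCast] at this
    rw [this]; push_cast; linarith
  · rw [Int.toNat_of_nonpos h0.le]; simp; linarith

/-! ### geometric sums over finite sets of integers -/
lemma geom_up (s : Finset ℤ) (j : ℤ) (h : ∀ k ∈ s, j ≤ k) : ∑ k ∈ s, (2:ℝ)^(j - k) ≤ 2 := by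
  have h1 : ∑ k ∈ s, (2:ℝ)^(j - k) = ∑ n ∈ s.image (fun k => (k - j).toNat), (1/2:ℝ)^n := by
    rw [Finset.sum_image]
    · refine Finset.sum_congr rfl fun k hk => ?_
      have := h k hk
      obtain ⟨n, rfl⟩ : ∃ n : ℕ, k = j + n := ⟨(k-j).toNat, by omega⟩
      simp
    · intro a ha b hb hab
      have := h a ha; have := h b hb
      simp only at hab
      omega
  rw [h1]
  have := (summable_geometric_two).sum_le_tsum (s.image (fun k => (k - j).toNat)) (fun i _ => by positivity)
  rw [tsum_geometric_two] at this
  exact this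

lemma geom_down (s : Finset ℤ) (j : ℤ) (h : ∀ k ∈ s, k ≤ j) : ∑ k ∈ s, (2:ℝ)^(k - j) ≤ 2 := by
  have := geom_up (s.image (fun k => -k)) (-j) (by simp; intro a ha; exact h a ha)
  rw [Finset.sum_image (by intro a _ b _ h; simpa using h)] at this
  refine le_trans (le_of_eq (Finset.sum_congr rfl fun k _ => ?_)) this
  congr 1; ring

end BHT



namespace BHT

/-! ## Part B: tiles and packet systems -/

/-- tiles `(k, m, l)` -/
abbrev Tile := ℤ × ℤ × ℤ

def iv (P : Tile) : ℤ × ℤ := (P.1, P.2.1)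

noncomputable def th (v : ℝ) (P : Tile) (ξ : ℝ) : ℝ := (2:ℝ)^P.1 * ξ - (P.2.2 + v)

noncomputable def fr (v γ : ℝ) (P : Tile) : ℝ := (P.2.2 + v + γ) / (2:ℝ)^P.1

noncomputable def ip (φ : Tile → ℝ → ℂ) (P Q : Tile) : ℂ := ∫ x, φ P x * (starRingEnd ℂ) (φ Q x)

/-- packet system -/
structure PS (φ : Tile → ℝ → ℂ) (v γ ρ R C : ℝ) (N : ℕ) : Prop where
  ρpos : 0 < ρ
  Cpos : 0 < C
  hR : |γ| + 2 * ρ ≤ R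
  cont : ∀ P, Continuous (φ P)
  decay : ∀ P x, ‖φ P x‖ ≤ C * w (iv P) x ^ N
  orth : ∀ P Q, ρ * (1 / (2:ℝ)^P.1 + 1 / (2:ℝ)^Q.1) < |fr v γ P - fr v γ Q| → ip φ P Q = 0
  osc : ∀ ξ : ℝ, ∃ e : ℝ → ℂ, (∀ x, ‖e x‖ = 1) ∧ ∀ P, |th v P ξ| ≤ R → ∀ x x' : ℝ, |x - x'| ≤ (2:ℝ)^P.1 →
    ‖e x * φ P x - e x' * φ P x'‖ ≤ C * (|x - x'| / (2:ℝ)^P.1) * w (iv P) x ^ N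

/-- sums of weights over tiles with controlled frequencies -/
lemma sum_tile_w (S : Finset Tile) (Ks : Finset ℤ) (a : ℤ → ℝ) (L : ℝ) (hL : 0 ≤ L) (hk : ∀ P ∈ S, P.1 ∈ Ks)
    (hl : ∀ P ∈ S, a P.1 ≤ P.2.2 ∧ (P.2.2 : ℝ) ≤ a P.1 + L) (c : ℤ → ℝ) (hc : ∀ k, 0 ≤ c k) (x : ℝ) :
    ∑ P ∈ S, c P.1 * w (iv P) x ^ 2 ≤ (L + 1) * cS * ∑ k ∈ Ks, c k := by
  rw [← Finset.sum_fiberwise_of_maps_to (g := fun P : Tile => P.1) (t := Ks) hk, Finset.mul_sum]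
  refine Finset.sum_le_sum fun k _ => ?_
  have h1 : ∑ P ∈ S with P.1 = k, c P.1 * w (iv P) x ^ 2 ≤
      ((Finset.Icc ⌈a k⌉ ⌊a k + L⌋).card : ℝ) * (c k * cS) := by
    refine sum_fiber_le _ _ (fun P => P.2.2) ?_ _ _ ?_
    · intro P hP
      rw [Finset.mem_filter] at hP
      obtain ⟨hP, rfl⟩ := hP
      have := hl P hP
      rw [Finset.mem_Icc]
      exact ⟨Int.ceil_le.2 this.1, Int.le_floor.2 this.2⟩
    · intro l _
      have e : ∑ P ∈ (S.filter (fun P => P.1 = k)).filter (fun P => P.2.2 = l), c P.1 * w (iv P) x ^ 2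
          = ∑ m ∈ ((S.filter (fun P => P.1 = k)).filter (fun P => P.2.2 = l)).image (fun P => P.2.1),
            c k * w (k, m) x ^ 2 := by
        rw [Finset.sum_image]
        · refine Finset.sum_congr rfl fun P hP => ?_
          rw [Finset.mem_filter, Finset.mem_filter] at hP
          rw [← hP.1.2]; rfl
        · rintro ⟨k1, m1, l1⟩ h1 ⟨k2, m2, l2⟩ h2 h
          simp only [Finset.coe_filter, Finset.mem_filter, Set.mem_ofPred_eq] at h1 h2 h
          obtain ⟨⟨_, rfl⟩, rfl⟩ := h1
          obtain ⟨⟨_, rfl⟩, rfl⟩ := h2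
          rw [h]
      rw [e, ← Finset.mul_sum]
      exact mul_le_mul_of_nonneg_left (sum_w_le _ _ _) (hc k)
  refine h1.trans ?_
  have := card_int_le (a k) (a k + L) L (by linarith) hL
  calc _ ≤ (L+1) * (c k * cS) := mul_le_mul_of_nonneg_right this (mul_nonneg (hc k) cS_nonneg)
    _ = _ := by ring

section
variable {φ : Tile → ℝ → ℂ} {v γ ρ R C : ℝ} {N : ℕ}

lemma PS.integrable_mul (h : PS φ v γ ρ R C N) (hN : 2 ≤ N) (P Q : Tile) :
    Integrable (fun x => φ P x * (starRingEnd ℂ) (φ Q x)) := by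
  refine ((integrable_ww hN (iv P) (iv Q)).const_mul (C*C)).mono'
    ((h.cont P).mul (Complex.continuous_conj.comp (h.cont Q))).aestronglyMeasurable (Eventually.of_forall fun x => ?_)
  rw [norm_mul, RCLike.norm_conj]
  calc _ ≤ (C * w (iv P) x ^ N) * (C * w (iv Q) x ^ N) := by
        gcongr
        · exact mul_nonneg h.Cpos.le (pow_nonneg (w_pos _ _).le _)
        · exact h.decay P x
        · exact h.decay Q x
    _ = _ := by ring

lemma PS.ip_le (h : PS φ v γ ρ R C N) (hN : 2 ≤ N) (P Q : Tile) :
    ‖ip φ P Q‖ ≤ C * C * ∫ x, w (iv P) x ^ N * w (iv Q) x ^ N := by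
  rw [← integral_const_mul]
  refine norm_integral_le_of_norm_le ((integrable_ww hN _ _).const_mul _) (Eventually.of_forall fun x => ?_)
  rw [norm_mul, RCLike.norm_conj]
  calc _ ≤ (C * w (iv P) x ^ N) * (C * w (iv Q) x ^ N) := by
        gcongr
        · exact mul_nonneg h.Cpos.le (pow_nonneg (w_pos _ _).le _)
        · exact h.decay P x
        · exact h.decay Q x
    _ = _ := by ring

lemma ip_symm (φ : Tile → ℝ → ℂ) (P Q : Tile) : ‖ip φ P Q‖ = ‖ip φ Q P‖ := by
  have : ip φ Q P = (starRingEnd ℂ) (ip φ P Q) := by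
    unfold ip
    rw [← integral_conj]
    congr 1; ext x; simp [mul_comm]
  rw [this, RCLike.norm_conj]

lemma PS.integrable_sum_sq (h : PS φ v γ ρ R C N) (hN : 2 ≤ N) (S : Finset Tile) (a : Tile → ℂ) :
    Integrable (fun x => ‖∑ P ∈ S, a P * φ P x‖^2) ∧
    ∫ x, ‖∑ P ∈ S, a P * φ P x‖^2 ≤ ∑ P ∈ S, ∑ Q ∈ S, ‖a P‖ * ‖a Q‖ * ‖ip φ P Q‖ := by
  have e : ∀ x, ((‖∑ P ∈ S, a P * φ P x‖^2 : ℝ) : ℂ) =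
      ∑ P ∈ S, ∑ Q ∈ S, (a P * (starRingEnd ℂ) (a Q)) * (φ P x * (starRingEnd ℂ) (φ Q x)) := by
    intro x
    have := Complex.mul_conj' (∑ P ∈ S, a P * φ P x)
    push_cast
    rw [← this, map_sum, Finset.sum_mul_sum]
    refine Finset.sum_congr rfl fun P _ => Finset.sum_congr rfl fun Q _ => ?_
    rw [map_mul]; ring
  have hi : Integrable (fun x => ∑ P ∈ S, ∑ Q ∈ S, (a P * (starRingEnd ℂ) (a Q)) * (φ P x * (starRingEnd ℂ) (φ Q x))) :=
    integrable_finsetSum _ fun P _ => integrable_finsetSum _ fun Q _ => (h.integrable_mul hN P Q).const_mul _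
  have hi' : Integrable (fun x => ((‖∑ P ∈ S, a P * φ P x‖^2 : ℝ) : ℂ)) := by simpa only [e] using hi
  have hi'' : Integrable (fun x => ‖∑ P ∈ S, a P * φ P x‖^2) := by
    have := hi'.re
    simpa only [RCLike.re_to_complex, Complex.ofReal_re] using this
  refine ⟨hi'', ?_⟩
  have h0 : 0 ≤ ∫ x, ‖∑ P ∈ S, a P * φ P x‖^2 := integral_nonneg fun x => by positivity
  calc ∫ x, ‖∑ P ∈ S, a P * φ P x‖^2 = ‖((∫ x, ‖∑ P ∈ S, a P * φ P x‖^2 : ℝ) : ℂ)‖ := by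
        rw [Complex.norm_real, Real.norm_of_nonneg h0]
    _ = ‖∑ P ∈ S, ∑ Q ∈ S, (a P * (starRingEnd ℂ) (a Q)) * ip φ P Q‖ := by
        rw [← integral_complex_ofReal]
        simp_rw [e]
        rw [integral_finsetSum _ fun P _ => integrable_finsetSum _ fun Q _ => (h.integrable_mul hN P Q).const_mul _]
        congr 1
        refine Finset.sum_congr rfl fun P _ => ?_
        rw [integral_finsetSum _ fun Q _ => (h.integrable_mul hN P Q).const_mul _]
        refine Finset.sum_congr rfl fun Q _ => ?_
        rw [integral_const_mul]; rfl
    _ ≤ _ := by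
        refine (norm_sum_le _ _).trans (Finset.sum_le_sum fun P _ => (norm_sum_le _ _).trans (Finset.sum_le_sum fun Q _ => ?_))
        rw [norm_mul, norm_mul, RCLike.norm_conj]

/-- row bound, near-diagonal scales -/
lemma PS.row_near (h : PS φ v γ ρ R C N) (hN : 2 ≤ N) (K : ℕ) (S : Finset Tile) (P : Tile) :
    ∑ Q ∈ S with |P.1 - Q.1| ≤ K, ‖ip φ P Q‖ ≤ C * C * ((2 * ρ * (2^K + 1) + 1) * cS * (2 * K + 1) * cW) * (2:ℝ)^P.1 := by
  set S' := S.filter (fun Q => |P.1 - Q.1| ≤ K ∧ ip φ P Q ≠ 0) with hS'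
  have e : ∑ Q ∈ S with |P.1 - Q.1| ≤ K, ‖ip φ P Q‖ = ∑ Q ∈ S', ‖ip φ P Q‖ := by
    rw [hS', ← Finset.filter_filter]
    symm
    refine Finset.sum_filter_of_ne fun Q _ hne => ?_
    simpa using hne
  have hρ := h.ρpos
  have hpt : ∀ x, ∑ Q ∈ S', w (iv Q) x ^ 2 ≤ (2 * ρ * (2^K + 1) + 1) * cS * (2 * K + 1) := by
    intro x
    have := sum_tile_w S' (Finset.Icc (P.1 - K) (P.1 + K))
      (fun k => (2:ℝ)^k * fr v γ P - v - γ - ρ * (2^K+1)) (2 * ρ * (2^K + 1)) (by positivity) ?_ ?_ (fun _ => 1)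
      (fun _ => by norm_num) x
    · simp only [one_mul, Finset.sum_const, Int.card_Icc, nsmul_eq_mul, mul_one] at this
      have e : ((P.1 + K + 1 - (P.1 - K)).toNat : ℝ) = 2 * K + 1 := by
        have : (P.1 + K + 1 - (P.1 - K)).toNat = 2 * K + 1 := by omega
        rw [this]; push_cast; ring
      rwa [e] at this
    · intro Q hQ
      simp only [hS', Finset.mem_filter, abs_le] at hQ
      rw [Finset.mem_Icc]; omega
    · intro Q hQ
      simp only [hS', Finset.mem_filter, abs_le] at hQ
      obtain ⟨_, hk, hne⟩ := hQ
      have h1 : |fr v γ P - fr v γ Q| ≤ ρ * (1 / (2:ℝ)^P.1 + 1 / (2:ℝ)^Q.1) := by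
        by_contra hcon
        exact hne (h.orth P Q (not_le.1 hcon))
      have hq := p2pos Q.1
      have hp := p2pos P.1
      have h2 : (2:ℝ)^Q.1 * fr v γ Q = Q.2.2 + v + γ := by unfold fr; field_simp
      have h3 : (2:ℝ)^Q.1 / (2:ℝ)^P.1 ≤ 2^K := by
        rw [← zpow_sub₀ (by norm_num), ← zpow_natCast]
        exact zpow_le_zpow_right₀ (by norm_num) (by omega)
      have h4 : (2:ℝ)^Q.1 * |fr v γ P - fr v γ Q| ≤ ρ * (2^K + 1) := by
        calc _ ≤ (2:ℝ)^Q.1 * (ρ * (1 / (2:ℝ)^P.1 + 1 / (2:ℝ)^Q.1)) := by gcongr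
          _ = ρ * ((2:ℝ)^Q.1 / (2:ℝ)^P.1 + 1) := by field_simp
          _ ≤ _ := by gcongr
      rw [← abs_of_pos hq, ← abs_mul, mul_sub, h2, abs_le] at h4
      constructor <;> linarith [h4.1, h4.2]
  rw [e]
  have hw : Integrable (fun x => w (iv P) x ^ 2 * ∑ Q ∈ S', w (iv Q) x ^ 2) := by
    simp_rw [Finset.mul_sum]
    exact integrable_finsetSum _ fun Q _ => integrable_ww le_rfl _ _
  have hCC : 0 ≤ C * C := mul_self_nonneg C
  calc ∑ Q ∈ S', ‖ip φ P Q‖ ≤ ∑ Q ∈ S', C * C * ∫ x, w (iv P) x ^ 2 * w (iv Q) x ^ 2 := by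
        refine Finset.sum_le_sum fun Q _ => (h.ip_le hN P Q).trans ?_
        refine mul_le_mul_of_nonneg_left ?_ hCC
        refine integral_mono (integrable_ww hN _ _) (integrable_ww le_rfl _ _) fun x => ?_
        exact mul_le_mul (w_pow_le hN _ _) (w_pow_le hN _ _) (pow_nonneg (w_pos _ _).le _) (pow_nonneg (w_pos _ _).le _)
    _ = C * C * ∫ x, w (iv P) x ^ 2 * ∑ Q ∈ S', w (iv Q) x ^ 2 := by
        rw [← Finset.mul_sum, ← integral_finsetSum _ fun Q _ => integrable_ww le_rfl _ _]
        simp_rw [Finset.mul_sum]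
    _ ≤ C * C * ∫ x, w (iv P) x ^ 2 * ((2 * ρ * (2^K + 1) + 1) * cS * (2 * K + 1)) := by
        refine mul_le_mul_of_nonneg_left ?_ hCC
        refine integral_mono hw ((integrable_w2 _).mul_const _) fun x => ?_
        exact mul_le_mul_of_nonneg_left (hpt x) (pow_nonneg (w_pos _ _).le _)
    _ = _ := by
        rw [integral_mul_const, integral_w2]
        simp only [ln, iv]; ring

/-- near-diagonal Schur -/
lemma PS.near (h : PS φ v γ ρ R C N) (hN : 2 ≤ N) (K : ℕ) (S : Finset Tile) (a : Tile → ℂ) :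
    ∑ P ∈ S, ∑ Q ∈ S with |P.1 - Q.1| ≤ K, ‖a P‖ * ‖a Q‖ * ‖ip φ P Q‖ ≤
     (C * C * ((2 * ρ * (2^K + 1) + 1) * cS * (2 * K + 1) * cW)) * ∑ P ∈ S, (2:ℝ)^P.1 * ‖a P‖^2 := by
  set D := C * C * ((2 * ρ * (2^K + 1) + 1) * cS * (2 * K + 1) * cW)
  have h1 : ∑ P ∈ S, ∑ Q ∈ S with |P.1 - Q.1| ≤ K, ‖a P‖^2 * ‖ip φ P Q‖ ≤ D * ∑ P ∈ S, (2:ℝ)^P.1 * ‖a P‖^2 := by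
    rw [Finset.mul_sum]
    refine Finset.sum_le_sum fun P _ => ?_
    rw [← Finset.mul_sum]
    calc _ ≤ ‖a P‖^2 * (D * (2:ℝ)^P.1) := mul_le_mul_of_nonneg_left (h.row_near hN K S P) (by positivity)
      _ = _ := by ring
  have h2 : ∑ P ∈ S, ∑ Q ∈ S with |P.1 - Q.1| ≤ K, ‖a Q‖^2 * ‖ip φ P Q‖ =
      ∑ P ∈ S, ∑ Q ∈ S with |P.1 - Q.1| ≤ K, ‖a P‖^2 * ‖ip φ P Q‖ := by
    simp_rw [Finset.sum_filter]
    rw [Finset.sum_comm]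
    refine Finset.sum_congr rfl fun P _ => Finset.sum_congr rfl fun Q _ => ?_
    rw [abs_sub_comm, ip_symm]
  have h3 : ∑ P ∈ S, ∑ Q ∈ S with |P.1 - Q.1| ≤ K, ‖a P‖ * ‖a Q‖ * ‖ip φ P Q‖ ≤
      (1/2) * (∑ P ∈ S, ∑ Q ∈ S with |P.1 - Q.1| ≤ K, ‖a P‖^2 * ‖ip φ P Q‖) +
      (1/2) * ∑ P ∈ S, ∑ Q ∈ S with |P.1 - Q.1| ≤ K, ‖a Q‖^2 * ‖ip φ P Q‖ := by
    simp_rw [Finset.mul_sum, ← Finset.sum_add_distrib]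
    refine Finset.sum_le_sum fun P _ => Finset.sum_le_sum fun Q _ => ?_
    have := two_mul_le_add_sq (‖a P‖) (‖a Q‖)
    nlinarith [norm_nonneg (ip φ P Q)]
  linarith

end

end BHT



namespace BHT

/-! ## Part C: trees and the counting estimate -/

def ftree (v R : ℝ) (t : (ℤ × ℤ) × ℝ) (P : Tile) : Prop := dy (iv P) ⊆ dy t.1 ∧ |th v P t.2| ≤ R

def lac (v γ ρ ε ξ : ℝ) (P : Tile) : Prop := 2 * ρ ≤ ε * (γ - th v P ξ)

noncomputable def cf (φ : Tile → ℝ → ℂ) (f : ℝ → ℂ) (P : Tile) : ℂ := ((2:ℝ)^P.1 : ℂ)⁻¹ * ∫ x, f x * φ P x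

/-- bounded integrable measurable functions -/
structure Nice (f : ℝ → ℂ) : Prop where
  meas : Measurable f
  int : Integrable f
  bdd : ∃ M, ∀ x, ‖f x‖ ≤ M

section
variable {φ : Tile → ℝ → ℂ} {v γ ρ R C : ℝ} {N : ℕ}

lemma PS.mono (h : PS φ v γ ρ R C N) {M : ℕ} (hM : M ≤ N) : PS φ v γ ρ R C M where
  ρpos := h.ρpos
  Cpos := h.Cpos
  hR := h.hR
  cont := h.cont
  decay P x := (h.decay P x).trans (mul_le_mul_of_nonneg_left (w_pow_le hM _ _) h.Cpos.le)
  orth := h.orth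
  osc ξ := by
    obtain ⟨e, he, H⟩ := h.osc ξ
    refine ⟨e, he, fun P hP x x' hx => (H P hP x x' hx).trans ?_⟩
    have := h.Cpos
    have := p2pos P.1
    exact mul_le_mul_of_nonneg_left (w_pow_le hM _ _) (by positivity)

lemma geo {ε : ℝ} (hε : ε = 1 ∨ ε = -1) (hρ : 0 < ρ) (hR : |γ| + 2 * ρ ≤ R) {K : ℕ} (hK : |γ| + R + 3 * ρ ≤ ρ * 2^K)
    {P Q : Tile} {ξ ξ' : ℝ} (hP : |th v P ξ| ≤ R) (hQ : lac v γ ρ ε ξ' Q) (hk : Q.1 + K < P.1)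
    (hfr : |fr v γ P - fr v γ Q| ≤ ρ * (1 / (2:ℝ)^Q.1 + 3 / (2:ℝ)^P.1)) :
    ε * ξ' < ε * ξ ∧ |th v Q ξ| ≤ R := by
  have hp := p2pos P.1
  have hq := p2pos Q.1
  set p := (2:ℝ)^P.1 with hpdef
  set q := (2:ℝ)^Q.1 with hqdef
  have hpq : q * 2^K < p := by
    rw [hpdef, hqdef, ← zpow_natCast, ← zpow_add₀ (by norm_num)]
    exact zpow_lt_zpow_right₀ (by norm_num) hk
  have hA : fr v γ P - ξ = (γ - th v P ξ) / p := by
    unfold fr th; rw [← hpdef]; field_simp; ring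
  have hB : fr v γ Q - ξ' = (γ - th v Q ξ') / q := by
    unfold fr th; rw [← hqdef]; field_simp; ring
  have hB2 : th v Q ξ = γ - q * (fr v γ Q - ξ) := by
    unfold fr th; rw [← hqdef]; field_simp; ring
  have hA' : |fr v γ P - ξ| ≤ (|γ| + R) / p := by
    rw [hA, abs_div, abs_of_pos hp]
    gcongr
    exact (abs_sub _ _).trans (by linarith)
  have hG : (|γ| + R) / p + 3 * ρ / p < ρ / q := by
    rw [← add_div, div_lt_div_iff₀ hp hq]
    calc (|γ| + R + 3 * ρ) * q ≤ ρ * 2^K * q := by gcongr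
      _ = ρ * (q * 2^K) := by ring
      _ < ρ * p := by gcongr
  have hfr' : |fr v γ P - fr v γ Q| ≤ ρ / q + 3 * ρ / p := by
    refine hfr.trans (le_of_eq ?_); ring
  constructor
  · have hB' : 2 * ρ / q ≤ ε * (fr v γ Q - ξ') := by
      rw [hB, ← mul_div_assoc]; exact (div_le_div_iff_of_pos_right hq).2 hQ
    have e1 : ε * (fr v γ P - ξ) ≤ (|γ| + R) / p := by
      refine (le_abs_self _).trans ?_
      rw [abs_mul]; rcases hε with rfl | rfl <;> simpa using hA'
    have e2 : -(ρ / q + 3 * ρ / p) ≤ ε * (fr v γ P - fr v γ Q) := by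
      have := neg_abs_le (ε * (fr v γ P - fr v γ Q))
      rw [abs_mul] at this
      rcases hε with rfl | rfl <;> simp at this ⊢ <;> linarith
    have e3 : 2 * ρ / q = ρ / q + ρ / q := by ring
    nlinarith
  · rw [hB2]
    have e1 : |fr v γ Q - ξ| ≤ 2 * ρ / q := by
      have : fr v γ Q - ξ = (fr v γ P - ξ) - (fr v γ P - fr v γ Q) := by ring
      rw [this]
      have e3 : 2 * ρ / q = ρ / q + ρ / q := by ring
      exact (abs_sub _ _).trans (by linarith)
    have e2 : q * |fr v γ Q - ξ| ≤ 2 * ρ := by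
      calc _ ≤ q * (2 * ρ / q) := by gcongr
        _ = _ := by field_simp
    refine (abs_sub _ _).trans ?_
    rw [abs_mul, abs_of_pos hq]; linarith

lemma PS.meet (h : PS φ v γ ρ R C N) {P Q : Tile} (hne : ip φ P Q ≠ 0) :
    |fr v γ P - fr v γ Q| ≤ ρ * (1 / (2:ℝ)^P.1 + 1 / (2:ℝ)^Q.1) := by
  by_contra hcon
  exact hne (h.orth P Q (not_le.1 hcon))

lemma PS.meet' (h : PS φ v γ ρ R C N) {P Q : Tile} (hne : ip φ P Q ≠ 0) :
    |fr v γ P - fr v γ Q| ≤ ρ * (1 / (2:ℝ)^Q.1 + 3 / (2:ℝ)^P.1) := by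
  refine (h.meet hne).trans ?_
  have := p2pos P.1
  refine mul_le_mul_of_nonneg_left ?_ h.ρpos.le
  have : 1 / (2:ℝ)^P.1 ≤ 3 / (2:ℝ)^P.1 := by gcongr; norm_num
  linarith

/-- the near-diagonal constant -/
noncomputable def nD (C ρ : ℝ) (K : ℕ) : ℝ := C * C * ((2 * ρ * (2^K + 1) + 1) * cS * (2 * K + 1) * cW)

lemma PS.nD_nonneg (h : PS φ v γ ρ R C N) (K : ℕ) : 0 ≤ nD C ρ K := by
  have := h.ρpos; have := h.Cpos; have := cS_nonneg; have := cW_nonneg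
  unfold nD; positivity

/-- almost orthogonality in a lacunary tree -/
lemma PS.lac_sq (h : PS φ v γ ρ R C N) (hN : 2 ≤ N) {K : ℕ} (hK : |γ| + R + 3 * ρ ≤ ρ * 2^K)
    {ε : ℝ} (hε : ε = 1 ∨ ε = -1) {ξ : ℝ} (S : Finset Tile) (hS : ∀ P ∈ S, |th v P ξ| ≤ R ∧ lac v γ ρ ε ξ P)
    (a : Tile → ℂ) :
    ∫ x, ‖∑ P ∈ S, a P * φ P x‖^2 ≤ nD C ρ K * ∑ P ∈ S, (2:ℝ)^P.1 * ‖a P‖^2 := by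
  refine (h.integrable_sum_sq hN S a).2.trans (le_trans (le_of_eq ?_) (h.near hN K S a))
  refine Finset.sum_congr rfl fun P hP => ?_
  rw [Finset.sum_filter_of_ne]
  intro Q hQ hne
  by_contra hcon
  have hip : ip φ P Q ≠ 0 := fun h0 => hne (by rw [h0]; simp)
  rw [abs_le] at hcon
  rcases lt_or_ge (Q.1 + (K:ℤ)) P.1 with h1 | h1
  · exact lt_irrefl _ (geo hε h.ρpos h.hR hK (hS P hP).1 (hS Q hQ).2 h1 (h.meet' hip)).1
  · have hip' : ip φ Q P ≠ 0 := by
      rw [← norm_ne_zero_iff, ip_symm, norm_ne_zero_iff]; exact hip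
    exact lt_irrefl _ (geo hε h.ρpos h.hR hK (hS Q hQ).1 (hS P hP).2 (by omega) (h.meet' hip')).1

lemma half_le_w {I : ℤ × ℤ} {y : ℝ} (hy : y ∈ dy I) : 1/2 ≤ w I y := by
  have hp := p2pos I.1
  unfold w
  rw [one_div]
  refine inv_anti₀ (by positivity) ?_
  obtain ⟨h1, h2⟩ := hy
  have e1 : (I.2:ℝ) ≤ y / (2:ℝ)^I.1 := by rw [le_div_iff₀ hp]; linarith
  have e2 : y / (2:ℝ)^I.1 ≤ I.2 + 1 := by rw [div_le_iff₀ hp]; linarith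
  have : |y / (2:ℝ)^I.1 - I.2| ≤ 1 := by rw [abs_le]; constructor <;> linarith
  linarith

/-- sum over a lacunary piece of weights outside the top interval -/
lemma tree_outside (S : Finset Tile) (t : (ℤ × ℤ) × ℝ) (hR : 0 ≤ R) (hS : ∀ P ∈ S, ftree v R t P) :
    ∑ P ∈ S, ∫ y in (dy t.1)ᶜ, w (iv P) y ^ 4 ≤ (2 * R + 1) * cS * (4 * cW) * ln t.1 := by
  have hms := (measurableSet_dy t.1).compl
  rw [← integral_finsetSum _ fun P _ => (integrable_wN (by norm_num) (iv P)).integrableOn]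
  set a := (2:ℝ)^t.1.1 * t.1.2
  set b := (2:ℝ)^t.1.1 * (t.1.2 + 1)
  let g : ℝ → ℤ → ℝ → ℝ := fun z k y => ((1 + |(y - z) / (2:ℝ)^k|)⁻¹)^2
  have gint : ∀ z k, Integrable (g z k) := fun z k =>
    (integrable_base.comp_div (p2pos k).ne').comp_sub_right z
  have gval : ∀ z k, ∫ y, g z k y = cW * (2:ℝ)^k := by
    intro z k
    have h1 := Measure.integral_comp_div (fun y : ℝ => ((1 + |y|)⁻¹)^2) ((2:ℝ)^k)
    have h2 := integral_sub_right_eq_self (μ := volume) (fun y : ℝ => ((1 + |y/(2:ℝ)^k|)⁻¹)^2) z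
    rw [h1, abs_of_pos (p2pos _)] at h2
    rw [mul_comm]; exact h2
  have gadd : ∀ k, Integrable (fun y => g a k y + g b k y) := fun k => (gint a k).add (gint b k)
  set Ks := S.image (fun P => P.1)
  have hpt : ∀ y ∈ (dy t.1)ᶜ, ∑ P ∈ S, w (iv P) y ^ 4 ≤ (2 * R + 1) * cS * ∑ k ∈ Ks, (g a k y + g b k y) := by
    intro y hy
    refine le_trans (Finset.sum_le_sum fun P hP => ?_) (sum_tile_w S Ks (fun k => (2:ℝ)^k * t.2 - v - R) (2 * R)
      (by linarith) (fun P hP => Finset.mem_image_of_mem _ hP) ?_ (fun k => g a k y + g b k y) (fun k => by positivity) y)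
    · have hsub := (hS P hP).1 (dy_mem_left (iv P))
      have hp := p2pos P.1
      have hw : w (iv P) y ^ 2 ≤ g a P.1 y + g b P.1 y := by
        have e : ∀ z, |y - z| ≤ |y - (2:ℝ)^P.1 * P.2.1| → w (iv P) y ^ 2 ≤ g z P.1 y := by
          intro z hz
          unfold w
          have e2 : y / (2:ℝ)^P.1 - P.2.1 = (y - (2:ℝ)^P.1 * P.2.1) / (2:ℝ)^P.1 := by field_simp
          simp only [iv, g]
          rw [e2, abs_div, abs_div, abs_of_pos hp]
          gcongr
        rw [mem_compl_iff, dy, mem_Ico, not_and_or, not_le, not_lt] at hy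
        obtain ⟨h1, h2⟩ := hsub
        simp only [iv] at h1 h2
        rcases hy with hy | hy
        · have := e a (by rw [abs_of_nonpos, abs_of_nonpos] <;> linarith)
          have : 0 ≤ g b P.1 y := by positivity
          linarith
        · have := e b (by rw [abs_of_nonneg, abs_of_nonneg] <;> linarith)
          have : 0 ≤ g a P.1 y := by positivity
          linarith
      calc w (iv P) y ^ 4 = w (iv P) y ^ 2 * w (iv P) y ^ 2 := by ring
        _ ≤ _ := by gcongr
    · intro P hP
      have := (hS P hP).2
      rw [th, abs_le] at this
      constructor <;> linarith [this.1, this.2]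
  have hc : 0 ≤ (2 * R + 1) * cS := mul_nonneg (by linarith) cS_nonneg
  have hInt0 : Integrable (fun y => (2 * R + 1) * cS * ∑ k ∈ Ks, (g a k y + g b k y)) :=
    (integrable_finsetSum _ fun k _ => gadd k).const_mul _
  calc _ ≤ ∫ y in (dy t.1)ᶜ, (2 * R + 1) * cS * ∑ k ∈ Ks, (g a k y + g b k y) := by
        refine setIntegral_mono_on ?_ hInt0.integrableOn hms hpt
        exact integrable_finsetSum _ fun P _ => (integrable_wN (by norm_num) (iv P)).integrableOn
    _ ≤ ∫ y, (2 * R + 1) * cS * ∑ k ∈ Ks, (g a k y + g b k y) := by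
        refine setIntegral_le_integral hInt0 (Eventually.of_forall fun y => ?_)
        exact mul_nonneg hc (Finset.sum_nonneg fun k _ => by positivity)
    _ = (2 * R + 1) * cS * ∑ k ∈ Ks, (2 * cW * (2:ℝ)^k) := by
        rw [integral_const_mul, integral_finsetSum _ fun k _ => gadd k]
        congr 1
        refine Finset.sum_congr rfl fun k _ => ?_
        rw [integral_add (gint a k) (gint b k), gval, gval]; ring
    _ ≤ (2 * R + 1) * cS * (2 * cW * (2 * ln t.1)) := by
        refine mul_le_mul_of_nonneg_left ?_ hc
        rw [← Finset.mul_sum]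
        refine mul_le_mul_of_nonneg_left ?_ (by linarith [cW_nonneg])
        have hg := geom_down Ks t.1.1 (by
          intro k hk
          obtain ⟨P, hP, rfl⟩ := Finset.mem_image.1 hk
          exact scale_le_of_subset (hS P hP).1)
        have : ∑ k ∈ Ks, (2:ℝ)^k = ln t.1 * ∑ k ∈ Ks, (2:ℝ)^(k - t.1.1) := by
          rw [Finset.mul_sum]
          refine Finset.sum_congr rfl fun k _ => ?_
          rw [zpow_sub₀ (by norm_num), ln]
          have := p2pos t.1.1
          field_simp
        rw [this]
        nlinarith [ln_pos t.1]
    _ = _ := by ring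

end

end BHT



namespace BHT

section
variable {φ : Tile → ℝ → ℂ} {v γ ρ R C : ℝ} {N : ℕ}

lemma Nice.mul_integrable {f : ℝ → ℂ} (hf : Nice f) {g : ℝ → ℂ} (hg : Continuous g) {M : ℝ} (hM : ∀ x, ‖g x‖ ≤ M) :
    Integrable (fun x => f x * g x) :=
  hf.int.mul_bdd hg.aestronglyMeasurable (Eventually.of_forall hM)

lemma Nice.sq_integrable {f : ℝ → ℂ} (hf : Nice f) : Integrable (fun x => ‖f x‖^2) := by
  obtain ⟨M, hM⟩ := hf.bdd
  have := hf.int.norm.mul_bdd (c := M) (g := fun x => ‖f x‖) hf.meas.norm.aestronglyMeasurable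
    (Eventually.of_forall fun x => by simpa using hM x)
  simpa only [sq] using this

lemma PS.bdd (h : PS φ v γ ρ R C N) (P : Tile) (x : ℝ) : ‖φ P x‖ ≤ C := by
  refine (h.decay P x).trans ?_
  exact mul_le_of_le_one_right h.Cpos.le (pow_le_one₀ (w_pos _ _).le (w_le_one _ _))

/-- dualisation -/
lemma PS.dual (h : PS φ v γ ρ R C N) (f : ℝ → ℂ) (hf : Nice f) (S : Finset Tile) :
    Integrable (fun x => ‖f x‖ * ‖∑ P ∈ S, (starRingEnd ℂ) (cf φ f P) * φ P x‖) ∧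
    ∑ P ∈ S, (2:ℝ)^P.1 * ‖cf φ f P‖^2 ≤ ∫ x, ‖f x‖ * ‖∑ P ∈ S, (starRingEnd ℂ) (cf φ f P) * φ P x‖ := by
  have hi : ∀ P, Integrable (fun x => f x * φ P x) := fun P => hf.mul_integrable (h.cont P) (h.bdd P)
  have hcont : Continuous (fun x => ∑ P ∈ S, (starRingEnd ℂ) (cf φ f P) * φ P x) :=
    continuous_finsetSum _ fun P _ => continuous_const.mul (h.cont P)
  have hb : ∀ x, ‖∑ P ∈ S, (starRingEnd ℂ) (cf φ f P) * φ P x‖ ≤ ∑ P ∈ S, ‖cf φ f P‖ * C := by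
    intro x
    refine (norm_sum_le _ _).trans (Finset.sum_le_sum fun P _ => ?_)
    rw [norm_mul, RCLike.norm_conj]
    exact mul_le_mul_of_nonneg_left (h.bdd P x) (norm_nonneg _)
  have hInt0 := hf.mul_integrable hcont hb
  have hInt0' := hInt0.norm
  simp_rw [norm_mul] at hInt0'
  refine ⟨hInt0', ?_⟩
  have e : ∫ x, f x * ∑ P ∈ S, (starRingEnd ℂ) (cf φ f P) * φ P x =
      ((∑ P ∈ S, (2:ℝ)^P.1 * ‖cf φ f P‖^2 : ℝ) : ℂ) := by
    have e1 : ∀ x, f x * ∑ P ∈ S, (starRingEnd ℂ) (cf φ f P) * φ P x =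
        ∑ P ∈ S, (starRingEnd ℂ) (cf φ f P) * (f x * φ P x) := by
      intro x; rw [Finset.mul_sum]; refine Finset.sum_congr rfl fun P _ => ?_; ring
    simp_rw [e1]
    rw [integral_finsetSum _ fun P _ => (hi P).const_mul _]
    push_cast
    refine Finset.sum_congr rfl fun P _ => ?_
    rw [integral_const_mul]
    have e2 : ∫ x, f x * φ P x = ((2:ℝ)^P.1 : ℂ) * cf φ f P := by
      unfold cf
      have : ((2:ℝ)^P.1 : ℂ) ≠ 0 := by
        have := (p2pos P.1).ne'
        exact_mod_cast this
      rw [← mul_assoc, mul_inv_cancel₀ this, one_mul]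
    rw [e2, ← Complex.conj_mul' (cf φ f P)]
    push_cast
    ring
  calc _ = ‖((∑ P ∈ S, (2:ℝ)^P.1 * ‖cf φ f P‖^2 : ℝ) : ℂ)‖ := by
        rw [Complex.norm_real, Real.norm_of_nonneg]
        exact Finset.sum_nonneg fun P _ => mul_nonneg (p2pos _).le (by positivity)
    _ ≤ ∫ x, ‖f x * ∑ P ∈ S, (starRingEnd ℂ) (cf φ f P) * φ P x‖ := by
        rw [← e]; exact norm_integral_le_integral_norm _
    _ = _ := by simp_rw [norm_mul]

/-- one row of far interactions -/
lemma PS.row_far (h : PS φ v γ ρ R C 6) {K : ℕ} (hK : |γ| + R + 3 * ρ ≤ ρ * 2^K)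
    {ε : ℝ} (hε : ε = 1 ∨ ε = -1) (U : Finset Tile) (top : Tile → (ℤ × ℤ) × ℝ)
    (h1 : ∀ P ∈ U, ftree v R (top P) P ∧ lac v γ ρ ε (top P).2 P)
    (h4 : ∀ P ∈ U, ∀ Q ∈ U, ftree v R (top P) Q → ε * (top P).2 ≤ ε * (top Q).2)
    (P : Tile) (hP : P ∈ U) :
    ∑ Q ∈ U with Q.1 + K < P.1, ‖ip φ P Q‖ ≤
      C * C * cW * 16 * (4 * ((4 * ρ + 1) * cS * (K + 1))) * ∫ y in (dy (top P).1)ᶜ, w (iv P) y ^ 4 := by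
  classical
  set S := U.filter (fun Q => Q.1 + K < P.1 ∧ ip φ P Q ≠ 0) with hS
  have e : ∑ Q ∈ U with Q.1 + K < P.1, ‖ip φ P Q‖ = ∑ Q ∈ S, ‖ip φ P Q‖ := by
    rw [hS, ← Finset.filter_filter]
    symm
    refine Finset.sum_filter_of_ne fun Q _ hne => ?_
    simpa using hne
  rw [e]
  have hρ := h.ρpos
  have hmem : ∀ Q ∈ S, Q ∈ U ∧ Q.1 + K < P.1 ∧ ip φ P Q ≠ 0 := fun Q hQ => by
    simpa [hS, Finset.mem_filter] using hQ
  have hdisj : ∀ Q ∈ S, Disjoint (dy (iv Q)) (dy (top P).1) := by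
    intro Q hQ
    obtain ⟨hQU, hk, hne⟩ := hmem Q hQ
    have hg := geo hε hρ h.hR hK (h1 P hP).1.2 (h1 Q hQU).2 hk (h.meet' hne)
    rw [Set.disjoint_left]
    intro y hy hy'
    have hsub : dy (iv Q) ⊆ dy (top P).1 := by
      refine dy_subset_of_mem ?_ hy hy'
      have := scale_le_of_subset (h1 P hP).1.1
      simp only [iv] at this ⊢
      omega
    exact absurd (h4 P hP Q hQU ⟨hsub, hg.2⟩) (not_le.2 hg.1)
  have hwin : ∀ Q ∈ S, ∀ Q' ∈ S, ∀ y, y ∈ dy (iv Q) → y ∈ dy (iv Q') → Q.1 ≤ Q'.1 + K := by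
    intro Q hQ Q' hQ' y hy hy'
    by_contra hcon
    push Not at hcon
    obtain ⟨hQU, hk, hne⟩ := hmem Q hQ
    obtain ⟨hQU', hk', hne'⟩ := hmem Q' hQ'
    have hm := h.meet hne
    have hm' := h.meet hne'
    have hp := p2pos P.1
    have hq := p2pos Q.1
    have hpq : 1 / (2:ℝ)^P.1 ≤ 1 / (2:ℝ)^Q.1 :=
      one_div_le_one_div_of_le hq (zpow_le_zpow_right₀ (by norm_num) (by omega))
    have hmm : |fr v γ Q - fr v γ Q'| ≤ ρ * (1 / (2:ℝ)^Q'.1 + 3 / (2:ℝ)^Q.1) := by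
      have : fr v γ Q - fr v γ Q' = (fr v γ P - fr v γ Q') - (fr v γ P - fr v γ Q) := by ring
      rw [this]
      refine (abs_sub _ _).trans ?_
      have e3 : 3 / (2:ℝ)^Q.1 = 1 / (2:ℝ)^Q.1 + 1 / (2:ℝ)^Q.1 + 1 / (2:ℝ)^Q.1 := by ring
      have := mul_le_mul_of_nonneg_left hpq hρ.le
      rw [e3]
      nlinarith
    have hg := geo hε hρ h.hR hK (h1 Q hQU).1.2 (h1 Q' hQU').2 hcon hmm
    have hsub : dy (iv Q') ⊆ dy (top Q).1 :=
      (dy_subset_of_mem (by simp only [iv]; omega) hy' hy).trans (h1 Q hQU).1.1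
    exact absurd (h4 Q hQU Q' hQU' ⟨hsub, hg.2⟩) (not_le.2 hg.1)
  set D := 4 * ((4 * ρ + 1) * cS * (K + 1)) with hD
  have hD0 : 0 ≤ D := by have := cS_nonneg; positivity
  have hpt : ∀ y, ∑ Q ∈ S, (dy (iv Q)).indicator (fun y => w (iv P) y ^ 4) y ≤
      (dy (top P).1)ᶜ.indicator (fun y => D * w (iv P) y ^ 4) y := by
    intro y
    have hw4 := pow_nonneg (w_pos (iv P) y).le 4
    by_cases hy : y ∈ dy (top P).1
    · rw [Set.indicator_of_notMem (by simpa using hy)]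
      refine (Finset.sum_eq_zero fun Q hQ => ?_).le
      exact Set.indicator_of_notMem (fun h' => Set.disjoint_left.1 (hdisj Q hQ) h' hy) _
    · rw [Set.indicator_of_mem (by simpa using hy)]
      have e1 : ∑ Q ∈ S, (dy (iv Q)).indicator (fun y => w (iv P) y ^ 4) y =
          (∑ Q ∈ S with y ∈ dy (iv Q), (1:ℝ)) * w (iv P) y ^ 4 := by
        rw [Finset.sum_mul, Finset.sum_filter (p := fun Q => y ∈ dy (iv Q))]
        refine Finset.sum_congr rfl fun Q _ => ?_
        by_cases hy : y ∈ dy (iv Q) <;> simp [hy]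
      rw [e1]
      refine mul_le_mul_of_nonneg_right ?_ hw4
      set S' := S.filter (fun Q => y ∈ dy (iv Q)) with hS'
      rcases S'.eq_empty_or_nonempty with h0 | h0
      · rw [h0]; simpa using hD0
      obtain ⟨Q0, hQ0, hmin⟩ := Finset.exists_min_image S' (fun Q => Q.1) h0
      have hmS' : ∀ Q ∈ S', Q ∈ S ∧ y ∈ dy (iv Q) := fun Q hQ => Finset.mem_filter.1 hQ
      have := sum_tile_w S' (Finset.Icc Q0.1 (Q0.1 + K)) (fun k => (2:ℝ)^k * fr v γ P - v - γ - 2 * ρ) (4 * ρ)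
        (by positivity) ?_ ?_ (fun _ => 1) (fun _ => by norm_num) y
      · simp only [one_mul, Finset.sum_const, Int.card_Icc, nsmul_eq_mul, mul_one] at this
        have e : ((Q0.1 + K + 1 - Q0.1).toNat : ℝ) = K + 1 := by
          have : (Q0.1 + K + 1 - Q0.1).toNat = K + 1 := by omega
          rw [this]; push_cast; ring
        rw [e] at this
        rw [hD]
        calc ∑ Q ∈ S', (1:ℝ) ≤ ∑ Q ∈ S', 4 * w (iv Q) y ^ 2 := by
              refine Finset.sum_le_sum fun Q hQ => ?_
              have := half_le_w (hmS' Q hQ).2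
              nlinarith
          _ ≤ _ := by rw [← Finset.mul_sum]; linarith
      · intro Q hQ
        rw [Finset.mem_Icc]
        exact ⟨hmin Q hQ, hwin Q (hmS' Q hQ).1 Q0 (hmS' Q0 hQ0).1 y (hmS' Q hQ).2 (hmS' Q0 hQ0).2⟩
      · intro Q hQ
        obtain ⟨_, hk, hne⟩ := hmem Q (hmS' Q hQ).1
        have hm := h.meet hne
        have hp := p2pos P.1
        have hq := p2pos Q.1
        have h2 : (2:ℝ)^Q.1 * fr v γ Q = Q.2.2 + v + γ := by unfold fr; field_simp
        have h3 : (2:ℝ)^Q.1 / (2:ℝ)^P.1 ≤ 1 := by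
          rw [div_le_one hp]; exact zpow_le_zpow_right₀ (by norm_num) (by omega)
        have h4 : (2:ℝ)^Q.1 * |fr v γ P - fr v γ Q| ≤ 2 * ρ := by
          calc _ ≤ (2:ℝ)^Q.1 * (ρ * (1 / (2:ℝ)^P.1 + 1 / (2:ℝ)^Q.1)) := by gcongr
            _ = ρ * ((2:ℝ)^Q.1 / (2:ℝ)^P.1 + 1) := by field_simp
            _ ≤ _ := by nlinarith
        rw [← abs_of_pos hq, ← abs_mul, mul_sub, h2, abs_le] at h4
        constructor <;> linarith [h4.1, h4.2]
  have hw4i : Integrable (fun y => w (iv P) y ^ 4) := integrable_wN (by norm_num) _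
  have hCC : 0 ≤ C * C * cW * 16 := by have := cW_nonneg; have := mul_self_nonneg C; positivity
  calc ∑ Q ∈ S, ‖ip φ P Q‖ ≤ ∑ Q ∈ S, C * C * cW * 16 * ∫ y, (dy (iv Q)).indicator (fun y => w (iv P) y ^ 4) y := by
        refine Finset.sum_le_sum fun Q hQ => (h.ip_le (by norm_num) P Q).trans ?_
        obtain ⟨_, hk, _⟩ := hmem Q hQ
        have hkk : (iv Q).1 ≤ (iv P).1 := by simp only [iv]; omega
        have i1 := integral_ww_le (M := 4) hkk
        have i2 : ln (iv Q) * w (iv P) ((2:ℝ)^(iv Q).1 * (iv Q).2) ^ 4 ≤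
            16 * ∫ y, (dy (iv Q)).indicator (fun y => w (iv P) y ^ 4) y := by
          rw [integral_indicator (measurableSet_dy _), ← integral_const_mul, ← volume_real_dy, ← smul_eq_mul,
            ← setIntegral_const]
          refine setIntegral_mono_on ?_ (hw4i.const_mul _).integrableOn (measurableSet_dy _) fun y hy => ?_
          · refine integrableOn_const ?_
            rw [volume_dy]; exact ENNReal.ofReal_ne_top
          have m1 := w_move (iv P) ((2:ℝ)^(iv Q).1 * (iv Q).2) y
          have m2 : 1 + |(2:ℝ)^(iv Q).1 * (iv Q).2 - y| / ln (iv P) ≤ 2 := by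
            have l1 : ln (iv Q) ≤ ln (iv P) := zpow_le_zpow_right₀ (by norm_num) hkk
            have l2 : |(2:ℝ)^(iv Q).1 * (iv Q).2 - y| ≤ ln (iv Q) := by
              obtain ⟨a1, a2⟩ := hy
              unfold ln
              rw [abs_le]; constructor <;> linarith
            have : |(2:ℝ)^(iv Q).1 * (iv Q).2 - y| / ln (iv P) ≤ 1 := by
              rw [div_le_one (ln_pos _)]; linarith
            linarith
          have m3 := w_pos (iv P) y
          calc w (iv P) ((2:ℝ)^(iv Q).1 * (iv Q).2) ^ 4 ≤ (2 * w (iv P) y)^4 := by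
                refine pow_le_pow_left₀ (w_pos _ _).le (m1.trans ?_) 4
                gcongr
            _ = _ := by ring
        calc _ ≤ C * C * (cW * ln (iv Q) * w (iv P) ((2:ℝ)^(iv Q).1 * (iv Q).2) ^ 4) :=
              mul_le_mul_of_nonneg_left i1 (mul_self_nonneg C)
          _ = C * C * cW * (ln (iv Q) * w (iv P) ((2:ℝ)^(iv Q).1 * (iv Q).2) ^ 4) := by ring
          _ ≤ C * C * cW * (16 * ∫ y, (dy (iv Q)).indicator (fun y => w (iv P) y ^ 4) y) :=
              mul_le_mul_of_nonneg_left i2 (mul_nonneg (mul_self_nonneg C) cW_nonneg)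
          _ = _ := by ring
    _ = C * C * cW * 16 * ∫ y, ∑ Q ∈ S, (dy (iv Q)).indicator (fun y => w (iv P) y ^ 4) y := by
        rw [← Finset.mul_sum, integral_finsetSum _ fun Q _ => hw4i.indicator (measurableSet_dy _)]
    _ ≤ C * C * cW * 16 * ∫ y, (dy (top P).1)ᶜ.indicator (fun y => D * w (iv P) y ^ 4) y := by
        refine mul_le_mul_of_nonneg_left ?_ hCC
        refine integral_mono (integrable_finsetSum _ fun Q _ => hw4i.indicator (measurableSet_dy _))
          ((hw4i.const_mul _).indicator (measurableSet_dy _).compl) hpt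
    _ = _ := by
        rw [integral_indicator (measurableSet_dy _).compl, integral_const_mul]; ring

/-- final constant in the counting estimate -/
noncomputable def cD (C ρ R : ℝ) (K : ℕ) : ℝ :=
  1 + nD C ρ K + 8 * (C * C * cW * 16 * (4 * ((4 * ρ + 1) * cS * (K + 1)))) * ((2 * R + 1) * cS * (4 * cW))

lemma PS.Rnn (h : PS φ v γ ρ R C N) : 0 ≤ R := by
  have := h.hR; have := h.ρpos; linarith [abs_nonneg γ]

lemma PS.cD_pos (h : PS φ v γ ρ R C N) (K : ℕ) : 0 < cD C ρ R K := by
  have := h.ρpos; have := h.Cpos; have := cS_nonneg; have := cW_nonneg; have := h.Rnn; have := h.nD_nonneg K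
  unfold cD
  have : 0 ≤ 8 * (C * C * cW * 16 * (4 * ((4 * ρ + 1) * cS * (K + 1)))) * ((2 * R + 1) * cS * (4 * cW)) := by positivity
  linarith

/-- the counting estimate -/
lemma PS.count (h : PS φ v γ ρ R C 6) {K : ℕ} (hK : |γ| + R + 3 * ρ ≤ ρ * 2^K)
    {ε : ℝ} (hε : ε = 1 ∨ ε = -1) (U : Finset Tile) (top : Tile → (ℤ × ℤ) × ℝ) (f : ℝ → ℂ) (hf : Nice f)
    {lam : ℝ} (hlam : 0 < lam)
    (h1 : ∀ P ∈ U, ftree v R (top P) P ∧ lac v γ ρ ε (top P).2 P)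
    (h2 : ∀ t ∈ U.image top, (lam/2)^2 * ln t.1 ≤ ∑ P ∈ U with top P = t, (2:ℝ)^P.1 * ‖cf φ f P‖^2)
    (h3 : ∀ P ∈ U, ‖cf φ f P‖ ≤ lam)
    (h4 : ∀ P ∈ U, ∀ Q ∈ U, ftree v R (top P) Q → ε * (top P).2 ≤ ε * (top Q).2) :
    lam^2 * ∑ t ∈ U.image top, ln t.1 ≤ 4 * cD C ρ R K * ∫ x, ‖f x‖^2 := by
  set X := ∑ P ∈ U, (2:ℝ)^P.1 * ‖cf φ f P‖^2 with hX
  have hXt : lam^2 * ∑ t ∈ U.image top, ln t.1 ≤ 4 * X := by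
    have : (lam/2)^2 * ∑ t ∈ U.image top, ln t.1 ≤ X := by
      rw [Finset.mul_sum, hX, ← Finset.sum_fiberwise_of_maps_to (g := top) (t := U.image top)
        (fun P hP => Finset.mem_image_of_mem _ hP)]
      exact Finset.sum_le_sum h2
    nlinarith
  set a : Tile → ℂ := fun P => (starRingEnd ℂ) (cf φ f P) with ha
  have han : ∀ P, ‖a P‖ = ‖cf φ f P‖ := fun P => RCLike.norm_conj _
  set E1 := C * C * cW * 16 * (4 * ((4 * ρ + 1) * cS * (K + 1))) with hE1
  set E2 := (2 * R + 1) * cS * (4 * cW) with hE2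
  have hρ := h.ρpos
  have hE1n : 0 ≤ E1 := by have := cS_nonneg; have := cW_nonneg; have := h.Cpos; positivity
  have hfar : ∑ P ∈ U, ∑ Q ∈ U with Q.1 + K < P.1, ‖a P‖ * ‖a Q‖ * ‖ip φ P Q‖ ≤
      lam^2 * (E1 * E2 * ∑ t ∈ U.image top, ln t.1) := by
    calc _ ≤ ∑ P ∈ U, lam^2 * (E1 * ∫ y in (dy (top P).1)ᶜ, w (iv P) y ^ 4) := by
          refine Finset.sum_le_sum fun P hP => ?_
          calc _ ≤ ∑ Q ∈ U with Q.1 + K < P.1, lam^2 * ‖ip φ P Q‖ := by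
                refine Finset.sum_le_sum fun Q hQ => ?_
                rw [han, han, sq]
                have := h3 P hP
                have := h3 Q (Finset.mem_filter.1 hQ).1
                gcongr
            _ ≤ _ := by
                rw [← Finset.mul_sum]
                exact mul_le_mul_of_nonneg_left (h.row_far hK hε U top h1 h4 P hP) (by positivity)
      _ = lam^2 * (E1 * ∑ t ∈ U.image top, ∑ P ∈ U with top P = t, ∫ y in (dy t.1)ᶜ, w (iv P) y ^ 4) := by
          rw [← Finset.mul_sum, ← Finset.mul_sum, ← Finset.sum_fiberwise_of_maps_to (g := top) (t := U.image top)
            (fun P hP => Finset.mem_image_of_mem _ hP)]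
          congr 2
          refine Finset.sum_congr rfl fun t _ => Finset.sum_congr rfl fun P hP => ?_
          rw [(Finset.mem_filter.1 hP).2]
      _ ≤ lam^2 * (E1 * ∑ t ∈ U.image top, E2 * ln t.1) := by
          refine mul_le_mul_of_nonneg_left (mul_le_mul_of_nonneg_left (Finset.sum_le_sum fun t _ => ?_) hE1n) (by positivity)
          refine tree_outside (v := v) _ t h.Rnn fun P hP => ?_
          rw [Finset.mem_filter] at hP
          rw [← hP.2]; exact (h1 P hP.1).1
      _ = _ := by rw [← Finset.mul_sum]; ring
  have hfar' : ∑ P ∈ U, ∑ Q ∈ U with P.1 + K < Q.1, ‖a P‖ * ‖a Q‖ * ‖ip φ P Q‖ =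
      ∑ P ∈ U, ∑ Q ∈ U with Q.1 + K < P.1, ‖a P‖ * ‖a Q‖ * ‖ip φ P Q‖ := by
    simp_rw [Finset.sum_filter]
    rw [Finset.sum_comm]
    refine Finset.sum_congr rfl fun P _ => Finset.sum_congr rfl fun Q _ => ?_
    rw [ip_symm, mul_comm ‖a Q‖]
  have hsplit : ∑ P ∈ U, ∑ Q ∈ U, ‖a P‖ * ‖a Q‖ * ‖ip φ P Q‖ ≤
      ∑ P ∈ U, ∑ Q ∈ U with |P.1 - Q.1| ≤ K, ‖a P‖ * ‖a Q‖ * ‖ip φ P Q‖ +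
      ∑ P ∈ U, ∑ Q ∈ U with Q.1 + K < P.1, ‖a P‖ * ‖a Q‖ * ‖ip φ P Q‖ +
      ∑ P ∈ U, ∑ Q ∈ U with P.1 + K < Q.1, ‖a P‖ * ‖a Q‖ * ‖ip φ P Q‖ := by
    simp_rw [Finset.sum_filter, ← Finset.sum_add_distrib]
    refine Finset.sum_le_sum fun P _ => Finset.sum_le_sum fun Q _ => ?_
    have hz : 0 ≤ ‖a P‖ * ‖a Q‖ * ‖ip φ P Q‖ := by positivity
    by_cases c1 : |P.1 - Q.1| ≤ K
    · rw [if_pos c1]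
      split_ifs <;> linarith
    · by_cases c2 : Q.1 + K < P.1
      · rw [if_pos c2]; split_ifs <;> linarith
      · have c3 : P.1 + K < Q.1 := by
          by_contra c3
          apply c1; rw [abs_le]; omega
        rw [if_pos c3]; split_ifs <;> linarith
  have hX0 : 0 ≤ X := Finset.sum_nonneg fun P _ => mul_nonneg (p2pos _).le (by positivity)
  have hsq : ∫ x, ‖∑ P ∈ U, a P * φ P x‖^2 ≤ cD C ρ R K * X := by
    have n1 := h.near (by norm_num) K U a
    have n2 := (h.integrable_sum_sq (by norm_num) U a).2
    simp_rw [han] at n1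
    have hE2n : 0 ≤ E2 := by have := cS_nonneg; have := cW_nonneg; have := h.Rnn; positivity
    have n3 := mul_le_mul_of_nonneg_left hXt (mul_nonneg hE1n hE2n)
    have : cD C ρ R K = 1 + nD C ρ K + 8 * E1 * E2 := rfl
    rw [this]
    change _ ≤ nD C ρ K * X at n1
    simp_rw [han] at n2 hfar hfar' hsplit
    nlinarith
  obtain ⟨d1, d2⟩ := h.dual f hf U
  have hcD := h.cD_pos K
  have d3 : ∫ x, ‖f x‖ * ‖∑ P ∈ U, a P * φ P x‖ ≤
      (1/2) * (cD C ρ R K * (∫ x, ‖f x‖^2) + (cD C ρ R K)⁻¹ * ∫ x, ‖∑ P ∈ U, a P * φ P x‖^2) := by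
    have i1 := hf.sq_integrable.const_mul (cD C ρ R K)
    have i2 := (h.integrable_sum_sq (by norm_num) U a).1.const_mul (cD C ρ R K)⁻¹
    rw [← integral_const_mul, ← integral_const_mul, ← integral_add i1 i2, ← integral_const_mul]
    refine integral_mono d1 ((i1.add i2).const_mul _) fun x => ?_
    simp only
    have := sq_nonneg (cD C ρ R K * ‖f x‖ - ‖∑ P ∈ U, a P * φ P x‖)
    have e : (1/2) * (cD C ρ R K * ‖f x‖^2 + (cD C ρ R K)⁻¹ * ‖∑ P ∈ U, a P * φ P x‖^2) - ‖f x‖ * ‖∑ P ∈ U, a P * φ P x‖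
      = (1/2) * (cD C ρ R K)⁻¹ * (cD C ρ R K * ‖f x‖ - ‖∑ P ∈ U, a P * φ P x‖)^2 := by
      field_simp; ring
    have : 0 ≤ (1/2) * (cD C ρ R K)⁻¹ * (cD C ρ R K * ‖f x‖ - ‖∑ P ∈ U, a P * φ P x‖)^2 := by positivity
    change ‖f x‖ * ‖∑ P ∈ U, a P * φ P x‖ ≤ _
    linarith
  have d4 : (cD C ρ R K)⁻¹ * ∫ x, ‖∑ P ∈ U, a P * φ P x‖^2 ≤ X := by
    rw [inv_mul_le_iff₀ hcD]; exact hsq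
  have d5 : X ≤ ∫ x, ‖f x‖ * ‖∑ P ∈ U, a P * φ P x‖ := d2
  nlinarith

end

end BHT



namespace BHT

/-! ## Part E: the size bound -/

lemma geom_abs (s : Finset ℤ) (j : ℤ) : ∑ k ∈ s, (2:ℝ)^(-|k - j|) ≤ 4 := by
  rw [← Finset.sum_filter_add_sum_filter_not s (fun k => j ≤ k)]
  have h1 := geom_up (s.filter (fun k => j ≤ k)) j (fun k hk => (Finset.mem_filter.1 hk).2)
  have h2 := geom_down (s.filter (fun k => ¬ j ≤ k)) j (fun k hk => by
    have := (Finset.mem_filter.1 hk).2; omega)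
  have e1 : ∑ k ∈ s with j ≤ k, (2:ℝ)^(-|k - j|) = ∑ k ∈ s with j ≤ k, (2:ℝ)^(j - k) := by
    refine Finset.sum_congr rfl fun k hk => ?_
    have := (Finset.mem_filter.1 hk).2
    rw [abs_of_nonneg (by omega)]; congr 1; ring
  have e2 : ∑ k ∈ s with ¬ j ≤ k, (2:ℝ)^(-|k - j|) = ∑ k ∈ s with ¬ j ≤ k, (2:ℝ)^(k - j) := by
    refine Finset.sum_congr rfl fun k hk => ?_
    have := (Finset.mem_filter.1 hk).2
    rw [abs_of_nonpos (by omega)]; congr 1; ring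
  rw [e1, e2]; linarith

lemma dy_children (j m : ℤ) : dy (j, m) = dy (j-1, 2*m) ∪ dy (j-1, 2*m+1) := by
  have hp := p2pos (j-1)
  have e : (2:ℝ)^j = 2 * (2:ℝ)^(j-1) := by
    rw [zpow_sub₀ (by norm_num)]; simp; ring
  unfold dy
  simp only
  rw [e]
  push_cast
  have e1 : 2 * (2:ℝ)^(j-1) * m = (2:ℝ)^(j-1) * (2 * m) := by ring
  have e2 : 2 * (2:ℝ)^(j-1) * (m + 1) = (2:ℝ)^(j-1) * (2 * m + 1 + 1) := by ring
  rw [e1, e2, Ico_union_Ico_eq_Ico] <;> nlinarith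

lemma dy_disj {j m m' : ℤ} (h : m ≠ m') : Disjoint (dy (j, m)) (dy (j, m')) := by
  rw [Set.disjoint_left]
  intro x hx hx'
  have := dy_inj (I := (j,m)) (J := (j,m')) rfl hx hx'
  exact h (by simpa using this)

lemma third_le_w {I : ℤ × ℤ} {j m : ℤ} (hI : I.1 = j) (hm : |I.2 - m| ≤ 1) {x : ℝ} (hx : x ∈ dy (j, m)) :
    1/3 ≤ w I x := by
  subst hI
  have hp := p2pos I.1
  unfold w
  rw [one_div]
  refine inv_anti₀ (by positivity) ?_
  obtain ⟨h1, h2⟩ := hx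
  simp only at h1 h2
  have e1 : (m:ℝ) ≤ x / (2:ℝ)^I.1 := by rw [le_div_iff₀ hp]; linarith
  have e2 : x / (2:ℝ)^I.1 ≤ m + 1 := by rw [div_le_iff₀ hp]; linarith
  have e3 : |(I.2:ℝ) - m| ≤ 1 := by exact_mod_cast hm
  rw [abs_le] at e3
  have : |x / (2:ℝ)^I.1 - I.2| ≤ 2 := by rw [abs_le]; constructor <;> linarith [e3.1, e3.2]
  linarith

lemma w_far {P : Tile} {j m m' : ℤ} (hm : 1 < |m' - m|) (hP : dy (iv P) ⊆ dy (j, m'))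
    {x : ℝ} (hx : x ∈ dy (j, m)) : w (iv P) x ≤ (2:ℝ)^(P.1 - j) ∧ (2:ℝ)^j ≤ |x - (2:ℝ)^P.1 * P.2.1| := by
  have hp := p2pos P.1
  have hj := p2pos j
  have hz := hP (dy_mem_left (iv P))
  obtain ⟨a1, a2⟩ := hz
  obtain ⟨b1, b2⟩ := hx
  simp only [iv] at a1 a2 b1 b2
  have key : (2:ℝ)^j ≤ |x - (2:ℝ)^P.1 * P.2.1| := by
    rcases lt_abs.1 hm with h | h
    · have : (m:ℝ) + 2 ≤ m' := by exact_mod_cast (by omega : m + 2 ≤ m')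
      have : (2:ℝ)^j * (m + 2) ≤ (2:ℝ)^j * m' := by gcongr
      rw [abs_of_nonpos] <;> linarith
    · have : (m':ℝ) + 2 ≤ m := by exact_mod_cast (by omega : m' + 2 ≤ m)
      have : (2:ℝ)^j * (m' + 2) ≤ (2:ℝ)^j * m := by gcongr
      rw [abs_of_nonneg] <;> linarith
  refine ⟨?_, key⟩
  unfold w
  simp only [iv]
  have e : x / (2:ℝ)^P.1 - P.2.1 = (x - (2:ℝ)^P.1 * P.2.1) / (2:ℝ)^P.1 := by field_simp
  rw [e, abs_div, abs_of_pos hp, zpow_sub₀ (by norm_num)]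
  have e2 : (2:ℝ)^P.1 / (2:ℝ)^j = ((2:ℝ)^j / (2:ℝ)^P.1)⁻¹ := by rw [inv_div]
  rw [e2]
  refine inv_anti₀ (by positivity) ?_
  have : (2:ℝ)^j / (2:ℝ)^P.1 ≤ |x - (2:ℝ)^P.1 * P.2.1| / (2:ℝ)^P.1 := by gcongr
  linarith

noncomputable def c2 (C R : ℝ) : ℝ := 8 * C * C * ((2 * R + 1) * cS)
noncomputable def c3 (C R : ℝ) (N : ℕ) : ℝ := C * C * 3^(N+1) * ((2 * R + 1) * cS * 2)
noncomputable def cE (C ρ R : ℝ) (K N : ℕ) : ℝ :=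
  3 * (2 * 3^N)^2 * (nD C ρ K + 1) + 6 * (2 * 3^N) * c2 C R + 2 * c3 C R N

section
variable {φ : Tile → ℝ → ℂ} {v γ ρ R C : ℝ} {N : ℕ}

lemma PS.cf_le (h : PS φ v γ ρ R C N) {N1 : ℕ} (hN : N1 ≤ N) {f : ℝ → ℂ} (hf : Nice f) {P : Tile} {B : ℝ}
    (hB : ∫ x, ‖f x‖ * w (iv P) x ^ N1 ≤ B * ln (iv P)) : ‖cf φ f P‖ ≤ C * B := by
  have hp := p2pos P.1
  unfold cf
  rw [norm_mul, norm_inv]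
  have e : ‖(((2:ℝ):ℂ)^P.1)‖ = (2:ℝ)^P.1 := by simp
  rw [e, inv_mul_le_iff₀ hp]
  calc ‖∫ x, f x * φ P x‖ ≤ ∫ x, C * (‖f x‖ * w (iv P) x ^ N1) := by
        refine norm_integral_le_of_norm_le (Integrable.const_mul ?_ _) (Eventually.of_forall fun x => ?_)
        · refine hf.int.norm.mul_bdd (c := 1) ((w_continuous _).pow _).aestronglyMeasurable (Eventually.of_forall fun x => ?_)
          rw [Real.norm_of_nonneg (pow_nonneg (w_pos _ _).le _)]
          exact pow_le_one₀ (w_pos _ _).le (w_le_one _ _)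
        · rw [norm_mul]
          have := (h.mono hN).decay P x
          calc _ ≤ ‖f x‖ * (C * w (iv P) x ^ N1) := by gcongr
            _ = _ := by ring
    _ ≤ C * (B * (2:ℝ)^P.1) := by
        rw [integral_const_mul]
        exact mul_le_mul_of_nonneg_left hB h.Cpos.le
    _ = _ := by ring

/-- the size bound -/
lemma PS.size_bound {N1 : ℕ} (h0 : PS φ v γ ρ R C N) (hN : N1 + 3 ≤ N) {K : ℕ} (hK : |γ| + R + 3 * ρ ≤ ρ * 2^K)
    {ε : ℝ} (hε : ε = 1 ∨ ε = -1) {ξ : ℝ} (J0 : ℤ × ℤ) (T : Finset Tile)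
    (hT : ∀ P ∈ T, dy (iv P) ⊆ dy J0 ∧ |th v P ξ| ≤ R ∧ lac v γ ρ ε ξ P)
    {f : ℝ → ℂ} (hf : Nice f) {B : ℝ} (hB0 : 0 ≤ B)
    (hB : ∀ P ∈ T, ∀ I, dy (iv P) ⊆ dy I → dy I ⊆ dy J0 → ∫ x, ‖f x‖ * w I x ^ N1 ≤ B * ln I) :
    ∑ P ∈ T, (2:ℝ)^P.1 * ‖cf φ f P‖^2 ≤ cE C ρ R K N1 * B^2 * ln J0 := by
  have h := h0.mono hN
  have hC := h.Cpos
  have hR := h.Rnn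
  have hSn := cS_nonneg
  have hcf : ∀ P ∈ T, ‖cf φ f P‖ ≤ C * B := fun P hP =>
    h0.cf_le (by omega) hf (hB P hP (iv P) Subset.rfl (hT P hP).1)
  have hnD := h.nD_nonneg K
  have hc2 : 0 ≤ c2 C R := by unfold c2; positivity
  have hc3 : 0 ≤ c3 C R N1 := by unfold c3; positivity
  rcases hB0.eq_or_lt with rfl | hBpos
  · refine le_trans (le_of_eq (Finset.sum_eq_zero fun P hP => ?_)) (by simp)
    have := hcf P hP
    have : ‖cf φ f P‖ = 0 := le_antisymm (by linarith) (norm_nonneg _)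
    rw [this]; simp
  rcases T.eq_empty_or_nonempty with hTe | ⟨P0, hP0⟩
  · rw [hTe]
    have := ln_pos J0
    simp only [Finset.sum_empty]
    have : 0 ≤ cE C ρ R K N1 := by unfold cE; positivity
    positivity
  set G : ℝ → ℂ := fun x => ∑ P ∈ T, (starRingEnd ℂ) (cf φ f P) * φ P x with hG
  have hGc : Continuous G := continuous_finsetSum _ fun P _ => continuous_const.mul (h.cont P)
  obtain ⟨hdi, hdual⟩ := h.dual f hf T
  change Integrable (fun x => ‖f x‖ * ‖G x‖) at hdi
  have hGi : ∀ a b : ℝ, IntegrableOn (fun x => ‖G x‖) (Ico a b) := fun a b =>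
    (hGc.norm.integrableOn_Icc (a := a) (b := b)).mono_set Ico_subset_Icc_self
  have hGd : ∀ J, IntegrableOn (fun x => ‖G x‖) (dy J) := fun J => hGi _ _
  obtain ⟨kmin, hkmin⟩ : ∃ kmin : ℤ, ∀ P ∈ T, kmin ≤ P.1 := by
    obtain ⟨P, _, hP⟩ := Finset.exists_min_image T (fun P => P.1) ⟨P0, hP0⟩
    exact ⟨P.1, hP⟩
  set Ks := T.image (fun P => P.1) with hKs
  have htw : ∀ (c : ℤ → ℝ), (∀ k, 0 ≤ c k) → ∀ x, ∑ P ∈ T, c P.1 * w (iv P) x ^ 2 ≤ (2 * R + 1) * cS * ∑ k ∈ Ks, c k := by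
    intro c hc x
    refine sum_tile_w T Ks (fun k => (2:ℝ)^k * ξ - v - R) (2 * R) (by linarith)
      (fun P hP => Finset.mem_image_of_mem _ hP) (fun P hP => ?_) c hc x
    have := (hT P hP).2.1
    rw [th, abs_le] at this
    constructor <;> linarith [this.1, this.2]
  -- oscillation on good intervals
  have hosc : ∀ J : ℤ × ℤ, (∀ P ∈ T, P.1 ≤ J.1 → 1 < |(anc J.1 (iv P)).2 - J.2|) →
      ∀ x ∈ dy J, ∀ x' ∈ dy J, ‖G x‖ ≤ ‖G x'‖ + c2 C R * B := by
    intro J hgood x hx x' hx'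
    obtain ⟨e, he, H⟩ := h.osc ξ
    have hxx : |x - x'| ≤ (2:ℝ)^J.1 := by
      obtain ⟨a1, a2⟩ := hx
      obtain ⟨b1, b2⟩ := hx'
      rw [abs_le]; constructor <;> nlinarith
    have key : ∀ P ∈ T, ‖e x * φ P x - e x' * φ P x'‖ ≤ C * ((2:ℝ)^(-|P.1 - J.1|) * w (iv P) x ^ 2
        + (2:ℝ)^(-|P.1 - J.1|) * w (iv P) x' ^ 2) := by
      intro P hP
      have hp := p2pos P.1
      have hwx := w_pos (iv P) x
      have hwx' := w_pos (iv P) x'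
      rcases le_or_gt P.1 J.1 with hk | hk
      · have hsub : dy (iv P) ⊆ dy (J.1, (anc J.1 (iv P)).2) := subset_anc (I := iv P) hk
        have hg := hgood P hP hk
        have f1 := (w_far hg hsub (x := x) hx).1
        have f2 := (w_far hg hsub (x := x') hx').1
        rw [abs_of_nonpos (by omega), neg_neg]
        have bd : ∀ y, w (iv P) y ≤ (2:ℝ)^(P.1 - J.1) → ‖e y * φ P y‖ ≤ C * ((2:ℝ)^(P.1 - J.1) * w (iv P) y ^ 2) := by
          intro y hy
          rw [norm_mul, he, one_mul]
          refine ((h.mono (by omega : 3 ≤ N1 + 3)).decay P y).trans ?_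
          refine mul_le_mul_of_nonneg_left ?_ hC.le
          have := w_pos (iv P) y
          calc w (iv P) y ^ 3 = w (iv P) y * w (iv P) y ^ 2 := by ring
            _ ≤ _ := by gcongr
        refine (norm_sub_le _ _).trans ?_
        rw [mul_add]
        exact add_le_add (bd x f1) (bd x' f2)
      · have hle : (2:ℝ)^J.1 ≤ (2:ℝ)^P.1 := zpow_le_zpow_right₀ (by norm_num) hk.le
        refine (H P (hT P hP).2.1 x x' (hxx.trans hle)).trans ?_
        rw [abs_of_nonneg (show (0:ℤ) ≤ P.1 - J.1 by omega), neg_sub, mul_assoc]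
        refine mul_le_mul_of_nonneg_left ?_ hC.le
        have e1 : |x - x'| / (2:ℝ)^P.1 ≤ (2:ℝ)^(J.1 - P.1) := by
          rw [zpow_sub₀ (by norm_num)]; gcongr
        calc _ ≤ (2:ℝ)^(J.1 - P.1) * w (iv P) x ^ 2 := by
              refine mul_le_mul e1 (w_pow_le (by omega) _ _) (by positivity) (p2pos _).le
          _ ≤ _ := by
              have := p2pos (J.1 - P.1)
              have : 0 ≤ (2:ℝ)^(J.1 - P.1) * w (iv P) x' ^ 2 := by positivity
              linarith
    have hdiff : ‖e x * G x - e x' * G x'‖ ≤ c2 C R * B := by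
      have e1 : e x * G x - e x' * G x' = ∑ P ∈ T, (starRingEnd ℂ) (cf φ f P) * (e x * φ P x - e x' * φ P x') := by
        simp only [hG, Finset.mul_sum, ← Finset.sum_sub_distrib]
        refine Finset.sum_congr rfl fun P _ => ?_
        ring
      rw [e1]
      calc _ ≤ ∑ P ∈ T, (C * B) * (C * ((2:ℝ)^(-|P.1 - J.1|) * w (iv P) x ^ 2
        + (2:ℝ)^(-|P.1 - J.1|) * w (iv P) x' ^ 2)) := by
            refine (norm_sum_le _ _).trans (Finset.sum_le_sum fun P hP => ?_)
            rw [norm_mul, RCLike.norm_conj]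
            exact mul_le_mul (hcf P hP) (key P hP) (norm_nonneg _) (by positivity)
        _ = C * B * C * (∑ P ∈ T, (2:ℝ)^(-|P.1 - J.1|) * w (iv P) x ^ 2 + ∑ P ∈ T, (2:ℝ)^(-|P.1 - J.1|) * w (iv P) x' ^ 2) := by
            rw [← Finset.sum_add_distrib, Finset.mul_sum]
            refine Finset.sum_congr rfl fun P _ => ?_
            ring
        _ ≤ C * B * C * ((2 * R + 1) * cS * 4 + (2 * R + 1) * cS * 4) := by
            have hb : ∀ y, ∑ P ∈ T, (2:ℝ)^(-|P.1 - J.1|) * w (iv P) y ^ 2 ≤ (2 * R + 1) * cS * 4 := fun y =>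
              (htw (fun k => (2:ℝ)^(-|k - J.1|)) (fun k => (p2pos _).le) y).trans
                (mul_le_mul_of_nonneg_left (geom_abs _ _) (by positivity))
            have := hb x; have := hb x'
            gcongr
        _ = _ := by unfold c2; ring
    have e2 : ‖G x‖ = ‖e x * G x‖ := by rw [norm_mul, he, one_mul]
    have e3 : ‖G x'‖ = ‖e x' * G x'‖ := by rw [norm_mul, he, one_mul]
    rw [e2, e3]
    have := norm_sub_norm_le (e x * G x) (e x' * G x')
    linarith
  -- averages of f
  set c1 : ℝ := 2 * 3^N1 with hc1
  have havg : ∀ P ∈ T, ∀ I J : ℤ × ℤ, dy (iv P) ⊆ dy I → dy I ⊆ dy J0 → (∀ x ∈ dy J, 1/3 ≤ w I x) → ln I ≤ 2 * ln J →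
      ∫ x in dy J, ‖f x‖ ≤ c1 * B * ln J := by
    intro P hP I J hPI hIJ hw hln
    have hi : Integrable (fun x => ‖f x‖ * w I x ^ N1) := by
      refine hf.int.norm.mul_bdd (c := 1) ((w_continuous _).pow _).aestronglyMeasurable (Eventually.of_forall fun x => ?_)
      rw [Real.norm_of_nonneg (pow_nonneg (w_pos _ _).le _)]
      exact pow_le_one₀ (w_pos _ _).le (w_le_one _ _)
    calc ∫ x in dy J, ‖f x‖ ≤ ∫ x in dy J, 3^N1 * (‖f x‖ * w I x ^ N1) := by
          refine setIntegral_mono_on hf.int.norm.integrableOn (hi.const_mul _).integrableOn (measurableSet_dy _) fun x hx => ?_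
          have h1 : (1:ℝ) ≤ (3 * w I x)^N1 := one_le_pow₀ (by linarith [hw x hx])
          rw [mul_pow] at h1
          nlinarith [norm_nonneg (f x)]
      _ ≤ 3^N1 * ∫ x, ‖f x‖ * w I x ^ N1 := by
          rw [integral_const_mul]
          refine mul_le_mul_of_nonneg_left ?_ (by positivity)
          refine setIntegral_le_integral hi (Eventually.of_forall fun x => ?_)
          exact mul_nonneg (norm_nonneg _) (pow_nonneg (w_pos _ _).le _)
      _ ≤ 3^N1 * (B * (2 * ln J)) := by
          refine mul_le_mul_of_nonneg_left ((hB P hP I hPI hIJ).trans ?_) (by positivity)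
          gcongr
      _ = _ := by rw [hc1]; ring
  have hind : ∀ n : ℕ, ∀ J : ℤ × ℤ, J.1 < kmin + n → J.1 ≤ J0.1 → ∫ x in dy J, ‖f x‖ ≤ c1 * B * ln J →
      ∫ x in dy J, ‖f x‖ * ‖G x‖ ≤ c1 * B * ((∫ x in dy J, ‖G x‖) + c2 C R * B * ln J) := by
    have hgoodcase : ∀ J : ℤ × ℤ, (∀ P ∈ T, P.1 ≤ J.1 → 1 < |(anc J.1 (iv P)).2 - J.2|) →
        ∫ x in dy J, ‖f x‖ ≤ c1 * B * ln J →
        ∫ x in dy J, ‖f x‖ * ‖G x‖ ≤ c1 * B * ((∫ x in dy J, ‖G x‖) + c2 C R * B * ln J) := by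
      intro J hgood hJ
      have hl := ln_pos J
      have hvol : volume (dy J) ≠ ⊤ := by rw [volume_dy]; exact ENNReal.ofReal_ne_top
      have hb : ∀ x ∈ dy J, ‖G x‖ * ln J ≤ (∫ x in dy J, ‖G x‖) + c2 C R * B * ln J := by
        intro x hx
        have : ∫ x' in dy J, ‖G x‖ ≤ ∫ x' in dy J, (‖G x'‖ + c2 C R * B) :=
          setIntegral_mono_on (integrableOn_const hvol) ((hGd _).add (integrableOn_const hvol)) (measurableSet_dy _)
            fun x' hx' => hosc J hgood x hx x' hx'
        rw [integral_add (hGd _) (integrableOn_const hvol), setIntegral_const, setIntegral_const, volume_real_dy,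
          smul_eq_mul, smul_eq_mul] at this
        linarith
      set A := (∫ x in dy J, ‖G x‖) + c2 C R * B * ln J with hA
      have hAi : 0 ≤ A := by
        obtain ⟨x, hx⟩ := dy_nonempty J
        exact le_trans (by positivity) (hb x hx)
      calc ∫ x in dy J, ‖f x‖ * ‖G x‖ ≤ ∫ x in dy J, ‖f x‖ * (A / ln J) := by
            refine setIntegral_mono_on hdi.integrableOn (hf.int.norm.mul_const _).integrableOn (measurableSet_dy _) fun x hx => ?_
            refine mul_le_mul_of_nonneg_left ?_ (norm_nonneg _)
            rw [le_div_iff₀ hl]; exact hb x hx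
        _ = (∫ x in dy J, ‖f x‖) * (A / ln J) := by rw [integral_mul_const]
        _ ≤ c1 * B * ln J * (A / ln J) := by gcongr
        _ = _ := by field_simp
    intro n
    induction n with
    | zero =>
      intro J hJ _ hJf
      refine hgoodcase J (fun P hP hPJ => ?_) hJf
      have := hkmin P hP
      simp at hJ
      omega
    | succ n ih =>
      intro J hJ hJ0 hJf
      by_cases hgood : ∀ P ∈ T, P.1 ≤ J.1 → 1 < |(anc J.1 (iv P)).2 - J.2|
      · exact hgoodcase J hgood hJf
      · push Not at hgood
        obtain ⟨P, hP, hPJ, hbad⟩ := hgood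
        obtain ⟨j, m⟩ := J
        simp only at hJ hJ0 hPJ hbad
        have hsub1 : dy (iv P) ⊆ dy (anc j (iv P)) := subset_anc hPJ
        have hsub2 : dy (anc j (iv P)) ⊆ dy J0 :=
          dy_subset_of_mem hJ0 (hsub1 (dy_mem_left _)) ((hT P hP).1 (dy_mem_left _))
        have hwJ : ∀ x ∈ dy (j, m), 1/3 ≤ w (anc j (iv P)) x := fun x hx => third_le_w rfl hbad hx
        have hln : ∀ m', ln (anc j (iv P)) ≤ 2 * ln (j-1, m') := by
          intro m'
          simp only [ln, anc]
          rw [zpow_sub₀ (by norm_num)]; simp; linarith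
        have hch := dy_children j m
        have hs1 : dy (j-1, 2*m) ⊆ dy (j, m) := by rw [hch]; exact subset_union_left
        have hs2 : dy (j-1, 2*m+1) ⊆ dy (j, m) := by rw [hch]; exact subset_union_right
        have i1 := ih (j-1, 2*m) (by push_cast at hJ; simp only; omega) (by simp only; omega)
          (havg P hP _ _ hsub1 hsub2 (fun x hx => hwJ x (hs1 hx)) (hln _))
        have i2 := ih (j-1, 2*m+1) (by push_cast at hJ; simp only; omega) (by simp only; omega)
          (havg P hP _ _ hsub1 hsub2 (fun x hx => hwJ x (hs2 hx)) (hln _))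
        have hdj : Disjoint (dy (j-1, 2*m)) (dy (j-1, 2*m+1)) := dy_disj (by omega)
        rw [hch, setIntegral_union hdj (measurableSet_dy _) hdi.integrableOn hdi.integrableOn,
          setIntegral_union hdj (measurableSet_dy _) (hGd _) (hGd _)]
        have el : ln (j, m) = ln (j-1, 2*m) + ln (j-1, 2*m+1) := by
          simp only [ln]
          rw [zpow_sub₀ (by norm_num)]; simp
        rw [el]
        linarith
  -- the three top intervals
  obtain ⟨kT, mT⟩ := J0
  set J0 : ℤ × ℤ := (kT, mT) with hJ0def
  have hlJ := ln_pos J0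
  have hthree : ∀ m : ℤ, |mT - m| ≤ 1 →
      ∫ x in dy (kT, m), ‖f x‖ * ‖G x‖ ≤ c1 * B * ((∫ x in dy (kT, m), ‖G x‖) + c2 C R * B * ln J0) := by
    intro m hm
    refine hind (kT - kmin + 1).toNat (kT, m) (by simp only; omega) le_rfl ?_
    refine havg P0 hP0 J0 (kT, m) (hT P0 hP0).1 Subset.rfl (fun x hx => third_le_w rfl hm hx) ?_
    change ln J0 ≤ 2 * ln J0
    linarith
  set A : Set ℝ := dy (kT, mT - 1) ∪ dy (kT, mT) ∪ dy (kT, mT + 1) with hA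
  have hAm : MeasurableSet A := ((measurableSet_dy _).union (measurableSet_dy _)).union (measurableSet_dy _)
  have hd1 : Disjoint (dy (kT, mT - 1)) (dy (kT, mT)) := dy_disj (by omega)
  have hd2 : Disjoint (dy (kT, mT - 1) ∪ dy (kT, mT)) (dy (kT, mT + 1)) :=
    Disjoint.union_left (dy_disj (by omega)) (dy_disj (by omega))
  have hGA : IntegrableOn (fun x => ‖G x‖) A := ((hGd _).union (hGd _)).union (hGd _)
  have hnear : ∫ x in A, ‖f x‖ * ‖G x‖ ≤ c1 * B * ((∫ x in A, ‖G x‖) + 3 * c2 C R * B * ln J0) := by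
    rw [hA, setIntegral_union hd2 (measurableSet_dy _) hdi.integrableOn hdi.integrableOn,
      setIntegral_union hd1 (measurableSet_dy _) hdi.integrableOn hdi.integrableOn,
      setIntegral_union hd2 (measurableSet_dy _) ((hGd _).union (hGd _)) (hGd _),
      setIntegral_union hd1 (measurableSet_dy _) (hGd _) (hGd _)]
    have a1 := hthree (mT - 1) (by simp)
    have a2 := hthree mT (by simp)
    have a3 := hthree (mT + 1) (by simp)
    linarith
  -- far region
  have hfarpt : ∀ x ∈ Aᶜ, ‖G x‖ ≤ c3 C R N1 * B * w J0 x ^ N1 := by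
    intro x hx
    set m := ⌊x / (2:ℝ)^kT⌋ with hm
    have hxm : x ∈ dy (kT, m) := mem_dy.2 rfl
    have hmm : 1 < |mT - m| := by
      by_contra hcon
      push Not at hcon
      rw [abs_le] at hcon
      apply hx
      have : m = mT - 1 ∨ m = mT ∨ m = mT + 1 := by omega
      rcases this with h' | h' | h' <;> rw [h'] at hxm
      · exact .inl (.inl hxm)
      · exact .inl (.inr hxm)
      · exact .inr hxm
    have hw : ∀ P ∈ T, w (iv P) x ≤ 3 * (2:ℝ)^(P.1 - kT) * w J0 x := by
      intro P hP
      have hp := p2pos P.1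
      have hk := p2pos kT
      have f1 := (w_far hmm (hT P hP).1 hxm).2
      obtain ⟨b1, b2⟩ := (hT P hP).1 (dy_mem_left (iv P))
      simp only [iv, hJ0def] at b1 b2
      unfold w
      simp only [iv, hJ0def]
      have e : x / (2:ℝ)^P.1 - P.2.1 = (x - (2:ℝ)^P.1 * P.2.1) / (2:ℝ)^P.1 := by field_simp
      have e' : x / (2:ℝ)^kT - mT = (x - (2:ℝ)^kT * mT) / (2:ℝ)^kT := by field_simp
      rw [e, e', abs_div, abs_div, abs_of_pos hp, abs_of_pos hk, zpow_sub₀ (by norm_num)]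
      set D := |x - (2:ℝ)^P.1 * P.2.1| with hD
      have e2 : |x - (2:ℝ)^kT * mT| ≤ D + (2:ℝ)^kT := by
        have : x - (2:ℝ)^kT * mT = (x - (2:ℝ)^P.1 * P.2.1) + ((2:ℝ)^P.1 * P.2.1 - (2:ℝ)^kT * mT) := by ring
        rw [this]
        refine (abs_add_le _ _).trans ?_
        gcongr
        rw [abs_le]; constructor <;> linarith
      rw [← div_eq_mul_inv, inv_eq_one_div, div_le_div_iff₀ (by positivity) (by positivity), one_mul]
      calc 1 + |x - (2:ℝ)^kT * mT| / (2:ℝ)^kT ≤ 1 + (D + (2:ℝ)^kT) / (2:ℝ)^kT := by gcongr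
        _ = ((2:ℝ)^kT + (2:ℝ)^kT + D) / (2:ℝ)^kT := by field_simp; ring
        _ ≤ (3 * D) / (2:ℝ)^kT := by gcongr; linarith
        _ = 3 * ((2:ℝ)^P.1 / (2:ℝ)^kT) * (D / (2:ℝ)^P.1) := by field_simp
        _ ≤ _ := by gcongr; linarith
    calc ‖G x‖ ≤ ∑ P ∈ T, (C * B) * (C * (3^(N1+1) * w J0 x ^ N1 * ((2:ℝ)^(P.1 - kT) * w (iv P) x ^ 2))) := by
          refine (norm_sum_le _ _).trans (Finset.sum_le_sum fun P hP => ?_)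
          rw [norm_mul, RCLike.norm_conj]
          refine mul_le_mul (hcf P hP) ((h.decay P x).trans (mul_le_mul_of_nonneg_left ?_ hC.le)) (norm_nonneg _) (by positivity)
          have hw0 := w_pos (iv P) x
          have hw1 := w_pos J0 x
          have hpk : (2:ℝ)^(P.1 - kT) ≤ 1 := zpow_le_one_of_nonpos₀ (by norm_num) (by
            have := scale_le_of_subset (hT P hP).1
            simp only [iv, hJ0def] at this; omega)
          have hpk0 := p2pos (P.1 - kT)
          calc w (iv P) x ^ (N1 + 3) = w (iv P) x ^ (N1+1) * w (iv P) x ^ 2 := by ring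
            _ ≤ (3 * (2:ℝ)^(P.1 - kT) * w J0 x) ^ (N1+1) * w (iv P) x ^ 2 := by
                gcongr; exact hw P hP
            _ = 3^(N1+1) * (w J0 x ^ (N1+1) * (((2:ℝ)^(P.1 - kT)) ^ (N1+1) * w (iv P) x ^ 2)) := by ring
            _ ≤ 3^(N1+1) * (w J0 x ^ N1 * ((2:ℝ)^(P.1 - kT) * w (iv P) x ^ 2)) := by
                gcongr 3^(N1+1) * (?_ * (?_ * _))
                · exact pow_le_pow_of_le_one hw1.le (w_le_one _ _) (by omega)
                · exact pow_le_of_le_one hpk0.le hpk (by omega)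
            _ = _ := by ring
      _ = C * B * C * 3^(N1+1) * w J0 x ^ N1 * ∑ P ∈ T, (2:ℝ)^(P.1 - kT) * w (iv P) x ^ 2 := by
          rw [Finset.mul_sum]; refine Finset.sum_congr rfl fun P _ => ?_; ring
      _ ≤ C * B * C * 3^(N1+1) * w J0 x ^ N1 * ((2 * R + 1) * cS * 2) := by
          have hw1 := w_pos J0 x
          refine mul_le_mul_of_nonneg_left ?_ (by positivity)
          refine (htw (fun k => (2:ℝ)^(k - kT)) (fun k => (p2pos _).le) x).trans
            (mul_le_mul_of_nonneg_left (geom_down _ _ ?_) (by positivity))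
          intro k hk
          obtain ⟨P, hP, rfl⟩ := Finset.mem_image.1 hk
          have := scale_le_of_subset (hT P hP).1
          simpa only [iv, hJ0def] using this
      _ = _ := by unfold c3; ring
  have hfar : ∫ x in Aᶜ, ‖f x‖ * ‖G x‖ ≤ c3 C R N1 * B * (B * ln J0) := by
    have hi : Integrable (fun x => ‖f x‖ * w J0 x ^ N1) := by
      refine hf.int.norm.mul_bdd (c := 1) ((w_continuous _).pow _).aestronglyMeasurable (Eventually.of_forall fun x => ?_)
      rw [Real.norm_of_nonneg (pow_nonneg (w_pos _ _).le _)]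
      exact pow_le_one₀ (w_pos _ _).le (w_le_one _ _)
    calc _ ≤ ∫ x in Aᶜ, c3 C R N1 * B * (‖f x‖ * w J0 x ^ N1) := by
          refine setIntegral_mono_on hdi.integrableOn (hi.const_mul _).integrableOn hAm.compl fun x hx => ?_
          have := mul_le_mul_of_nonneg_left (hfarpt x hx) (norm_nonneg (f x))
          linarith
      _ ≤ c3 C R N1 * B * ∫ x, ‖f x‖ * w J0 x ^ N1 := by
          rw [integral_const_mul]
          refine mul_le_mul_of_nonneg_left (setIntegral_le_integral hi (Eventually.of_forall fun x => ?_)) (by positivity)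
          exact mul_nonneg (norm_nonneg _) (pow_nonneg (w_pos _ _).le _)
      _ ≤ _ := mul_le_mul_of_nonneg_left (hB P0 hP0 J0 (hT P0 hP0).1 Subset.rfl) (by positivity)
  set X := ∑ P ∈ T, (2:ℝ)^P.1 * ‖cf φ f P‖^2 with hX
  have hX0 : 0 ≤ X := Finset.sum_nonneg fun P _ => mul_nonneg (p2pos _).le (by positivity)
  have hsq : ∫ x, ‖G x‖^2 ≤ nD C ρ K * X := by
    have := h.lac_sq (by omega) hK hε T (fun P hP => (hT P hP).2) (fun P => (starRingEnd ℂ) (cf φ f P))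
    simp only [RCLike.norm_conj] at this
    exact this
  have hGsq : Integrable (fun x => ‖G x‖^2) := (h.integrable_sum_sq (by omega) T _).1
  have hvA : volume A ≠ ⊤ := by
    have hv : ∀ I, volume (dy I) < ⊤ := fun I => by rw [volume_dy]; exact ENNReal.ofReal_lt_top
    exact (measure_union_lt_top (measure_union_lt_top (hv _) (hv _)) (hv _)).ne
  have hvA' : volume.real A = 3 * ln J0 := by
    have hv : ∀ I, volume (dy I) ≠ ⊤ := fun I => by rw [volume_dy]; exact ENNReal.ofReal_ne_top
    rw [hA, measureReal_union hd2 (measurableSet_dy _) (by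
        exact (measure_union_lt_top (hv _).lt_top (hv _).lt_top).ne) (hv _),
      measureReal_union hd1 (measurableSet_dy _) (hv _) (hv _), volume_real_dy, volume_real_dy, volume_real_dy]
    simp only [ln, hJ0def]; ring
  set τ := c1 * B * (nD C ρ K + 1) with hτ
  have hc1p : 0 < c1 := by rw [hc1]; positivity
  have hτp : 0 < τ := by positivity
  have hGAle : ∫ x in A, ‖G x‖ ≤ (1/2) * (τ * (3 * ln J0) + τ⁻¹ * (nD C ρ K * X)) := by
    calc ∫ x in A, ‖G x‖ ≤ ∫ x in A, ((1/2) * τ + (1/2) * τ⁻¹ * ‖G x‖^2) := by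
          refine setIntegral_mono_on hGA ((integrableOn_const hvA).add (hGsq.const_mul _).integrableOn) hAm fun x _ => ?_
          have e : (1/2) * τ + (1/2) * τ⁻¹ * ‖G x‖^2 - ‖G x‖ = (1/2) * τ⁻¹ * (τ - ‖G x‖)^2 := by field_simp; ring
          have : 0 ≤ (1/2) * τ⁻¹ * (τ - ‖G x‖)^2 := by positivity
          linarith
      _ = (1/2) * τ * (3 * ln J0) + (1/2) * τ⁻¹ * ∫ x in A, ‖G x‖^2 := by
          have hco : IntegrableOn (fun _ : ℝ => (1/2) * τ) A := integrableOn_const hvA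
          rw [integral_add hco (hGsq.const_mul _).integrableOn, setIntegral_const, hvA',
            integral_const_mul, smul_eq_mul]; ring
      _ ≤ (1/2) * τ * (3 * ln J0) + (1/2) * τ⁻¹ * (nD C ρ K * X) := by
          have : ∫ x in A, ‖G x‖^2 ≤ nD C ρ K * X :=
            (setIntegral_le_integral hGsq (Eventually.of_forall fun x => by positivity)).trans hsq
          gcongr
      _ = _ := by ring
  have hτX : c1 * B * ((1/2) * (τ⁻¹ * (nD C ρ K * X))) ≤ (1/2) * X := by
    have : c1 * B * τ⁻¹ = (nD C ρ K + 1)⁻¹ := by rw [hτ]; field_simp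
    have h2 : (nD C ρ K + 1)⁻¹ * nD C ρ K ≤ 1 := by
      rw [inv_mul_le_iff₀ (by positivity)]; linarith
    calc _ = (1/2) * ((c1 * B * τ⁻¹) * nD C ρ K * X) := by ring
      _ ≤ (1/2) * (1 * X) := by rw [this]; gcongr
      _ = _ := by ring
  have htot : X ≤ (∫ x in A, ‖f x‖ * ‖G x‖) + ∫ x in Aᶜ, ‖f x‖ * ‖G x‖ := by
    rw [integral_add_compl hAm hdi]; exact hdual
  have hm1 := mul_le_mul_of_nonneg_left hGAle (by positivity : 0 ≤ c1 * B)
  have : X ≤ 3 * (c1 * B * τ) * ln J0 + 6 * c1 * c2 C R * B^2 * ln J0 + 2 * c3 C R N1 * B^2 * ln J0 := by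
    nlinarith
  refine this.trans (le_of_eq ?_)
  rw [hτ]; unfold cE; rw [← hc1]; ring

end

end BHT


namespace BHT

open scoped Classical in
/-- lacunary tree energy -/
noncomputable def en (v γ ρ R ε : ℝ) (F : Tile → ℝ) (S : Finset Tile) (t : (ℤ × ℤ) × ℝ) : ℝ :=
  ∑ P ∈ S with (ftree v R t P ∧ lac v γ ρ ε t.2 P), (2:ℝ)^P.1 * F P ^ 2

lemma en_mono {v γ ρ R ε : ℝ} {F : Tile → ℝ} {S S' : Finset Tile} (h : S ⊆ S') (t : (ℤ × ℤ) × ℝ) :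
    en v γ ρ R ε F S t ≤ en v γ ρ R ε F S' t := by
  classical
  unfold en
  refine Finset.sum_le_sum_of_subset_of_nonneg (Finset.filter_subset_filter _ h) fun P _ _ => ?_
  exact mul_nonneg (p2pos _).le (sq_nonneg _)

lemma select {v γ ρ R ε : ℝ} (F : Tile → ℝ) (A : Finset ((ℤ × ℤ) × ℝ)) {lam : ℝ} (hlam : 0 < lam) :
    ∀ (n : ℕ) (S : Finset Tile), S.card ≤ n → ∃ (U : Finset Tile) (top : Tile → (ℤ × ℤ) × ℝ) (S' : Finset Tile),
      U ⊆ S ∧ S' ⊆ S ∧ (∀ P ∈ U, top P ∈ A) ∧ (∀ P ∈ U, ftree v R (top P) P ∧ lac v γ ρ ε (top P).2 P) ∧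
      (∀ t ∈ U.image top, (lam/2)^2 * ln t.1 ≤ ∑ P ∈ U with top P = t, (2:ℝ)^P.1 * F P^2) ∧
      (∀ P ∈ U, ∀ Q ∈ U, ftree v R (top P) Q → ε * (top P).2 ≤ ε * (top Q).2) ∧
      (∀ t ∈ A, en v γ ρ R ε F S' t ≤ (lam/2)^2 * ln t.1) ∧
      (∀ P ∈ S, P ∈ S' ∨ ∃ t ∈ U.image top, ftree v R t P) := by
  classical
  intro n
  induction n with
  | zero =>
    intro S hS
    refine ⟨∅, fun _ => ((0,0),0), ∅, by simp, by simp, by simp, by simp, by simp, by simp, ?_, ?_⟩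
    · intro t _
      simp only [en, Finset.filter_empty, Finset.sum_empty]
      have := ln_pos t.1
      positivity
    · have : S = ∅ := Finset.card_eq_zero.1 (by omega)
      simp [this]
  | succ n ih =>
    intro S hS
    set V := A.filter (fun t => (lam/2)^2 * ln t.1 ≤ en v γ ρ R ε F S t) with hV
    rcases V.eq_empty_or_nonempty with hVe | hVn
    · refine ⟨∅, fun _ => ((0,0),0), S, by simp, by simp, by simp, by simp, by simp, by simp, ?_, ?_⟩
      · intro t ht
        by_contra hcon
        push Not at hcon
        have : t ∈ V := Finset.mem_filter.2 ⟨ht, hcon.le⟩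
        simp [hVe] at this
      · intro P hP; exact .inl hP
    · obtain ⟨t, htV, htmax⟩ := Finset.exists_max_image V (fun t => ε * t.2) hVn
      obtain ⟨htA, htv⟩ := Finset.mem_filter.1 htV
      set St := S.filter (fun P => ftree v R t P ∧ lac v γ ρ ε t.2 P) with hSt
      set S1 := S.filter (fun P => ¬ ftree v R t P) with hS1
      have hStn : St.Nonempty := by
        by_contra hcon
        rw [Finset.not_nonempty_iff_eq_empty] at hcon
        have h0 : en v γ ρ R ε F S t = 0 := by
          have : en v γ ρ R ε F S t = ∑ P ∈ St, (2:ℝ)^P.1 * F P ^ 2 := by unfold en; congr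
          rw [this, hcon, Finset.sum_empty]
        have := ln_pos t.1
        have : 0 < (lam/2)^2 * ln t.1 := by positivity
        linarith
      obtain ⟨P0, hP0⟩ := hStn
      have hP0' := Finset.mem_filter.1 hP0
      have hcard : S1.card < S.card := by
        refine Finset.card_lt_card ⟨Finset.filter_subset _ _, fun hcon => ?_⟩
        exact (Finset.mem_filter.1 (hcon hP0'.1)).2 hP0'.2.1
      obtain ⟨U1, top1, S', hU1, hS', htA1, h1, h2, h4, hout, hcov⟩ := ih S1 (by omega)
      have hnot : ∀ P ∈ U1, P ∉ St := fun P hP hcon =>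
        (Finset.mem_filter.1 (hU1 hP)).2 (Finset.mem_filter.1 hcon).2.1
      have hne : ∀ P ∈ U1, top1 P ≠ t := fun P hP hcon =>
        (Finset.mem_filter.1 (hU1 hP)).2 (hcon ▸ (h1 P hP).1)
      set top : Tile → (ℤ × ℤ) × ℝ := fun P => if P ∈ St then t else top1 P with htop
      have e1 : ∀ P ∈ St, top P = t := fun P hP => if_pos hP
      have e2 : ∀ P ∈ U1, top P = top1 P := fun P hP => if_neg (hnot P hP)
      have hS1S : S1 ⊆ S := Finset.filter_subset _ _
      have hmem : ∀ P ∈ St ∪ U1, P ∈ St ∨ P ∈ U1 := fun P hP => Finset.mem_union.1 hP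
      refine ⟨St ∪ U1, top, S', ?_, hS'.trans hS1S, ?_, ?_, ?_, ?_, hout, ?_⟩
      · exact Finset.union_subset (Finset.filter_subset _ _) (hU1.trans hS1S)
      · intro P hP
        rcases hmem P hP with h | h
        · rw [e1 P h]; exact htA
        · rw [e2 P h]; exact htA1 P h
      · intro P hP
        rcases hmem P hP with h | h
        · rw [e1 P h]; exact (Finset.mem_filter.1 h).2
        · rw [e2 P h]; exact h1 P h
      · intro t' ht'
        obtain ⟨P, hP, rfl⟩ := Finset.mem_image.1 ht'
        rcases hmem P hP with h | h
        · rw [e1 P h]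
          have : (St ∪ U1).filter (fun Q => top Q = t) = St := by
            ext Q
            simp only [Finset.mem_filter, Finset.mem_union]
            constructor
            · rintro ⟨h' | h', h''⟩
              · exact h'
              · rw [e2 Q h'] at h''; exact absurd h'' (hne Q h')
            · intro h'; exact ⟨.inl h', e1 Q h'⟩
          rw [this]
          refine htv.trans (le_of_eq ?_)
          unfold en; congr
        · rw [e2 P h]
          have := h2 (top1 P) (Finset.mem_image_of_mem _ h)
          refine this.trans (Finset.sum_le_sum_of_subset_of_nonneg ?_ fun P _ _ => mul_nonneg (p2pos _).le (sq_nonneg _))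
          intro Q hQ
          obtain ⟨hQ, hQ'⟩ := Finset.mem_filter.1 hQ
          refine Finset.mem_filter.2 ⟨Finset.mem_union_right _ hQ, ?_⟩
          rw [e2 Q hQ, hQ']
      · intro P hP Q hQ hPQ
        rcases hmem P hP with h | h <;> rcases hmem Q hQ with h' | h'
        · rw [e1 P h, e1 Q h']
        · rw [e1 P h] at hPQ
          exact absurd hPQ (Finset.mem_filter.1 (hU1 h')).2
        · rw [e2 P h, e1 Q h']
          refine htmax _ (Finset.mem_filter.2 ⟨htA1 P h, ?_⟩)
          refine (h2 (top1 P) (Finset.mem_image_of_mem _ h)).trans ?_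
          unfold en
          refine Finset.sum_le_sum_of_subset_of_nonneg ?_ fun P _ _ => mul_nonneg (p2pos _).le (sq_nonneg _)
          intro Z hZ
          obtain ⟨hZ, hZ'⟩ := Finset.mem_filter.1 hZ
          refine Finset.mem_filter.2 ⟨hS1S (hU1 hZ), ?_⟩
          rw [← hZ']; exact h1 Z hZ
        · rw [e2 P h] at hPQ ⊢
          rw [e2 Q h']
          exact h4 P h Q h' hPQ
      · intro P hP
        by_cases hf : ftree v R t P
        · right
          refine ⟨t, Finset.mem_image.2 ⟨P0, Finset.mem_union_left _ hP0, e1 P0 hP0⟩, hf⟩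
        · rcases hcov P (Finset.mem_filter.2 ⟨hP, hf⟩) with h | ⟨t', ht', h⟩
          · exact .inl h
          · right
            obtain ⟨Q, hQ, rfl⟩ := Finset.mem_image.1 ht'
            exact ⟨top1 Q, Finset.mem_image.2 ⟨Q, Finset.mem_union_right _ hQ, e2 Q hQ⟩, h⟩

/-- size of a collection -/
def Sz (v γ ρ R : ℝ) (A : Finset ((ℤ × ℤ) × ℝ)) (F : Tile → ℝ) (S : Finset Tile) (lam : ℝ) : Prop :=
  ∀ ε : ℝ, ε = 1 ∨ ε = -1 → ∀ t ∈ A, en v γ ρ R ε F S t ≤ lam^2 * ln t.1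

lemma Sz.mono {v γ ρ R : ℝ} {A : Finset ((ℤ × ℤ) × ℝ)} {F : Tile → ℝ} {S S' : Finset Tile} {lam : ℝ}
    (h : Sz v γ ρ R A F S lam) (hS : S' ⊆ S) : Sz v γ ρ R A F S' lam :=
  fun ε hε t ht => (en_mono hS t).trans (h ε hε t ht)

lemma PS.select2 {φ : Tile → ℝ → ℂ} {v γ ρ R C : ℝ} (h : PS φ v γ ρ R C 6) {K : ℕ} (hK : |γ| + R + 3 * ρ ≤ ρ * 2^K)
    {f : ℝ → ℂ} (hf : Nice f) (A : Finset ((ℤ × ℤ) × ℝ)) {lam : ℝ} (hlam : 0 < lam) (S : Finset Tile)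
    (h3 : ∀ P ∈ S, ‖cf φ f P‖ ≤ lam) :
    ∃ (𝒯 : Finset ((ℤ × ℤ) × ℝ)) (S' : Finset Tile), 𝒯 ⊆ A ∧ S' ⊆ S ∧
      Sz v γ ρ R A (fun P => ‖cf φ f P‖) S' (lam/2) ∧ (∀ P ∈ S, P ∈ S' ∨ ∃ t ∈ 𝒯, ftree v R t P) ∧
      lam^2 * ∑ t ∈ 𝒯, ln t.1 ≤ 8 * cD C ρ R K * ∫ x, ‖f x‖^2 := by
  classical
  obtain ⟨U1, top1, S1, a1, a2, a3, a4, a5, a6, a7, a8⟩ :=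
    select (v := v) (γ := γ) (ρ := ρ) (R := R) (ε := 1) (fun P => ‖cf φ f P‖) A hlam S.card S le_rfl
  obtain ⟨U2, top2, S2, b1, b2, b3, b4, b5, b6, b7, b8⟩ :=
    select (v := v) (γ := γ) (ρ := ρ) (R := R) (ε := -1) (fun P => ‖cf φ f P‖) A hlam S1.card S1 le_rfl
  have c1 := h.count hK (.inl rfl) U1 top1 f hf hlam a4 a5 (fun P hP => h3 P (a1 hP)) a6
  have c2 := h.count hK (.inr rfl) U2 top2 f hf hlam b4 b5 (fun P hP => h3 P (a2 (b1 hP))) b6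
  refine ⟨U1.image top1 ∪ U2.image top2, S2, ?_, b2.trans a2, ?_, ?_, ?_⟩
  · refine Finset.union_subset ?_ ?_
    · intro t ht; obtain ⟨P, hP, rfl⟩ := Finset.mem_image.1 ht; exact a3 P hP
    · intro t ht; obtain ⟨P, hP, rfl⟩ := Finset.mem_image.1 ht; exact b3 P hP
  · rintro ε (rfl | rfl) t ht
    · exact (en_mono b2 t).trans (a7 t ht)
    · exact b7 t ht
  · intro P hP
    rcases a8 P hP with h' | ⟨t, ht, h'⟩
    · rcases b8 P h' with h'' | ⟨t, ht, h''⟩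
      · exact .inl h''
      · exact .inr ⟨t, Finset.mem_union_right _ ht, h''⟩
    · exact .inr ⟨t, Finset.mem_union_left _ ht, h'⟩
  · have : ∑ t ∈ U1.image top1 ∪ U2.image top2, ln t.1 ≤ ∑ t ∈ U1.image top1, ln t.1 + ∑ t ∈ U2.image top2, ln t.1 := by
      rw [← Finset.sum_union_inter]
      have : 0 ≤ ∑ t ∈ U1.image top1 ∩ U2.image top2, ln t.1 := Finset.sum_nonneg fun t _ => (ln_pos _).le
      linarith
    have := mul_le_mul_of_nonneg_left this (sq_nonneg lam)
    linarith

/-- triple packet system -/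
structure TS (φ : Fin 3 → Tile → ℝ → ℂ) (v : ℝ) (γ : Fin 3 → ℝ) (ρ R C : ℝ) (N K : ℕ) : Prop where
  ps : ∀ i, PS (φ i) v (γ i) ρ R C N
  hK : ∀ i, |γ i| + R + 3 * ρ ≤ ρ * 2^K
  sep : ∀ i j, i ≠ j → 4 * ρ ≤ |γ i - γ j|

/-- the trilinear sum -/
noncomputable def Lam (F : Fin 3 → Tile → ℝ) (S : Finset Tile) : ℝ := ∑ P ∈ S, (2:ℝ)^P.1 * ∏ i, F i P

/-- tops -/
def GoodA (v : ℝ) (γ : Fin 3 → ℝ) (A : Finset ((ℤ × ℤ) × ℝ)) (S : Finset Tile) : Prop :=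
  ∀ P ∈ S, ∀ j, (iv P, fr v (γ j) P) ∈ A

section
variable {φ : Fin 3 → Tile → ℝ → ℂ} {v : ℝ} {γ : Fin 3 → ℝ} {ρ R C : ℝ} {N K : ℕ}

lemma th_fr (v γ : ℝ) (P : Tile) : th v P (fr v γ P) = γ := by
  have := p2pos P.1
  unfold th fr; field_simp; ring

lemma abs_sep {a b : ℝ} {r : ℝ} (h : r ≤ |a - b|) : ∃ ε : ℝ, (ε = 1 ∨ ε = -1) ∧ r ≤ ε * (a - b) := by
  rcases le_total 0 (a - b) with h' | h'
  · exact ⟨1, .inl rfl, by rw [abs_of_nonneg h'] at h; linarith⟩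
  · exact ⟨-1, .inr rfl, by rw [abs_of_nonpos h'] at h; linarith⟩

lemma exists_ne3 (i : Fin 3) : ∃ j, j ≠ i := by
  fin_cases i
  · exact ⟨1, by decide⟩
  · exact ⟨0, by decide⟩
  · exact ⟨0, by decide⟩

lemma TS.F_le (h : TS φ v γ ρ R C N K) {A : Finset ((ℤ × ℤ) × ℝ)} {S : Finset Tile} (hA : GoodA v γ A S) {F : Tile → ℝ}
    (hF : ∀ P, 0 ≤ F P) {i : Fin 3} {lam : ℝ} (hl : 0 ≤ lam) (hS : Sz v (γ i) ρ R A F S lam) {P : Tile} (hP : P ∈ S) : F P ≤ lam := by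
  classical
  obtain ⟨j, hj⟩ := exists_ne3 i
  have hρ := (h.ps i).ρpos
  obtain ⟨ε, hε, hs⟩ := abs_sep (h.sep i j hj.symm)
  have := hS ε hε _ (hA P hP j)
  have h2 : (2:ℝ)^P.1 * F P^2 ≤ en v (γ i) ρ R ε F S (iv P, fr v (γ j) P) := by
    unfold en
    refine Finset.single_le_sum (f := fun P => (2:ℝ)^P.1 * F P^2) (fun P _ => mul_nonneg (p2pos _).le (sq_nonneg _)) ?_
    refine Finset.mem_filter.2 ⟨hP, ⟨Subset.rfl, ?_⟩, ?_⟩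
    · simp only [th_fr]; have := (h.ps j).hR; linarith
    · simp only [lac, th_fr]; linarith
  have h3 : (2:ℝ)^P.1 * F P^2 ≤ (2:ℝ)^P.1 * lam^2 := by
    refine (h2.trans this).trans (le_of_eq ?_)
    simp only [ln, iv]; ring
  have h4 := le_of_mul_le_mul_left h3 (p2pos _)
  exact (pow_le_pow_iff_left₀ (hF P) hl (by norm_num)).1 h4

lemma TS.tree (h : TS φ v γ ρ R C N K) {A : Finset ((ℤ × ℤ) × ℝ)} {S : Finset Tile} (hA : GoodA v γ A S) {F : Fin 3 → Tile → ℝ}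
    (hF : ∀ i P, 0 ≤ F i P) {μ : Fin 3 → ℝ} (hμ : ∀ i, 0 < μ i) (hS : ∀ i, Sz v (γ i) ρ R A (F i) S (μ i))
    {t : (ℤ × ℤ) × ℝ} (ht : t ∈ A) {S' : Finset Tile} (hS' : S' ⊆ S) (hf : ∀ P ∈ S', ftree v R t P) :
    Lam F S' ≤ 3 * ln t.1 * ∏ i, μ i := by
  classical
  have hFm : ∀ i, ∀ P ∈ S, F i P ≤ μ i := fun i P hP => h.F_le hA (hF i) (hμ i).le (hS i) hP
  set e : Fin 3 → ℝ → Tile → ℝ := fun i ε P => if lac v (γ i) ρ ε t.2 P then (2:ℝ)^P.1 * F i P^2 else 0 with he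
  have he0 : ∀ i ε P, 0 ≤ e i ε P := fun i ε P => by
    simp only [he]; split_ifs
    · exact mul_nonneg (p2pos _).le (sq_nonneg _)
    · exact le_rfl
  have hesum : ∀ i ε, ε = 1 ∨ ε = -1 → ∑ P ∈ S', e i ε P ≤ μ i^2 * ln t.1 := by
    intro i ε hε
    refine le_trans ?_ (hS i ε hε t ht)
    simp only [he]
    rw [← Finset.sum_filter]
    unfold en
    refine Finset.sum_le_sum_of_subset_of_nonneg ?_ fun P _ _ => mul_nonneg (p2pos _).le (sq_nonneg _)
    intro P hP
    obtain ⟨hP, hP'⟩ := Finset.mem_filter.1 hP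
    exact Finset.mem_filter.2 ⟨hS' hP, hf P hP, hP'⟩
  have hpt : ∀ P ∈ S', (2:ℝ)^P.1 * ∏ i, F i P ≤ (∏ i, μ i) * (1/2 * ∑ i, (μ i^2)⁻¹ * (e i 1 P + e i (-1) P)) := by
    intro P hP
    have hp := p2pos P.1
    set x : Fin 3 → ℝ := fun i => F i P / μ i with hx
    have hx0 : ∀ i, 0 ≤ x i := fun i => div_nonneg (hF i P) (hμ i).le
    have hx1 : ∀ i, x i ≤ 1 := fun i => (div_le_one (hμ i)).2 (hFm i P (hS' hP))
    set y : Fin 3 → ℝ := fun i => (μ i^2)⁻¹ * (e i 1 P + e i (-1) P) with hy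
    have hy0 : ∀ i, 0 ≤ y i := fun i => mul_nonneg (inv_nonneg.2 (sq_nonneg _)) (add_nonneg (he0 _ _ _) (he0 _ _ _))
    have hprod : ∏ i, F i P = (∏ i, μ i) * ∏ i, x i := by
      rw [← Finset.prod_mul_distrib]
      refine Finset.prod_congr rfl fun i _ => ?_
      simp only [hx]; have := hμ i; field_simp
    have hlac : ∀ i, 2 * ρ ≤ |γ i - th v P t.2| → (2:ℝ)^P.1 * x i^2 ≤ y i := by
      intro i hi
      obtain ⟨ε, hε, hs⟩ := abs_sep hi
      have e1 : e i ε P = (2:ℝ)^P.1 * F i P^2 := by simp only [he]; exact if_pos hs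
      have e2 : (2:ℝ)^P.1 * x i^2 = (μ i^2)⁻¹ * e i ε P := by
        rw [e1]; simp only [hx]; have := hμ i; field_simp
      rw [e2]
      refine mul_le_mul_of_nonneg_left ?_ (inv_nonneg.2 (sq_nonneg _))
      rcases hε with rfl | rfl
      · linarith [he0 i (-1) P]
      · linarith [he0 i 1 P]
    have hsep : ∀ i j, i ≠ j → 2 * ρ ≤ |γ i - th v P t.2| ∨ 2 * ρ ≤ |γ j - th v P t.2| := by
      intro i j hij
      by_contra hcon
      push Not at hcon
      have h4 := h.sep i j hij
      have : |γ i - γ j| ≤ |γ i - th v P t.2| + |γ j - th v P t.2| := by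
        have := abs_sub_le (γ i) (th v P t.2) (γ j)
        rwa [abs_sub_comm (th v P t.2) (γ j)] at this
      linarith [hcon.1, hcon.2]
    rw [hprod]
    have hgoal : (2:ℝ)^P.1 * ∏ i, x i ≤ 1/2 * ∑ i, y i := by
      rw [Fin.prod_univ_three, Fin.sum_univ_three]
      have a := hx0 0; have b := hx0 1; have c := hx0 2
      have a' := hx1 0; have b' := hx1 1; have c' := hx1 2
      have two : ∀ i j k : Fin 3, (2:ℝ)^P.1 * x i^2 ≤ y i → (2:ℝ)^P.1 * x j^2 ≤ y j →
          (2:ℝ)^P.1 * (x i * x j * x k) ≤ 1/2 * (y i + y j) := by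
        intro i j k h1 h2
        have h3 : x i * x j * x k ≤ x i * x j := mul_le_of_le_one_right (mul_nonneg (hx0 i) (hx0 j)) (hx1 k)
        have h4 : x i * x j ≤ 1/2 * (x i^2 + x j^2) := by nlinarith [sq_nonneg (x i - x j)]
        have := mul_le_mul_of_nonneg_left (h3.trans h4) hp.le
        linarith
      have := hy0 0; have := hy0 1; have := hy0 2
      rcases hsep 0 1 (by decide) with h01 | h01
      · rcases hsep 1 2 (by decide) with h12 | h12
        · have := two 0 1 2 (hlac _ h01) (hlac _ h12); linarith
        · have := two 0 2 1 (hlac _ h01) (hlac _ h12)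
          have e : x 0 * x 1 * x 2 = x 0 * x 2 * x 1 := by ring
          rw [e]; linarith
      · rcases hsep 0 2 (by decide) with h02 | h02
        · have := two 0 1 2 (hlac _ h02) (hlac _ h01); linarith
        · have := two 1 2 0 (hlac _ h01) (hlac _ h02)
          have e : x 0 * x 1 * x 2 = x 1 * x 2 * x 0 := by ring
          rw [e]; linarith
    have hμ' : 0 ≤ ∏ i, μ i := Finset.prod_nonneg fun i _ => (hμ i).le
    have := mul_le_mul_of_nonneg_left hgoal hμ'
    calc _ = (∏ i, μ i) * ((2:ℝ)^P.1 * ∏ i, x i) := by ring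
      _ ≤ _ := this
  unfold Lam
  refine (Finset.sum_le_sum hpt).trans ?_
  rw [← Finset.mul_sum, ← Finset.mul_sum, Finset.sum_comm, mul_comm (3 * ln t.1)]
  refine mul_le_mul_of_nonneg_left ?_ (Finset.prod_nonneg fun i _ => (hμ i).le)
  have : ∀ i ∈ (Finset.univ : Finset (Fin 3)), ∑ P ∈ S', (μ i^2)⁻¹ * (e i 1 P + e i (-1) P) ≤ 2 * ln t.1 := by
    intro i _
    rw [← Finset.mul_sum, Finset.sum_add_distrib, inv_mul_le_iff₀ (by have := hμ i; positivity)]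
    have := hesum i 1 (.inl rfl)
    have := hesum i (-1) (.inr rfl)
    linarith
  have := Finset.sum_le_sum this
  simp only [Finset.sum_const, Finset.card_univ, Fintype.card_fin, nsmul_eq_mul] at this
  push_cast at this
  linarith

lemma TS.step (h : TS φ v γ ρ R C 6 K) {f : Fin 3 → ℝ → ℂ} (hf : ∀ i, Nice (f i)) {A : Finset ((ℤ × ℤ) × ℝ)} {S : Finset Tile}
    (hA : GoodA v γ A S) {lam μ : Fin 3 → ℝ} (hlam : ∀ i, 0 < lam i) (hμ : ∀ i, 0 < μ i)
    (hS : ∀ i, Sz v (γ i) ρ R A (fun P => ‖cf (φ i) (f i) P‖) S (lam i))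
    (hS2 : ∀ i, Sz v (γ i) ρ R A (fun P => ‖cf (φ i) (f i) P‖) S (μ i)) {D : ℝ}
    (hD : ∀ i, ∫ x, ‖f i x‖^2 ≤ D * lam i^2) :
    ∃ S' ⊆ S, (∀ i, Sz v (γ i) ρ R A (fun P => ‖cf (φ i) (f i) P‖) S' (lam i / 2)) ∧
      Lam (fun i P => ‖cf (φ i) (f i) P‖) S ≤ Lam (fun i P => ‖cf (φ i) (f i) P‖) S' + 72 * cD C ρ R K * D * ∏ i, μ i := by
  classical
  set F : Fin 3 → Tile → ℝ := fun i P => ‖cf (φ i) (f i) P‖ with hF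
  have hF0 : ∀ i P, 0 ≤ F i P := fun i P => norm_nonneg _
  have hcD := (h.ps 0).cD_pos K
  have sel := fun i => (h.ps i).select2 (h.hK i) (hf i) A (hlam i) S
    (fun P hP => h.F_le hA (hF0 i) (hlam i).le (hS i) hP)
  choose 𝒯 S1 s1 s2 s3 s4 s5 using sel
  set S' := S.filter (fun P => ∀ i, P ∈ S1 i) with hS'
  have hsub : ∀ i, S' ⊆ S1 i := fun i P hP => (Finset.mem_filter.1 hP).2 i
  refine ⟨S', Finset.filter_subset _ _, fun i => (s3 i).mono (hsub i), ?_⟩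
  have hg : ∀ P, 0 ≤ (2:ℝ)^P.1 * ∏ i, F i P := fun P =>
    mul_nonneg (p2pos _).le (Finset.prod_nonneg fun i _ => hF0 i P)
  have hmain : Lam F S ≤ Lam F S' + ∑ i, ∑ t ∈ 𝒯 i, Lam F (S.filter (ftree v R t)) := by
    simp only [Lam, Finset.sum_filter, hS']
    rw [show (∑ i, ∑ t ∈ 𝒯 i, ∑ P ∈ S, if ftree v R t P then (2:ℝ)^P.1 * ∏ i, F i P else 0) =
      ∑ P ∈ S, ∑ i, ∑ t ∈ 𝒯 i, if ftree v R t P then (2:ℝ)^P.1 * ∏ i, F i P else 0 by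
        rw [Finset.sum_comm]; refine Finset.sum_congr rfl fun i _ => ?_; rw [Finset.sum_comm], ← Finset.sum_add_distrib]
    refine Finset.sum_le_sum fun P hP => ?_
    have hnn : ∀ i, ∀ t ∈ 𝒯 i, 0 ≤ if ftree v R t P then (2:ℝ)^P.1 * ∏ i, F i P else 0 := fun i t _ => by
      split_ifs
      · exact hg P
      · exact le_rfl
    by_cases hall : ∀ i, P ∈ S1 i
    · rw [if_pos hall]
      exact le_add_of_nonneg_right (Finset.sum_nonneg fun i _ => Finset.sum_nonneg (hnn i))
    · rw [if_neg hall, zero_add]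
      push Not at hall
      obtain ⟨i, hi⟩ := hall
      obtain ⟨t, ht, htP⟩ := (s4 i P hP).resolve_left hi
      calc (2:ℝ)^P.1 * ∏ i, F i P = if ftree v R t P then (2:ℝ)^P.1 * ∏ i, F i P else 0 := (if_pos htP).symm
        _ ≤ ∑ t ∈ 𝒯 i, if ftree v R t P then (2:ℝ)^P.1 * ∏ i, F i P else 0 :=
            Finset.single_le_sum (f := fun t => if ftree v R t P then (2:ℝ)^P.1 * ∏ i, F i P else 0) (hnn i) ht
        _ ≤ _ := Finset.single_le_sum (f := fun i => ∑ t ∈ 𝒯 i, if ftree v R t P then (2:ℝ)^P.1 * ∏ i, F i P else 0)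
            (fun i _ => Finset.sum_nonneg (hnn i)) (Finset.mem_univ i)
  refine hmain.trans ?_
  gcongr
  have hμ0 : 0 ≤ ∏ i, μ i := Finset.prod_nonneg fun i _ => (hμ i).le
  calc ∑ i, ∑ t ∈ 𝒯 i, Lam F (S.filter (ftree v R t)) ≤ ∑ i : Fin 3, ∑ t ∈ 𝒯 i, 3 * ln t.1 * ∏ i, μ i := by
        refine Finset.sum_le_sum fun i _ => Finset.sum_le_sum fun t ht => ?_
        exact h.tree hA hF0 hμ hS2 (s1 i ht) (Finset.filter_subset _ _) fun P hP => (Finset.mem_filter.1 hP).2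
    _ = ∑ i : Fin 3, 3 * (∏ i, μ i) * ∑ t ∈ 𝒯 i, ln t.1 := by
        refine Finset.sum_congr rfl fun i _ => ?_
        rw [Finset.mul_sum]; refine Finset.sum_congr rfl fun t _ => ?_; ring
    _ ≤ ∑ i : Fin 3, 3 * (∏ i, μ i) * (8 * cD C ρ R K * D) := by
        refine Finset.sum_le_sum fun i _ => mul_le_mul_of_nonneg_left ?_ (by positivity)
        have hl : 0 < lam i^2 := by have := hlam i; positivity
        refine le_of_mul_le_mul_left ((s5 i).trans ?_) hl
        calc 8 * cD C ρ R K * ∫ x, ‖f i x‖^2 ≤ 8 * cD C ρ R K * (D * lam i^2) := by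
              have := hD i; gcongr
          _ = _ := by ring
    _ = _ := by simp; ring

lemma TS.iter (h : TS φ v γ ρ R C 6 K) {f : Fin 3 → ℝ → ℂ} (hf : ∀ i, Nice (f i)) {A : Finset ((ℤ × ℤ) × ℝ)} {S : Finset Tile}
    (hA : GoodA v γ A S) {E Z : Fin 3 → ℝ} (hZ : ∀ i, 0 < Z i) (hZE : ∀ i, Z i ≤ E i)
    (hS : ∀ i, Sz v (γ i) ρ R A (fun P => ‖cf (φ i) (f i) P‖) S (Z i)) {D : ℝ}
    (hD : ∀ i, ∫ x, ‖f i x‖^2 ≤ D * E i^2) (n : ℕ) :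
    ∃ S' ⊆ S, (∀ i, Sz v (γ i) ρ R A (fun P => ‖cf (φ i) (f i) P‖) S' (E i / 2^n)) ∧
      Lam (fun i P => ‖cf (φ i) (f i) P‖) S ≤ Lam (fun i P => ‖cf (φ i) (f i) P‖) S' +
        72 * cD C ρ R K * D * ∑ m ∈ Finset.range n, 4^m * ∏ i, min (E i / 2^m) (Z i) := by
  induction n with
  | zero =>
    refine ⟨S, Subset.rfl, fun i ε hε t ht => (hS i ε hε t ht).trans ?_, by simp⟩
    have := hZ i; have := hZE i; have := ln_pos t.1
    rw [pow_zero, div_one]; gcongr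
  | succ n ih =>
    obtain ⟨S1, hS1, hsz, hlam⟩ := ih
    have hE : ∀ i, 0 < E i := fun i => (hZ i).trans_le (hZE i)
    have hA1 : GoodA v γ A S1 := fun P hP => hA P (hS1 hP)
    obtain ⟨S2, hS2, hsz2, hlam2⟩ := h.step hf hA1 (lam := fun i => E i / 2^n) (μ := fun i => min (E i / 2^n) (Z i))
      (fun i => by have := hE i; positivity) (fun i => by have := hE i; exact lt_min (by positivity) (hZ i)) hsz
      (fun i ε hε t ht => by
        rcases min_choice (E i / 2^n) (Z i) with e | e
        · rw [e]; exact hsz i ε hε t ht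
        · rw [e]; exact (en_mono hS1 t).trans (hS i ε hε t ht)) (D := D * 4^n)
      (fun i => (hD i).trans (le_of_eq (by
        have : (4:ℝ)^n = (2^n)^2 := by rw [← pow_mul, mul_comm, pow_mul]; norm_num
        rw [this]; field_simp)))
    refine ⟨S2, hS2.trans hS1, fun i => ?_, ?_⟩
    · have := hsz2 i
      rwa [div_div, ← pow_succ] at this
    · rw [Finset.sum_range_succ]
      nlinarith

/-- the abstract estimate -/
lemma TS.energy (h : TS φ v γ ρ R C 6 K) {f : Fin 3 → ℝ → ℂ} (hf : ∀ i, Nice (f i)) {A : Finset ((ℤ × ℤ) × ℝ)} {S : Finset Tile}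
    (hA : GoodA v γ A S) {E Z : Fin 3 → ℝ} (hZ : ∀ i, 0 < Z i) (hZE : ∀ i, Z i ≤ E i)
    (hS : ∀ i, Sz v (γ i) ρ R A (fun P => ‖cf (φ i) (f i) P‖) S (Z i)) {D : ℝ} (hD0 : 0 ≤ D)
    (hD : ∀ i, ∫ x, ‖f i x‖^2 ≤ D * E i^2) {θ : Fin 3 → ℝ} (hθ0 : ∀ i, 0 ≤ θ i) (hθ1 : ∀ i, θ i ≤ 1) (hθ : ∑ i, θ i < 1) :
    Lam (fun i P => ‖cf (φ i) (f i) P‖) S ≤ 72 * cD C ρ R K * (1 - (2:ℝ)^(-(1 - ∑ i, θ i)))⁻¹ * D *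
      ∏ i, (Z i ^ θ i * E i ^ (1 - θ i)) := by
  have hE : ∀ i, 0 < E i := fun i => (hZ i).trans_le (hZE i)
  have hcD := (h.ps 0).cD_pos K
  set q : ℝ := (2:ℝ)^(-(1 - ∑ i, θ i)) with hq
  have hq0 : 0 < q := by positivity
  have hq1 : q < 1 := Real.rpow_lt_one_of_one_lt_of_neg (by norm_num) (by linarith)
  set Pr := ∏ i, (Z i ^ θ i * E i ^ (1 - θ i)) with hPr
  have hPr0 : 0 ≤ Pr := Finset.prod_nonneg fun i _ => by have := hZ i; have := hE i; positivity
  have hterm : ∀ m : ℕ, 4^m * ∏ i, min (E i / 2^m) (Z i) ≤ Pr * q^m := by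
    intro m
    have h1 : ∀ i, min (E i / 2^m) (Z i) ≤ (Z i ^ θ i * E i ^ (1 - θ i)) * ((2:ℝ)^m) ^ (-(1 - θ i)) := by
      intro i
      have hz := hZ i; have he := hE i
      set x := min (E i / 2^m) (Z i) with hx
      have hx0 : 0 < x := lt_min (by positivity) hz
      calc x = x ^ θ i * x ^ (1 - θ i) := by rw [← Real.rpow_add hx0]; simp
        _ ≤ Z i ^ θ i * (E i / 2^m) ^ (1 - θ i) := by
            gcongr
            · exact hθ0 i
            · exact min_le_right _ _
            · linarith [hθ1 i]
            · exact min_le_left _ _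
        _ = _ := by
            rw [Real.div_rpow he.le (by positivity), Real.rpow_neg (by positivity)]; ring
    calc 4^m * ∏ i, min (E i / 2^m) (Z i) ≤ 4^m * ∏ i, ((Z i ^ θ i * E i ^ (1 - θ i)) * ((2:ℝ)^m) ^ (-(1 - θ i))) := by
          refine mul_le_mul_of_nonneg_left (Finset.prod_le_prod (fun i _ => ?_) fun i _ => h1 i) (by positivity)
          have := hZ i; have := hE i
          exact le_min (by positivity) (by positivity)
      _ = Pr * (4^m * ((2:ℝ)^m) ^ (∑ i, -(1 - θ i))) := by
          rw [Finset.prod_mul_distrib, Real.rpow_sum_of_pos (by positivity)]; ring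
      _ = Pr * q^m := by
          congr 1
          rw [hq, ← Real.rpow_natCast, ← Real.rpow_natCast, ← Real.rpow_natCast, ← Real.rpow_mul (by norm_num),
            ← Real.rpow_mul (by norm_num), show (4:ℝ) = 2^(2:ℝ) by norm_num, ← Real.rpow_mul (by norm_num),
            ← Real.rpow_add (by norm_num)]
          congr 1
          simp only [Fin.sum_univ_three]; ring
  have hsum : ∀ n : ℕ, ∑ m ∈ Finset.range n, 4^m * ∏ i, min (E i / 2^m) (Z i) ≤ Pr * (1 - q)⁻¹ := by
    intro n
    calc _ ≤ ∑ m ∈ Finset.range n, Pr * q^m := Finset.sum_le_sum fun m _ => hterm m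
      _ = Pr * ∑ m ∈ Finset.range n, q^m := by rw [Finset.mul_sum]
      _ ≤ _ := by
          refine mul_le_mul_of_nonneg_left ?_ hPr0
          rw [← tsum_geometric_of_lt_one hq0.le hq1]
          exact (summable_geometric_of_lt_one hq0.le hq1).sum_le_tsum _ fun m _ => by positivity
  have hall : ∀ n : ℕ, Lam (fun i P => ‖cf (φ i) (f i) P‖) S ≤ (∑ P ∈ S, (2:ℝ)^P.1 * ∏ i, E i) * (1/2)^n +
      72 * cD C ρ R K * D * (Pr * (1 - q)⁻¹) := by
    intro n
    obtain ⟨S', hS', hsz, hlam⟩ := h.iter hf hA hZ hZE hS hD n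
    refine hlam.trans (add_le_add ?_ (mul_le_mul_of_nonneg_left (hsum n) (by positivity)))
    rw [Finset.sum_mul]
    unfold Lam
    refine (Finset.sum_le_sum fun P hP => ?_).trans (Finset.sum_le_sum_of_subset_of_nonneg hS' fun P _ _ => ?_)
    · rw [mul_assoc]
      refine mul_le_mul_of_nonneg_left ?_ (p2pos _).le
      have hb : ∀ i, ‖cf (φ i) (f i) P‖ ≤ E i * (1/2)^n := fun i => by
        have := h.F_le (fun P hP => hA P (hS' hP)) (fun P => norm_nonneg _) (by have := hE i; positivity) (hsz i) hP
        rw [one_div, inv_pow]; exact this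
      calc ∏ i, ‖cf (φ i) (f i) P‖ ≤ ∏ i, (E i * (1/2)^n) := Finset.prod_le_prod (fun i _ => norm_nonneg _) fun i _ => hb i
        _ = (∏ i, E i) * ((1/2)^n)^3 := by rw [Finset.prod_mul_distrib]; simp
        _ ≤ _ := by
            refine mul_le_mul_of_nonneg_left ?_ (Finset.prod_nonneg fun i _ => (hE i).le)
            exact pow_le_of_le_one (by positivity) (pow_le_one₀ (by norm_num) (by norm_num)) (by norm_num)
    · have := p2pos P.1
      have : 0 ≤ ∏ i, E i := Finset.prod_nonneg fun i _ => (hE i).le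
      positivity
  have hlim : Tendsto (fun n : ℕ => (∑ P ∈ S, (2:ℝ)^P.1 * ∏ i, E i) * (1/2)^n + 72 * cD C ρ R K * D * (Pr * (1 - q)⁻¹)) atTop
      (𝓝 ((∑ P ∈ S, (2:ℝ)^P.1 * ∏ i, E i) * 0 + 72 * cD C ρ R K * D * (Pr * (1 - q)⁻¹))) :=
    ((tendsto_pow_atTop_nhds_zero_of_lt_one (by norm_num) (by norm_num)).const_mul _).add_const _
  have := ge_of_tendsto' hlim hall
  refine this.trans (le_of_eq (by ring))

end
end BHT


namespace BHT

lemma w_sub_le {I J : ℤ × ℤ} (h : dy I ⊆ dy J) (x : ℝ) : w I x ≤ 2 * w J x := by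
  have hI := p2pos I.1
  have hJ := p2pos J.1
  have hle : (2:ℝ)^I.1 ≤ (2:ℝ)^J.1 := ln_le_of_subset h
  obtain ⟨b1, b2⟩ := h (dy_mem_left I)
  unfold w
  have e : x / (2:ℝ)^I.1 - I.2 = (x - (2:ℝ)^I.1 * I.2) / (2:ℝ)^I.1 := by field_simp
  have e' : x / (2:ℝ)^J.1 - J.2 = (x - (2:ℝ)^J.1 * J.2) / (2:ℝ)^J.1 := by field_simp
  rw [e, e', abs_div, abs_div, abs_of_pos hI, abs_of_pos hJ]
  set D := |x - (2:ℝ)^I.1 * I.2| with hD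
  have e2 : |x - (2:ℝ)^J.1 * J.2| ≤ D + (2:ℝ)^J.1 := by
    have : x - (2:ℝ)^J.1 * J.2 = (x - (2:ℝ)^I.1 * I.2) + ((2:ℝ)^I.1 * I.2 - (2:ℝ)^J.1 * J.2) := by ring
    rw [this]
    refine (abs_add_le _ _).trans ?_
    gcongr
    rw [abs_le]; constructor <;> linarith
  have hD0 : 0 ≤ D := abs_nonneg _
  have h1 : 1 + |x - (2:ℝ)^J.1 * J.2| / (2:ℝ)^J.1 ≤ 2 * (1 + D / (2:ℝ)^I.1) := by
    calc 1 + |x - (2:ℝ)^J.1 * J.2| / (2:ℝ)^J.1 ≤ 1 + (D + (2:ℝ)^J.1) / (2:ℝ)^J.1 := by gcongr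
      _ = 2 + D / (2:ℝ)^J.1 := by field_simp; ring
      _ ≤ 2 + D / (2:ℝ)^I.1 := by gcongr
      _ ≤ _ := by
        have : 0 ≤ D / (2:ℝ)^I.1 := by positivity
        linarith
  rw [← div_eq_mul_inv, inv_eq_one_div, div_le_div_iff₀ (by positivity) (by positivity)]
  linarith

/-- the level function -/
noncomputable def lv (f : ℝ → ℂ) (B : ℝ) (a : ℕ) (I0 : ℤ × ℤ) (x : ℝ) : ℝ := max 1 (‖f x‖ / B) * ((w I0 x)⁻¹)^a

/-- level pieces -/
noncomputable def pc (f : ℝ → ℂ) (B : ℝ) (a : ℕ) (I0 : ℤ × ℤ) (q : ℕ) : ℝ → ℂ :=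
  Set.indicator {x | (2:ℝ)^q ≤ lv f B a I0 x ∧ lv f B a I0 x < (2:ℝ)^(q+1)} f

lemma lv_meas {f : ℝ → ℂ} (hf : Nice f) (B : ℝ) (a : ℕ) (I0 : ℤ × ℤ) : Measurable (lv f B a I0) := by
  have := hf.meas
  have h2 := (w_continuous I0).measurable
  unfold lv
  fun_prop

lemma one_le_lv (f : ℝ → ℂ) (B : ℝ) (a : ℕ) (I0 : ℤ × ℤ) (x : ℝ) : 1 ≤ lv f B a I0 x := by
  unfold lv
  have h1 := w_pos I0 x
  have h2 := w_le_one I0 x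
  have : 1 ≤ ((w I0 x)⁻¹)^a := one_le_pow₀ ((one_le_inv₀ h1).2 h2)
  exact one_le_mul_of_one_le_of_one_le (le_max_left _ _) this

lemma Nice.indicator {f : ℝ → ℂ} (hf : Nice f) {s : Set ℝ} (hs : MeasurableSet s) : Nice (s.indicator f) := by
  obtain ⟨M, hM⟩ := hf.bdd
  refine ⟨hf.meas.indicator hs, hf.int.indicator hs, M, fun x => ?_⟩
  exact (norm_indicator_le_norm_self _ _).trans (hM x)

lemma pc_nice {f : ℝ → ℂ} (hf : Nice f) (B : ℝ) (a : ℕ) (I0 : ℤ × ℤ) (q : ℕ) : Nice (pc f B a I0 q) := by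
  have := lv_meas hf B a I0
  exact hf.indicator ((measurableSet_le measurable_const this).inter (measurableSet_lt this measurable_const))

lemma sum_pc {f : ℝ → ℂ} (B : ℝ) (a : ℕ) (I0 : ℤ × ℤ) (Q : ℕ) (x : ℝ) :
    ∑ q ∈ Finset.range Q, pc f B a I0 q x = Set.indicator {x | lv f B a I0 x < (2:ℝ)^Q} f x := by
  induction Q with
  | zero =>
    rw [Finset.range_zero, Finset.sum_empty, indicator_of_notMem]
    simp only [mem_ofPred_eq, pow_zero, not_lt]
    exact one_le_lv _ _ _ _ _
  | succ Q ih =>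
    rw [Finset.sum_range_succ, ih]
    simp only [pc, Set.indicator, mem_ofPred_eq]
    have : (2:ℝ)^Q < (2:ℝ)^(Q+1) := pow_lt_pow_right₀ (by norm_num) (by omega)
    by_cases h1 : lv f B a I0 x < (2:ℝ)^Q
    · rw [if_pos h1, if_neg (by intro h; linarith [h.1]), if_pos (h1.trans this), add_zero]
    · rw [if_neg h1, zero_add]
      push Not at h1
      by_cases h2 : lv f B a I0 x < (2:ℝ)^(Q+1)
      · rw [if_pos h2, if_pos ⟨h1, h2⟩]
      · rw [if_neg h2, if_neg (fun h => h2 h.2)]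

lemma Nice.int_rpow_w {f : ℝ → ℂ} (hf : Nice f) {s : ℝ} (hs : 0 ≤ s) {N : ℕ} (hN : 2 ≤ N) (I : ℤ × ℤ) :
    Integrable (fun x => ‖f x‖^s * w I x^N) := by
  obtain ⟨M, hM⟩ := hf.bdd
  refine (integrable_wN hN I).bdd_mul (c := M^s) ?_ (Eventually.of_forall fun x => ?_)
  · exact (hf.meas.norm.pow_const s).aestronglyMeasurable
  · rw [Real.norm_of_nonneg (by positivity)]
    exact Real.rpow_le_rpow (norm_nonneg _) (hM x) hs

lemma Nice.int_w {f : ℝ → ℂ} (hf : Nice f) (N : ℕ) (I : ℤ × ℤ) : Integrable (fun x => ‖f x‖ * w I x^N) := by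
  refine hf.int.norm.mul_bdd (c := 1) ((w_continuous _).pow _).aestronglyMeasurable (Eventually.of_forall fun x => ?_)
  rw [Real.norm_of_nonneg (pow_nonneg (w_pos _ _).le _)]
  exact pow_le_one₀ (w_pos _ _).le (w_le_one _ _)

lemma pc_size {f : ℝ → ℂ} (hf : Nice f) {B : ℝ} (hB : 0 < B) {s : ℝ} (hs1 : 1 < s) (hs2 : s ≤ 2) {a N0 : ℕ} (hN0 : 2 ≤ N0)
    {I I0 : ℤ × ℤ} (hI : dy I ⊆ dy I0) (h : ∫ x, ‖f x‖^s * w I x^N0 ≤ B^s * ln I) (q : ℕ) :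
    ∫ x, ‖pc f B a I0 q x‖ * w I x^(N0 + a) ≤ 2^a * (1 + cW) * B * (2:ℝ)^(-(q * (s-1))) * ln I := by
  have hcW := cW_nonneg
  have hl := ln_pos I
  set κ : ℝ := (2:ℝ)^(-(q * (s-1))) with hκ
  have hκ0 : 0 < κ := by positivity
  have hpt : ∀ x, ‖pc f B a I0 q x‖ * w I x^(N0 + a) ≤
      2^a * κ * (B^(1-s) * (‖f x‖^s * w I x^N0)) + 2^a * κ * (B * w I x^2) := by
    intro x
    have hw := w_pos I x
    have hw0 := w_pos I0 x
    have hwa : w I x^a ≤ 2^a * w I0 x^a := by rw [← mul_pow]; gcongr; exact w_sub_le hI x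
    have t1 : 0 ≤ 2^a * κ * (B^(1-s) * (‖f x‖^s * w I x^N0)) := by positivity
    have t2 : 0 ≤ 2^a * κ * (B * w I x^2) := by positivity
    unfold pc
    by_cases hx : x ∈ {x | (2:ℝ)^q ≤ lv f B a I0 x ∧ lv f B a I0 x < (2:ℝ)^(q+1)}
    swap
    · rw [indicator_of_notMem hx, norm_zero, zero_mul]; positivity
    rw [indicator_of_mem hx]
    have hx1 := hx.1
    have hwi : (w I0 x)⁻¹ ^ a * w I0 x^a = 1 := by rw [← mul_pow, inv_mul_cancel₀ hw0.ne', one_pow]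
    have hwi1 : 1 ≤ (w I0 x)⁻¹ ^ a := one_le_pow₀ ((one_le_inv₀ hw0).2 (w_le_one _ _))
    set Y := (w I0 x)⁻¹ ^ a with hY
    have hκ' : κ = ((2:ℝ)^q)^(-(s-1)) := by
      rw [hκ, ← Real.rpow_natCast, ← Real.rpow_mul (by norm_num)]; congr 1; ring
    rcases le_or_gt B ‖f x‖ with hfB | hfB
    · refine le_trans ?_ (le_add_of_nonneg_right t2)
      set u := ‖f x‖ / B with hu
      have hu1 : 1 ≤ u := (one_le_div hB).2 hfB
      have hm : (2:ℝ)^q ≤ u * Y := by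
        have := hx1
        unfold lv at this
        rwa [max_eq_right hu1] at this
      have e1 : B^(1-s) * ‖f x‖^s = ‖f x‖ * u^(s-1) := by
        have hfp : 0 < ‖f x‖ := hB.trans_le hfB
        rw [hu, Real.div_rpow (norm_nonneg _) hB.le, show (1-s) = -(s-1) by ring, Real.rpow_neg hB.le,
          Real.rpow_sub_one hfp.ne']
        field_simp
      have e2 : w I x^a ≤ 2^a * κ * u^(s-1) := by
        have h1 : ((2:ℝ)^q)^(s-1) ≤ u^(s-1) * Y := by
          calc ((2:ℝ)^q)^(s-1) ≤ (u * Y)^(s-1) := Real.rpow_le_rpow (by positivity) hm (by linarith)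
            _ = u^(s-1) * Y^(s-1) := Real.mul_rpow (by positivity) (by positivity)
            _ ≤ u^(s-1) * Y^(1:ℝ) := by
                gcongr
                linarith
            _ = _ := by rw [Real.rpow_one]
        have h2 : κ * ((2:ℝ)^q)^(s-1) = 1 := by
          rw [hκ', ← Real.rpow_add (by positivity)]; simp
        calc w I x^a ≤ 2^a * w I0 x^a * (κ * ((2:ℝ)^q)^(s-1)) := by rw [h2, mul_one]; exact hwa
          _ ≤ 2^a * w I0 x^a * (κ * (u^(s-1) * Y)) := by gcongr
          _ = 2^a * κ * u^(s-1) * (Y * w I0 x^a) := by ring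
          _ = _ := by rw [hwi, mul_one]
      calc ‖f x‖ * w I x^(N0+a) = ‖f x‖ * w I x^N0 * w I x^a := by ring
        _ ≤ ‖f x‖ * w I x^N0 * (2^a * κ * u^(s-1)) := by gcongr
        _ = 2^a * κ * ((‖f x‖ * u^(s-1)) * w I x^N0) := by ring
        _ = _ := by rw [← e1]; ring
    · refine le_trans ?_ (le_add_of_nonneg_left t1)
      have hm : (2:ℝ)^q ≤ Y := by
        have := hx1
        unfold lv at this
        rwa [max_eq_left ((div_le_one hB).2 hfB.le), one_mul] at this
      have e2 : w I x^a ≤ 2^a * κ := by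
        have h1 : ((2:ℝ)^q)⁻¹ ≤ κ := by
          rw [hκ', ← Real.rpow_neg_one]
          exact Real.rpow_le_rpow_of_exponent_le (one_le_pow₀ (by norm_num)) (by linarith)
        have h3 : w I0 x^a ≤ ((2:ℝ)^q)⁻¹ := by
          have : w I0 x^a = Y⁻¹ := eq_inv_of_mul_eq_one_right hwi
          rw [this]; gcongr
        calc _ ≤ _ := hwa
          _ ≤ _ := by gcongr; exact h3.trans h1
      calc ‖f x‖ * w I x^(N0+a) = ‖f x‖ * (w I x^N0 * w I x^a) := by ring
        _ ≤ B * (w I x^2 * (2^a * κ)) := by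
            have := w_pow_le hN0 I x
            gcongr ?_ * (?_ * ?_)
        _ = _ := by ring
  have i1 := ((hf.int_rpow_w (by linarith : 0 ≤ s) hN0 I).const_mul (B^(1-s))).const_mul (2^a * κ)
  have i2 := ((integrable_w2 I).const_mul B).const_mul (2^a * κ)
  refine (integral_mono ((pc_nice hf B a I0 q).int_w _ _) (i1.add i2) hpt).trans ?_
  simp only [Pi.add_apply]
  rw [integral_add i1 i2, integral_const_mul, integral_const_mul, integral_const_mul, integral_const_mul, integral_w2]
  have e : B^(1-s) * B^s = B := by rw [← Real.rpow_add hB]; simp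
  calc 2^a * κ * (B^(1-s) * ∫ x, ‖f x‖^s * w I x^N0) + 2^a * κ * (B * (cW * ln I)) ≤
      2^a * κ * (B^(1-s) * (B^s * ln I)) + 2^a * κ * (B * (cW * ln I)) := by gcongr
    _ = 2^a * κ * ((B^(1-s) * B^s) * ln I) + 2^a * κ * (B * (cW * ln I)) := by ring
    _ = _ := by rw [e]; ring

lemma pc_energy {f : ℝ → ℂ} (hf : Nice f) {B : ℝ} (hB : 0 < B) {s : ℝ} (hs1 : 1 < s) (hs2 : s ≤ 2) {a N0 : ℕ} (hN0 : 2 ≤ N0)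
    (ha : N0 ≤ a) {I0 : ℤ × ℤ} (h : ∫ x, ‖f x‖^s * w I0 x^N0 ≤ B^s * ln I0) (q : ℕ) :
    ∫ x, ‖pc f B a I0 q x‖^2 ≤ ln I0 * (2 * B * (2:ℝ)^(q * ((2 - s + N0 / a)/2)))^2 := by
  have ha0 : (0:ℝ) < a := by exact_mod_cast (by omega : 0 < a)
  set κ : ℝ := 2 - s + N0 / a with hκ
  have hna : (N0:ℝ) / a ≤ 1 := (div_le_one ha0).2 (by exact_mod_cast ha)
  have hna0 : 0 ≤ (N0:ℝ)/a := by positivity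
  have hpt : ∀ x, ‖pc f B a I0 q x‖^2 ≤ B^(2-s) * ((2:ℝ)^(q+1))^κ * (‖f x‖^s * w I0 x^N0) := by
    intro x
    have hw0 := w_pos I0 x
    unfold pc
    by_cases hx : x ∈ {x | (2:ℝ)^q ≤ lv f B a I0 x ∧ lv f B a I0 x < (2:ℝ)^(q+1)}
    swap
    · rw [indicator_of_notMem hx, norm_zero, zero_pow two_ne_zero]; positivity
    rw [indicator_of_mem hx]
    have hx2 := hx.2
    unfold lv at hx2
    have hwi1 : 1 ≤ (w I0 x)⁻¹ ^ a := one_le_pow₀ ((one_le_inv₀ hw0).2 (w_le_one _ _))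
    set Y := (w I0 x)⁻¹ ^ a with hY
    set Q := (2:ℝ)^(q+1) with hQ
    have hQ0 : 0 < Q := by positivity
    have hm1 := le_max_left 1 (‖f x‖ / B)
    have hm2 := le_max_right 1 (‖f x‖ / B)
    have hf1 : ‖f x‖ ≤ B * Q := by
      have : ‖f x‖ / B ≤ Q := by nlinarith
      rw [div_le_iff₀ hB] at this; linarith
    have hY1 : Y ≤ Q := by nlinarith
    have hwN : 1 ≤ Q^((N0:ℝ)/a) * w I0 x^N0 := by
      have : (w I0 x)⁻¹ ^ N0 = Y^((N0:ℝ)/a) := by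
        rw [hY, ← Real.rpow_natCast, ← Real.rpow_natCast, ← Real.rpow_mul (by positivity)]
        congr 1; field_simp
      calc (1:ℝ) = (w I0 x)⁻¹ ^ N0 * w I0 x^N0 := by rw [← mul_pow, inv_mul_cancel₀ hw0.ne', one_pow]
        _ ≤ _ := by rw [this]; gcongr
    calc ‖f x‖^2 = ‖f x‖^(2-s) * ‖f x‖^s := by
          rw [← Real.rpow_natCast, ← Real.rpow_add_of_nonneg (norm_nonneg _) (by linarith) (by linarith)]
          congr 1; push_cast; ring
      _ ≤ (B * Q)^(2-s) * ‖f x‖^s := by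
          gcongr
      _ ≤ (B * Q)^(2-s) * ‖f x‖^s * (Q^((N0:ℝ)/a) * w I0 x^N0) := le_mul_of_one_le_right (by positivity) hwN
      _ = B^(2-s) * (Q^(2-s) * Q^((N0:ℝ)/a)) * (‖f x‖^s * w I0 x^N0) := by
          rw [Real.mul_rpow hB.le hQ0.le]; ring
      _ = _ := by rw [← Real.rpow_add hQ0]
  refine (integral_mono (pc_nice hf B a I0 q).sq_integrable
    ((hf.int_rpow_w (by linarith : 0 ≤ s) hN0 I0).const_mul _) hpt).trans ?_
  rw [integral_const_mul]
  have hl := ln_pos I0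
  have e : B^(2-s) * B^s = B^2 := by rw [← Real.rpow_add hB, ← Real.rpow_natCast]; congr 1; push_cast; ring
  have e3 : ((2:ℝ)^(q+1))^κ ≤ 4 * ((2:ℝ)^(q * (κ/2)))^2 := by
    have e4 : ((2:ℝ)^(q * (κ/2)))^2 = (2:ℝ)^(q*κ) := by
      rw [← Real.rpow_natCast, ← Real.rpow_mul (by norm_num)]; congr 1; push_cast; ring
    rw [e4, ← Real.rpow_natCast, ← Real.rpow_mul (by norm_num)]
    push_cast
    rw [show ((q:ℝ)+1) * κ = κ + q*κ by ring, Real.rpow_add (by norm_num)]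
    gcongr
    calc (2:ℝ)^κ ≤ (2:ℝ)^(2:ℝ) := Real.rpow_le_rpow_of_exponent_le (by norm_num) (by rw [hκ]; linarith)
      _ = 4 := by norm_num
  calc _ ≤ B^(2-s) * (4 * ((2:ℝ)^(q * (κ/2)))^2) * (B^s * ln I0) := by
        have : 0 ≤ ∫ x, ‖f x‖^s * w I0 x^N0 := integral_nonneg fun x =>
          mul_nonneg (by positivity) (pow_nonneg (w_pos _ _).le _)
        gcongr
    _ = (B^(2-s) * B^s) * (4 * ((2:ℝ)^(q * (κ/2)))^2) * ln I0 := by ring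
    _ = _ := by rw [e]; ring

end BHT


namespace BHT

lemma cf_sum {φ : Tile → ℝ → ℂ} {ι : Type*} (s : Finset ι) (f : ι → ℝ → ℂ) (P : Tile)
    (h : ∀ i ∈ s, Integrable (fun x => f i x * φ P x)) :
    cf φ (fun x => ∑ i ∈ s, f i x) P = ∑ i ∈ s, cf φ (f i) P := by
  unfold cf
  rw [← Finset.mul_sum]
  congr 1
  rw [← integral_finsetSum s h]
  congr 1; ext x
  rw [Finset.sum_mul]

lemma local_est (ρ R C : ℝ) (K N0 a : ℕ) (s θ : Fin 3 → ℝ) (hN0 : 2 ≤ N0) (ha : N0 ≤ a)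
    (hs1 : ∀ i, 1 < s i) (hs2 : ∀ i, s i ≤ 2) (hθ0 : ∀ i, 0 ≤ θ i) (hθ1 : ∀ i, θ i ≤ 1) (hθ : ∑ i, θ i < 1)
    (hσ : ∀ i, 0 < (s i - 1) * θ i - (2 - s i + N0 / a) / 2 * (1 - θ i)) :
    ∃ Cst : ℝ, 0 < Cst ∧ ∀ (φ : Fin 3 → Tile → ℝ → ℂ) (v : ℝ) (γ : Fin 3 → ℝ), TS φ v γ ρ R C (N0 + a + 3) K →
      ∀ f : Fin 3 → ℝ → ℂ, (∀ i, Nice (f i)) → ∀ (S : Finset Tile) (I0 : ℤ × ℤ), (∀ P ∈ S, dy (iv P) ⊆ dy I0) →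
      ∀ B : Fin 3 → ℝ, (∀ i, 0 < B i) →
      (∀ i, ∀ P ∈ S, ∀ I, dy (iv P) ⊆ dy I → dy I ⊆ dy I0 → ∫ x, ‖f i x‖^(s i) * w I x^N0 ≤ (B i)^(s i) * ln I) →
      Lam (fun i P => ‖cf (φ i) (f i) P‖) S ≤ Cst * ln I0 * ∏ i, B i := by
  classical
  set A : ℝ := 2 + (|cE C ρ R K (N0 + a)| + 1) * (2^a * (1 + cW)) with hA
  have hcW := cW_nonneg
  have hA2 : 2 ≤ A := by
    rw [hA]
    have : 0 ≤ (|cE C ρ R K (N0 + a)| + 1) * (2^a * (1 + cW)) := by positivity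
    linarith
  have hA0 : 0 < A := by linarith
  set σ : Fin 3 → ℝ := fun i => (s i - 1) * θ i - (2 - s i + N0 / a) / 2 * (1 - θ i) with hσd
  set c0 : ℝ := 72 * cD C ρ R K * (1 - (2:ℝ)^(-(1 - ∑ i, θ i)))⁻¹ with hc0
  set G : ℝ := ∏ i, (1 - (2:ℝ)^(-(σ i)))⁻¹ with hG
  refine ⟨|c0| * A^3 * |G| + 1, by positivity, ?_⟩
  intro φ v γ hTS f hf S I0 hSI B hB hyp
  have hl := ln_pos I0
  have hBp : 0 < ∏ i, B i := Finset.prod_pos fun i _ => hB i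
  rcases S.eq_empty_or_nonempty with hSe | ⟨P0, hP0⟩
  · rw [hSe]; simp only [Lam, Finset.sum_empty]; positivity
  have hTS6 : TS φ v γ ρ R C 6 K := ⟨fun i => (hTS.ps i).mono (by omega), hTS.hK, hTS.sep⟩
  set 𝒜 : Finset ((ℤ × ℤ) × ℝ) := (S ×ˢ (Finset.univ : Finset (Fin 3))).image (fun z => (iv z.1, fr v (γ z.2) z.1)) with h𝒜
  have hgood : GoodA v γ 𝒜 S := fun P hP j =>
    Finset.mem_image.2 ⟨(P, j), Finset.mem_product.2 ⟨hP, Finset.mem_univ _⟩, rfl⟩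
  have hq0 : ∀ i, 0 < (2:ℝ)^(-(σ i)) := fun i => by positivity
  have hq1 : ∀ i, (2:ℝ)^(-(σ i)) < 1 := fun i => Real.rpow_lt_one_of_one_lt_of_neg (by norm_num) (by have h7 : 0 < σ i := hσ i; linarith)
  have hpc : ∀ i q, Nice (pc (f i) (B i) a I0 q) := fun i q => pc_nice (hf i) _ _ _ _
  -- single pieces
  have hone : ∀ p : Fin 3 → ℕ, Lam (fun i P => ‖cf (φ i) (pc (f i) (B i) a I0 (p i)) P‖) S ≤
      |c0| * ln I0 * (A^3 * (∏ i, B i)) * ∏ i, ((2:ℝ)^(-(σ i)))^(p i) := by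
    intro p
    set Z : Fin 3 → ℝ := fun i => A * B i * (2:ℝ)^(-(p i * (s i - 1))) with hZ
    set E : Fin 3 → ℝ := fun i => A * B i * (2:ℝ)^(p i * ((2 - s i + N0 / a)/2)) with hE
    have hZ0 : ∀ i, 0 < Z i := fun i => by have := hB i; simp only [hZ]; positivity
    have hE0 : ∀ i, 0 < E i := fun i => by have := hB i; simp only [hE]; positivity
    have := hTS6.energy (f := fun i => pc (f i) (B i) a I0 (p i)) (fun i => hpc i _) hgood (E := E) (Z := Z) hZ0 ?_ ?_
      (D := ln I0) hl.le ?_ hθ0 hθ1 hθ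
    · refine this.trans ?_
      have e : ∏ i, (Z i ^ θ i * E i ^ (1 - θ i)) = A^3 * (∏ i, B i) * ∏ i, ((2:ℝ)^(-(σ i)))^(p i) := by
        have : A^3 = ∏ _i : Fin 3, A := by simp
        rw [this, ← Finset.prod_mul_distrib, ← Finset.prod_mul_distrib]
        refine Finset.prod_congr rfl fun i _ => ?_
        have hb := hB i
        have hab : 0 < A * B i := by positivity
        simp only [hZ, hE]
        rw [Real.mul_rpow hab.le (by positivity), Real.mul_rpow hab.le (by positivity), ← Real.rpow_mul (by norm_num),
          ← Real.rpow_mul (by norm_num), ← Real.rpow_natCast, ← Real.rpow_mul (by norm_num)]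
        have e1 : (A * B i)^(θ i) * (A * B i)^(1 - θ i) = A * B i := by rw [← Real.rpow_add hab]; simp
        calc _ = ((A * B i)^(θ i) * (A * B i)^(1 - θ i)) * ((2:ℝ)^(-(p i * (s i - 1)) * θ i) *
              (2:ℝ)^(p i * ((2 - s i + N0 / a)/2) * (1 - θ i))) := by ring
          _ = _ := by
            rw [e1, ← Real.rpow_add (by norm_num)]
            congr 2
            simp only [hσd]; ring
      rw [e]
      have : 0 ≤ A^3 * (∏ i, B i) * ∏ i, ((2:ℝ)^(-(σ i)))^(p i) := by
        have : 0 ≤ ∏ i, ((2:ℝ)^(-(σ i)))^(p i) := Finset.prod_nonneg fun i _ => by positivity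
        positivity
      calc _ ≤ |c0| * ln I0 * (A^3 * (∏ i, B i) * ∏ i, ((2:ℝ)^(-(σ i)))^(p i)) := by
            gcongr; exact le_abs_self _
        _ = _ := by ring
    · intro i
      have := hB i
      simp only [hZ, hE]
      gcongr
      · norm_num
      · have h1 : 0 ≤ (p i : ℝ) * (s i - 1) := mul_nonneg (by positivity) (by linarith [hs1 i])
        have h2 : 0 ≤ (p i : ℝ) * ((2 - s i + N0 / a)/2) := by
          have := hs2 i
          have : (0:ℝ) ≤ N0 / a := by positivity
          exact mul_nonneg (by positivity) (by linarith)
        linarith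
    · intro i ε hε t ht
      obtain ⟨⟨P', j⟩, hz, rfl⟩ := Finset.mem_image.1 ht
      have hP' := (Finset.mem_product.1 hz).1
      simp only at hP'
      have hb := hB i
      have hsz := (hTS.ps i).size_bound (N1 := N0 + a) le_rfl (hTS.hK i) hε (ξ := fr v (γ j) P') (iv P')
        (S.filter (fun P => ftree v R (iv P', fr v (γ j) P') P ∧ lac v (γ i) ρ ε (fr v (γ j) P') P))
        (fun P hP => by
          have := (Finset.mem_filter.1 hP).2
          exact ⟨this.1.1, this.1.2, this.2⟩) (hpc i (p i)) (B := 2^a * (1 + cW) * B i * (2:ℝ)^(-(p i * (s i-1)))) (by positivity)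
        (fun P hP I h1 h2 => by
          have h2' := h2.trans (hSI P' hP')
          exact pc_size (hf i) hb (hs1 i) (hs2 i) hN0 h2' (hyp i P (Finset.mem_filter.1 hP).1 I h1 h2') _)
      have hln := ln_pos (iv P')
      refine le_trans (le_of_eq ?_) (hsz.trans ?_)
      · unfold en; congr
      · simp only [hZ]
        refine mul_le_mul_of_nonneg_right ?_ hln.le
        set X := B i * (2:ℝ)^(-(p i * (s i-1))) with hX
        have : cE C ρ R K (N0 + a) * (2^a * (1 + cW))^2 ≤ A^2 := by
          have h1 : cE C ρ R K (N0+a) ≤ (|cE C ρ R K (N0+a)| + 1)^2 := by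
            nlinarith [le_abs_self (cE C ρ R K (N0+a)), abs_nonneg (cE C ρ R K (N0+a))]
          calc _ ≤ (|cE C ρ R K (N0+a)| + 1)^2 * (2^a * (1 + cW))^2 := by gcongr
            _ = ((|cE C ρ R K (N0+a)| + 1) * (2^a * (1 + cW)))^2 := by ring
            _ ≤ A^2 := by gcongr; rw [hA]; linarith
        calc _ = cE C ρ R K (N0 + a) * (2^a * (1 + cW))^2 * X^2 := by rw [hX]; ring
          _ ≤ A^2 * X^2 := by gcongr
          _ = _ := by rw [hX]; ring
    · intro i
      have hb := hB i
      refine (pc_energy (hf i) hb (hs1 i) (hs2 i) hN0 ha (hyp i P0 hP0 I0 (hSI P0 hP0) Subset.rfl) (p i)).trans ?_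
      simp only [hE]
      gcongr
  -- truncations
  set fQ : ℕ → Fin 3 → ℝ → ℂ := fun Q i => Set.indicator {x | lv (f i) (B i) a I0 x < (2:ℝ)^Q} (f i) with hfQ
  have hInt0 : ∀ i q P, Integrable (fun x => pc (f i) (B i) a I0 q x * φ i P x) := fun i q P =>
    (hpc i q).mul_integrable ((hTS6.ps i).cont P) ((hTS6.ps i).bdd P)
  have htr : ∀ Q, Lam (fun i P => ‖cf (φ i) (fQ Q i) P‖) S ≤ |c0| * ln I0 * (A^3 * (∏ i, B i)) * |G| := by
    intro Q
    have hcf : ∀ i P, ‖cf (φ i) (fQ Q i) P‖ ≤ ∑ q ∈ Finset.range Q, ‖cf (φ i) (pc (f i) (B i) a I0 q) P‖ := by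
      intro i P
      have : fQ Q i = fun x => ∑ q ∈ Finset.range Q, pc (f i) (B i) a I0 q x := by
        ext x; rw [sum_pc]
      rw [this, cf_sum _ _ _ fun q _ => hInt0 i q P]
      exact norm_sum_le _ _
    calc Lam (fun i P => ‖cf (φ i) (fQ Q i) P‖) S
        ≤ ∑ P ∈ S, (2:ℝ)^P.1 * ∏ i, ∑ q ∈ Finset.range Q, ‖cf (φ i) (pc (f i) (B i) a I0 q) P‖ := by
          unfold Lam
          refine Finset.sum_le_sum fun P _ => mul_le_mul_of_nonneg_left ?_ (p2pos _).le
          exact Finset.prod_le_prod (fun i _ => norm_nonneg _) fun i _ => hcf i P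
      _ = ∑ p ∈ Fintype.piFinset (fun _ : Fin 3 => Finset.range Q),
            Lam (fun i P => ‖cf (φ i) (pc (f i) (B i) a I0 (p i)) P‖) S := by
          unfold Lam
          rw [Finset.sum_comm]
          refine Finset.sum_congr rfl fun P _ => ?_
          rw [Finset.prod_univ_sum, Finset.mul_sum]
      _ ≤ ∑ p ∈ Fintype.piFinset (fun _ : Fin 3 => Finset.range Q),
            |c0| * ln I0 * (A^3 * (∏ i, B i)) * ∏ i, ((2:ℝ)^(-(σ i)))^(p i) := Finset.sum_le_sum fun p _ => hone p
      _ = |c0| * ln I0 * (A^3 * (∏ i, B i)) * ∏ i, ∑ q ∈ Finset.range Q, ((2:ℝ)^(-(σ i)))^q := by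
          rw [Finset.prod_univ_sum, Finset.mul_sum]
      _ ≤ _ := by
          refine mul_le_mul_of_nonneg_left ?_ (by positivity)
          refine le_trans ?_ (le_abs_self _)
          refine Finset.prod_le_prod (fun i _ => Finset.sum_nonneg fun q _ => by positivity) fun i _ => ?_
          rw [← tsum_geometric_of_lt_one (hq0 i).le (hq1 i)]
          exact (summable_geometric_of_lt_one (hq0 i).le (hq1 i)).sum_le_tsum _ fun m _ => by positivity
  have hlim : Tendsto (fun Q => Lam (fun i P => ‖cf (φ i) (fQ Q i) P‖) S) atTop (𝓝 (Lam (fun i P => ‖cf (φ i) (f i) P‖) S)) := by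
    unfold Lam
    refine tendsto_finsetSum _ fun P _ => Tendsto.const_mul _ (tendsto_finsetProd _ fun i _ => Tendsto.norm ?_)
    unfold cf
    refine Tendsto.const_mul _ ?_
    have hi := (hf i).mul_integrable ((hTS6.ps i).cont P) ((hTS6.ps i).bdd P)
    refine tendsto_integral_of_dominated_convergence (fun x => ‖f i x * φ i P x‖) (fun Q => ?_) hi.norm (fun Q => ?_) ?_
    · have hm := lv_meas (hf i) (B i) a I0
      exact (((hf i).meas.indicator (measurableSet_lt hm measurable_const)).mul ((hTS6.ps i).cont P).measurable).aestronglyMeasurable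
    · refine Eventually.of_forall fun x => ?_
      rw [norm_mul, norm_mul]
      exact mul_le_mul_of_nonneg_right (norm_indicator_le_norm_self _ _) (norm_nonneg _)
    · refine Eventually.of_forall fun x => ?_
      refine tendsto_const_nhds.congr' ?_
      obtain ⟨n, hn⟩ := pow_unbounded_of_one_lt (lv (f i) (B i) a I0 x) (by norm_num : (1:ℝ) < 2)
      filter_upwards [eventually_ge_atTop n] with Q hQ
      simp only [hfQ]
      rw [indicator_of_mem]
      exact hn.trans_le (pow_le_pow_right₀ (by norm_num) hQ)
  refine (le_of_tendsto' hlim htr).trans ?_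
  calc |c0| * ln I0 * (A^3 * (∏ i, B i)) * |G| = (|c0| * A^3 * |G|) * ln I0 * ∏ i, B i := by ring
    _ ≤ _ := by gcongr; linarith

end BHT


namespace BHT

lemma exists_tops (S : Finset Tile) : ∃ (T : Finset (ℤ × ℤ)) (t : Tile → ℤ × ℤ),
    (∀ I ∈ T, ∃ P ∈ S, I = iv P) ∧ (∀ I ∈ T, ∀ J ∈ T, ∀ x, x ∈ dy I → x ∈ dy J → I = J) ∧
    (∀ P ∈ S, t P ∈ T ∧ dy (iv P) ⊆ dy (t P)) := by
  classical
  set V := S.image iv with hV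
  set T := V.filter (fun I => ∀ J ∈ V, dy I ⊆ dy J → J = I) with hT
  have h : ∀ P ∈ S, ∃ I ∈ T, dy (iv P) ⊆ dy I := by
    intro P hP
    obtain ⟨J, hJ, hmax⟩ := Finset.exists_max_image (V.filter (fun J => dy (iv P) ⊆ dy J)) (fun J => J.1)
      ⟨iv P, by simp only [Finset.mem_filter]; exact ⟨Finset.mem_image_of_mem _ hP, Subset.rfl⟩⟩
    rw [Finset.mem_filter] at hJ
    refine ⟨J, ?_, hJ.2⟩
    rw [hT, Finset.mem_filter]
    refine ⟨hJ.1, fun J' hJ' hs => ?_⟩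
    have h1 := hmax J' (Finset.mem_filter.2 ⟨hJ', hJ.2.trans hs⟩)
    have h2 := scale_le_of_subset hs
    exact dy_inj (le_antisymm h1 h2) (hs (dy_mem_left J)) (dy_mem_left J)
  choose! t ht using h
  refine ⟨T, t, fun I hI => ?_, fun I hI J hJ x hx hx' => ?_, ht⟩
  · rw [hT, Finset.mem_filter, hV, Finset.mem_image] at hI
    obtain ⟨⟨P, hP, e⟩, _⟩ := hI
    exact ⟨P, hP, e.symm⟩
  · rw [hT, Finset.mem_filter] at hI hJ
    rcases dy_nested hx hx' with h | h
    · exact (hI.2 J hJ.1 h).symm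
    · exact hJ.2 I hI.1 h

lemma sum_zpow_ind (N : Finset ℤ) {u : ℝ} (hu : 0 ≤ u) :
    ∑ n ∈ N with (2:ℝ)^n ≤ u, (2:ℝ)^n ≤ 2 * u := by
  classical
  induction' h : (N.filter (fun n => (2:ℝ)^n ≤ u)).card using Nat.strong_induction_on with c ih generalizing N u
  rcases (N.filter (fun n => (2:ℝ)^n ≤ u)).eq_empty_or_nonempty with he | hne
  · rw [he]; simp; exact hu
  set V := N.filter (fun n => (2:ℝ)^n ≤ u) with hV
  obtain ⟨m, hm, hmax⟩ := V.exists_max_image id hne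
  have hmu : (2:ℝ)^m ≤ u := (Finset.mem_filter.1 hm).2
  have e : (V.erase m).filter (fun n => (2:ℝ)^n ≤ (2:ℝ)^m/2) = V.erase m := by
    refine Finset.filter_true_of_mem fun n hn => ?_
    have h1 := hmax n (Finset.mem_of_mem_erase hn)
    have h2 : n ≤ m - 1 := by have := Finset.ne_of_mem_erase hn; simp only [id] at h1; omega
    calc (2:ℝ)^n ≤ (2:ℝ)^(m-1) := zpow_le_zpow_right₀ (by norm_num) h2
      _ = _ := by rw [zpow_sub_one₀ (by norm_num)]; ring
  have := ih _ (by rw [← h, e]; exact Finset.card_erase_lt_of_mem hm) (V.erase m) (u := (2:ℝ)^m/2) (by positivity) rfl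
  rw [e] at this
  rw [← Finset.add_sum_erase _ _ hm]
  linarith

/-- infimum over interval -/
noncomputable def iu (U : ℝ → ℝ) (I : ℤ × ℤ) : ℝ := sInf (U '' dy I)

lemma iu_le {U : ℝ → ℝ} (hU : ∀ x, 0 ≤ U x) {I : ℤ × ℤ} {x : ℝ} (hx : x ∈ dy I) : iu U I ≤ U x :=
  csInf_le ⟨0, by rintro _ ⟨y, _, rfl⟩; exact hU y⟩ ⟨x, hx, rfl⟩

lemma iu_nonneg {U : ℝ → ℝ} (hU : ∀ x, 0 ≤ U x) (I : ℤ × ℤ) : 0 ≤ iu U I :=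
  le_csInf ((dy_nonempty I).image _) (by rintro _ ⟨y, _, rfl⟩; exact hU y)

lemma le_iu {U : ℝ → ℝ} {I : ℤ × ℤ} {c : ℝ} (h : ∀ x ∈ dy I, c ≤ U x) : c ≤ iu U I :=
  le_csInf ((dy_nonempty I).image _) (by rintro _ ⟨y, hy, rfl⟩; exact h y hy)

lemma iu_anti {U : ℝ → ℝ} (hU : ∀ x, 0 ≤ U x) {I J : ℤ × ℤ} (h : dy I ⊆ dy J) : iu U J ≤ iu U I :=
  le_iu fun _ hx => iu_le hU (h hx)

lemma le_of_avg {U : ℝ → ℝ} {I : ℤ × ℤ} {a s V l : ℝ} (hU : ∀ x, 0 ≤ U x) (ha : 0 < a) (hs : 0 < s) (hl : 0 < l) (hV : 0 ≤ V)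
    (h : ∀ x ∈ dy I, V ≤ (a * U x)^s * l) : V ≤ (a * iu U I)^s * l := by
  have h1 : (V / l)^(1/s) / a ≤ iu U I := by
    refine le_iu fun x hx => ?_
    rw [div_le_iff₀ ha, mul_comm]
    have := h x hx
    rw [← div_le_iff₀ hl] at this
    calc (V/l)^(1/s) ≤ ((a * U x)^s)^(1/s) := Real.rpow_le_rpow (by positivity) this (by positivity)
      _ = _ := by rw [one_div, Real.rpow_rpow_inv (mul_nonneg ha.le (hU x)) hs.ne']
  rw [div_le_iff₀ ha, mul_comm] at h1
  rw [← div_le_iff₀ hl]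
  have h2 : 0 ≤ (V/l)^(1/s) := by positivity
  calc V / l = ((V/l)^(1/s))^s := by rw [one_div, Real.rpow_inv_rpow (by positivity) hs.ne']
    _ ≤ _ := Real.rpow_le_rpow h2 h1 hs.le

lemma model_core (ρ R C : ℝ) (K N0 a : ℕ) (s θ : Fin 3 → ℝ) (hN0 : 2 ≤ N0) (ha : N0 ≤ a)
    (hs1 : ∀ i, 1 < s i) (hs2 : ∀ i, s i ≤ 2) (hθ0 : ∀ i, 0 ≤ θ i) (hθ1 : ∀ i, θ i ≤ 1) (hθ : ∑ i, θ i < 1)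
    (hσ : ∀ i, 0 < (s i - 1) * θ i - (2 - s i + N0 / a) / 2 * (1 - θ i)) (A : ℝ) (hA : 0 < A) (e : Fin 3 → ℝ) (he : ∑ i, e i < 0) :
    ∃ Cst : ℝ, 0 < Cst ∧ ∀ (φ : Fin 3 → Tile → ℝ → ℂ) (v : ℝ) (γ : Fin 3 → ℝ), TS φ v γ ρ R C (N0 + a + 3) K →
      ∀ f : Fin 3 → ℝ → ℂ, (∀ i, Nice (f i)) → ∀ (S : Finset Tile) (U : Fin 3 → ℝ → ℝ) (d : ℤ × ℤ → ℕ),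
      (∀ i x, 0 ≤ U i x) → (∀ I J, dy I ⊆ dy J → d J ≤ d I) →
      (∀ i I, ∀ y ∈ dy I, ∫ x, ‖f i x‖^(s i) * w I x^N0 ≤ (A * (2:ℝ)^(e i * d I) * U i y)^(s i) * ln I) →
      ENNReal.ofReal (Lam (fun i P => ‖cf (φ i) (f i) P‖) S) ≤ ENNReal.ofReal Cst * ∫⁻ x, ENNReal.ofReal (∏ i, U i x) := by
  classical
  obtain ⟨c0, hc0, hloc⟩ := local_est ρ R C K N0 a s θ hN0 ha hs1 hs2 hθ0 hθ1 hθ hσ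
  set q : ℝ := (2:ℝ)^(∑ i, e i) with hq
  have hq0 : 0 < q := by positivity
  have hq1 : q < 1 := Real.rpow_lt_one_of_one_lt_of_neg (by norm_num) he
  set K1 : ℝ := c0 * (2 * A)^3 with hK1
  have hK1p : 0 < K1 := by positivity
  have h1q : 0 < 1 - q := by linarith
  refine ⟨K1 * (1 - q)⁻¹ * 8, by positivity, ?_⟩
  intro φ v γ hTS f hf S U d hU hd havg
  have havg' : ∀ i I, ∫ x, ‖f i x‖^(s i) * w I x^N0 ≤ (A * (2:ℝ)^(e i * d I) * iu (U i) I)^(s i) * ln I := by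
    intro i I
    exact le_of_avg (hU i) (by positivity) (by linarith [hs1 i]) (ln_pos I)
      (integral_nonneg fun x => mul_nonneg (by positivity) (pow_nonneg (w_pos _ _).le _)) (havg i I)
  -- remove null tiles
  set S1 := S.filter (fun P => ∀ i, 0 < iu (U i) (iv P)) with hS1
  have hzero : ∀ P, ∀ i, ¬ 0 < iu (U i) (iv P) → cf (φ i) (f i) P = 0 := by
    intro P i hn
    have h0 : iu (U i) (iv P) = 0 := le_antisymm (not_lt.1 hn) (iu_nonneg (hU i) _)
    have h1 := havg' i (iv P)
    have hsi := hs1 i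
    rw [h0, mul_zero, Real.zero_rpow (by linarith), zero_mul] at h1
    have hnn : ∀ x, 0 ≤ ‖f i x‖^(s i) * w (iv P) x^N0 := fun x => mul_nonneg (by positivity) (pow_nonneg (w_pos _ _).le _)
    have h2 := (integral_eq_zero_iff_of_nonneg hnn ((hf i).int_rpow_w (by linarith) hN0 (iv P))).1 (le_antisymm h1 (integral_nonneg hnn))
    unfold cf
    rw [integral_eq_zero_of_ae, mul_zero]
    filter_upwards [h2] with x hx
    simp only [Pi.zero_apply, mul_eq_zero] at hx ⊢
    left
    rcases hx with hx | hx
    · exact norm_eq_zero.1 ((Real.rpow_eq_zero (norm_nonneg _) (by linarith)).1 hx)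
    · exact absurd hx (pow_pos (w_pos _ _) _).ne'
  have hLS : Lam (fun i P => ‖cf (φ i) (f i) P‖) S = Lam (fun i P => ‖cf (φ i) (f i) P‖) S1 := by
    unfold Lam
    rw [hS1, Finset.sum_filter]
    refine Finset.sum_congr rfl fun P _ => ?_
    split_ifs with h
    · rfl
    · push Not at h
      obtain ⟨i, hi⟩ := h
      rw [Finset.prod_eq_zero (Finset.mem_univ i), mul_zero]
      show ‖cf (φ i) (f i) P‖ = 0
      rw [hzero P i (not_lt.2 hi), norm_zero]
  rw [hLS]
  -- classes
  set cl : ℤ × ℤ → ℕ × (Fin 3 → ℤ) := fun I => (d I, fun i => Int.log 2 (iu (U i) I)) with hcl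
  have hclass : ∀ c : ℕ × (Fin 3 → ℤ), ∃ T : Finset (ℤ × ℤ), (∀ I ∈ T, ∃ P ∈ S1, cl (iv P) = c ∧ I = iv P) ∧
      (∀ I ∈ T, ∀ J ∈ T, ∀ x, x ∈ dy I → x ∈ dy J → I = J) ∧
      Lam (fun i P => ‖cf (φ i) (f i) P‖) (S1.filter (fun P => cl (iv P) = c)) ≤
        K1 * q^c.1 * (∏ i, (2:ℝ)^(c.2 i)) * ∑ I ∈ T, ln I := by
    intro c
    obtain ⟨T, t, hT1, hT2, hT3⟩ := exists_tops (S1.filter (fun P => cl (iv P) = c))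
    refine ⟨T, fun I hI => ?_, hT2, ?_⟩
    · obtain ⟨P, hP, e⟩ := hT1 I hI
      rw [Finset.mem_filter] at hP
      exact ⟨P, hP.1, hP.2, e⟩
    have e1 : Lam (fun i P => ‖cf (φ i) (f i) P‖) (S1.filter (fun P => cl (iv P) = c)) =
        ∑ I ∈ T, Lam (fun i P => ‖cf (φ i) (f i) P‖) ((S1.filter (fun P => cl (iv P) = c)).filter (fun P => t P = I)) := by
      unfold Lam
      rw [Finset.sum_fiberwise_of_maps_to fun P hP => (hT3 P hP).1]
    rw [e1, Finset.mul_sum]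
    refine Finset.sum_le_sum fun I0 hI0 => ?_
    obtain ⟨P0, hP0, e0⟩ := hT1 I0 hI0
    rw [Finset.mem_filter] at hP0
    have hcI0 : cl I0 = c := by rw [e0]; exact hP0.2
    have h := hloc φ v γ hTS f hf ((S1.filter (fun P => cl (iv P) = c)).filter (fun P => t P = I0)) I0 ?_
      (fun i => A * (2:ℝ)^(e i * c.1) * (2:ℝ)^(c.2 i + 1)) (fun i => by positivity) ?_
    · refine h.trans (le_of_eq ?_)
      have e2 : q^c.1 = ∏ i, (2:ℝ)^(e i * c.1) := by
        rw [hq, ← Real.rpow_natCast, ← Real.rpow_mul (by norm_num), Finset.sum_mul,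
          Real.rpow_sum_of_pos (by norm_num)]
      rw [e2, hK1, Finset.prod_mul_distrib, Finset.prod_mul_distrib]
      have e3 : ∏ i, (2:ℝ)^(c.2 i + 1) = 8 * ∏ i, (2:ℝ)^(c.2 i) := by
        simp only [zpow_add_one₀ (two_ne_zero' ℝ), Finset.prod_mul_distrib, Finset.prod_const]
        simp; ring
      rw [e3]
      simp only [Finset.prod_const, Finset.card_univ, Fintype.card_fin]
      ring
    · intro P hP
      rw [Finset.mem_filter] at hP
      have := (hT3 P hP.1).2
      rwa [hP.2] at this
    · intro i P hP I hPI hII0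
      rw [Finset.mem_filter, Finset.mem_filter] at hP
      have hcP := hP.1.2
      have hpos := (Finset.mem_filter.1 hP.1.1).2 i
      have hdI : d I = c.1 := by
        have h1 := hd _ _ hPI
        have h2 := hd _ _ hII0
        have h3 : d (iv P) = c.1 := congrArg Prod.fst hcP
        have h4 : d I0 = c.1 := congrArg Prod.fst hcI0
        omega
      have hposI0 : 0 < iu (U i) I0 := by rw [e0]; exact (Finset.mem_filter.1 hP0.1).2 i
      have hposI : 0 < iu (U i) I := hposI0.trans_le (iu_anti (hU i) hII0)
      have hlogI : Int.log 2 (iu (U i) I) ≤ c.2 i := by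
        have h3 : Int.log 2 (iu (U i) (iv P)) = c.2 i := congrFun (congrArg Prod.snd hcP) i
        rw [← h3]
        exact Int.log_mono_right hposI (iu_anti (hU i) hPI)
      have hlt : iu (U i) I ≤ (2:ℝ)^(c.2 i + 1) := by
        have := Int.lt_zpow_succ_log_self (R := ℝ) (b := 2) (by norm_num) (iu (U i) I)
        refine this.le.trans ?_
        push_cast
        exact zpow_le_zpow_right₀ (by norm_num) (by omega)
      refine (havg' i I).trans ?_
      rw [hdI]
      refine mul_le_mul_of_nonneg_right ?_ (ln_pos I).le
      have := hs1 i
      refine Real.rpow_le_rpow (mul_nonneg (by positivity) hposI.le) ?_ (by linarith)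
      exact mul_le_mul_of_nonneg_left hlt (by positivity)
  choose T hT1 hT2 hT3 using hclass
  set 𝒞 := S1.image (fun P => cl (iv P)) with h𝒞
  set h : ℝ → ℝ := fun x => ∑ c ∈ 𝒞, K1 * q^c.1 * (∏ i, (2:ℝ)^(c.2 i)) * ∑ I ∈ T c, (dy I).indicator (fun _ => (1:ℝ)) x with hh
  have hind : ∀ I : ℤ × ℤ, Integrable ((dy I).indicator (fun _ => (1:ℝ))) := fun I =>
    (integrable_indicator_iff (measurableSet_dy I)).2 (integrableOn_const (by rw [volume_dy]; exact ENNReal.ofReal_ne_top))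
  have hLam : Lam (fun i P => ‖cf (φ i) (f i) P‖) S1 ≤ ∫ x, h x := by
    have e1 : Lam (fun i P => ‖cf (φ i) (f i) P‖) S1 =
        ∑ c ∈ 𝒞, Lam (fun i P => ‖cf (φ i) (f i) P‖) (S1.filter (fun P => cl (iv P) = c)) := by
      unfold Lam
      rw [Finset.sum_fiberwise_of_maps_to fun P hP => Finset.mem_image_of_mem _ hP]
    rw [e1, hh, integral_finsetSum _ fun c _ => (integrable_finsetSum _ fun I _ => hind I).const_mul _]
    refine Finset.sum_le_sum fun c _ => (hT3 c).trans (le_of_eq ?_)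
    rw [integral_const_mul, integral_finsetSum _ fun I _ => hind I]
    congr 1
    refine Finset.sum_congr rfl fun I _ => ?_
    rw [integral_indicator_const _ (measurableSet_dy I), volume_real_dy]; simp
  have hhn : ∀ x, 0 ≤ h x := fun x => Finset.sum_nonneg fun c _ => mul_nonneg (by positivity)
    (Finset.sum_nonneg fun I _ => indicator_nonneg (fun _ _ => zero_le_one) _)
  have hhi : Integrable h := integrable_finsetSum _ fun c _ => (integrable_finsetSum _ fun I _ => hind I).const_mul _
  have hpt : ∀ x, h x ≤ K1 * (1 - q)⁻¹ * 8 * ∏ i, U i x := by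
    intro x
    have hterm : ∀ c, ∑ I ∈ T c, (dy I).indicator (fun _ => (1:ℝ)) x ≤ ∏ i, (if (2:ℝ)^(c.2 i) ≤ U i x then (1:ℝ) else 0) := by
      intro c
      by_cases hx : ∃ I ∈ T c, x ∈ dy I
      · obtain ⟨I, hI, hxI⟩ := hx
        rw [Finset.sum_eq_single_of_mem I hI]
        · rw [indicator_of_mem hxI, Finset.prod_congr rfl (g := fun _ => (1:ℝ))]
          · simp
          · intro i _
            rw [if_pos]
            obtain ⟨P, hP, hc, e⟩ := hT1 c I hI
            have h3 : Int.log 2 (iu (U i) (iv P)) = c.2 i := congrFun (congrArg Prod.snd hc) i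
            have h4 := Int.zpow_log_le_self (R := ℝ) (b := 2) (by norm_num) ((Finset.mem_filter.1 hP).2 i)
            rw [h3] at h4
            push_cast at h4
            refine h4.trans (iu_le (hU i) ?_)
            rw [← e]; exact hxI
        · intro J hJ hne
          rw [indicator_of_notMem]
          intro hxJ
          exact hne (hT2 c J hJ I hI x hxJ hxI)
      · push Not at hx
        rw [Finset.sum_eq_zero fun I hI => indicator_of_notMem (hx I hI) _]
        exact Finset.prod_nonneg fun i _ => by split_ifs <;> norm_num
    set Nn : Finset ℤ := (𝒞 ×ˢ (Finset.univ : Finset (Fin 3))).image (fun z => z.1.2 z.2) with hNn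
    set Dd : ℕ := (𝒞.sup Prod.fst) + 1 with hDd
    have hsub : 𝒞 ⊆ (Finset.range Dd) ×ˢ (Fintype.piFinset fun _ : Fin 3 => Nn) := by
      intro c hc
      rw [Finset.mem_product, Finset.mem_range, Fintype.mem_piFinset]
      refine ⟨Nat.lt_succ_of_le (Finset.le_sup (f := Prod.fst) hc), fun i => ?_⟩
      exact Finset.mem_image.2 ⟨(c, i), Finset.mem_product.2 ⟨hc, Finset.mem_univ _⟩, rfl⟩
    calc h x ≤ ∑ c ∈ 𝒞, K1 * q^c.1 * ∏ i, (if (2:ℝ)^(c.2 i) ≤ U i x then (2:ℝ)^(c.2 i) else 0) := by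
          refine Finset.sum_le_sum fun c _ => ?_
          rw [mul_assoc]
          refine mul_le_mul_of_nonneg_left ?_ (by positivity)
          refine (mul_le_mul_of_nonneg_left (hterm c) (by positivity)).trans (le_of_eq ?_)
          rw [← Finset.prod_mul_distrib]
          refine Finset.prod_congr rfl fun i _ => ?_
          split_ifs <;> simp
      _ ≤ ∑ c ∈ (Finset.range Dd) ×ˢ (Fintype.piFinset fun _ : Fin 3 => Nn), K1 * q^c.1 * ∏ i, (if (2:ℝ)^(c.2 i) ≤ U i x then (2:ℝ)^(c.2 i) else 0) := by
          refine Finset.sum_le_sum_of_subset_of_nonneg hsub fun c _ _ => ?_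
          refine mul_nonneg (by positivity) (Finset.prod_nonneg fun i _ => ?_)
          split_ifs
          · positivity
          · exact le_rfl
      _ = K1 * (∑ k ∈ Finset.range Dd, q^k) * ∏ i, ∑ n ∈ Nn, (if (2:ℝ)^n ≤ U i x then (2:ℝ)^n else 0) := by
          rw [Finset.sum_product, Finset.prod_univ_sum, mul_assoc, Finset.sum_mul, Finset.mul_sum]
          refine Finset.sum_congr rfl fun k _ => ?_
          rw [← mul_assoc, Finset.mul_sum]
      _ ≤ K1 * (1 - q)⁻¹ * ∏ i, (2 * U i x) := by
          refine mul_le_mul ?_ ?_ (Finset.prod_nonneg fun i _ => Finset.sum_nonneg fun n _ => by split_ifs; positivity; exact le_rfl) (by positivity)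
          · refine mul_le_mul_of_nonneg_left ?_ hK1p.le
            rw [← tsum_geometric_of_lt_one hq0.le hq1]
            exact (summable_geometric_of_lt_one hq0.le hq1).sum_le_tsum _ fun _ _ => by positivity
          · refine Finset.prod_le_prod (fun i _ => Finset.sum_nonneg fun n _ => by split_ifs; positivity; exact le_rfl) fun i _ => ?_
            rw [← Finset.sum_filter]
            exact sum_zpow_ind Nn (hU i x)
      _ = _ := by rw [Finset.prod_mul_distrib]; simp only [Finset.prod_const, Finset.card_univ, Fintype.card_fin]; ring
  calc ENNReal.ofReal (Lam (fun i P => ‖cf (φ i) (f i) P‖) S1) ≤ ENNReal.ofReal (∫ x, h x) := ENNReal.ofReal_le_ofReal hLam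
    _ = ∫⁻ x, ENNReal.ofReal (h x) := ofReal_integral_eq_lintegral_ofReal hhi (Eventually.of_forall hhn)
    _ ≤ ∫⁻ x, ENNReal.ofReal (K1 * (1 - q)⁻¹ * 8) * ENNReal.ofReal (∏ i, U i x) := by
        refine lintegral_mono fun x => ?_
        rw [← ENNReal.ofReal_mul (by positivity)]
        exact ENNReal.ofReal_le_ofReal (hpt x)
    _ = _ := lintegral_const_mul' _ _ ENNReal.ofReal_ne_top

end BHT


namespace BHT

/-- M dominates centred maximal averages of `‖f‖^s` -/
def Dom (f : ℝ → ℂ) (s : ℝ) (M : ℝ → ℝ) : Prop :=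
  ∀ x, 0 ≤ M x ∧ ∀ r : ℝ, 0 < r → ∫ y in Icc (x - r) (x + r), ‖f y‖^s ≤ r * M x^s

lemma poisson_pt (t : ℝ) (ht : 0 ≤ t) (J : ℕ) :
    ((1 + t)⁻¹)^2 ≤ ∑ j ∈ Finset.range J, 4 * (1/4:ℝ)^j * (if t ≤ 2^j then 1 else 0) + 4 * (1/4:ℝ)^J := by
  induction J with
  | zero =>
    simp only [Finset.range_zero, Finset.sum_empty, pow_zero]
    have : ((1 + t)⁻¹)^2 ≤ 1 := pow_le_one₀ (by positivity) (inv_le_one_of_one_le₀ (by linarith))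
    linarith
  | succ J ih =>
    rw [Finset.sum_range_succ]
    split_ifs with h
    · have : 0 < (1/4:ℝ)^(J+1) := by positivity
      linarith
    · have h0 : 0 ≤ ∑ j ∈ Finset.range J, 4 * (1/4:ℝ)^j * (if t ≤ 2^j then (1:ℝ) else 0) :=
        Finset.sum_nonneg fun j _ => by split_ifs <;> positivity
      have h2 : (1 + t)⁻¹ ≤ (2^J)⁻¹ := inv_anti₀ (by positivity) (by linarith)
      have h3 : ((1 + t)⁻¹)^2 ≤ ((2^J)⁻¹)^2 := by gcongr
      have h4 : (((2:ℝ)^J)⁻¹)^2 = (1/4:ℝ)^J := by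
        rw [inv_pow, ← pow_mul, mul_comm, pow_mul, one_div, inv_pow]; norm_num
      have h5 : 4 * (1/4:ℝ)^(J+1) = (1/4:ℝ)^J := by rw [pow_succ]; ring
      rw [h5]; linarith

lemma poisson {g : ℝ → ℝ} (hg : Integrable g) (hg0 : ∀ x, 0 ≤ g x) {x A H : ℝ} (hA : 0 < A) (hH0 : 0 ≤ H)
    (hH : ∀ r : ℝ, 0 < r → ∫ y in Icc (x - r) (x + r), g y ≤ r * H) :
    ∫ y, g y * ((1 + |y - x| / A)⁻¹)^2 ≤ 8 * A * H := by
  have key : ∀ J : ℕ, ∫ y, g y * ((1 + |y - x| / A)⁻¹)^2 ≤ 8 * A * H + 4 * (1/4:ℝ)^J * ∫ y, g y := by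
    intro J
    have hi : ∀ j : ℕ, Integrable (fun y => 4 * (1/4:ℝ)^j * (Icc (x - 2^j*A) (x + 2^j*A)).indicator g y) := fun j =>
      (hg.indicator measurableSet_Icc).const_mul _
    have hle : ∀ y, g y * ((1 + |y - x| / A)⁻¹)^2 ≤
        ∑ j ∈ Finset.range J, 4 * (1/4:ℝ)^j * (Icc (x - 2^j*A) (x + 2^j*A)).indicator g y + 4 * (1/4:ℝ)^J * g y := by
      intro y
      refine (mul_le_mul_of_nonneg_left (poisson_pt (|y - x|/A) (by positivity) J) (hg0 y)).trans (le_of_eq ?_)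
      rw [mul_add, Finset.mul_sum]
      congr 1
      · refine Finset.sum_congr rfl fun j _ => ?_
        have hiff : |y - x|/A ≤ 2^j ↔ y ∈ Icc (x - 2^j*A) (x + 2^j*A) := by
          rw [div_le_iff₀ hA, abs_le, mem_Icc]
          constructor <;> rintro ⟨h1, h2⟩ <;> constructor <;> linarith
        by_cases h : y ∈ Icc (x - 2^j*A) (x + 2^j*A)
        · rw [if_pos (hiff.2 h), indicator_of_mem h]; ring
        · rw [if_neg (fun h' => h (hiff.1 h')), indicator_of_notMem h]; ring
      · ring
    have hInt0 : Integrable (fun y => ∑ j ∈ Finset.range J, 4 * (1/4:ℝ)^j * (Icc (x - 2^j*A) (x + 2^j*A)).indicator g y + 4 * (1/4:ℝ)^J * g y) :=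
      (integrable_finsetSum _ fun j _ => hi j).add (hg.const_mul _)
    refine (integral_mono_of_nonneg (Eventually.of_forall fun y => mul_nonneg (hg0 y) (by positivity)) hInt0 (Eventually.of_forall hle)).trans ?_
    rw [integral_add (integrable_finsetSum _ fun j _ => hi j) (hg.const_mul _), integral_finsetSum _ fun j _ => hi j, integral_const_mul]
    gcongr
    calc ∑ j ∈ Finset.range J, ∫ y, 4 * (1/4:ℝ)^j * (Icc (x - 2^j*A) (x + 2^j*A)).indicator g y
        ≤ ∑ j ∈ Finset.range J, (4 * A * H) * (1/2:ℝ)^j := by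
          refine Finset.sum_le_sum fun j _ => ?_
          rw [integral_const_mul, integral_indicator measurableSet_Icc]
          refine (mul_le_mul_of_nonneg_left (hH (2^j*A) (by positivity)) (by positivity)).trans (le_of_eq ?_)
          have : (1/4:ℝ)^j * 2^j = (1/2:ℝ)^j := by rw [← mul_pow]; norm_num
          rw [← this]; ring
      _ = (4 * A * H) * ∑ j ∈ Finset.range J, (1/2:ℝ)^j := by rw [Finset.mul_sum]
      _ ≤ (4 * A * H) * 2 := by
          refine mul_le_mul_of_nonneg_left ?_ (by positivity)
          exact (summable_geometric_two.sum_le_tsum _ fun _ _ => by positivity).trans tsum_geometric_two.le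
      _ = _ := by ring
  have lim : Tendsto (fun J : ℕ => 8 * A * H + 4 * (1/4:ℝ)^J * ∫ y, g y) atTop (𝓝 (8 * A * H + 4 * 0 * ∫ y, g y)) :=
    ((tendsto_pow_atTop_nhds_zero_of_lt_one (by norm_num) (by norm_num)).const_mul 4).mul_const _ |>.const_add _
  have := ge_of_tendsto' lim key
  simpa using this

lemma w_le_pt {I : ℤ × ℤ} {x : ℝ} (hx : x ∈ dy I) (y : ℝ) : w I y ≤ 2 * (1 + |y - x| / ln I)⁻¹ := by
  have hl := ln_pos I
  obtain ⟨h1, h2⟩ := hx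
  rw [← div_eq_mul_inv, le_div_iff₀ (by positivity)]
  have h3 := w_pos I y
  have h4 : 1 + |y - x| / ln I ≤ 2 * (w I y)⁻¹ := by
    rw [winv]
    have e : y / (2:ℝ)^I.1 - I.2 = (y - 2^I.1 * I.2) / ln I := by
      rw [ln, sub_div, mul_div_cancel_left₀ _ (p2pos I.1).ne']
    rw [e, abs_div, abs_of_pos hl]
    have h5 : |y - x| ≤ |y - 2^I.1 * I.2| + ln I := by
      have : |2^I.1 * I.2 - x| ≤ ln I := by rw [abs_le, ln] at *; constructor <;> linarith
      calc |y - x| = |(y - 2^I.1 * I.2) + (2^I.1 * I.2 - x)| := by ring_nf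
        _ ≤ _ := (abs_add_le _ _).trans (by linarith)
    have h6 : |y - x| / ln I ≤ |y - 2^I.1 * I.2| / ln I + 1 := by
      rw [div_add_one hl.ne']; gcongr
    have : 0 ≤ |y - 2^I.1 * I.2| / ln I := by positivity
    linarith
  calc w I y * (1 + |y - x| / ln I) ≤ w I y * (2 * (w I y)⁻¹) := mul_le_mul_of_nonneg_left h4 h3.le
    _ = 2 := by field_simp

lemma Nice.int_rpow {f : ℝ → ℂ} (hf : Nice f) {s : ℝ} (hs : 1 ≤ s) : Integrable (fun x => ‖f x‖^s) := by
  obtain ⟨M, hM⟩ := hf.bdd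
  have hM0 : 0 ≤ M := (norm_nonneg _).trans (hM 0)
  refine (hf.int.norm.const_mul (M^(s-1))).mono' (hf.meas.norm.pow_const s).aestronglyMeasurable (Eventually.of_forall fun x => ?_)
  rw [Real.norm_of_nonneg (by positivity)]
  rcases (norm_nonneg (f x)).eq_or_lt with h | h
  · rw [← h, Real.zero_rpow (by linarith)]; simp
  · calc ‖f x‖^s = ‖f x‖^(s-1) * ‖f x‖ := by rw [← Real.rpow_add_one h.ne']; ring_nf
      _ ≤ _ := by gcongr; exact hM x

lemma Dom.wavg {f : ℝ → ℂ} (hf : Nice f) {s : ℝ} (hs : 1 ≤ s) {M : ℝ → ℝ} (h : Dom f s M) {I : ℤ × ℤ} (N : ℕ) {c z : ℝ} (hc : 0 ≤ c)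
    (hw : ∀ y, f y ≠ 0 → w I y^(N+2) ≤ c * ((1 + |y - z| / ln I)⁻¹)^2) :
    ∫ x, ‖f x‖^s * w I x^(N+2) ≤ 8 * c * M z^s * ln I := by
  have hl := ln_pos I
  have h1 := poisson (hf.int_rpow hs) (fun x => by positivity) hl (Real.rpow_nonneg (h z).1 s) (h z).2
  have hi : Integrable (fun y => ‖f y‖^s * ((1 + |y - z| / ln I)⁻¹)^2) := by
    refine (hf.int_rpow hs).mul_bdd (c := 1) ?_ (Eventually.of_forall fun x => ?_)
    · refine Continuous.aestronglyMeasurable (Continuous.pow (Continuous.inv₀ (by fun_prop) fun x => ?_) 2)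
      positivity
    · rw [Real.norm_of_nonneg (by positivity)]
      exact pow_le_one₀ (by positivity) (inv_le_one_of_one_le₀ (by have : 0 ≤ |x - z| / ln I := by positivity
                                                                   linarith))
  calc ∫ x, ‖f x‖^s * w I x^(N+2) ≤ ∫ x, c * (‖f x‖^s * ((1 + |x - z| / ln I)⁻¹)^2) := by
        refine integral_mono (hf.int_rpow_w (by linarith) (by omega) I) (hi.const_mul c) fun y => ?_
        by_cases hy : f y = 0
        · simp [hy, Real.zero_rpow (by linarith : s ≠ 0)]
        · have := mul_le_mul_of_nonneg_left (hw y hy) (by positivity : 0 ≤ ‖f y‖^s)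
          simp only; linarith
    _ ≤ c * (8 * ln I * M z^s) := by rw [integral_const_mul]; gcongr
    _ = _ := by ring

noncomputable def dZ (Z : Set ℝ) (I : ℤ × ℤ) : ℕ := sInf {d : ℕ | ∃ z ∈ Z, ∃ y ∈ dy I, |z - y| ≤ (2^d - 1) * ln I}

lemma dZ_ne {Z : Set ℝ} (hZ : Z.Nonempty) (I : ℤ × ℤ) : {d : ℕ | ∃ z ∈ Z, ∃ y ∈ dy I, |z - y| ≤ (2^d - 1) * ln I}.Nonempty := by
  obtain ⟨z, hz⟩ := hZ
  obtain ⟨y, hy⟩ := dy_nonempty I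
  have hl := ln_pos I
  obtain ⟨d, hd⟩ := pow_unbounded_of_one_lt (|z - y| / ln I + 1) (one_lt_two (α := ℝ))
  refine ⟨d, z, hz, y, hy, ?_⟩
  rw [← div_le_iff₀ hl]; linarith

lemma dZ_anti {Z : Set ℝ} (hZ : Z.Nonempty) (I J : ℤ × ℤ) (h : dy I ⊆ dy J) : dZ Z J ≤ dZ Z I := by
  have hm := Nat.sInf_mem (dZ_ne hZ I)
  obtain ⟨z, hz, y, hy, hle⟩ := hm
  refine Nat.sInf_le ⟨z, hz, y, h hy, hle.trans ?_⟩
  refine mul_le_mul_of_nonneg_left (ln_le_of_subset h) ?_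
  have : (1:ℝ) ≤ 2^(sInf {d : ℕ | ∃ z ∈ Z, ∃ y ∈ dy I, |z - y| ≤ (2^d - 1) * ln I}) := one_le_pow₀ (by norm_num)
  linarith

lemma dZ_far {Z : Set ℝ} (I : ℤ × ℤ) {z y : ℝ} (hz : z ∈ Z) (hy : y ∈ dy I) : w I z ≤ 4 * (1/2:ℝ)^(dZ Z I) := by
  rcases Nat.eq_zero_or_pos (dZ Z I) with h | h
  · rw [h]; have := w_le_one I z; simp; linarith
  · obtain ⟨d, hd⟩ : ∃ d, dZ Z I = d + 1 := ⟨dZ Z I - 1, by omega⟩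
    have hn : d ∉ {d : ℕ | ∃ z ∈ Z, ∃ y ∈ dy I, |z - y| ≤ (2^d - 1) * ln I} := Nat.notMem_of_lt_sInf (by
      show d < dZ Z I
      omega)
    rw [mem_ofPred_eq] at hn
    push Not at hn
    have h1 := hn z hz y hy
    have hl := ln_pos I
    rw [← lt_div_iff₀ hl] at h1
    rw [hd]
    refine (w_le_pt hy z).trans ?_
    have h2 : (1 + |z - y| / ln I)⁻¹ ≤ ((2:ℝ)^d)⁻¹ := inv_anti₀ (by positivity) (by linarith)
    rw [pow_succ, one_div, inv_pow]
    linarith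

lemma model (ρ R C : ℝ) (K a : ℕ) (s θ : Fin 3 → ℝ) (ha : 12 ≤ a)
    (hs1 : ∀ i, 1 < s i) (hs2 : ∀ i, s i ≤ 2) (hθ0 : ∀ i, 0 ≤ θ i) (hθ1 : ∀ i, θ i ≤ 1) (hθ : ∑ i, θ i < 1)
    (hσ : ∀ i, 0 < (s i - 1) * θ i - (2 - s i + (12:ℕ) / a) / 2 * (1 - θ i)) :
    ∃ Cst : ℝ, 0 < Cst ∧ ∀ (φ : Fin 3 → Tile → ℝ → ℂ) (v : ℝ) (γ : Fin 3 → ℝ), TS φ v γ ρ R C (12 + a + 3) K →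
      ∀ f : Fin 3 → ℝ → ℂ, (∀ i, Nice (f i)) → ∀ (S : Finset Tile) (M : Fin 3 → ℝ → ℝ) (τ₁ τ₂ : ℝ) (Z : Set ℝ),
      (∀ i, Dom (f i) (s i) (M i)) → (∀ x, f 0 x ≠ 0 → x ∈ Z) → (∀ x ∈ Z, M 1 x ≤ τ₁) → (∀ x ∈ Z, M 2 x ≤ τ₂) →
      ENNReal.ofReal (Lam (fun i P => ‖cf (φ i) (f i) P‖) S) ≤
        ENNReal.ofReal Cst * ∫⁻ x, ENNReal.ofReal (M 0 x * min (M 1 x) τ₁ * min (M 2 x) τ₂) := by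
  set A : ℝ := 8 * 4^13 with hA
  set e : Fin 3 → ℝ := ![-10 / s 0, 2 / s 1, 2 / s 2] with he
  have hesum : ∑ i, e i < 0 := by
    rw [Fin.sum_univ_three]
    simp only [he, Matrix.cons_val_zero, Matrix.cons_val_one, Matrix.cons_val]
    have h1 : 2 / s 1 < 2 := by rw [div_lt_iff₀ (by linarith [hs1 1])]; linarith [hs1 1]
    have h2 : 2 / s 2 < 2 := by rw [div_lt_iff₀ (by linarith [hs1 2])]; linarith [hs1 2]
    have h3 : -10 / s 0 ≤ -5 := by rw [div_le_iff₀ (by linarith [hs1 0])]; linarith [hs2 0]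
    linarith
  obtain ⟨c, hc, hcore⟩ := model_core ρ R C K 12 a s θ (by norm_num) ha hs1 hs2 hθ0 hθ1 hθ hσ A (by positivity) e hesum
  refine ⟨c, hc, ?_⟩
  intro φ v γ hTS f hf S M τ₁ τ₂ Z hM hZ h1 h2
  rcases Z.eq_empty_or_nonempty with hZe | hZn
  · have h0 : ∀ x, f 0 x = 0 := fun x => by
      by_contra hx
      have := hZ x hx
      rw [hZe] at this; exact this
    have : Lam (fun i P => ‖cf (φ i) (f i) P‖) S = 0 := by
      unfold Lam
      refine Finset.sum_eq_zero fun P _ => ?_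
      rw [Finset.prod_eq_zero (Finset.mem_univ 0), mul_zero]
      simp [cf, h0]
    rw [this]; simp
  have hτ1 : 0 ≤ τ₁ := by obtain ⟨z, hz⟩ := hZn; exact (hM 1 z).1.trans (h1 z hz)
  have hτ2 : 0 ≤ τ₂ := by obtain ⟨z, hz⟩ := hZn; exact (hM 2 z).1.trans (h2 z hz)
  set U : Fin 3 → ℝ → ℝ := ![M 0, fun x => min (M 1 x) τ₁, fun x => min (M 2 x) τ₂] with hU
  have hA1 : 1 ≤ A := by rw [hA]; norm_num
  have hApow : ∀ i, A ≤ A^(s i) := fun i => by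
    conv_lhs => rw [← Real.rpow_one A]
    exact Real.rpow_le_rpow_of_exponent_le hA1 (hs1 i).le
  -- generic estimate for i = 1, 2
  have gen : ∀ (i : Fin 3) (τ : ℝ), 0 ≤ τ → (∀ x ∈ Z, M i x ≤ τ) → ∀ I, ∀ y ∈ dy I,
      ∫ x, ‖f i x‖^(s i) * w I x^12 ≤ (A * (2:ℝ)^(2 / s i * dZ Z I) * min (M i y) τ)^(s i) * ln I := by
    intro i τ hτ hZτ I y hy
    have hsi := hs1 i
    have hl := ln_pos I
    have hMy := (hM i y).1
    have e1 : (A * (2:ℝ)^(2 / s i * dZ Z I) * min (M i y) τ)^(s i) = A^(s i) * 4^(dZ Z I) * (min (M i y) τ)^(s i) := by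
      rw [Real.mul_rpow (by positivity) (le_min hMy hτ), Real.mul_rpow (by positivity) (by positivity), ← Real.rpow_mul (by norm_num)]
      congr 2
      rw [show 2 / s i * (dZ Z I:ℝ) * s i = (2:ℝ) * dZ Z I by field_simp, Real.rpow_mul (by norm_num), Real.rpow_natCast]
      norm_num
    rw [e1]
    have hA32 : 32 ≤ A := by rw [hA]; norm_num
    rcases le_total (M i y) τ with hle | hle
    · rw [min_eq_left hle]
      have := (hM i).wavg (hf i) hsi.le 10 (I := I) (c := 4) (z := y) (by norm_num) (fun x _ => by
        refine (w_pow_le (by norm_num : 2 ≤ 12) I x).trans ?_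
        refine (pow_le_pow_left₀ (w_pos I x).le (w_le_pt hy x) 2).trans (le_of_eq ?_)
        ring)
      refine this.trans ?_
      refine mul_le_mul_of_nonneg_right ?_ hl.le
      refine mul_le_mul_of_nonneg_right ?_ (by positivity)
      have : (1:ℝ) ≤ 4^(dZ Z I) := one_le_pow₀ (by norm_num)
      have := hApow i
      nlinarith
    · rw [min_eq_right hle]
      obtain ⟨z, hz, y0, hy0, hd⟩ := Nat.sInf_mem (dZ_ne hZn I)
      change |z - y0| ≤ (2^(dZ Z I) - 1) * ln I at hd
      have := (hM i).wavg (hf i) hsi.le 10 (I := I) (c := 4 * 4^(dZ Z I)) (z := z) (by positivity) (fun x _ => by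
        refine (w_pow_le (by norm_num : 2 ≤ 12) I x).trans ?_
        have h3 : w I x ≤ 2 * (2^(dZ Z I) * (1 + |x - z| / ln I)⁻¹) := by
          refine (w_le_pt hy0 x).trans ?_
          refine mul_le_mul_of_nonneg_left ?_ (by norm_num)
          rw [← div_eq_mul_inv, le_div_iff₀ (by positivity), inv_mul_le_iff₀ (by positivity)]
          have h4 : |x - z| / ln I ≤ |x - y0| / ln I + (2^(dZ Z I) - 1) := by
            rw [div_add' _ _ _ hl.ne']
            gcongr
            calc |x - z| = |(x - y0) - (z - y0)| := by ring_nf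
              _ ≤ |x - y0| + |z - y0| := abs_sub _ _
              _ ≤ _ := by linarith
          have h5 : (1:ℝ) ≤ 2^(dZ Z I) := one_le_pow₀ (by norm_num)
          have h6 : 0 ≤ |x - y0| / ln I := by positivity
          nlinarith
        refine (pow_le_pow_left₀ (w_pos I x).le h3 2).trans (le_of_eq ?_)
        rw [show (4:ℝ)^(dZ Z I) = (2^(dZ Z I))^2 by rw [← pow_mul, mul_comm, pow_mul]; norm_num]
        ring)
      refine this.trans ?_
      refine mul_le_mul_of_nonneg_right ?_ hl.le
      have h7 : M i z^(s i) ≤ τ^(s i) := Real.rpow_le_rpow (hM i z).1 (hZτ z hz) (by linarith)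
      calc 8 * (4 * 4^(dZ Z I)) * M i z^(s i) ≤ 8 * (4 * 4^(dZ Z I)) * τ^(s i) := by gcongr
        _ = 32 * 4^(dZ Z I) * τ^(s i) := by ring
        _ ≤ _ := by have := hApow i; gcongr; linarith
  have := hcore φ v γ hTS f hf S U (dZ Z) ?_ (fun I J h => dZ_anti hZn I J h) ?_
  · refine this.trans (le_of_eq ?_)
    congr 1
    refine lintegral_congr fun x => ?_
    rw [Fin.prod_univ_three]
    simp [hU]
  · intro i x
    fin_cases i
    · exact (hM 0 x).1
    · exact le_min (hM 1 x).1 hτ1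
    · exact le_min (hM 2 x).1 hτ2
  · intro i I y hy
    fin_cases i
    · have hsi := hs1 0
      have hl := ln_pos I
      have hMy := (hM 0 y).1
      show ∫ x, ‖f 0 x‖^(s 0) * w I x^12 ≤ (A * (2:ℝ)^(-10 / s 0 * dZ Z I) * M 0 y)^(s 0) * ln I
      have e1 : (A * (2:ℝ)^(-10 / s 0 * dZ Z I) * M 0 y)^(s 0) = A^(s 0) * ((1/2:ℝ)^(dZ Z I))^10 * (M 0 y)^(s 0) := by
        rw [Real.mul_rpow (by positivity) hMy, Real.mul_rpow (by positivity) (by positivity), ← Real.rpow_mul (by norm_num)]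
        congr 2
        rw [show -10 / s 0 * (dZ Z I:ℝ) * s 0 = -((dZ Z I * 10 : ℕ):ℝ) by push_cast; field_simp, Real.rpow_neg (by norm_num), Real.rpow_natCast,
          ← pow_mul, one_div, inv_pow]
      rw [e1]
      have := (hM 0).wavg (hf 0) hsi.le 10 (I := I) (c := 4^11 * ((1/2:ℝ)^(dZ Z I))^10) (z := y) (by positivity) (fun x hx => by
        have h3 := dZ_far I (hZ x hx) hy
        have h4 := w_le_pt hy x
        rw [pow_add]
        calc w I x^10 * w I x^2 ≤ (4 * (1/2:ℝ)^(dZ Z I))^10 * (2 * (1 + |x - y| / ln I)⁻¹)^2 := by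
              have := w_pos I x
              gcongr
          _ = _ := by rw [mul_pow, mul_pow]; ring)
      refine this.trans ?_
      refine mul_le_mul_of_nonneg_right ?_ hl.le
      refine mul_le_mul_of_nonneg_right ?_ (by positivity)
      have h5 : 8 * 4^11 ≤ A^(s 0) := le_trans (by rw [hA]; norm_num) (hApow 0)
      calc 8 * (4^11 * ((1/2:ℝ)^(dZ Z I))^10) = 8 * 4^11 * ((1/2:ℝ)^(dZ Z I))^10 := by ring
        _ ≤ _ := by gcongr
    · exact gen 1 τ₁ hτ1 h1 I y hy
    · exact gen 2 τ₂ hτ2 h2 I y hy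

end BHT


namespace BHT

/-- centred maximal function -/
noncomputable def mx (G : ℝ → ℝ≥0∞) (x : ℝ) : ℝ≥0∞ := ⨆ (r : ℝ) (_ : 0 < r), (∫⁻ y in Icc (x - r) (x + r), G y) / ENNReal.ofReal r

lemma le_mx (G : ℝ → ℝ≥0∞) (x : ℝ) {r : ℝ} (hr : 0 < r) : ∫⁻ y in Icc (x - r) (x + r), G y ≤ ENNReal.ofReal r * mx G x := by
  have : (∫⁻ y in Icc (x - r) (x + r), G y) / ENNReal.ofReal r ≤ mx G x :=
    le_iSup₂ (f := fun (r : ℝ) (_ : 0 < r) => (∫⁻ y in Icc (x - r) (x + r), G y) / ENNReal.ofReal r) r hr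
  rw [ENNReal.div_le_iff (by simpa using hr) ENNReal.ofReal_ne_top] at this
  rwa [mul_comm]

lemma lt_mx_iff {G : ℝ → ℝ≥0∞} {x : ℝ} {c : ℝ≥0∞} : c < mx G x ↔ ∃ r : ℝ, 0 < r ∧ c * ENNReal.ofReal r < ∫⁻ y in Icc (x - r) (x + r), G y := by
  unfold mx
  simp only [lt_iSup_iff]
  constructor
  · rintro ⟨r, hr, h⟩
    refine ⟨r, hr, ?_⟩
    rwa [ENNReal.lt_div_iff_mul_lt (by left; simpa using hr) (by left; exact ENNReal.ofReal_ne_top)] at h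
  · rintro ⟨r, hr, h⟩
    refine ⟨r, hr, ?_⟩
    rwa [ENNReal.lt_div_iff_mul_lt (by left; simpa using hr) (by left; exact ENNReal.ofReal_ne_top)]

lemma mx_meas (G : ℝ → ℝ≥0∞) : Measurable (mx G) := by
  refine measurable_of_Ioi fun c => IsOpen.measurableSet ?_
  rw [isOpen_iff_mem_nhds]
  intro x hx
  rw [mem_preimage, mem_Ioi, lt_mx_iff] at hx
  obtain ⟨r, hr, h⟩ := hx
  rcases eq_or_ne c ⊤ with rfl | hc
  · rw [ENNReal.top_mul (by simpa using hr)] at h; exact absurd h (by simp)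
  have hcont : Continuous (fun x' : ℝ => c * ENNReal.ofReal (r + |x' - x|)) :=
    (ENNReal.continuous_const_mul hc).comp (ENNReal.continuous_ofReal.comp (by fun_prop))
  have h2 : ∀ᶠ x' in 𝓝 x, c * ENNReal.ofReal (r + |x' - x|) < ∫⁻ y in Icc (x - r) (x + r), G y := by
    refine hcont.continuousAt.eventually_lt_const ?_
    simpa using h
  filter_upwards [h2] with x' hx'
  rw [mem_preimage, mem_Ioi, lt_mx_iff]
  refine ⟨r + |x' - x|, by positivity, hx'.trans_le (lintegral_mono_set ?_)⟩
  have := neg_abs_le (x' - x)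
  have := le_abs_self (x' - x)
  refine Icc_subset_Icc ?_ ?_ <;> linarith

lemma mx_weak (G : ℝ → ℝ≥0∞) {c : ℝ} (hc : 0 < c) :
    ENNReal.ofReal c * volume {x | ENNReal.ofReal c < mx G x} ≤ 8 * ∫⁻ y, G y := by
  rcases eq_or_ne (∫⁻ y, G y) ⊤ with htop | htop
  · rw [htop, ENNReal.mul_top (by norm_num)]; exact le_top
  have hE : ∀ x ∈ {x | ENNReal.ofReal c < mx G x}, ∃ r : ℝ, 0 < r ∧ ENNReal.ofReal c * ENNReal.ofReal r < ∫⁻ y in Icc (x - r) (x + r), G y :=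
    fun x hx => lt_mx_iff.1 hx
  choose! r hr hlt using hE
  set E := {x | ENNReal.ofReal c < mx G x} with hEd
  have hbd : ∀ x ∈ E, r x ≤ (∫⁻ y, G y).toReal / c := by
    intro x hx
    rw [le_div_iff₀ hc]
    have h1 := (hlt x hx).le.trans (setLIntegral_le_lintegral _ _)
    rw [← ENNReal.ofReal_mul hc.le] at h1
    have := (ENNReal.ofReal_le_iff_le_toReal htop).1 h1
    linarith
  obtain ⟨u, hu, hdisj, hcov⟩ := Vitali.exists_disjoint_subfamily_covering_enlargement_closedBall E id r _ hbd 4 (by norm_num)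
  have hcount : u.Countable := hdisj.countable_of_nonempty_interior fun x hx => by
    have := hr x (hu hx)
    rw [id, Real.closedBall_eq_Icc, interior_Icc]
    exact ⟨x, by constructor <;> linarith⟩
  have hsub : E ⊆ ⋃ b ∈ u, Metric.closedBall b (4 * r b) := by
    intro x hx
    obtain ⟨b, hb, h⟩ := hcov x hx
    exact mem_biUnion hb (h (Metric.mem_closedBall_self (hr x hx).le))
  have : Countable u := hcount.to_subtype
  calc ENNReal.ofReal c * volume E ≤ ENNReal.ofReal c * ∑' b : u, volume (Metric.closedBall (b:ℝ) (4 * r b)) := by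
        gcongr
        exact (measure_mono hsub).trans (measure_biUnion_le _ hcount _)
    _ = ∑' b : u, ENNReal.ofReal c * volume (Metric.closedBall (b:ℝ) (4 * r b)) := ENNReal.tsum_mul_left.symm
    _ ≤ ∑' b : u, 8 * ∫⁻ y in Metric.closedBall (b:ℝ) (r b), G y := by
        refine ENNReal.tsum_le_tsum fun b => ?_
        have hb := hr b (hu b.2)
        rw [Real.volume_closedBall, Real.closedBall_eq_Icc, show 2 * (4 * r b) = 8 * r b by ring, ENNReal.ofReal_mul (by norm_num),
          ← mul_assoc, mul_comm (ENNReal.ofReal c), mul_assoc]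
        have := (hlt b (hu b.2)).le
        refine mul_le_mul' (by simp) this
    _ = 8 * ∑' b : u, ∫⁻ y in Metric.closedBall (b:ℝ) (r b), G y := ENNReal.tsum_mul_left
    _ = 8 * ∫⁻ y in ⋃ b : u, Metric.closedBall (b:ℝ) (r b), G y := by
        rw [lintegral_iUnion (fun b => measurableSet_closedBall)]
        intro b b' hne
        exact hdisj b.2 b'.2 (fun h => hne (Subtype.ext h))
    _ ≤ _ := by gcongr; exact Measure.restrict_le_self

lemma mx_le_const {G : ℝ → ℝ≥0∞} {B : ℝ} (h : ∀ x, G x ≤ ENNReal.ofReal B) (x : ℝ) : mx G x ≤ ENNReal.ofReal (2 * B) := by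
  refine iSup₂_le fun r hr => ?_
  rw [ENNReal.div_le_iff (by simpa using hr) ENNReal.ofReal_ne_top]
  calc ∫⁻ y in Icc (x - r) (x + r), G y ≤ ∫⁻ y in Icc (x - r) (x + r), ENNReal.ofReal B := lintegral_mono fun y => h y
    _ = ENNReal.ofReal B * ENNReal.ofReal (2 * r) := by rw [setLIntegral_const, Real.volume_Icc]; congr 2; ring
    _ = _ := by rw [ENNReal.ofReal_mul (by norm_num), ENNReal.ofReal_mul (by norm_num)]; ring

lemma mx_split {g : ℝ → ℝ} (hg : Measurable g) {c : ℝ} (hc : 0 < c) (x : ℝ) :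
    mx (fun y => ENNReal.ofReal (g y)) x ≤ mx (fun y => {y | c < g y}.indicator (fun y => ENNReal.ofReal (g y)) y) x + ENNReal.ofReal (2 * c) := by
  refine iSup₂_le fun r hr => ?_
  rw [ENNReal.div_le_iff (by simpa using hr) ENNReal.ofReal_ne_top]
  have hm : MeasurableSet {y | c < g y} := measurableSet_lt measurable_const hg
  calc ∫⁻ y in Icc (x - r) (x + r), ENNReal.ofReal (g y)
      ≤ ∫⁻ y in Icc (x - r) (x + r), ({y | c < g y}.indicator (fun y => ENNReal.ofReal (g y)) y + ENNReal.ofReal c) := by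
        refine lintegral_mono fun y => ?_
        by_cases h : y ∈ {y | c < g y}
        · simp only [indicator_of_mem h]; exact le_self_add
        · simp only [indicator_of_notMem h, zero_add]
          exact ENNReal.ofReal_le_ofReal (not_lt.1 h)
    _ = (∫⁻ y in Icc (x - r) (x + r), {y | c < g y}.indicator (fun y => ENNReal.ofReal (g y)) y) + ENNReal.ofReal c * ENNReal.ofReal (2 * r) := by
        rw [lintegral_add_right _ measurable_const, setLIntegral_const, Real.volume_Icc]; congr 3; ring
    _ ≤ _ := by
        rw [add_mul]
        refine add_le_add ((le_mx _ x hr).trans (mul_comm _ _).le) (le_of_eq ?_)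
        rw [ENNReal.ofReal_mul (by norm_num), ENNReal.ofReal_mul (by norm_num)]; ring

lemma mx_strong {g : ℝ → ℝ} (hg : Measurable g) (hg0 : ∀ x, 0 ≤ g x) {B : ℝ} (hB : ∀ x, g x ≤ B) {q : ℝ} (hq : 1 < q) :
    ∫⁻ x, ENNReal.ofReal ((mx (fun y => ENNReal.ofReal (g y)) x).toReal^q) ≤
      ENNReal.ofReal (3^q * q * 8 / (q-1)) * ∫⁻ x, ENNReal.ofReal (g x^q) := by
  set G : ℝ → ℝ≥0∞ := fun y => ENNReal.ofReal (g y) with hG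
  have hGm : Measurable G := hg.ennreal_ofReal
  have hfin : ∀ x, mx G x ≠ ⊤ := fun x => ((mx_le_const (B := B) (fun y => ENNReal.ofReal_le_ofReal (hB y)) x).trans_lt ENNReal.ofReal_lt_top).ne
  set h : ℝ → ℝ := fun x => (mx G x).toReal / 3 with hh
  have hm : Measurable h := (mx_meas G).ennreal_toReal.div_const 3
  have hh0 : ∀ x, 0 ≤ h x := fun x => by simp only [hh]; positivity
  have hq0 : 0 < q := by linarith
  have e1 : ∀ x, ENNReal.ofReal ((mx G x).toReal^q) = ENNReal.ofReal (3^q) * ENNReal.ofReal (h x^q) := by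
    intro x
    rw [← ENNReal.ofReal_mul (by positivity), ← Real.mul_rpow (by norm_num) (hh0 x)]
    congr 2; simp only [hh]; ring
  simp_rw [e1]
  rw [lintegral_const_mul _ (by fun_prop), lintegral_rpow_eq_lintegral_meas_lt_mul volume (Eventually.of_forall hh0) hm.aemeasurable hq0]
  set ν := volume.withDensity G with hν
  have e2 := lintegral_rpow_eq_lintegral_meas_lt_mul ν (Eventually.of_forall hg0) hg.aemeasurable (p := q - 1) (by linarith)
  rw [lintegral_withDensity_eq_lintegral_mul _ hGm (by fun_prop)] at e2
  have e3 : ∀ x, (G * fun a => ENNReal.ofReal (g a^(q-1))) x = ENNReal.ofReal (g x^q) := by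
    intro x
    simp only [Pi.mul_apply, hG]
    rw [← ENNReal.ofReal_mul (hg0 x)]
    congr 1
    rcases (hg0 x).eq_or_lt with h0 | h0
    · rw [← h0, Real.zero_rpow (by linarith), Real.zero_rpow (by linarith)]; simp
    · rw [mul_comm, ← Real.rpow_add_one h0.ne']; ring_nf
  rw [lintegral_congr e3] at e2
  rw [e2, show 3^q * q * 8 / (q-1) = 3^q * (q * 8 * (q-1)⁻¹) by rw [div_eq_mul_inv]; ring, ENNReal.ofReal_mul (by positivity)]
  rw [mul_assoc]
  refine mul_le_mul_right ?_ _
  have hq1 : 0 < q - 1 := by linarith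
  rw [← mul_assoc, ← ENNReal.ofReal_mul (by positivity), show q * 8 * (q-1)⁻¹ * (q-1) = q * 8 by field_simp, ENNReal.ofReal_mul hq0.le, mul_assoc]
  refine mul_le_mul_right ?_ _
  rw [← lintegral_const_mul' _ _ ENNReal.ofReal_ne_top]
  refine setLIntegral_mono' measurableSet_Ioi fun t ht => ?_
  rw [mem_Ioi] at ht
  have hsub : {a | t < h a} ⊆ {x | ENNReal.ofReal t < mx (fun y => {y | t < g y}.indicator (fun y => ENNReal.ofReal (g y)) y) x} := by
    intro x hx
    rw [mem_ofPred_eq] at hx ⊢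
    by_contra hcon
    rw [not_lt] at hcon
    have h1 := (mx_split hg ht x).trans (add_le_add_left hcon _)
    rw [← ENNReal.ofReal_add ht.le (by positivity)] at h1
    have h2 := ENNReal.toReal_le_of_le_ofReal (by positivity) h1
    simp only [hh] at hx
    change (mx G x).toReal ≤ _ at h2
    linarith
  have h3 := mx_weak (fun y => {y | t < g y}.indicator (fun y => ENNReal.ofReal (g y)) y) ht
  have hm' : MeasurableSet {y | t < g y} := measurableSet_lt measurable_const hg
  have e4 : ∫⁻ y, {y | t < g y}.indicator (fun y => ENNReal.ofReal (g y)) y = ν {y | t < g y} := by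
    rw [lintegral_indicator hm', hν, withDensity_apply _ hm']
  rw [e4] at h3
  have e5 : ENNReal.ofReal (t^(q-1)) = ENNReal.ofReal t * ENNReal.ofReal (t^(q-1-1)) := by
    rw [← ENNReal.ofReal_mul ht.le]; congr 1
    rw [mul_comm, ← Real.rpow_add_one ht.ne']; ring_nf
  rw [e5, ← mul_assoc, ← mul_assoc]
  refine mul_le_mul_left ?_ _
  rw [mul_comm]
  refine (mul_le_mul_right (measure_mono hsub) _).trans (h3.trans (le_of_eq ?_))
  simp

/-- the maximal function attached to `f` and exponent `s` -/
noncomputable def MM (f : ℝ → ℂ) (s : ℝ) (x : ℝ) : ℝ := ((mx (fun y => ENNReal.ofReal (‖f y‖^s)) x).toReal)^(1/s)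

lemma MM_meas (f : ℝ → ℂ) (s : ℝ) : Measurable (MM f s) := ((mx_meas _).ennreal_toReal).pow_const _

lemma MM_dom {f : ℝ → ℂ} (hf : Nice f) {s : ℝ} (hs : 1 ≤ s) : Dom f s (MM f s) := by
  intro x
  refine ⟨by unfold MM; positivity, fun r hr => ?_⟩
  obtain ⟨M, hM⟩ := hf.bdd
  have hM0 : 0 ≤ M := (norm_nonneg _).trans (hM 0)
  have hfin : mx (fun y => ENNReal.ofReal (‖f y‖^s)) x ≠ ⊤ :=
    ((mx_le_const (B := M^s) (fun y => ENNReal.ofReal_le_ofReal (Real.rpow_le_rpow (norm_nonneg _) (hM y) (by linarith))) x).trans_lt ENNReal.ofReal_lt_top).ne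
  have h1 := le_mx (fun y => ENNReal.ofReal (‖f y‖^s)) x hr
  rw [integral_eq_lintegral_of_nonneg_ae (Eventually.of_forall fun y => by positivity) (hf.meas.norm.pow_const s).aestronglyMeasurable]
  have e : MM f s x^s = (mx (fun y => ENNReal.ofReal (‖f y‖^s)) x).toReal := by
    unfold MM; rw [one_div, Real.rpow_inv_rpow ENNReal.toReal_nonneg (by linarith)]
  rw [e]
  have := ENNReal.toReal_mono (ENNReal.mul_ne_top ENNReal.ofReal_ne_top hfin) h1
  rwa [ENNReal.toReal_mul, ENNReal.toReal_ofReal hr.le] at this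

lemma MM_strong {f : ℝ → ℂ} (hf : Nice f) {s p : ℝ} (hs : 1 ≤ s) (hp : s < p) :
    ∫⁻ x, ENNReal.ofReal (MM f s x^p) ≤ ENNReal.ofReal (3^(p/s) * (p/s) * 8 / (p/s-1)) * ∫⁻ x, ENNReal.ofReal (‖f x‖^p) := by
  obtain ⟨M, hM⟩ := hf.bdd
  have := mx_strong (g := fun y => ‖f y‖^s) (hf.meas.norm.pow_const s) (fun x => by positivity) (B := M^s)
    (fun y => Real.rpow_le_rpow (norm_nonneg _) (hM y) (by linarith)) (q := p/s) (by rw [lt_div_iff₀ (by linarith)]; linarith)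
  refine (le_of_eq (lintegral_congr fun x => ?_)).trans (this.trans (le_of_eq ?_))
  · unfold MM; rw [← Real.rpow_mul ENNReal.toReal_nonneg]; congr 2; ring
  · congr 1
    refine lintegral_congr fun x => ?_
    rw [← Real.rpow_mul (norm_nonneg _)]; congr 2; field_simp

lemma dom_const {f : ℝ → ℂ} (hf : Nice f) {s B : ℝ} (hs : 1 ≤ s) (hB : ∀ x, ‖f x‖ ≤ B) : Dom f s (fun _ => 2 * B) := by
  have hB0 : 0 ≤ B := (norm_nonneg _).trans (hB 0)
  intro x
  refine ⟨by positivity, fun r hr => ?_⟩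
  calc ∫ y in Icc (x - r) (x + r), ‖f y‖^s ≤ ∫ y in Icc (x - r) (x + r), B^s := by
        refine integral_mono (hf.int_rpow hs).integrableOn (integrableOn_const (by simp)) fun y => ?_
        exact Real.rpow_le_rpow (norm_nonneg _) (hB y) (by linarith)
    _ = 2 * r * B^s := by
        rw [setIntegral_const, smul_eq_mul, Measure.real, Real.volume_Icc, ENNReal.toReal_ofReal (by linarith)]; ring
    _ ≤ r * (2 * B)^s := by
        rw [Real.mul_rpow (by norm_num) hB0]
        have : (2:ℝ) ≤ 2^s := by conv_lhs => rw [← Real.rpow_one 2]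
                                 exact Real.rpow_le_rpow_of_exponent_le (by norm_num) hs
        have h2 : 0 ≤ B^s := by positivity
        nlinarith [mul_nonneg hr.le h2]

end BHT



namespace BHT

/-! ## Part K: Fourier analysis -/

noncomputable def ee (t : ℝ) : ℂ := Complex.exp ((2 * Real.pi * t : ℝ) * Complex.I)

lemma ee_norm (t : ℝ) : ‖ee t‖ = 1 := Complex.norm_exp_ofReal_mul_I _

lemma ee_add (s t : ℝ) : ee (s + t) = ee s * ee t := by
  unfold ee; rw [← Complex.exp_add]; congr 1; push_cast; ring

lemma ee_zero : ee 0 = 1 := by simp [ee]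

lemma ee_conj (t : ℝ) : (starRingEnd ℂ) (ee t) = ee (-t) := by
  unfold ee; rw [← Complex.exp_conj]; congr 1
  rw [map_mul, Complex.conj_ofReal, Complex.conj_I]; push_cast; ring

@[fun_prop] lemma ee_cont : Continuous ee := by unfold ee; fun_prop

lemma ee_deriv (c x : ℝ) : HasDerivAt (fun y => ee (c * y)) ((2 * Real.pi * c : ℝ) * Complex.I * ee (c * x)) x := by
  unfold ee
  have h : HasDerivAt (fun y : ℝ => ((2 * Real.pi * (c * y) : ℝ) : ℂ) * Complex.I) ((2 * Real.pi * c : ℝ) * Complex.I) x := by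
    refine HasDerivAt.mul_const ?_ _
    refine HasDerivAt.ofReal_comp ?_
    have := ((hasDerivAt_id x).const_mul c).const_mul (2 * Real.pi)
    simpa [mul_assoc] using this
  have := h.cexp
  convert this using 1
  ring

noncomputable def FT (f : ℝ → ℂ) (ξ : ℝ) : ℂ := ∫ x, f x * ee (-(x * ξ))

lemma FT_eq (f : ℝ → ℂ) (ξ : ℝ) : FT f ξ = FourierTransform.fourier f ξ := by
  rw [Real.fourier_real_eq_integral_exp_smul]
  unfold FT ee
  refine integral_congr_ae (Eventually.of_forall fun x => ?_)
  simp only [smul_eq_mul]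
  rw [mul_comm]; congr 2; push_cast; ring

lemma FT_neg (f : ℝ → ℂ) (ξ : ℝ) : FT f (-ξ) = FourierTransformInv.fourierInv f ξ := by
  rw [FT_eq, Real.fourierInv_eq_fourier_neg]

lemma FT_cont {f : ℝ → ℂ} (hf : Integrable f) : Continuous (FT f) := by
  have : FT f = FourierTransform.fourier f := funext (FT_eq f)
  rw [this]
  exact VectorFourier.fourierIntegral_continuous Real.continuous_fourierChar (by fun_prop) hf

lemma FT_inv {f : ℝ → ℂ} (hc : Continuous f) (hf : Integrable f) (hF : Integrable (FT f)) (x : ℝ) :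
    FT (FT f) x = f (-x) := by
  have e : FT f = FourierTransform.fourier f := funext (FT_eq f)
  have := congrFun (hc.fourierInv_fourier_eq hf (e ▸ hF)) (-x)
  rw [← FT_neg, ← e, neg_neg] at this
  exact this

lemma ee_int {f : ℝ → ℂ} (hf : Integrable f) {g : ℝ → ℝ} (hg : Continuous g) : Integrable (fun x => f x * ee (g x)) :=
  hf.mul_bdd (c := 1) (by fun_prop) (Eventually.of_forall fun x => (ee_norm _).le)

/-- decay of a profile -/
structure Prof (g : ℝ → ℂ) : Prop where
  dec : ∀ N : ℕ, ∃ C, 0 < C ∧ ∀ x, ‖g x‖ ≤ C * ((1 + |x|)⁻¹)^N ∧ ‖deriv g x‖ ≤ C * ((1 + |x|)⁻¹)^N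
  dif : Differentiable ℝ g
  int : Integrable g

lemma prof_schwartz (g : SchwartzMap ℝ ℂ) : Prof g where
  dif := g.differentiable
  int := g.integrable
  dec := by
    intro N
    refine ⟨2^N * (Finset.Iic (N,1)).sup (fun m => SchwartzMap.seminorm ℝ m.1 m.2) g + 1, by positivity, fun x => ?_⟩
    have h0 := SchwartzMap.one_add_le_sup_seminorm_apply (𝕜 := ℝ) (m := (N,1)) (k := N) (n := 0) le_rfl (by simp) g x
    have h1 := SchwartzMap.one_add_le_sup_seminorm_apply (𝕜 := ℝ) (m := (N,1)) (k := N) (n := 1) le_rfl le_rfl g x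
    rw [norm_iteratedFDeriv_zero] at h0
    rw [norm_iteratedFDeriv_one, ← norm_deriv_eq_norm_fderiv] at h1
    have hp : 0 < (1 + |x|)^N := by positivity
    rw [Real.norm_eq_abs] at h0 h1
    rw [inv_pow, ← div_eq_mul_inv, le_div_iff₀ hp, le_div_iff₀ hp]
    constructor <;> linarith

lemma Prof.cont {g : ℝ → ℂ} (hg : Prof g) : Continuous g := hg.dif.continuous

structure BL (g : ℝ → ℂ) : Prop extends Prof g where
  rep : ∃ ψ : ℝ → ℂ, Continuous ψ ∧ Integrable ψ ∧ (∀ x, 1 < |x| → ψ x = 0) ∧ ∀ x, g x = FT ψ x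
  sup : ∀ ξ, 1 < |ξ| → FT g ξ = 0
  tg : g.HasTemperateGrowth

lemma FT_scale (g : ℝ → ℂ) {B : ℝ} (hB : 0 < B) (y ξ : ℝ) :
    ∫ x, g (x / B - y) * ee (-(x * ξ)) = B * ee (-(B * y * ξ)) * FT g (B * ξ) := by
  have h := Measure.integral_comp_div (fun x => g (x - y) * ee (-((B * x) * ξ))) B
  have h2 := integral_sub_right_eq_self (μ := volume) (fun x => g x * ee (-((B * (x + y)) * ξ))) y
  simp only [sub_add_cancel] at h2
  have e1 : ∀ x, B * (x / B) = x := fun x => by field_simp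
  simp only [e1] at h
  rw [h, h2, abs_of_pos hB, FT, Complex.real_smul, mul_assoc, ← integral_const_mul (ee _)]
  congr 1
  refine integral_congr_ae (Eventually.of_forall fun x => ?_)
  simp only
  rw [mul_left_comm, ← ee_add]
  congr 2; ring

lemma BL.orth {g : ℝ → ℂ} (hg : BL g) {A B : ℝ} (hA : 0 < A) (hB : 0 < B) (y y' τ : ℝ)
    (h : 1 / A + 1 / B < |τ|) :
    ∫ x, g (x / A - y) * (starRingEnd ℂ) (g (x / B - y')) * ee (τ * x) = 0 := by
  obtain ⟨ψ, hψc, hψi, hψs, hψ⟩ := hg.rep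
  have hG : Integrable (fun x => g (x / B - y')) := (hg.int.comp_sub_right y').comp_div hB.ne'
  have hG2 : Integrable (fun x => (starRingEnd ℂ) (g (x / B - y'))) := by
    have : Continuous fun x => (starRingEnd ℂ) (g (x / B - y')) :=
      Complex.continuous_conj.comp (hg.cont.comp (by fun_prop))
    refine (hG.norm).mono' this.aestronglyMeasurable (Eventually.of_forall fun x => by simp)
  calc ∫ x, g (x / A - y) * (starRingEnd ℂ) (g (x / B - y')) * ee (τ * x)
      = ∫ x, ∫ ζ, ψ ζ * (starRingEnd ℂ) (g (x / B - y')) * ee (-(ζ * (x / A - y)) + τ * x) := by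
        refine integral_congr_ae (Eventually.of_forall fun x => ?_)
        simp only
        rw [hψ (x / A - y), FT, mul_assoc, ← integral_mul_const]
        refine integral_congr_ae (Eventually.of_forall fun ζ => ?_)
        simp only [ee_add]; ring
    _ = ∫ ζ, ∫ x, ψ ζ * (starRingEnd ℂ) (g (x / B - y')) * ee (-(ζ * (x / A - y)) + τ * x) := by
        refine integral_integral_swap ?_
        have h1 : Integrable (fun z : ℝ × ℝ => (starRingEnd ℂ) (g (z.1 / B - y')) * ψ z.2) := hG2.mul_prod hψi
        refine (h1.mul_bdd (c := 1) (g := fun z : ℝ × ℝ => ee (-(z.2 * (z.1 / A - y)) + τ * z.1)) ?_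
          (Eventually.of_forall fun x => (ee_norm _).le)).congr (Eventually.of_forall fun z => ?_)
        · exact (by fun_prop : Continuous _).aestronglyMeasurable
        · simp only [Function.uncurry]; ring
    _ = ∫ ζ : ℝ, (0:ℂ) := by
        refine integral_congr_ae (Eventually.of_forall fun ζ => ?_)
        simp only
        by_cases hz : 1 < |ζ|
        · simp [hψs ζ hz]
        push Not at hz
        have e : ∀ x, ψ ζ * (starRingEnd ℂ) (g (x / B - y')) * ee (-(ζ * (x / A - y)) + τ * x) =
            (ψ ζ * ee (ζ * y)) * (starRingEnd ℂ) (g (x / B - y') * ee (-(x * (τ - ζ / A)))) := by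
          intro x
          rw [map_mul, ee_conj]
          have : -(ζ * (x / A - y)) + τ * x = ζ * y + - -(x * (τ - ζ / A)) := by ring
          rw [this, ee_add]; ring
        simp only [e]
        rw [integral_const_mul, integral_conj, FT_scale g hB, hg.sup]
        · simp
        rw [abs_mul, abs_of_pos hB]
        have h1 : |ζ / A| ≤ 1 / A := by
          rw [abs_div, abs_of_pos hA]; gcongr
        have h2 := abs_sub_abs_le_abs_sub τ (ζ / A)
        have h3 : 1 / B < |τ - ζ / A| := by linarith
        rw [div_lt_iff₀ hB] at h3; linarith
    _ = 0 := by simp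

/-- wave packets -/
noncomputable def pk (g : ℝ → ℂ) (α γ u v : ℝ) (P : Tile) (x : ℝ) : ℂ :=
  g (x / (2:ℝ)^P.1 - (P.2.1 + u)) * ee (-(α * γ * (x / (2:ℝ)^P.1 - (P.2.1 + u)))) *
    ee (-(α * ((P.2.2 + v) / (2:ℝ)^P.1) * x))

lemma shift_w {u : ℝ} (hu0 : 0 ≤ u) (hu1 : u ≤ 1) (P : Tile) (x : ℝ) (N : ℕ) :
    ((1 + |x / (2:ℝ)^P.1 - (P.2.1 + u)|)⁻¹)^N ≤ 2^N * w (iv P) x ^ N := by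
  rw [← mul_pow]
  refine pow_le_pow_left₀ (by positivity) ?_ _
  unfold w iv
  simp only
  rw [← div_eq_mul_inv, ← one_div, div_le_div_iff₀ (by positivity) (by positivity)]
  have : |x / (2:ℝ)^P.1 - P.2.1| ≤ |x / (2:ℝ)^P.1 - (P.2.1 + u)| + u := by
    have := abs_add_le (x / (2:ℝ)^P.1 - (P.2.1 + u)) u
    rw [abs_of_nonneg hu0] at this
    refine le_trans (le_of_eq ?_) this
    congr 1; ring
  linarith [abs_nonneg (x / (2:ℝ)^P.1 - (P.2.1 + u))]

lemma Prof.osc {g : ℝ → ℂ} (hg : Prof g) (K : ℝ) (hK : 0 ≤ K) (N : ℕ) : ∃ C, 0 < C ∧ ∀ κ, |κ| ≤ K → ∀ z z', |z - z'| ≤ 1 →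
    ‖ee (κ * z) * g z - ee (κ * z') * g z'‖ ≤ C * |z - z'| * ((1 + |z|)⁻¹)^N := by
  obtain ⟨C, hC, hd⟩ := hg.dec N
  have hpi := Real.pi_pos
  refine ⟨(2 * Real.pi * K * C + C) * 2^N, by positivity, fun κ hκ z z' hz => ?_⟩
  have hder : ∀ x ∈ uIcc z z', HasDerivWithinAt (fun y => ee (κ * y) * g y)
      ((2 * Real.pi * κ : ℝ) * Complex.I * ee (κ * x) * g x + ee (κ * x) * deriv g x) (uIcc z z') x := fun x _ =>
    ((ee_deriv κ x).mul (hg.dif x).hasDerivAt).hasDerivWithinAt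
  have hb : ∀ x ∈ uIcc z z', ‖(2 * Real.pi * κ : ℝ) * Complex.I * ee (κ * x) * g x + ee (κ * x) * deriv g x‖ ≤
      (2 * Real.pi * K * C + C) * 2^N * ((1 + |z|)⁻¹)^N := by
    intro x hx
    have hxz : |x - z| ≤ 1 := (abs_sub_left_of_mem_uIcc hx).trans (by rwa [abs_sub_comm])
    have hw : ((1 + |x|)⁻¹)^N ≤ 2^N * ((1 + |z|)⁻¹)^N := by
      rw [← mul_pow]
      refine pow_le_pow_left₀ (by positivity) ?_ _
      rw [← div_eq_mul_inv, ← one_div, div_le_div_iff₀ (by positivity) (by positivity)]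
      have := abs_sub_abs_le_abs_sub z x
      rw [abs_sub_comm] at this
      linarith [abs_nonneg x]
    refine (norm_add_le _ _).trans ?_
    simp only [norm_mul, ee_norm, Complex.norm_I, Complex.norm_real, Real.norm_eq_abs, mul_one, one_mul]
    rw [abs_of_pos hpi, abs_two]
    have := hd x
    calc _ ≤ 2 * Real.pi * K * (C * ((1 + |x|)⁻¹)^N) + C * ((1 + |x|)⁻¹)^N := by
            gcongr
            · exact this.1
            · exact this.2
      _ = (2 * Real.pi * K * C + C) * ((1 + |x|)⁻¹)^N := by ring
      _ ≤ (2 * Real.pi * K * C + C) * (2^N * ((1 + |z|)⁻¹)^N) := by gcongr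
      _ = _ := by ring
  have := (convex_uIcc z z').norm_image_sub_le_of_norm_hasDerivWithin_le hder hb right_mem_uIcc left_mem_uIcc
  refine this.trans (le_of_eq ?_)
  rw [Real.norm_eq_abs]; ring

theorem pk_PS {g : ℝ → ℂ} (hg : BL g) {α : ℝ} (hα : α ≠ 0) (γ ρ R : ℝ) (N : ℕ) (hρ : 1 / |α| ≤ ρ)
    (hR : |γ| + 2 * ρ ≤ R) : ∃ C, 0 < C ∧ ∀ u v : ℝ, 0 ≤ u → u ≤ 1 → PS (pk g α γ u v) v γ ρ R C N := by
  have hα' : 0 < |α| := abs_pos.2 hα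
  have hρ0 : 0 < ρ := lt_of_lt_of_le (by positivity) hρ
  obtain ⟨C1, hC1, h1⟩ := hg.dec N
  have hR0 : 0 ≤ R := by linarith [abs_nonneg γ]
  obtain ⟨C2, hC2, h2⟩ := hg.toProf.osc (|α| * (R + |γ|)) (by positivity) N
  refine ⟨(C1 + C2) * 2^N, by positivity, fun u v hu0 hu1 => ⟨hρ0, by positivity, hR, fun P => ?_, fun P x => ?_, fun P Q h => ?_, fun ξ => ?_⟩⟩
  · unfold pk
    have := hg.cont
    fun_prop
  · unfold pk
    rw [norm_mul, norm_mul, ee_norm, ee_norm, mul_one, mul_one]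
    refine (h1 _).1.trans ?_
    rw [mul_assoc]
    refine mul_le_mul ?_ (shift_w hu0 hu1 P x N) (by positivity) (by positivity)
    linarith
  · unfold ip
    have hP := p2pos P.1
    have hQ := p2pos Q.1
    have key := hg.orth hP hQ (P.2.1 + u) (Q.2.1 + u) (-(α * (fr v γ P - fr v γ Q))) (by
      rw [abs_neg, abs_mul]
      have h3 : 1 ≤ |α| * ρ := by rw [div_le_iff₀ hα'] at hρ; linarith
      have h4 : |α| * (ρ * (1 / (2:ℝ)^P.1 + 1 / (2:ℝ)^Q.1)) < |α| * |fr v γ P - fr v γ Q| := by gcongr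
      have h5 : 1 * (1 / (2:ℝ)^P.1 + 1 / (2:ℝ)^Q.1) ≤ |α| * ρ * (1 / (2:ℝ)^P.1 + 1 / (2:ℝ)^Q.1) := by gcongr
      linarith)
    have e : ∀ x, pk g α γ u v P x * (starRingEnd ℂ) (pk g α γ u v Q x) =
        ee (α * γ * (P.2.1 + u) - α * γ * (Q.2.1 + u)) * (g (x / (2:ℝ)^P.1 - (P.2.1 + u)) *
          (starRingEnd ℂ) (g (x / (2:ℝ)^Q.1 - (Q.2.1 + u))) * ee (-(α * (fr v γ P - fr v γ Q)) * x)) := by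
      intro x
      unfold pk
      simp only [map_mul, ee_conj]
      have e2 : ∀ a b c d e f p q : ℂ, c * d * e * f = p * q → a * c * d * (b * e * f) = p * (a * b * q) := by
        intro a b c d e f p q h
        linear_combination a * b * h
      apply e2
      simp only [← ee_add]
      congr 1
      unfold fr
      field_simp
      ring
    simp only [e]
    rw [integral_const_mul, key, mul_zero]
  · refine ⟨fun x => ee (α * ξ * x), fun x => ee_norm _, fun P hP x x' hx => ?_⟩
    have hp := p2pos P.1
    have e : ∀ x, ee (α * ξ * x) * pk g α γ u v P x = ee (α * th v P ξ * (P.2.1 + u)) *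
        (ee (α * (th v P ξ - γ) * (x / (2:ℝ)^P.1 - (P.2.1 + u))) * g (x / (2:ℝ)^P.1 - (P.2.1 + u))) := by
      intro x
      unfold pk
      have e2 : ∀ a b c d p q : ℂ, a * c * d = p * q → a * (b * c * d) = p * (q * b) := by
        intro a b c d p q h
        linear_combination b * h
      apply e2
      simp only [← ee_add]
      congr 1
      unfold th
      field_simp
      ring
    simp only [e]
    rw [← mul_sub, norm_mul, ee_norm, one_mul]
    have ex : x / (2:ℝ)^P.1 - (P.2.1 + u) - (x' / (2:ℝ)^P.1 - (P.2.1 + u)) = (x - x') / (2:ℝ)^P.1 := by ring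
    refine (h2 _ ?_ _ _ ?_).trans ?_
    · rw [abs_mul]
      have := abs_sub (th v P ξ) γ
      gcongr
      linarith
    · rw [ex, abs_div, abs_of_pos hp, div_le_one hp]; exact hx
    · rw [ex, abs_div, abs_of_pos hp]
      have := shift_w hu0 hu1 P x N
      calc _ ≤ C2 * (|x - x'| / (2:ℝ)^P.1) * (2^N * w (iv P) x ^ N) := by gcongr
        _ ≤ (C1 + C2) * (|x - x'| / (2:ℝ)^P.1) * (2^N * w (iv P) x ^ N) := by
          have := w_pos (iv P) x
          gcongr; linarith
        _ = _ := by ring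

end BHT



namespace BHT

/-! ## Part L: choice of the profile and of the frequency -/

/-- multiplication formula -/
lemma FT_mul {f g : ℝ → ℂ} (hf : Integrable f) (hg : Integrable g) : ∫ x, FT f x * g x = ∫ x, f x * FT g x := by
  have h1 : ∀ x, FT f x * g x = ∫ y, f y * g x * ee (-(y * x)) := by
    intro x; rw [FT, ← integral_mul_const]
    exact integral_congr_ae (Eventually.of_forall fun y => by simp only; ring)
  have h2 : ∀ y, f y * FT g y = ∫ x, f y * g x * ee (-(y * x)) := by
    intro y; rw [FT, ← integral_const_mul]
    exact integral_congr_ae (Eventually.of_forall fun x => by simp only; rw [mul_comm y x]; ring)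
  simp only [h1, h2]
  refine integral_integral_swap ?_
  refine ((hg.mul_prod hf).mul_bdd (c := 1) (g := fun z : ℝ × ℝ => ee (-(z.2 * z.1))) ?_
          (Eventually.of_forall fun x => (ee_norm _).le)).congr (Eventually.of_forall fun z => ?_)
  · exact (by fun_prop : Continuous _).aestronglyMeasurable
  · simp only [Function.uncurry]; ring

lemma Prof.bdd {g : ℝ → ℂ} (hg : Prof g) : ∃ C, 0 < C ∧ ∀ x, ‖g x‖ ≤ C := by
  obtain ⟨C, hC, h⟩ := hg.dec 0
  exact ⟨C, hC, fun x => by simpa using (h x).1⟩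

theorem exists_g : ∃ g : ℝ → ℂ, BL g ∧ ∫ x, g x * g x * g x ≠ 0 := by
  let p : ContDiffBump (0:ℝ) := ⟨1/2, 1, by norm_num, by norm_num⟩
  have hp0 : ∀ x, 0 ≤ p x := fun x => p.nonneg
  have hp1 : p 0 = 1 := p.one_of_mem_closedBall (by simp [p])
  have hpc : Continuous p := p.continuous
  have hpI : Integrable p := hpc.integrable_of_hasCompactSupport p.hasCompactSupport
  have hps : ∀ x, 1 < |x| → p x = 0 := fun x hx => p.zero_of_le_dist (by simp [p]; exact hx.le)
  have hcs : HasCompactSupport (fun x => (p x : ℂ)) := p.hasCompactSupport.comp_left (g := fun r : ℝ => (r:ℂ)) (by simp)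
  let ψ : SchwartzMap ℝ ℂ := hcs.toSchwartzMap (Complex.ofRealCLM.contDiff.comp p.contDiff)
  have hψ : ∀ x, ψ x = (p x : ℂ) := fun x => rfl
  let g : SchwartzMap ℝ ℂ := FourierTransform.fourier ψ
  have hg : ∀ x, g x = FT ψ x := fun x => by rw [FT_eq, ← SchwartzMap.fourier_coe]
  have hgf : (g : ℝ → ℂ) = FT ψ := funext hg
  have hFg : ∀ ξ, FT g ξ = p (-ξ) := by
    intro ξ
    have h2 : Integrable (FT ψ) := by rw [← hgf]; exact g.integrable
    rw [hgf, FT_inv ψ.continuous ψ.integrable h2, hψ]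
  have hbl : BL g := by
    refine ⟨prof_schwartz g, ⟨ψ, ψ.continuous, ψ.integrable, fun x hx => by simp [hψ, hps x hx], hg⟩, fun ξ hξ => ?_, g.hasTemperateGrowth⟩
    rw [hFg, hps _ (by rwa [abs_neg])]; simp
  refine ⟨g, hbl, ?_⟩
  obtain ⟨B, hB, hb⟩ := hbl.bdd
  have hgg : Integrable (fun x => g x * g x) := g.integrable.mul_bdd (c := B) g.continuous.aestronglyMeasurable
    (Eventually.of_forall hb)
  have hJ : ∀ ξ, FT (fun x => g x * g x) ξ = ((∫ ζ, p ζ * p (-ζ - ξ) : ℝ) : ℂ) := by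
    intro ξ
    have h1 : FT (fun x => g x * g x) ξ = ∫ x, FT ψ x * (g x * ee (-(x * ξ))) := by
      unfold FT
      refine integral_congr_ae (Eventually.of_forall fun x => ?_)
      simp only
      rw [mul_assoc, hg x]; rfl
    rw [h1, FT_mul ψ.integrable (ee_int g.integrable (by fun_prop)), ← integral_complex_ofReal]
    refine integral_congr_ae (Eventually.of_forall fun ζ => ?_)
    simp only
    have : FT (fun x => g x * ee (-(x * ξ))) ζ = FT g (ζ + ξ) := by
      unfold FT
      refine integral_congr_ae (Eventually.of_forall fun x => ?_)
      simp only
      rw [mul_assoc, ← ee_add]; congr 2; ring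
    rw [this, hFg, hψ]; push_cast; congr 3; ring
  have e : ∫ x, g x * g x * g x = ((∫ ξ, p ξ * (∫ ζ, p ζ * p (-ζ - ξ)) : ℝ) : ℂ) := by
    have h1 : ∫ x, g x * g x * g x = ∫ x, FT ψ x * (g x * g x) :=
      integral_congr_ae (Eventually.of_forall fun x => by simp only [← hgf]; ring)
    rw [h1, FT_mul ψ.integrable hgg, ← integral_complex_ofReal]
    refine integral_congr_ae (Eventually.of_forall fun ζ => ?_)
    simp only [hJ, hψ]; push_cast; rfl
  rw [e]
  norm_cast
  have hJc : Continuous (fun ξ => ∫ ζ, p ζ * p (-ζ - ξ)) := by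
    have := Complex.continuous_re.comp (FT_cont hgg)
    refine this.congr fun ξ => ?_
    simp [hJ]
  refine ne_of_gt ?_
  refine Continuous.integral_pos_of_hasCompactSupport_nonneg_nonzero (x := 0) (hpc.mul hJc) p.hasCompactSupport.mul_right ?_ ?_
  · intro ξ; exact mul_nonneg (hp0 _) (integral_nonneg fun ζ => mul_nonneg (hp0 _) (hp0 _))
  · simp only [hp1, one_mul]
    refine ne_of_gt ?_
    refine Continuous.integral_pos_of_hasCompactSupport_nonneg_nonzero (x := 0) (by fun_prop) p.hasCompactSupport.mul_right ?_ ?_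
    · intro ζ; exact mul_nonneg (hp0 _) (hp0 _)
    · simp [hp1]

noncomputable def sg (u : ℝ) : ℝ := if 0 ≤ u then 1 else -1

lemma sg_meas : Measurable sg := Measurable.ite measurableSet_Ici measurable_const measurable_const

lemma sg_abs (u : ℝ) : |sg u| = 1 := by unfold sg; split_ifs <;> simp

lemma sg_mul (u : ℝ) : sg u * |u| = u := by
  unfold sg; split_ifs with h
  · rw [abs_of_nonneg h, one_mul]
  · rw [abs_of_neg (by linarith)]; ring

noncomputable def hh (g : ℝ → ℂ) (β u : ℝ) : ℂ := ∫ y, g y * g (y + β * u) * g (y + u)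

lemma shear_int {f g : ℝ → ℂ} (hf : Integrable f) (hg : Integrable g) :
    Integrable (fun z : ℝ × ℝ => f z.1 * g (z.1 + z.2)) := by
  have h := (measurePreserving_prod_add (volume : Measure ℝ) (volume : Measure ℝ)).integrable_comp_of_integrable
    (hf.mul_prod hg)
  exact h

lemma Prof.hh_int {g : ℝ → ℂ} (hg : Prof g) (β : ℝ) : Integrable (hh g β) := by
  obtain ⟨B, hB, hb⟩ := hg.bdd
  have hc := hg.cont
  have h : Integrable (fun z : ℝ × ℝ => g z.1 * g (z.1 + z.2) * g (z.1 + β * z.2)) :=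
    (shear_int hg.int hg.int).mul_bdd (c := B) (by fun_prop) (Eventually.of_forall fun z => hb _)
  refine h.integral_prod_right.congr (Eventually.of_forall fun u => ?_)
  simp only [hh]
  exact integral_congr_ae (Eventually.of_forall fun y => by simp only; ring)

lemma Prof.hh_cont {g : ℝ → ℂ} (hg : Prof g) (β : ℝ) : Continuous (hh g β) := by
  obtain ⟨B, hB, hb⟩ := hg.bdd
  have hc := hg.cont
  unfold hh
  refine continuous_of_dominated (bound := fun y => ‖g y‖ * B * B) (fun u => by fun_prop) (fun u => Eventually.of_forall fun y => ?_)
    ((hg.int.norm.mul_const _).mul_const _) (Eventually.of_forall fun y => by fun_prop)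
  rw [norm_mul, norm_mul]
  gcongr
  · exact hb _
  · exact hb _

theorem exists_D {g : ℝ → ℂ} (hg : Prof g) (β D0 : ℝ) (h0 : ∫ x, g x * g x * g x ≠ 0) :
    ∃ D, D0 ≤ |D| ∧ ∫ u, (sg u : ℂ) * hh g β u * ee (-(u * D)) ≠ 0 := by
  by_contra! hcon
  set F : ℝ → ℂ := fun u => (sg u : ℂ) * hh g β u with hF
  have hFi : Integrable F := by
    have := (hg.hh_int β).mul_bdd (c := 1) (g := fun u => (sg u : ℂ)) (Complex.measurable_ofReal.comp sg_meas).aestronglyMeasurable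
      (Eventually.of_forall fun u => by rw [Complex.norm_real, Real.norm_eq_abs, sg_abs])
    exact this.congr (Eventually.of_forall fun u => by simp only [hF]; ring)
  have hz : ∀ D, D0 ≤ |D| → FT F D = 0 := fun D hD => hcon D hD
  have hcs : HasCompactSupport (FT F) := by
    refine HasCompactSupport.intro (K := Icc (-D0) D0) isCompact_Icc fun x hx => hz x ?_
    by_contra! h
    exact hx ⟨by linarith [neg_abs_le x], by linarith [le_abs_self x]⟩
  have hFFi : Integrable (FT F) := (FT_cont hFi).integrable_of_hasCompactSupport hcs
  have hinv : ∀ x, x ≠ 0 → FT (FT F) (-x) = F x := by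
    intro x hx
    have e : FT F = FourierTransform.fourier F := funext (FT_eq F)
    have hca : ContinuousAt F x := by
      have hs : ContinuousAt (fun u => (sg u : ℂ)) x := by
        rcases lt_or_gt_of_ne hx with h | h
        · refine ContinuousAt.congr (f := fun _ => (-1:ℂ)) continuousAt_const ?_
          filter_upwards [Iio_mem_nhds h] with y hy
          have : ¬ (0 ≤ y) := not_le.2 hy
          simp [sg, this]
        · refine ContinuousAt.congr (f := fun _ => (1:ℂ)) continuousAt_const ?_
          filter_upwards [Ioi_mem_nhds h] with y hy
          have : 0 ≤ y := le_of_lt hy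
          simp [sg, this]
      exact hs.mul (hg.hh_cont β).continuousAt
    have := hFi.fourierInv_fourier_eq (e ▸ hFFi) hca
    rwa [← FT_neg, ← e] at this
  have hc : Continuous (fun x => FT (FT F) (-x)) := (FT_cont hFFi).comp continuous_neg
  have hhc := hg.hh_cont β
  have t1 : Tendsto (fun x => FT (FT F) (-x)) (𝓝[>] 0) (𝓝 (hh g β 0)) := by
    refine Tendsto.congr' ?_ ((hhc.tendsto 0).mono_left nhdsWithin_le_nhds)
    filter_upwards [self_mem_nhdsWithin] with x hx
    rw [hinv x (ne_of_gt hx)]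
    simp [hF, sg, le_of_lt (show 0 < x from hx)]
  have t2 : Tendsto (fun x => FT (FT F) (-x)) (𝓝[<] 0) (𝓝 (-hh g β 0)) := by
    refine Tendsto.congr' ?_ ((hhc.neg.tendsto 0).mono_left nhdsWithin_le_nhds)
    filter_upwards [self_mem_nhdsWithin] with x hx
    rw [hinv x (ne_of_lt hx)]
    simp [hF, sg, not_le.2 (show x < 0 from hx)]
  have e1 := tendsto_nhds_unique t1 ((hc.tendsto 0).mono_left nhdsWithin_le_nhds)
  have e2 := tendsto_nhds_unique t2 ((hc.tendsto 0).mono_left nhdsWithin_le_nhds)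
  have e3 : hh g β 0 = 0 := by
    have : hh g β 0 + hh g β 0 = 0 := by
      nth_rw 1 [e1, ← e2]; ring
    have h2 : (2:ℂ) * hh g β 0 = 0 := by linear_combination this
    simpa using h2
  apply h0
  rw [← e3, hh]
  simp

end BHT



namespace BHT

/-! ## Part M: the trilinear form -/

lemma FT_mod (f : ℝ → ℂ) (c d ξ : ℝ) : FT (fun x => f x * ee (c * x + d)) ξ = ee d * FT f (ξ - c) := by
  unfold FT
  rw [← integral_const_mul]
  refine integral_congr_ae (Eventually.of_forall fun x => ?_)
  simp only
  rw [mul_assoc, ← ee_add, mul_left_comm, ← ee_add]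
  congr 2; ring

lemma FT_int (f : SchwartzMap ℝ ℂ) {g : ℝ → ℂ} (hg : g.HasTemperateGrowth) (s y c d : ℝ) :
    Integrable (FT (fun x => f x * g (x / s - y) * ee (c * x + d))) := by
  have hG : (fun x : ℝ => g (x / s - y)).HasTemperateGrowth := by
    have h1 : (fun x : ℝ => x / s - y).HasTemperateGrowth := by
      simp only [div_eq_mul_inv]
      exact (Function.HasTemperateGrowth.id'.mul (Function.HasTemperateGrowth.const _)).sub (Function.HasTemperateGrowth.const _)
    exact hg.comp h1
  let F : SchwartzMap ℝ ℂ := SchwartzMap.smulLeftCLM ℂ (fun x : ℝ => g (x / s - y)) f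
  have hF : ∀ x, f x * g (x / s - y) = F x := fun x => by
    simp only [F, SchwartzMap.smulLeftCLM_apply_apply hG, smul_eq_mul, mul_comm]
  have e : FT (fun x => f x * g (x / s - y) * ee (c * x + d)) = fun ξ => ee d * FT F (ξ - c) := by
    funext ξ
    rw [FT_mod (fun x => f x * g (x / s - y)) c d ξ]
    congr 2
    funext x; exact hF x
  rw [e]
  have : FT F = (FourierTransform.fourier F : SchwartzMap ℝ ℂ) := by
    funext x; rw [FT_eq, ← SchwartzMap.fourier_coe]
  rw [this]
  exact ((SchwartzMap.integrable _).comp_sub_right c).const_mul _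

lemma tri_id {F1 F2 F3 : ℝ → ℂ} (h1 : Integrable F1) (h3 : Integrable F3) (h2 : Integrable F2) (h2c : Continuous F2)
    (h2F : Integrable (FT F2)) (β : ℝ) :
    ∫ q : ℝ × ℝ, F1 q.1 * F2 (q.1 + β * q.2) * F3 (q.1 + q.2) =
      ∫ η, FT F1 ((β - 1) * η) * FT F2 (1 * η) * FT F3 (-β * η) := by
  have hinv : ∀ z, F2 z = ∫ η, FT F2 η * ee (η * z) := by
    intro z
    have := FT_inv h2c h2 h2F (-z)
    rw [neg_neg] at this
    rw [← this, FT]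
    simp
  have hs := shear_int h1 h3
  calc ∫ q : ℝ × ℝ, F1 q.1 * F2 (q.1 + β * q.2) * F3 (q.1 + q.2)
      = ∫ q : ℝ × ℝ, ∫ η, (F1 q.1 * F3 (q.1 + q.2)) * FT F2 η * ee (η * (q.1 + β * q.2)) := by
        refine integral_congr_ae (Eventually.of_forall fun q => ?_)
        simp only
        rw [hinv]
        simp only [mul_assoc (F1 q.1 * F3 (q.1 + q.2))]
        rw [integral_const_mul]
        ring
    _ = ∫ η, ∫ q : ℝ × ℝ, (F1 q.1 * F3 (q.1 + q.2)) * FT F2 η * ee (η * (q.1 + β * q.2)) := by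
        refine integral_integral_swap ?_
        refine (hs.mul_prod h2F).mul_bdd (c := 1) (g := fun z : (ℝ × ℝ) × ℝ => ee (z.2 * (z.1.1 + β * z.1.2))) ?_
          (Eventually.of_forall fun x => (ee_norm _).le)
        exact (by fun_prop : Continuous _).aestronglyMeasurable
    _ = _ := by
        refine integral_congr_ae (Eventually.of_forall fun η => ?_)
        simp only
        have e1 : ∀ q : ℝ × ℝ, (F1 q.1 * F3 (q.1 + q.2)) * FT F2 η * ee (η * (q.1 + β * q.2)) =
            FT F2 η * ((F1 q.1 * ee (-(q.1 * ((β - 1) * η)))) * (F3 (q.1 + q.2) * ee (-((q.1 + q.2) * (-β * η))))) := by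
          intro q
          have : η * (q.1 + β * q.2) = -(q.1 * ((β - 1) * η)) + -((q.1 + q.2) * (-β * η)) := by ring
          rw [this, ee_add]; ring
        simp only [e1]
        rw [integral_const_mul]
        have mp := measurePreserving_prod_add (volume : Measure ℝ) (volume : Measure ℝ)
        have := mp.integral_comp (MeasurableEquiv.shearAddRight ℝ).measurableEmbedding
          (fun z : ℝ × ℝ => (F1 z.1 * ee (-(z.1 * ((β - 1) * η)))) * (F3 z.2 * ee (-(z.2 * (-β * η)))))
        simp only at this
        have e2 : (∫ q : ℝ × ℝ, (F1 q.1 * ee (-(q.1 * ((β - 1) * η)))) * (F3 (q.1 + q.2) * ee (-((q.1 + q.2) * (-β * η))))) =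
            FT F1 ((β - 1) * η) * FT F3 (-β * η) := by
          refine this.trans ?_
          exact integral_prod_mul (fun x => F1 x * ee (-(x * ((β - 1) * η)))) (fun x => F3 x * ee (-(x * (-β * η))))
        rw [e2, one_mul]; ring

end BHT



namespace BHT

noncomputable def ph (g : ℝ → ℂ) (c z : ℝ) : ℂ := g z * ee (-(c * z))

noncomputable def Psi (g : ℝ → ℂ) (β L u : ℝ) : ℂ := hh g β u * ee (-(u * (L * (β * (β - 1)))))

lemma Psi_eq (g : ℝ → ℂ) (β L u : ℝ) :
    ∫ y, ph g 0 y * ph g (L * β) (y + β * u) * ph g (-β * L) (y + u) = Psi g β L u := by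
  unfold Psi hh ph
  rw [← integral_mul_const]
  refine integral_congr_ae (Eventually.of_forall fun y => ?_)
  simp only
  have : -(u * (L * (β * (β - 1)))) = -(0 * y) + -(L * β * (y + β * u)) + -(-β * L * (y + u)) := by ring
  rw [this, ee_add, ee_add]; ring

lemma Psi_eq' (g : ℝ → ℂ) (β L x t s : ℝ) :
    ∫ y, ph g 0 (x / s - y) * ph g (L * β) ((x + β * t) / s - y) * ph g (-β * L) ((x + t) / s - y) = Psi g β L (t / s) := by
  rw [← Psi_eq, ← integral_sub_left_eq_self (fun y => ph g 0 y * ph g (L * β) (y + β * (t / s)) * ph g (-β * L) (y + t / s)) volume (x / s)]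
  refine integral_congr_ae (Eventually.of_forall fun y => ?_)
  simp only
  congr 3 <;> ring

noncomputable def Kd (g : ℝ → ℂ) (β L δ t : ℝ) : ℂ := ∫ s in Icc δ δ⁻¹, (((s^2)⁻¹ : ℝ) : ℂ) * Psi g β L (t / s)

noncomputable def Td (g : ℝ → ℂ) (β L δ : ℝ) (f₂ f₃ : ℝ → ℂ) (x : ℝ) : ℂ :=
  ∫ t, f₂ (x + β * t) * f₃ (x + t) * Kd g β L δ t

lemma mp_theta (δ : ℝ) : MeasurePreserving (fun z : (ℝ × ℝ) × (ℝ × ℝ) => (z.1, (z.2.1, z.1.1 / z.2.1 - z.2.2)))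
    ((volume : Measure (ℝ × ℝ)).prod ((volume.restrict (Icc δ δ⁻¹)).prod volume))
    ((volume : Measure (ℝ × ℝ)).prod ((volume.restrict (Icc δ δ⁻¹)).prod volume)) := by
  refine MeasurePreserving.skew_product (f := id) (g := fun (q p : ℝ × ℝ) => (p.1, q.1 / p.1 - p.2)) (MeasurePreserving.id _) ?_ ?_
  · simp only [Function.uncurry_def]; fun_prop
  · refine Eventually.of_forall fun q => ?_
    refine (MeasurePreserving.skew_product (f := id) (g := fun s y => q.1 / s - y) (MeasurePreserving.id _) ?_ ?_).map_eq
    · simp only [Function.uncurry_def]; fun_prop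
    · refine Eventually.of_forall fun s => ?_
      exact (Measure.measurePreserving_sub_left volume (q.1 / s)).map_eq

lemma int_s2 {δ : ℝ} (hδ : 0 < δ) : IntegrableOn (fun s : ℝ => (s^2)⁻¹) (Icc δ δ⁻¹) := by
  refine ContinuousOn.integrableOn_Icc ?_
  refine ContinuousOn.inv₀ (by fun_prop) fun s hs => ?_
  have : 0 < s := lt_of_lt_of_le hδ hs.1
  positivity

noncomputable def GG (g f₁ f₂ f₃ : ℝ → ℂ) (β L : ℝ) (z : (ℝ × ℝ) × (ℝ × ℝ)) : ℂ :=
  (((z.2.1^2)⁻¹ : ℝ) : ℂ) * ((f₁ z.1.1 * ph g 0 (z.1.1 / z.2.1 - z.2.2)) *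
    (f₂ (z.1.1 + β * z.1.2) * ph g (L * β) ((z.1.1 + β * z.1.2) / z.2.1 - z.2.2)) *
    (f₃ (z.1.1 + z.1.2) * ph g (-β * L) ((z.1.1 + z.1.2) / z.2.1 - z.2.2)))

lemma GG_int {g f₁ f₂ f₃ : ℝ → ℂ} (hg : Prof g) (h1 : Nice f₁) (h2 : Nice f₂) (h3 : Nice f₃) (β L : ℝ) {δ : ℝ} (hδ : 0 < δ) :
    Integrable (GG g f₁ f₂ f₃ β L) ((volume : Measure (ℝ × ℝ)).prod ((volume.restrict (Icc δ δ⁻¹)).prod volume)) := by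
  obtain ⟨B, hB, hb⟩ := hg.bdd
  obtain ⟨M, hM⟩ := h2.bdd
  have hM0 : 0 ≤ M := (norm_nonneg _).trans (hM 0)
  have hgm := hg.cont.measurable
  have h2m := h2.meas
  have hee : Measurable ee := ee_cont.measurable
  have hK : Integrable (fun p : ℝ × ℝ => (((p.1^2)⁻¹ : ℝ) : ℂ) * g p.2) ((volume.restrict (Icc δ δ⁻¹)).prod volume) :=
    Integrable.mul_prod (f := fun s : ℝ => (((s^2)⁻¹ : ℝ) : ℂ)) (int_s2 hδ).ofReal hg.int
  have hA := (shear_int h1.int h3.int).mul_prod hK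
  have hA2 := (mp_theta δ).integrable_comp_of_integrable hA
  refine (hA2.mul_bdd (c := M * B * B) (g := fun z : (ℝ × ℝ) × (ℝ × ℝ) =>
    ee (-(0 * (z.1.1 / z.2.1 - z.2.2))) * (f₂ (z.1.1 + β * z.1.2) * ph g (L * β) ((z.1.1 + β * z.1.2) / z.2.1 - z.2.2)) *
    (ph g (-β * L) ((z.1.1 + z.1.2) / z.2.1 - z.2.2))) ?_ ?_).congr ?_
  · unfold ph
    refine Measurable.aestronglyMeasurable ?_
    fun_prop
  · refine Eventually.of_forall fun z => ?_
    unfold ph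
    simp only [norm_mul, ee_norm, one_mul, mul_one]
    gcongr
    · exact hM _
    · exact hb _
    · exact hb _
  · refine Eventually.of_forall fun z => ?_
    simp only [GG, Function.comp, ph]
    ring

lemma Nice_schwartz (f : SchwartzMap ℝ ℂ) : Nice f := by
  refine ⟨f.continuous.measurable, f.integrable, ?_⟩
  obtain ⟨C, _, h⟩ := (prof_schwartz f).bdd
  exact ⟨C, h⟩

theorem form_le {g : ℝ → ℂ} (hg : BL g) {f₁ : ℝ → ℂ} (h1 : Nice f₁) (f₂ f₃ : SchwartzMap ℝ ℂ) (β L : ℝ) {δ : ℝ} (hδ : 0 < δ) :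
    ‖∫ x, f₁ x * Td g β L δ f₂ f₃ x‖ₑ ≤ ∫⁻ s in Icc δ δ⁻¹, ∫⁻ y, ∫⁻ η, ENNReal.ofReal ((s^2)⁻¹) *
      (‖FT (fun x => f₁ x * ph g 0 (x / s - y)) ((β - 1) * η)‖ₑ * ‖FT (fun x => f₂ x * ph g (L * β) (x / s - y)) (1 * η)‖ₑ *
        ‖FT (fun x => f₃ x * ph g (-β * L) (x / s - y)) (-β * η)‖ₑ) := by
  have hG := GG_int hg.toProf h1 (Nice_schwartz f₂) (Nice_schwartz f₃) β L hδ
  have hH : (fun q : ℝ × ℝ => f₁ q.1 * (f₂ (q.1 + β * q.2) * f₃ (q.1 + q.2) * Kd g β L δ q.2)) =ᵐ[volume]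
      fun q => ∫ p, GG g f₁ f₂ f₃ β L (q, p) ∂((volume.restrict (Icc δ δ⁻¹)).prod volume) := by
    filter_upwards [hG.prod_right_ae] with q hq
    rw [integral_prod _ hq, Kd, ← integral_const_mul, ← integral_const_mul]
    refine integral_congr_ae (Eventually.of_forall fun s => ?_)
    simp only [← Psi_eq' g β L q.1 q.2 s]
    rw [← integral_const_mul, ← integral_const_mul, ← integral_const_mul]
    refine integral_congr_ae (Eventually.of_forall fun y => ?_)
    simp only [GG]; ring
  have hHi := (hG.integral_prod_left).congr hH.symm
  have e1 : ∫ x, f₁ x * Td g β L δ f₂ f₃ x = ∫ s in Icc δ δ⁻¹, ∫ y, ∫ q, GG g f₁ f₂ f₃ β L (q, (s, y)) := by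
    calc ∫ x, f₁ x * Td g β L δ f₂ f₃ x = ∫ x, ∫ t, f₁ x * (f₂ (x + β * t) * f₃ (x + t) * Kd g β L δ t) := by
          refine integral_congr_ae (Eventually.of_forall fun x => ?_)
          simp only [Td]; rw [integral_const_mul]
      _ = ∫ q : ℝ × ℝ, f₁ q.1 * (f₂ (q.1 + β * q.2) * f₃ (q.1 + q.2) * Kd g β L δ q.2) := (integral_prod _ hHi).symm
      _ = ∫ q, ∫ p, GG g f₁ f₂ f₃ β L (q, p) ∂((volume.restrict (Icc δ δ⁻¹)).prod volume) := integral_congr_ae hH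
      _ = ∫ p, ∫ q, GG g f₁ f₂ f₃ β L (q, p) ∂volume ∂((volume.restrict (Icc δ δ⁻¹)).prod volume) :=
          integral_integral_swap (f := fun q p => GG g f₁ f₂ f₃ β L (q, p)) hG
      _ = _ := integral_prod _ hG.integral_prod_right
  rw [e1]
  refine (enorm_integral_le_lintegral_enorm _).trans ?_
  refine lintegral_mono fun s => ?_
  refine (enorm_integral_le_lintegral_enorm _).trans ?_
  refine lintegral_mono fun y => ?_
  simp only
  have hgc := hg.cont
  have hgi : ∀ (f : ℝ → ℂ), Nice f → ∀ c, Integrable (fun x => f x * ph g c (x / s - y)) := by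
    intro f hf c
    obtain ⟨B, hB, hb⟩ := hg.bdd
    refine hf.int.mul_bdd (c := B) ?_ (Eventually.of_forall fun x => ?_)
    · unfold ph; exact (by fun_prop : Continuous _).aestronglyMeasurable
    · unfold ph; rw [norm_mul, ee_norm, mul_one]; exact hb _
  have h2F : Integrable (FT (fun x => f₂ x * ph g (L * β) (x / s - y))) := by
    have := FT_int f₂ hg.tg s y (-(L * β / s)) (L * β * y)
    convert this using 3
    unfold ph
    rw [← mul_assoc]
    congr 2; ring
  have e2 : ∫ q : ℝ × ℝ, GG g f₁ f₂ f₃ β L (q, (s, y)) = (((s^2)⁻¹ : ℝ) : ℂ) * ∫ η, FT (fun x => f₁ x * ph g 0 (x / s - y)) ((β - 1) * η) *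
      FT (fun x => f₂ x * ph g (L * β) (x / s - y)) (1 * η) * FT (fun x => f₃ x * ph g (-β * L) (x / s - y)) (-β * η) := by
    rw [← tri_id (hgi _ h1 _) (hgi _ (Nice_schwartz f₃) _) (hgi _ (Nice_schwartz f₂) _) ?_ h2F β, ← integral_const_mul]
    · rfl
    · unfold ph
      have := f₂.continuous
      fun_prop
  rw [e2, ← integral_const_mul]
  refine (enorm_integral_le_lintegral_enorm _).trans (le_of_eq ?_)
  refine lintegral_congr fun η => ?_
  rw [enorm_mul, enorm_mul, enorm_mul]
  congr 1
  rw [← ofReal_norm, Complex.norm_real, Real.norm_eq_abs, abs_of_nonneg (by positivity)]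

end BHT



namespace BHT

/-! ## Part N: discretisation -/

lemma lint_scale (F : ℝ → ℝ≥0∞) {a : ℝ} (ha : 0 < a) : ENNReal.ofReal a * ∫⁻ x, F (a * x) = ∫⁻ x, F x := by
  have h := Real.smul_map_volume_mul_left ha.ne'
  conv_rhs => rw [← h]
  rw [lintegral_smul_measure, abs_of_pos ha, smul_eq_mul]
  congr 1
  exact (lintegral_map_equiv F (Homeomorph.mulLeft₀ a ha.ne').toMeasurableEquiv).symm

lemma discA {F : ℝ → ℝ≥0∞} (hF : Measurable F) :
    ∫⁻ s in Ioi (0:ℝ), F s = ∫⁻ σ in Ico (1:ℝ) 2, ∑' k : ℤ, ENNReal.ofReal ((2:ℝ)^k) * F ((2:ℝ)^k * σ) := by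
  have hU : Ioi (0:ℝ) = ⋃ k : ℤ, Ico ((2:ℝ)^k) ((2:ℝ)^(k+1)) := by
    ext x
    simp only [mem_Ioi, mem_iUnion]
    constructor
    · intro hx; exact exists_mem_Ico_zpow hx (by norm_num)
    · rintro ⟨k, hk⟩; exact lt_of_lt_of_le (p2pos k) hk.1
  have hd : Pairwise (Function.onFun Disjoint fun k : ℤ => Ico ((2:ℝ)^k) ((2:ℝ)^(k+1))) := by
    intro i j hij
    rw [Function.onFun, Set.disjoint_left]
    intro x hx hy
    have h1 := (zpow_lt_zpow_iff_right₀ (by norm_num : (1:ℝ) < 2)).1 (lt_of_le_of_lt hx.1 hy.2)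
    have h2 := (zpow_lt_zpow_iff_right₀ (by norm_num : (1:ℝ) < 2)).1 (lt_of_le_of_lt hy.1 hx.2)
    omega
  rw [hU, lintegral_iUnion (fun k => measurableSet_Ico) hd, lintegral_tsum fun k => by fun_prop]
  refine tsum_congr fun k => ?_
  have hk := p2pos k
  rw [lintegral_const_mul _ (by fun_prop), ← lintegral_indicator measurableSet_Ico, ← lintegral_indicator measurableSet_Ico,
    ← lint_scale _ hk]
  congr 1
  refine lintegral_congr fun x => ?_
  simp only [indicator_apply, mem_Ico]
  congr 1
  rw [zpow_add_one₀ (by norm_num), eq_iff_iff, le_mul_iff_one_le_right hk, mul_lt_mul_iff_right₀ hk]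

lemma discB {F : ℝ → ℝ≥0∞} (hF : Measurable F) :
    ∫⁻ y, F y = ∫⁻ u in Ico (0:ℝ) 1, ∑' m : ℤ, F (m + u) := by
  have hd : Pairwise (Function.onFun Disjoint fun k : ℤ => Ico (k:ℝ) (k+1)) := by
    intro i j hij
    rw [Function.onFun, Set.disjoint_left]
    intro x hx hy
    apply hij
    rw [← Int.floor_eq_iff.2 hx, Int.floor_eq_iff.2 hy]
  have hU : (univ : Set ℝ) = ⋃ k : ℤ, Ico (k:ℝ) (k+1) := by
    ext x
    simp only [mem_univ, mem_iUnion, true_iff]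
    exact ⟨⌊x⌋, Int.floor_eq_iff.1 rfl⟩
  rw [← setLIntegral_univ, hU, lintegral_iUnion (fun k => measurableSet_Ico) hd, lintegral_tsum fun k => by fun_prop]
  refine tsum_congr fun k => ?_
  rw [← lintegral_indicator measurableSet_Ico, ← lintegral_indicator measurableSet_Ico, ← lintegral_add_left_eq_self _ (k:ℝ)]
  refine lintegral_congr fun x => ?_
  simp only [indicator_apply, mem_Ico]
  congr 1
  simp

lemma disc_le {Q : ℝ → ℝ → ℝ → ℝ≥0∞} (hQ : Measurable (fun z : ℝ × ℝ × ℝ => Q z.1 z.2.1 z.2.2)) (B : ℝ≥0∞)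
    (h : ∀ σ ∈ Ico (1:ℝ) 2, ∀ u ∈ Ico (0:ℝ) 1, ∀ v ∈ Ico (0:ℝ) 1,
      ∑' P : Tile, ENNReal.ofReal ((2:ℝ)^P.1) * Q ((2:ℝ)^P.1 * σ) (P.2.1 + u) (P.2.2 + v) ≤ B) :
    ∫⁻ s in Ioi (0:ℝ), ∫⁻ y, ∫⁻ η, Q s y η ≤ B := by
  have hQ' : ∀ {X : Type} [MeasurableSpace X] (a b c : X → ℝ), Measurable a → Measurable b → Measurable c →
      Measurable fun x => Q (a x) (b x) (c x) := by
    intro X _ a b c ha hb hc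
    exact hQ.comp (ha.prodMk (hb.prodMk hc))
  have hH1 : ∀ {X : Type} [MeasurableSpace X] (a b c : X → ℝ), Measurable a → Measurable b → Measurable c →
      Measurable fun x => ∑' l : ℤ, Q (a x) (b x) (l + c x) := by
    intro X _ a b c ha hb hc
    exact Measurable.tsum fun l => hQ' _ _ _ ha hb (hc.const_add _)
  have hH2 : ∀ {X : Type} [MeasurableSpace X] (a b c : X → ℝ), Measurable a → Measurable b → Measurable c →
      Measurable fun x => ∑' m : ℤ, ∑' l : ℤ, Q (a x) (m + b x) (l + c x) := by
    intro X _ a b c ha hb hc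
    exact Measurable.tsum fun l => hH1 _ _ _ ha (hb.const_add _) hc
  calc ∫⁻ s in Ioi (0:ℝ), ∫⁻ y, ∫⁻ η, Q s y η
      = ∫⁻ s in Ioi (0:ℝ), ∫⁻ y, ∫⁻ v in Ico (0:ℝ) 1, ∑' l : ℤ, Q s y (l + v) := by
        refine lintegral_congr fun s => lintegral_congr fun y => ?_
        exact discB (hQ' _ _ _ measurable_const measurable_const measurable_id)
    _ = ∫⁻ s in Ioi (0:ℝ), ∫⁻ v in Ico (0:ℝ) 1, ∫⁻ y, ∑' l : ℤ, Q s y (l + v) := by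
        refine lintegral_congr fun s => ?_
        refine lintegral_lintegral_swap (Measurable.aemeasurable ?_)
        exact hH1 _ _ _ measurable_const measurable_fst measurable_snd
    _ = ∫⁻ s in Ioi (0:ℝ), ∫⁻ v in Ico (0:ℝ) 1, ∫⁻ u in Ico (0:ℝ) 1, ∑' m : ℤ, ∑' l : ℤ, Q s (m + u) (l + v) := by
        refine lintegral_congr fun s => lintegral_congr fun v => ?_
        exact discB (hH1 _ _ _ measurable_const measurable_id measurable_const)
    _ = ∫⁻ v in Ico (0:ℝ) 1, ∫⁻ s in Ioi (0:ℝ), ∫⁻ u in Ico (0:ℝ) 1, ∑' m : ℤ, ∑' l : ℤ, Q s (m + u) (l + v) := by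
        refine lintegral_lintegral_swap (Measurable.aemeasurable ?_)
        refine Measurable.lintegral_prod_right' (f := fun z : (ℝ × ℝ) × ℝ => ∑' m : ℤ, ∑' l : ℤ, Q z.1.1 (m + z.2) (l + z.1.2)) ?_
        exact hH2 _ _ _ measurable_fst.fst measurable_snd measurable_fst.snd
    _ = ∫⁻ v in Ico (0:ℝ) 1, ∫⁻ u in Ico (0:ℝ) 1, ∫⁻ s in Ioi (0:ℝ), ∑' m : ℤ, ∑' l : ℤ, Q s (m + u) (l + v) := by
        refine lintegral_congr fun v => ?_
        refine lintegral_lintegral_swap (Measurable.aemeasurable ?_)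
        exact hH2 _ _ _ measurable_fst measurable_snd measurable_const
    _ = ∫⁻ v in Ico (0:ℝ) 1, ∫⁻ u in Ico (0:ℝ) 1, ∫⁻ σ in Ico (1:ℝ) 2, ∑' k : ℤ, ENNReal.ofReal ((2:ℝ)^k) *
          ∑' m : ℤ, ∑' l : ℤ, Q ((2:ℝ)^k * σ) (m + u) (l + v) := by
        refine lintegral_congr fun v => lintegral_congr fun u => ?_
        exact discA (F := fun s => ∑' m : ℤ, ∑' l : ℤ, Q s (m + u) (l + v)) (hH2 _ _ _ measurable_id measurable_const measurable_const)
    _ ≤ ∫⁻ v in Ico (0:ℝ) 1, ∫⁻ u in Ico (0:ℝ) 1, ∫⁻ σ in Ico (1:ℝ) 2, B := by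
        refine setLIntegral_mono' measurableSet_Ico fun v hv => setLIntegral_mono' measurableSet_Ico fun u hu =>
          setLIntegral_mono' measurableSet_Ico fun σ hσ => le_trans (le_of_eq ?_) (h σ hσ u hu v hv)
        rw [ENNReal.tsum_prod']
        refine tsum_congr fun k => ?_
        rw [ENNReal.tsum_prod', ← ENNReal.tsum_mul_left]
        refine tsum_congr fun m => ?_
        rw [← ENNReal.tsum_mul_left]
    _ = B := by
        simp only [setLIntegral_const, Real.volume_Ico]
        norm_num

/-- relation between Fourier transforms and packet coefficients -/
lemma FT_cf (g f : ℝ → ℂ) (α γ u v σ : ℝ) (hσ : 0 < σ) (P : Tile) :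
    FT (fun x => f x * ph g (α * γ) (x / ((2:ℝ)^P.1 * σ) - (P.2.1 + u))) (α * ((P.2.2 + v) / ((2:ℝ)^P.1 * σ))) =
      (((2:ℝ)^P.1 * σ : ℝ) : ℂ) * cf (pk g α γ u v) (fun x => f (σ * x)) P := by
  have hk := p2pos P.1
  unfold FT cf
  have h := Measure.integral_comp_mul_left (fun x => f x * ph g (α * γ) (x / ((2:ℝ)^P.1 * σ) - (P.2.1 + u)) *
    ee (-(x * (α * ((P.2.2 + v) / ((2:ℝ)^P.1 * σ)))))) σ
  have e : ∀ x, f (σ * x) * ph g (α * γ) (σ * x / ((2:ℝ)^P.1 * σ) - (P.2.1 + u)) *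
    ee (-(σ * x * (α * ((P.2.2 + v) / ((2:ℝ)^P.1 * σ))))) = f (σ * x) * pk g α γ u v P x := by
    intro x
    have e1 : σ * x / ((2:ℝ)^P.1 * σ) = x / (2:ℝ)^P.1 := by field_simp
    have e2 : -(σ * x * (α * ((P.2.2 + v) / ((2:ℝ)^P.1 * σ)))) = -(α * ((P.2.2 + v) / (2:ℝ)^P.1) * x) := by field_simp
    rw [e1, e2, ph, pk]; ring
  simp only [e] at h
  rw [h, abs_of_pos (by positivity), Complex.real_smul]
  generalize (∫ x, f x * ph g (α * γ) (x / ((2:ℝ)^P.1 * σ) - (P.2.1 + u)) *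
    ee (-(x * (α * ((P.2.2 + v) / ((2:ℝ)^P.1 * σ)))))) = J
  push_cast
  have h1 : (σ : ℂ) ≠ 0 := by exact_mod_cast hσ.ne'
  have h2 : ((2:ℂ)^P.1) ≠ 0 := zpow_ne_zero _ (by norm_num)
  field_simp

lemma Dom_scale {f : ℝ → ℂ} {s : ℝ} {M : ℝ → ℝ} (h : Dom f s M) {σ : ℝ} (hσ : 0 < σ) :
    Dom (fun x => f (σ * x)) s (fun x => M (σ * x)) := by
  intro x
  refine ⟨(h _).1, fun r hr => ?_⟩
  have h1 := (h (σ * x)).2 (σ * r) (by positivity)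
  rw [← integral_indicator measurableSet_Icc] at h1 ⊢
  have e := Measure.integral_comp_mul_left ((Icc (σ * x - σ * r) (σ * x + σ * r)).indicator fun y => ‖f y‖^s) σ
  have e2 : ∀ y, (Icc (σ * x - σ * r) (σ * x + σ * r)).indicator (fun y => ‖f y‖^s) (σ * y) =
      (Icc (x - r) (x + r)).indicator (fun y => ‖f (σ * y)‖^s) y := by
    intro y
    simp only [indicator_apply, mem_Icc]
    congr 1
    rw [← mul_sub, ← mul_add, mul_le_mul_iff_right₀ hσ, mul_le_mul_iff_right₀ hσ]
  simp only [e2] at e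
  rw [e, abs_of_pos (by positivity), smul_eq_mul, inv_mul_le_iff₀ hσ]
  linarith

lemma Nice.scale {f : ℝ → ℂ} (h : Nice f) {σ : ℝ} (hσ : 0 < σ) : Nice (fun x => f (σ * x)) := by
  refine ⟨h.meas.comp (by fun_prop), h.int.comp_mul_left' hσ.ne', ?_⟩
  obtain ⟨M, hM⟩ := h.bdd
  exact ⟨M, fun x => hM _⟩

lemma FT_meas {f g : ℝ → ℂ} (hf : Measurable f) (hg : Measurable g) (c α : ℝ) :
    Measurable (fun z : ℝ × ℝ × ℝ => ‖FT (fun x => f x * ph g c (x / z.1 - z.2.1)) (α * (z.2.2 / z.1))‖ₑ) := by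
  have hee : Measurable ee := ee_cont.measurable
  have : Measurable (fun p : (ℝ × ℝ × ℝ) × ℝ => f p.2 * ph g c (p.2 / p.1.1 - p.1.2.1) * ee (-(p.2 * (α * (p.1.2.2 / p.1.1))))) := by
    unfold ph; fun_prop
  exact (this.stronglyMeasurable.integral_prod_right').measurable.enorm

end BHT



namespace BHT

lemma PS.monoC {φ : Tile → ℝ → ℂ} {v γ ρ R C C' : ℝ} {N : ℕ} (h : PS φ v γ ρ R C N) (hC : C ≤ C') : PS φ v γ ρ R C' N where
  ρpos := h.ρpos
  Cpos := h.Cpos.trans_le hC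
  hR := h.hR
  cont := h.cont
  decay P x := (h.decay P x).trans (mul_le_mul_of_nonneg_right hC (pow_nonneg (w_pos _ _).le _))
  orth := h.orth
  osc ξ := by
    obtain ⟨e, he, h1⟩ := h.osc ξ
    refine ⟨e, he, fun P hP x x' hx => (h1 P hP x x' hx).trans ?_⟩
    have := w_pos (iv P) x
    have := p2pos P.1
    gcongr

theorem pk_TS {g : ℝ → ℂ} (hg : BL g) (α γ : Fin 3 → ℝ) (hα : ∀ i, α i ≠ 0) (ρ : ℝ) (hρ : ∀ i, 1 / |α i| ≤ ρ)
    (hsep : ∀ i j, i ≠ j → 4 * ρ ≤ |γ i - γ j|) (N : ℕ) : ∃ R C : ℝ, ∃ K : ℕ, ∀ u v : ℝ, 0 ≤ u → u ≤ 1 →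
    TS (fun i => pk g (α i) (γ i) u v) v γ ρ R C N K := by
  have hρ0 : 0 < ρ := lt_of_lt_of_le (by have := abs_pos.2 (hα 0); positivity) (hρ 0)
  set Γ := ∑ i, |γ i| with hΓ
  have hle : ∀ i, |γ i| ≤ Γ := fun i => Finset.single_le_sum (fun j _ => abs_nonneg (γ j)) (Finset.mem_univ i)
  have hR : ∀ i, |γ i| + 2 * ρ ≤ Γ + 2 * ρ := fun i => by linarith [hle i]
  choose C hC hps using fun i => pk_PS hg (hα i) (γ i) ρ (Γ + 2 * ρ) N (hρ i) (hR i)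
  obtain ⟨K, hK⟩ := pow_unbounded_of_one_lt ((Γ + (Γ + 2 * ρ) + 3 * ρ) / ρ) (by norm_num : (1:ℝ) < 2)
  refine ⟨Γ + 2 * ρ, ∑ i, C i, K, fun u v hu0 hu1 => ⟨fun i => ?_, fun i => ?_, hsep⟩⟩
  · exact (hps i u v hu0 hu1).monoC (Finset.single_le_sum (fun j _ => (hC j).le) (Finset.mem_univ i))
  · rw [div_lt_iff₀ hρ0] at hK
    linarith [hle i]

theorem sum_bound {g : ℝ → ℂ} (hg : BL g) (α γ : Fin 3 → ℝ) (hα : ∀ i, α i ≠ 0) (ρ : ℝ) (hρ : ∀ i, 1 / |α i| ≤ ρ)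
    (hsep : ∀ i j, i ≠ j → 4 * ρ ≤ |γ i - γ j|) (a : ℕ) (s θ : Fin 3 → ℝ) (ha : 12 ≤ a) (hs1 : ∀ i, 1 < s i) (hs2 : ∀ i, s i ≤ 2)
    (hθ0 : ∀ i, 0 < θ i) (hθ1 : ∀ i, θ i < 1) (hθ : ∑ i, θ i < 1)
    (hσ : ∀ i, 0 < (s i - 1) * θ i - (2 - s i + (12:ℕ) / a) / 2 * (1 - θ i)) :
    ∃ Cst, 0 < Cst ∧ ∀ F : Fin 3 → ℝ → ℂ, (∀ i, Nice (F i)) → ∀ (M : Fin 3 → ℝ → ℝ) (τ₁ τ₂ : ℝ) (Z : Set ℝ),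
      (∀ i, Dom (F i) (s i) (M i)) → (∀ x, F 0 x ≠ 0 → x ∈ Z) → (∀ x ∈ Z, M 1 x ≤ τ₁) → (∀ x ∈ Z, M 2 x ≤ τ₂) →
      ∀ σ ∈ Ico (1:ℝ) 2, ∀ u ∈ Ico (0:ℝ) 1, ∀ v : ℝ,
      ∑' P : Tile, ENNReal.ofReal ((2:ℝ)^P.1) * ∏ i, ‖cf (pk g (α i) (γ i) u v) (fun x => F i (σ * x)) P‖ₑ ≤
        ENNReal.ofReal Cst * ∫⁻ x, ENNReal.ofReal (M 0 x * min (M 1 x) τ₁ * min (M 2 x) τ₂) := by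
  obtain ⟨R, C, K, hTS⟩ := pk_TS hg α γ hα ρ hρ hsep (12 + a + 3)
  obtain ⟨Cst, hCst, hm⟩ := model ρ R C K a s θ ha hs1 hs2 (fun i => (hθ0 i).le) (fun i => (hθ1 i).le) hθ hσ
  refine ⟨Cst, hCst, fun F hF M τ₁ τ₂ Z hD hZ hZ1 hZ2 σ hσ' u hu v => ?_⟩
  have hσ0 : 0 < σ := by linarith [hσ'.1]
  rw [ENNReal.tsum_eq_iSup_sum]
  refine iSup_le fun S => ?_
  have key := hm _ v γ (hTS u v hu.1 hu.2.le) (fun i x => F i (σ * x)) (fun i => (hF i).scale hσ0) S (fun i x => M i (σ * x)) τ₁ τ₂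
    {x | σ * x ∈ Z} (fun i => Dom_scale (hD i) hσ0) (fun x hx => hZ _ hx) (fun x hx => hZ1 _ hx) (fun x hx => hZ2 _ hx)
  refine le_trans (le_of_eq ?_) (key.trans ?_)
  · unfold Lam
    rw [ENNReal.ofReal_sum_of_nonneg]
    · refine Finset.sum_congr rfl fun P _ => ?_
      rw [ENNReal.ofReal_mul (p2pos _).le, ENNReal.ofReal_prod_of_nonneg fun i _ => norm_nonneg _]
      simp only [ofReal_norm]
    · intro P _
      exact mul_nonneg (p2pos _).le (Finset.prod_nonneg fun i _ => norm_nonneg _)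
  · refine mul_le_mul_right ?_ _
    rw [← lint_scale (fun x => ENNReal.ofReal (M 0 x * min (M 1 x) τ₁ * min (M 2 x) τ₂)) hσ0]
    refine le_mul_of_one_le_left (zero_le) ?_
    rw [← ENNReal.ofReal_one]
    exact ENNReal.ofReal_le_ofReal hσ'.1

noncomputable def rho (β : ℝ) : ℝ := 1 / |β - 1| + 1 + 1 / |β|

def Lok (β L : ℝ) : Prop := 4 * rho β ≤ |L| ∧ 4 * rho β ≤ |L| * |β| ∧ 4 * rho β ≤ |L| * |β - 1|

theorem form_bound (β : ℝ) (hβ0 : β ≠ 0) (hβ1 : β ≠ 1) {g : ℝ → ℂ} (hg : BL g) (L : ℝ) (hL : Lok β L)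
    (a : ℕ) (s θ : Fin 3 → ℝ) (ha : 12 ≤ a) (hs1 : ∀ i, 1 < s i) (hs2 : ∀ i, s i ≤ 2)
    (hθ0 : ∀ i, 0 < θ i) (hθ1 : ∀ i, θ i < 1) (hθ : ∑ i, θ i < 1)
    (hσ : ∀ i, 0 < (s i - 1) * θ i - (2 - s i + (12:ℕ) / a) / 2 * (1 - θ i)) :
    ∃ Cst, 0 < Cst ∧ ∀ (f₁ : ℝ → ℂ) (f₂ f₃ : SchwartzMap ℝ ℂ), Nice f₁ → ∀ (M₁ M₂ M₃ : ℝ → ℝ) (τ₁ τ₂ : ℝ) (Z : Set ℝ),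
      Dom f₁ (s 0) M₁ → Dom f₂ (s 1) M₂ → Dom f₃ (s 2) M₃ → (∀ x, f₁ x ≠ 0 → x ∈ Z) → (∀ x ∈ Z, M₂ x ≤ τ₁) → (∀ x ∈ Z, M₃ x ≤ τ₂) →
      ∀ δ : ℝ, 0 < δ → ‖∫ x, f₁ x * Td g β L δ f₂ f₃ x‖ₑ ≤
        ENNReal.ofReal Cst * ∫⁻ x, ENNReal.ofReal (M₁ x * min (M₂ x) τ₁ * min (M₃ x) τ₂) := by
  have hb : 0 < |β| := abs_pos.2 hβ0
  have hb1 : 0 < |β - 1| := abs_pos.2 (sub_ne_zero.2 hβ1)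
  obtain ⟨Cst, hCst, hS⟩ := sum_bound hg ![β - 1, 1, -β] ![0, L * β, L]
    (by intro i; fin_cases i <;> simp [hβ0, sub_ne_zero.2 hβ1]) (rho β) (by
      have h1 : 0 < 1 / |β - 1| := by positivity
      have h2 : 0 < 1 / |β| := by positivity
      have i1 : 1 / |β - 1| ≤ rho β := by unfold rho; linarith
      have i2 : 1 / |(1:ℝ)| ≤ rho β := by unfold rho; norm_num only [abs_one]; linarith
      have i3 : 1 / |-β| ≤ rho β := by unfold rho; rw [abs_neg]; linarith
      intro i
      fin_cases i
      · exact i1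
      · exact i2
      · exact i3) (by
      obtain ⟨h1, h2, h3⟩ := hL
      have e : |L * β - L| = |L| * |β - 1| := by rw [← abs_mul]; ring_nf
      intro i j hij
      have k1 : 4 * rho β ≤ |0 - L * β| := by rw [zero_sub, abs_neg, abs_mul]; exact h2
      have k2 : 4 * rho β ≤ |0 - L| := by rw [zero_sub, abs_neg]; exact h1
      have k3 : 4 * rho β ≤ |L * β - L| := by rw [e]; exact h3
      fin_cases i <;> fin_cases j
      · exact absurd rfl hij
      · exact k1
      · exact k2
      · rw [abs_sub_comm]; exact k1
      · exact absurd rfl hij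
      · exact k3
      · rw [abs_sub_comm]; exact k2
      · rw [abs_sub_comm]; exact k3
      · exact absurd rfl hij) a s θ ha hs1 hs2 hθ0 hθ1 hθ hσ
  refine ⟨Cst, hCst, fun f₁ f₂ f₃ h1 M₁ M₂ M₃ τ₁ τ₂ Z hD1 hD2 hD3 hZ hZ1 hZ2 δ hδ => ?_⟩
  have hS' := hS ![f₁, f₂, f₃] (by
    intro i; fin_cases i
    · exact h1
    · exact Nice_schwartz f₂
    · exact Nice_schwartz f₃) ![M₁, M₂, M₃] τ₁ τ₂ Z (by
    intro i; fin_cases i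
    · exact hD1
    · exact hD2
    · exact hD3) hZ hZ1 hZ2
  refine (form_le hg h1 f₂ f₃ β L hδ).trans ?_
  set Q : ℝ → ℝ → ℝ → ℝ≥0∞ := fun s y η => ENNReal.ofReal s⁻¹ * (ENNReal.ofReal ((s^2)⁻¹) *
      (‖FT (fun x => f₁ x * ph g 0 (x / s - y)) ((β - 1) * (η / s))‖ₑ * ‖FT (fun x => f₂ x * ph g (L * β) (x / s - y)) (1 * (η / s))‖ₑ *
        ‖FT (fun x => f₃ x * ph g (-β * L) (x / s - y)) (-β * (η / s))‖ₑ)) with hQ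
  have hgm := hg.cont.measurable
  have hQm : Measurable (fun z : ℝ × ℝ × ℝ => Q z.1 z.2.1 z.2.2) := by
    simp only [hQ]
    have m1 := FT_meas h1.meas hgm 0 (β - 1)
    have m2 := FT_meas f₂.continuous.measurable hgm (L * β) 1
    have m3 := FT_meas f₃.continuous.measurable hgm (-β * L) (-β)
    exact Measurable.mul (f := fun z : ℝ × ℝ × ℝ => ENNReal.ofReal z.1⁻¹) (by fun_prop)
      (Measurable.mul (f := fun z : ℝ × ℝ × ℝ => ENNReal.ofReal ((z.1^2)⁻¹)) (by fun_prop) ((m1.mul m2).mul m3))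
  refine le_trans ?_ (disc_le hQm _ ?_)
  · refine (lintegral_mono_set (t := Ioi 0) (fun x hx => lt_of_lt_of_le hδ hx.1)).trans (le_of_eq ?_)
    · · refine setLIntegral_congr_fun measurableSet_Ioi fun s hs => ?_
        have hs : 0 < s := hs
        refine lintegral_congr fun y => ?_
        rw [← lint_scale _ (inv_pos.2 hs), ← lintegral_const_mul']
        · refine lintegral_congr fun η => ?_
          simp only [hQ, div_eq_inv_mul]
        · exact ENNReal.ofReal_ne_top
  · intro σ hσ' u hu v hv
    refine le_trans (le_of_eq ?_) (hS' σ hσ' u hu v)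
    refine tsum_congr fun P => ?_
    congr 1
    have hσ0 : 0 < σ := by linarith [hσ'.1]
    have hk := p2pos P.1
    have e1 := FT_cf g f₁ (β - 1) 0 u v σ hσ0 P
    have e2 := FT_cf g f₂ 1 (L * β) u v σ hσ0 P
    have e3 := FT_cf g f₃ (-β) L u v σ hσ0 P
    rw [mul_zero] at e1
    rw [one_mul (L * β)] at e2
    simp only [hQ]
    rw [e1, e2, e3, Fin.prod_univ_three]
    simp only [enorm_mul]
    have e4 : ‖(((2:ℝ)^P.1 * σ : ℝ) : ℂ)‖ₑ = ENNReal.ofReal ((2:ℝ)^P.1 * σ) := by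
      rw [← ofReal_norm, Complex.norm_real, Real.norm_eq_abs, abs_of_pos (by positivity)]
    rw [e4]
    have e5 : ENNReal.ofReal ((2:ℝ)^P.1 * σ)⁻¹ * ENNReal.ofReal ((((2:ℝ)^P.1 * σ)^2)⁻¹) * (ENNReal.ofReal ((2:ℝ)^P.1 * σ) *
        ENNReal.ofReal ((2:ℝ)^P.1 * σ) * ENNReal.ofReal ((2:ℝ)^P.1 * σ)) = 1 := by
      have : 0 < (2:ℝ)^P.1 * σ := by positivity
      generalize (2:ℝ)^P.1 * σ = S at this
      rw [← ENNReal.ofReal_mul (by positivity), ← ENNReal.ofReal_mul (by positivity), ← ENNReal.ofReal_mul (by positivity), ← ENNReal.ofReal_mul (by positivity),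
        ← ENNReal.ofReal_one]
      congr 1; field_simp
    simp only [Matrix.cons_val_zero, Matrix.cons_val_one, Matrix.cons_val]
    generalize ENNReal.ofReal ((2:ℝ)^P.1 * σ) = A at *
    generalize ENNReal.ofReal ((2:ℝ)^P.1 * σ)⁻¹ = A' at *
    generalize ENNReal.ofReal (((2:ℝ)^P.1 * σ)^2)⁻¹ = A'' at *
    generalize ‖cf (pk g (β - 1) 0 u v) (fun x => f₁ (σ * x)) P‖ₑ = x1
    generalize ‖cf (pk g 1 (L * β) u v) (fun x => f₂ (σ * x)) P‖ₑ = x2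
    generalize ‖cf (pk g (-β) L u v) (fun x => f₃ (σ * x)) P‖ₑ = x3
    calc _ = (A' * A'' * (A * A * A)) * (x1 * x2 * x3) := by ring
      _ = _ := by rw [e5, one_mul]

end BHT



namespace BHT

lemma Psi_cont {g : ℝ → ℂ} (hg : Prof g) (β L : ℝ) : Continuous (Psi g β L) := by
  unfold Psi
  exact (hg.hh_cont β).mul (ee_cont.comp (by fun_prop))

lemma Psi_int {g : ℝ → ℂ} (hg : Prof g) (β L : ℝ) : Integrable (Psi g β L) := by
  unfold Psi
  exact (hg.hh_int β).mul_bdd (c := 1) (ee_cont.comp (by fun_prop)).aestronglyMeasurable (Eventually.of_forall fun u => (ee_norm _).le)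

lemma Psi_bdd {g : ℝ → ℂ} (hg : Prof g) (β L : ℝ) : ∃ B, ∀ u, ‖Psi g β L u‖ ≤ B := by
  obtain ⟨B, hB, hb⟩ := hg.bdd
  refine ⟨∫ y, ‖g y‖ * B * B, fun u => ?_⟩
  unfold Psi hh
  rw [norm_mul, ee_norm, mul_one]
  refine norm_integral_le_of_norm_le ((hg.int.norm.mul_const _).mul_const _) (Eventually.of_forall fun y => ?_)
  rw [norm_mul, norm_mul]
  gcongr
  · exact hb _
  · exact hb _

theorem exists_L (β : ℝ) (hβ0 : β ≠ 0) (hβ1 : β ≠ 1) {g : ℝ → ℂ} (hg : Prof g) (h0 : ∫ x, g x * g x * g x ≠ 0) :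
    ∃ L, Lok β L ∧ ∫ u, (sg u : ℂ) * Psi g β L u ≠ 0 := by
  have hb : 0 < |β| := abs_pos.2 hβ0
  have hb1' : β - 1 ≠ 0 := sub_ne_zero.2 hβ1
  have hb1 : 0 < |β - 1| := abs_pos.2 hb1'
  have hr : 0 < rho β := by unfold rho; positivity
  obtain ⟨D, hD, hne⟩ := exists_D hg β (|β| * |β - 1| * (4 * rho β * (1 + |β|⁻¹ + |β - 1|⁻¹))) h0
  refine ⟨D / (β * (β - 1)), ?_, ?_⟩
  · have hL : 4 * rho β * (1 + |β|⁻¹ + |β - 1|⁻¹) ≤ |D / (β * (β - 1))| := by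
      rw [abs_div, abs_mul, le_div_iff₀ (by positivity)]
      linarith
    have i1 : 0 < |β|⁻¹ := by positivity
    have i2 : 0 < |β - 1|⁻¹ := by positivity
    refine ⟨?_, ?_, ?_⟩
    · refine le_trans ?_ hL
      nlinarith [mul_pos hr i1, mul_pos hr i2]
    · refine le_trans ?_ (mul_le_mul_of_nonneg_right hL hb.le)
      have : |β|⁻¹ * |β| = 1 := inv_mul_cancel₀ hb.ne'
      have : 4 * rho β * (1 + |β|⁻¹ + |β - 1|⁻¹) * |β| = 4 * rho β * (|β| + |β|⁻¹ * |β| + |β - 1|⁻¹ * |β|) := by ring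
      rw [this, inv_mul_cancel₀ hb.ne']
      have : 0 < |β - 1|⁻¹ * |β| := by positivity
      nlinarith
    · refine le_trans ?_ (mul_le_mul_of_nonneg_right hL hb1.le)
      have : 4 * rho β * (1 + |β|⁻¹ + |β - 1|⁻¹) * |β - 1| = 4 * rho β * (|β - 1| + |β|⁻¹ * |β - 1| + |β - 1|⁻¹ * |β - 1|) := by ring
      rw [this, inv_mul_cancel₀ hb1.ne']
      have : 0 < |β|⁻¹ * |β - 1| := by positivity
      nlinarith
  · convert hne using 1
    refine integral_congr_ae (Eventually.of_forall fun u => ?_)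
    simp only [Psi]
    rw [div_mul_cancel₀ _ (mul_ne_zero hβ0 hb1'), mul_assoc]

lemma sub_int (F : ℝ → ℂ) {t δ : ℝ} (ht : 0 < t) (hδ : 0 < δ) :
    (t : ℂ) * ∫ s in Icc δ δ⁻¹, (((s^2)⁻¹ : ℝ) : ℂ) * F (t / s) = ∫ u in Icc (t * δ) (t / δ), F u := by
  have him : (fun s => t / s) '' Icc δ δ⁻¹ = Icc (t * δ) (t / δ) := by
    ext u
    constructor
    · rintro ⟨s, ⟨h1, h2⟩, rfl⟩
      have hs : 0 < s := hδ.trans_le h1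
      refine ⟨?_, ?_⟩
      · rw [le_div_iff₀ hs]
        have : δ * s ≤ 1 := by
          calc δ * s ≤ δ * δ⁻¹ := by gcongr
            _ = 1 := mul_inv_cancel₀ hδ.ne'
        nlinarith
      · simp only; gcongr
    · rintro ⟨h1, h2⟩
      have hu : 0 < u := lt_of_lt_of_le (by positivity) h1
      refine ⟨t / u, ⟨?_, ?_⟩, by simp only; field_simp⟩
      · rw [le_div_iff₀ hu]; rw [le_div_iff₀ hδ] at h2; linarith
      · rw [div_le_iff₀ hu, inv_mul_eq_div, le_div_iff₀ hδ]; linarith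
  rw [← him, integral_image_eq_integral_abs_deriv_smul (f' := fun s => -t / s^2) measurableSet_Icc]
  · rw [← integral_const_mul]
    refine setIntegral_congr_fun measurableSet_Icc fun s hs => ?_
    have hs : 0 < s := hδ.trans_le hs.1
    rw [abs_div, abs_neg, abs_of_pos ht, abs_of_pos (by positivity), Complex.real_smul, ← mul_assoc, div_eq_mul_inv]
    push_cast; ring
  · intro s hs
    have hs : s ≠ 0 := (hδ.trans_le hs.1).ne'
    have := ((hasDerivAt_inv hs).const_mul t).hasDerivWithinAt (s := Icc δ δ⁻¹)
    refine (this.congr_deriv (by field_simp)).congr (fun y _ => by rw [div_eq_mul_inv]) (by rw [div_eq_mul_inv])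
  · intro s hs s' hs' h
    have h1 : s ≠ 0 := (hδ.trans_le hs.1).ne'
    have h2 : s' ≠ 0 := (hδ.trans_le hs'.1).ne'
    simp only at h
    rw [div_eq_div_iff h1 h2] at h
    exact (mul_left_cancel₀ ht.ne' h).symm

noncomputable def dl (n : ℕ) : ℝ := ((n:ℝ) + 1)⁻¹

lemma dl_pos (n : ℕ) : 0 < dl n := by unfold dl; positivity

lemma dl_tendsto : Tendsto dl atTop (𝓝 0) := by
  have := tendsto_one_div_add_atTop_nhds_zero_nat (𝕜 := ℝ)
  refine this.congr fun n => ?_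
  simp [dl]

lemma trunc_tendsto {F : ℝ → ℂ} (hF : Integrable F) {t : ℝ} (ht : 0 < t) :
    Tendsto (fun n => ∫ u in Icc (t * dl n) (t / dl n), F u) atTop (𝓝 (∫ u in Ioi 0, F u)) := by
  simp_rw [← integral_indicator measurableSet_Icc, ← integral_indicator measurableSet_Ioi]
  refine tendsto_integral_of_dominated_convergence (fun u => ‖F u‖) (fun n => hF.aestronglyMeasurable.indicator measurableSet_Icc) hF.norm
    (fun n => Eventually.of_forall fun u => norm_indicator_le_norm_self _ _) (Eventually.of_forall fun u => ?_)
  by_cases hu : 0 < u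
  · refine Tendsto.congr' ?_ tendsto_const_nhds
    have h1 : Tendsto (fun n => t * dl n) atTop (𝓝 0) := by simpa using dl_tendsto.const_mul t
    have h2 : Tendsto (fun n => u * dl n) atTop (𝓝 0) := by simpa using dl_tendsto.const_mul u
    filter_upwards [h1.eventually (Iio_mem_nhds hu), h2.eventually (Iio_mem_nhds ht)] with n a b
    have a : t * dl n < u := a
    have b : u * dl n < t := b
    rw [indicator_of_mem (show u ∈ Ioi 0 from hu), indicator_of_mem]
    exact ⟨a.le, by rw [le_div_iff₀ (dl_pos n)]; exact b.le⟩
  · refine Tendsto.congr (fun n => ?_) tendsto_const_nhds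
    rw [indicator_of_notMem (show u ∉ Ioi 0 from hu), indicator_of_notMem]
    rintro ⟨h, -⟩
    have := mul_pos ht (dl_pos n)
    exact hu (this.trans_le h)

lemma int_fold {F : ℝ → ℂ} (hF : Integrable F) : ∫ t, F t = ∫ t in Ioi 0, (F t + F (-t)) := by
  rw [integral_add hF.integrableOn hF.comp_neg.integrableOn, integral_comp_neg_Ioi, neg_zero, add_comm,
    ← intervalIntegral.integral_Iic_add_Ioi hF.integrableOn hF.integrableOn]

lemma Kd_meas {g : ℝ → ℂ} (hg : Prof g) (β L δ : ℝ) : Measurable (Kd g β L δ) := by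
  have hP := (Psi_cont hg β L).measurable
  have : Measurable (fun p : ℝ × ℝ => (((p.2^2)⁻¹ : ℝ) : ℂ) * Psi g β L (p.1 / p.2)) := by fun_prop
  exact (this.stronglyMeasurable.integral_prod_right' (ν := volume.restrict (Icc δ δ⁻¹))).measurable

lemma Kd_integrand {g : ℝ → ℂ} (hg : Prof g) (β L : ℝ) {δ : ℝ} (hδ : 0 < δ) (t : ℝ) :
    Integrable (fun s => (((s^2)⁻¹ : ℝ) : ℂ) * Psi g β L (t / s)) (volume.restrict (Icc δ δ⁻¹)) := by
  obtain ⟨B, hB⟩ := Psi_bdd hg β L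
  have hP := (Psi_cont hg β L).measurable
  refine Integrable.mul_bdd (c := B) (int_s2 hδ).ofReal (Measurable.aestronglyMeasurable (by fun_prop)) (Eventually.of_forall fun s => hB _)

lemma Kd_bdd {g : ℝ → ℂ} (hg : Prof g) (β L : ℝ) {δ : ℝ} (hδ : 0 < δ) : ∃ B, ∀ t, ‖Kd g β L δ t‖ ≤ B := by
  obtain ⟨B, hB⟩ := Psi_bdd hg β L
  refine ⟨∫ s in Icc δ δ⁻¹, (s^2)⁻¹ * B, fun t => ?_⟩
  unfold Kd
  refine norm_integral_le_of_norm_le ((int_s2 hδ).mul_const _) (Eventually.of_forall fun s => ?_)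
  rw [norm_mul, Complex.norm_real, Real.norm_eq_abs, abs_of_nonneg (by positivity)]
  gcongr
  exact hB _

noncomputable def hx (f₂ f₃ : ℝ → ℂ) (β x t : ℝ) : ℂ := f₂ (x + β * t) * f₃ (x + t)

noncomputable def kx (f₂ f₃ : ℝ → ℂ) (β x t : ℝ) : ℂ := (hx f₂ f₃ β x t - hx f₂ f₃ β x (-t)) / t

lemma Prof.lip {f : ℝ → ℂ} (hf : Prof f) : ∃ C, 0 < C ∧ ∀ x y, ‖f x - f y‖ ≤ C * |x - y| := by
  obtain ⟨C, hC, h⟩ := hf.dec 0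
  refine ⟨C, hC, fun x y => ?_⟩
  have := Convex.norm_image_sub_le_of_norm_deriv_le (f := f) (s := univ) (x := y) (y := x) (C := C) (fun z _ => hf.dif z) (fun z _ => by simpa using (h z).2)
    convex_univ (mem_univ _) (mem_univ _)
  simpa using this

lemma hx_cont {f₂ f₃ : ℝ → ℂ} (h2 : Prof f₂) (h3 : Prof f₃) (β x : ℝ) : Continuous (hx f₂ f₃ β x) := by
  have := h2.cont
  have := h3.cont
  unfold hx; fun_prop

lemma hx_int {f₂ f₃ : ℝ → ℂ} (h2 : Prof f₂) (h3 : Prof f₃) (β x : ℝ) : Integrable (hx f₂ f₃ β x) := by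
  have := h2.cont
  obtain ⟨B, hB, hb⟩ := h2.bdd
  unfold hx
  exact Integrable.bdd_mul (c := B) (h3.int.comp_add_left x) (by fun_prop) (Eventually.of_forall fun s => hb _)

lemma kx_int {f₂ f₃ : ℝ → ℂ} (h2 : Prof f₂) (h3 : Prof f₃) (β x : ℝ) : IntegrableOn (kx f₂ f₃ β x) (Ioi 0) := by
  have hc := (hx_cont h2 h3 β x).measurable
  have hm : Measurable (kx f₂ f₃ β x) := by unfold kx; fun_prop
  rw [← Ioc_union_Ioi_eq_Ioi zero_le_one]
  refine IntegrableOn.union ?_ ?_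
  · obtain ⟨B2, hB2, hb2⟩ := h2.bdd
    obtain ⟨B3, hB3, hb3⟩ := h3.bdd
    obtain ⟨C2, hC2, hc2⟩ := h2.lip
    obtain ⟨C3, hC3, hc3⟩ := h3.lip
    refine Measure.integrableOn_of_bounded (M := C2 * |2 * β| * B3 + B2 * (C3 * 2)) (by simp) hm.aestronglyMeasurable ?_
    refine ae_restrict_of_forall_mem measurableSet_Ioc fun t ht => ?_
    unfold kx
    rw [norm_div, Complex.norm_real, Real.norm_eq_abs, abs_of_pos ht.1, div_le_iff₀ ht.1]
    unfold hx
    have e : f₂ (x + β * t) * f₃ (x + t) - f₂ (x + β * -t) * f₃ (x + -t) = (f₂ (x + β * t) - f₂ (x + β * -t)) * f₃ (x + t) +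
      f₂ (x + β * -t) * (f₃ (x + t) - f₃ (x + -t)) := by ring
    rw [e]
    refine (norm_add_le _ _).trans ?_
    rw [norm_mul, norm_mul]
    have i1 := hc2 (x + β * t) (x + β * -t)
    have i2 := hc3 (x + t) (x + -t)
    rw [show x + β * t - (x + β * -t) = 2 * β * t by ring, abs_mul, abs_of_pos ht.1] at i1
    rw [show x + t - (x + -t) = 2 * t by ring, abs_mul, abs_of_pos ht.1, abs_two] at i2
    calc _ ≤ (C2 * (|2 * β| * t)) * B3 + B2 * (C3 * (2 * t)) := by
          gcongr
          · have := ht.1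
            positivity
          · exact hb3 _
          · exact hb2 _
      _ = _ := by ring
  · have hi := hx_int h2 h3 β x
    refine Integrable.mono' (hi.norm.add hi.comp_neg.norm).integrableOn hm.aestronglyMeasurable ?_
    refine ae_restrict_of_forall_mem measurableSet_Ioi fun t ht => ?_
    have ht : 1 < t := ht
    unfold kx
    rw [norm_div, Complex.norm_real, Real.norm_eq_abs, abs_of_pos (by linarith)]
    refine (div_le_self (norm_nonneg _) ht.le).trans ?_
    exact norm_sub_le _ _

lemma pv_tendsto {f₂ f₃ : ℝ → ℂ} (h2 : Prof f₂) (h3 : Prof f₃) (β x : ℝ) :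
    Tendsto (fun ε : ℝ => ∫ t in {t : ℝ | ε < |t|}, f₂ (x + β * t) * f₃ (x + t) / (t : ℂ)) (𝓝[>] (0:ℝ)) (𝓝 (∫ t in Ioi 0, kx f₂ f₃ β x t)) := by
  have hk := kx_int h2 h3 β x
  have hi := hx_int h2 h3 β x
  have key : Tendsto (fun ε : ℝ => ∫ t in Ioi 0, (Ioi ε).indicator (kx f₂ f₃ β x) t) (𝓝[>] (0:ℝ)) (𝓝 (∫ t in Ioi 0, kx f₂ f₃ β x t)) := by
    refine tendsto_integral_filter_of_dominated_convergence (fun t => ‖kx f₂ f₃ β x t‖) 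
      (Eventually.of_forall fun ε => hk.aestronglyMeasurable.indicator measurableSet_Ioi) 
      (Eventually.of_forall fun ε => Eventually.of_forall fun u => norm_indicator_le_norm_self _ _) hk.norm ?_
    refine ae_restrict_of_forall_mem measurableSet_Ioi fun t ht => ?_
    refine Tendsto.congr' ?_ tendsto_const_nhds
    filter_upwards [mem_nhdsWithin_of_mem_nhds (Iio_mem_nhds ht)] with ε hε
    rw [indicator_of_mem (show t ∈ Ioi ε from hε)]
  refine key.congr' ?_
  filter_upwards [self_mem_nhdsWithin] with ε hε
  have hε : 0 < ε := hε
  have hS : MeasurableSet {t : ℝ | ε < |t|} := measurableSet_lt measurable_const measurable_id.abs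
  rw [← integral_indicator hS]
  have hF : Integrable ({t : ℝ | ε < |t|}.indicator fun t => f₂ (x + β * t) * f₃ (x + t) / (t : ℂ)) := by
    have hc := (hx_cont h2 h3 β x).measurable
    refine Integrable.mono' (hi.norm.div_const ε) (Measurable.aestronglyMeasurable ?_) (Eventually.of_forall fun t => ?_)
    · refine Measurable.indicator ?_ hS
      have : Measurable fun t => hx f₂ f₃ β x t / (t:ℂ) := by fun_prop
      exact this
    · by_cases ht : ε < |t|
      · rw [indicator_of_mem (show t ∈ {t : ℝ | ε < |t|} from ht), norm_div, Complex.norm_real, Real.norm_eq_abs]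
        unfold hx
        gcongr
      · rw [indicator_of_notMem (show t ∉ {t : ℝ | ε < |t|} from ht), norm_zero]
        positivity
  rw [int_fold hF]
  refine setIntegral_congr_fun measurableSet_Ioi fun t ht => ?_
  have ht : 0 < t := ht
  simp only [indicator, mem_ofPred_eq, mem_Ioi, abs_neg, abs_of_pos ht]
  split_ifs with h
  · unfold kx hx
    push_cast
    rw [div_neg, sub_div]; ring
  · simp

lemma Td_int {g : ℝ → ℂ} (hg : Prof g) (β L : ℝ) {δ : ℝ} (hδ : 0 < δ) {f₂ f₃ : ℝ → ℂ} (h2 : Prof f₂) (h3 : Prof f₃) (x : ℝ) :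
    Integrable (fun t => hx f₂ f₃ β x t * Kd g β L δ t) := by
  obtain ⟨B, hB⟩ := Kd_bdd hg β L hδ
  exact (hx_int h2 h3 β x).mul_bdd (c := B) (Kd_meas hg β L δ).aestronglyMeasurable (Eventually.of_forall fun u => hB _)

theorem Td_tendsto {g : ℝ → ℂ} (hg : Prof g) (β L : ℝ) {f₂ f₃ : ℝ → ℂ} (h2 : Prof f₂) (h3 : Prof f₃) (x : ℝ) :
    Tendsto (fun n => Td g β L (dl n) f₂ f₃ x - Td g β L (dl n) (fun y => f₂ (-y)) (fun y => f₃ (-y)) (-x)) atTop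
      (𝓝 ((∫ u, (sg u : ℂ) * Psi g β L u) * ∫ t in Ioi 0, kx f₂ f₃ β x t)) := by
  have hk := kx_int h2 h3 β x
  set Po : ℝ → ℂ := fun u => Psi g β L u - Psi g β L (-u) with hPo
  have hPi := Psi_int hg β L
  have hPoi : Integrable Po := hPi.sub hPi.comp_neg
  have hc : ∫ u, (sg u : ℂ) * Psi g β L u = ∫ u in Ioi 0, Po u := by
    rw [int_fold]
    · refine setIntegral_congr_fun measurableSet_Ioi fun t ht => ?_
      have ht : 0 < t := ht
      simp only [sg, ht.le, hPo, if_true, if_neg (show ¬ (0 ≤ -t) by linarith)]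
      push_cast; ring
    · exact hPi.bdd_mul (c := 1) (f := fun u => (sg u : ℂ)) (Complex.measurable_ofReal.comp sg_meas).aestronglyMeasurable
        (Eventually.of_forall fun u => by rw [Complex.norm_real, Real.norm_eq_abs, sg_abs])
  have e : ∀ n, Td g β L (dl n) f₂ f₃ x - Td g β L (dl n) (fun y => f₂ (-y)) (fun y => f₃ (-y)) (-x) =
      ∫ t in Ioi 0, kx f₂ f₃ β x t * ∫ u in Icc (t * dl n) (t / dl n), Po u := by
    intro n
    have hδ := dl_pos n
    have i1 := Td_int hg β L hδ h2 h3 x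
    have hr : ∀ t, f₂ (-(-x + β * t)) * f₃ (-(-x + t)) = hx f₂ f₃ β x (-t) := by
      intro t; unfold hx; congr 2 <;> ring
    have i2 : Integrable (fun t => hx f₂ f₃ β x (-t) * Kd g β L (dl n) t) := by
      obtain ⟨B, hB⟩ := Kd_bdd hg β L hδ
      exact (hx_int h2 h3 β x).comp_neg.mul_bdd (c := B) (Kd_meas hg β L _).aestronglyMeasurable (Eventually.of_forall fun u => hB _)
    unfold Td
    simp_rw [hr]
    have : (fun t => f₂ (x + β * t) * f₃ (x + t) * Kd g β L (dl n) t) = fun t => hx f₂ f₃ β x t * Kd g β L (dl n) t := rfl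
    rw [this, ← integral_sub i1 i2, int_fold (F := fun t => hx f₂ f₃ β x t * Kd g β L (dl n) t - hx f₂ f₃ β x (-t) * Kd g β L (dl n) t) (i1.sub i2)]
    refine setIntegral_congr_fun measurableSet_Ioi fun t ht => ?_
    have ht : 0 < t := ht
    rw [← sub_int Po ht hδ]
    have e1 : ∫ s in Icc (dl n) (dl n)⁻¹, (((s^2)⁻¹ : ℝ) : ℂ) * Po (t / s) = Kd g β L (dl n) t - Kd g β L (dl n) (-t) := by
      unfold Kd
      rw [← integral_sub (Kd_integrand hg β L hδ t) (Kd_integrand hg β L hδ (-t))]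
      refine integral_congr_ae (Eventually.of_forall fun s => ?_)
      simp only [hPo, neg_div]; ring
    rw [e1]
    unfold kx
    have : (t:ℂ) ≠ 0 := by exact_mod_cast ht.ne'
    rw [neg_neg]
    field_simp
    ring
  simp_rw [e]
  rw [hc, mul_comm, ← integral_mul_const]
  have hkm : AEStronglyMeasurable (kx f₂ f₃ β x) (volume.restrict (Ioi 0)) := hk.aestronglyMeasurable
  refine tendsto_integral_of_dominated_convergence (fun t => ‖kx f₂ f₃ β x t‖ * ∫ u, ‖Po u‖) (fun n => ?_) (hk.norm.mul_const _) (fun n => ?_) ?_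
  · refine hkm.mul ?_
    have hPm : Measurable Po := by have := (Psi_cont hg β L).measurable; fun_prop
    have : Measurable (fun p : ℝ × ℝ => {q : ℝ × ℝ | q.1 * dl n ≤ q.2 ∧ q.2 ≤ q.1 / dl n}.indicator (fun q => Po q.2) p) := by
      refine Measurable.indicator (by fun_prop) (MeasurableSet.inter (measurableSet_le (f := fun q : ℝ × ℝ => q.1 * dl n) (g := fun q => q.2) (by fun_prop) (by fun_prop)) (measurableSet_le (f := fun q : ℝ × ℝ => q.2) (g := fun q => q.1 / dl n) (by fun_prop) (by fun_prop)))
    have := (this.stronglyMeasurable.integral_prod_right' (ν := volume)).aestronglyMeasurable (μ := volume.restrict (Ioi 0))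
    refine this.congr (Eventually.of_forall fun t => ?_)
    simp only
    rw [← integral_indicator measurableSet_Icc]
    rfl
  · refine Eventually.of_forall fun t => ?_
    rw [norm_mul]
    gcongr
    exact (norm_integral_le_integral_norm _).trans (setIntegral_le_integral hPoi.norm (Eventually.of_forall fun u => norm_nonneg _))
  · refine ae_restrict_of_forall_mem measurableSet_Ioi fun t ht => ?_
    exact (trunc_tendsto hPoi ht).const_mul _

lemma Td_meas {g : ℝ → ℂ} (hg : Prof g) (β L δ : ℝ) {f₂ f₃ : ℝ → ℂ} (h2 : Prof f₂) (h3 : Prof f₃) : Measurable (Td g β L δ f₂ f₃) := by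
  have h2 := h2.cont.measurable
  have h3 := h3.cont.measurable
  have hK := Kd_meas hg β L δ
  have : Measurable (fun p : ℝ × ℝ => f₂ (p.1 + β * p.2) * f₃ (p.1 + p.2) * Kd g β L δ p.2) := by fun_prop
  exact (this.stronglyMeasurable.integral_prod_right' (ν := volume)).measurable

lemma Td_bdd {g : ℝ → ℂ} (hg : Prof g) (β L : ℝ) {δ : ℝ} (hδ : 0 < δ) {f₂ f₃ : ℝ → ℂ} (h2 : Prof f₂) (h3 : Prof f₃) : ∃ B, ∀ x, ‖Td g β L δ f₂ f₃ x‖ ≤ B := by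
  obtain ⟨B, hB⟩ := Kd_bdd hg β L hδ
  have hB0 : 0 ≤ B := (norm_nonneg _).trans (hB 0)
  obtain ⟨B2, hB2, hb2⟩ := h2.bdd
  refine ⟨∫ t, ‖f₃ t‖ * (B2 * B), fun x => ?_⟩
  rw [← integral_add_left_eq_self _ x]
  unfold Td
  refine norm_integral_le_of_norm_le ((h3.int.comp_add_left x).norm.mul_const _) (Eventually.of_forall fun s => ?_)
  rw [norm_mul, norm_mul]
  calc _ ≤ B2 * ‖f₃ (x + s)‖ * B := by
        gcongr
        · exact hb2 _
        · exact hB _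
    _ = _ := by ring

end BHT



namespace BHT

lemma young_eta {η q q' a b : ℝ} (hη : 0 < η) (hq : q.HolderConjugate q') (ha : 0 ≤ a) (hb : 0 ≤ b) :
    a * b ≤ η * a^q + (η^(q'/q))⁻¹ * b^q' := by
  have hq0 := hq.pos
  have hq'0 := hq.symm.pos
  have h1 : 0 < η^(1/q) := by positivity
  have := Real.young_inequality_of_nonneg (a := η^(1/q) * a) (b := (η^(1/q))⁻¹ * b) (by positivity) (by positivity) hq
  rw [show η^(1/q) * a * ((η^(1/q))⁻¹ * b) = a * b by field_simp, Real.mul_rpow h1.le ha, Real.mul_rpow (by positivity) hb,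
    Real.inv_rpow h1.le, ← Real.rpow_mul hη.le, ← Real.rpow_mul hη.le, one_div_mul_cancel hq0.ne', Real.rpow_one, one_div_mul_eq_div] at this
  refine this.trans (add_le_add (div_le_self (by positivity) hq.lt.le) (div_le_self (by positivity) hq.symm.lt.le))

lemma half_absorb {x y : ℝ≥0∞} (hx : x ≠ ⊤) (h : x ≤ ENNReal.ofReal (1/2) * x + y) : x ≤ 2 * y := by
  by_cases hy : y = ⊤
  · subst hy; simp
  lift x to NNReal using hx
  lift y to NNReal using hy
  have e : ENNReal.ofReal (1/2) = ((1/2 : NNReal) : ℝ≥0∞) := by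
    rw [ENNReal.ofReal, Real.toNNReal_div zero_le_one]; simp
  rw [e] at h
  norm_cast at h ⊢
  have h : (x:ℝ) ≤ 1/2 * x + y := by exact_mod_cast h
  have : (x:ℝ) ≤ 2 * y := by linarith
  exact_mod_cast this

lemma level {s q q' Cst : ℝ} (hs : 1 ≤ s) (hsq : s < q) (hq : q.HolderConjugate q') (hC : 0 < Cst) :
    ∃ K : ℝ, 0 < K ∧ ∀ T : ℝ → ℂ, Measurable T → (∃ B, ∀ x, ‖T x‖ ≤ B) → ∀ V : ℝ → ℝ, (∀ x, 0 ≤ V x) → ∀ l : ℝ, 0 < l →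
      ∀ Z : Set ℝ, MeasurableSet Z → (∀ f : ℝ → ℂ, Nice f → (∀ x, f x ≠ 0 → x ∈ Z) →
        ‖∫ x, f x * T x‖ₑ ≤ ENNReal.ofReal Cst * ∫⁻ x, ENNReal.ofReal (MM f s x * (l * V x))) →
      volume ({x | l < ‖T x‖} ∩ Z) ≤ ENNReal.ofReal K * ∫⁻ x, ENNReal.ofReal (V x^q') := by
  set A := 3^(q/s) * (q/s) * 8 / (q/s-1) with hA
  have hqs : 1 < q / s := by rw [lt_div_iff₀ (by linarith)]; linarith
  have hA0 : 0 < A := by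
    have : 0 < q/s - 1 := by linarith
    have : 0 < q / s := by linarith
    positivity
  set η := 1 / (2 * Cst * A) with hη
  have hη0 : 0 < η := by positivity
  refine ⟨2 * (Cst * (η^(q'/q))⁻¹), by positivity, fun T hT hTb V hV l hl Z hZ hyp => ?_⟩
  obtain ⟨B, hB⟩ := hTb
  have hTn : Measurable fun x => ‖T x‖ := hT.norm
  have hS : MeasurableSet {x | l < ‖T x‖} := measurableSet_lt measurable_const hTn
  have key : ∀ n : ℕ, volume ({x | l < ‖T x‖} ∩ Z ∩ Icc (-(n:ℝ)) n) ≤ ENNReal.ofReal (2 * (Cst * (η^(q'/q))⁻¹)) * ∫⁻ x, ENNReal.ofReal (V x^q') := by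
    intro n
    set G := {x | l < ‖T x‖} ∩ Z ∩ Icc (-(n:ℝ)) n with hG
    have hGm : MeasurableSet G := (hS.inter hZ).inter measurableSet_Icc
    have hGf : volume G < ⊤ := (measure_mono inter_subset_right).trans_lt (by simp)
    set f : ℝ → ℂ := G.indicator fun x => (starRingEnd ℂ) (T x) / ((‖T x‖ : ℝ) : ℂ) with hf
    have hfn : ∀ x, ‖f x‖ ≤ G.indicator (fun _ => (1:ℝ)) x := by
      intro x
      by_cases hx : x ∈ G
      · rw [hf, indicator_of_mem hx, indicator_of_mem hx, norm_div, RCLike.norm_conj, Complex.norm_real, norm_norm]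
        exact div_self_le_one _
      · rw [hf, indicator_of_notMem hx, indicator_of_notMem hx, norm_zero]
    have hfm : Measurable f := by
      refine Measurable.indicator ?_ hGm
      have : Measurable fun x => (starRingEnd ℂ) (T x) := Complex.continuous_conj.measurable.comp hT
      fun_prop
    have hind : Integrable (G.indicator fun _ => (1:ℝ)) := (integrable_indicator_iff hGm).2 (integrableOn_const hGf.ne)
    have hfN : Nice f := by
      refine ⟨hfm, Integrable.mono' hind hfm.aestronglyMeasurable (Eventually.of_forall hfn), 1, fun x => (hfn x).trans ?_⟩
      by_cases hx : x ∈ G <;> simp [hx]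
    have hfz : ∀ x, f x ≠ 0 → x ∈ Z := by
      intro x hx
      have : x ∈ G := by
        by_contra h
        exact hx (by rw [hf, indicator_of_notMem h])
      exact this.1.2
    have h1 := hyp f hfN hfz
    have hfT : ∀ x, f x * T x = ((G.indicator (fun x => ‖T x‖) x : ℝ) : ℂ) := by
      intro x
      by_cases hx : x ∈ G
      · have hpos : 0 < ‖T x‖ := hl.trans hx.1.1
        have hne : ((‖T x‖ : ℝ) : ℂ) ≠ 0 := by exact_mod_cast hpos.ne'
        rw [hf, indicator_of_mem hx, indicator_of_mem hx, div_mul_eq_mul_div, mul_comm, Complex.mul_conj, Complex.normSq_eq_norm_sq, div_eq_iff hne]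
        push_cast; ring
      · rw [hf, indicator_of_notMem hx, indicator_of_notMem hx]; simp
    have h2 : ENNReal.ofReal l * volume G ≤ ‖∫ x, f x * T x‖ₑ := by
      simp_rw [hfT]
      rw [integral_complex_ofReal, ← ofReal_norm, Complex.norm_real, Real.norm_eq_abs, ← ENNReal.ofReal_toReal hGf.ne, ← ENNReal.ofReal_mul hl.le]
      refine ENNReal.ofReal_le_ofReal (le_trans ?_ (le_abs_self _))
      rw [integral_indicator hGm]
      have : ∫ x in G, l = l * (volume G).toReal := by
        rw [setIntegral_const, smul_eq_mul, mul_comm]; rfl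
      rw [← this]
      refine setIntegral_mono_on (integrableOn_const hGf.ne) ?_ hGm fun x hx => (show l < ‖T x‖ from hx.1.1).le
      exact Measure.integrableOn_of_bounded (M := B) hGf.ne hTn.aestronglyMeasurable (Eventually.of_forall fun x => by rw [norm_norm]; exact hB x)
    have h3 : ∫⁻ x, ENNReal.ofReal (MM f s x * (l * V x)) ≤ ENNReal.ofReal l * (ENNReal.ofReal η * (ENNReal.ofReal A * volume G) +
        ENNReal.ofReal (η^(q'/q))⁻¹ * ∫⁻ x, ENNReal.ofReal (V x^q')) := by
      have hM0 : ∀ x, 0 ≤ MM f s x := fun x => (MM_dom hfN hs x).1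
      calc _ ≤ ∫⁻ x, ENNReal.ofReal l * (ENNReal.ofReal η * ENNReal.ofReal (MM f s x^q) + ENNReal.ofReal (η^(q'/q))⁻¹ * ENNReal.ofReal (V x^q')) := by
            refine lintegral_mono fun x => ?_
            have := young_eta hη0 hq (hM0 x) (hV x)
            have hh := hM0 x
            have hh' := hV x
            rw [← ENNReal.ofReal_mul hη0.le, ← ENNReal.ofReal_mul (by positivity), ← ENNReal.ofReal_add (by positivity) (by positivity), ← ENNReal.ofReal_mul hl.le]
            refine ENNReal.ofReal_le_ofReal ?_
            calc _ = l * (MM f s x * V x) := by ring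
              _ ≤ _ := by gcongr
        _ = ENNReal.ofReal l * (ENNReal.ofReal η * (∫⁻ x, ENNReal.ofReal (MM f s x^q)) + ENNReal.ofReal (η^(q'/q))⁻¹ * ∫⁻ x, ENNReal.ofReal (V x^q')) := by
            have := MM_meas f s
            rw [lintegral_const_mul' _ _ ENNReal.ofReal_ne_top, lintegral_add_left (by fun_prop), lintegral_const_mul' _ _ ENNReal.ofReal_ne_top,
              lintegral_const_mul' _ _ ENNReal.ofReal_ne_top]
        _ ≤ _ := by
            refine mul_le_mul_right (add_le_add (mul_le_mul_right ((MM_strong hfN hs hsq).trans (mul_le_mul_right ?_ _)) _) le_rfl) _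
            calc ∫⁻ x, ENNReal.ofReal (‖f x‖^q) ≤ ∫⁻ x, G.indicator (fun _ => 1) x := by
                  refine lintegral_mono fun x => ?_
                  by_cases hx : x ∈ G
                  · rw [indicator_of_mem hx, ← ENNReal.ofReal_one]
                    have := hfn x
                    rw [indicator_of_mem hx] at this
                    exact ENNReal.ofReal_le_ofReal (Real.rpow_le_one (norm_nonneg _) this hq.pos.le)
                  · have : f x = 0 := by rw [hf, indicator_of_notMem hx]
                    rw [this, norm_zero, Real.zero_rpow hq.pos.ne']; simp
              _ = volume G := by rw [lintegral_indicator hGm]; simp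
    have h4 := h2.trans (h1.trans (mul_le_mul_right h3 _))
    rw [← mul_assoc, mul_comm (ENNReal.ofReal Cst), mul_assoc] at h4
    have h5 := (ENNReal.mul_le_mul_iff_right (by simpa using hl) ENNReal.ofReal_ne_top).1 h4
    have h6 := half_absorb (y := ENNReal.ofReal Cst * (ENNReal.ofReal (η^(q'/q))⁻¹ * ∫⁻ x, ENNReal.ofReal (V x^q'))) hGf.ne (h5.trans (le_of_eq (by
      rw [mul_add]
      congr 1
      rw [← mul_assoc, ← mul_assoc, ← ENNReal.ofReal_mul hC.le, ← ENNReal.ofReal_mul (by positivity)]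
      congr 2
      rw [hη]; field_simp)))
    refine h6.trans (le_of_eq ?_)
    rw [ENNReal.ofReal_mul zero_le_two, ENNReal.ofReal_mul hC.le]
    simp only [ENNReal.ofReal_ofNat]
    ring
  have hU : {x | l < ‖T x‖} ∩ Z = ⋃ n : ℕ, {x | l < ‖T x‖} ∩ Z ∩ Icc (-(n:ℝ)) n := by
    rw [← inter_iUnion]
    refine (inter_eq_left.2 fun x _ => ?_).symm
    obtain ⟨n, hn⟩ := exists_nat_ge |x|
    exact mem_iUnion.2 ⟨n, abs_le.1 hn⟩
  rw [hU]
  have hmono : Monotone fun n : ℕ => {x | l < ‖T x‖} ∩ Z ∩ Icc (-(n:ℝ)) n := by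
    intro n m h
    have : (n:ℝ) ≤ m := by exact_mod_cast h
    exact inter_subset_inter_right _ (Icc_subset_Icc (by linarith) this)
  exact le_of_tendsto' (tendsto_measure_iUnion_atTop hmono) key

lemma int_sum {κ : ℝ} (hκ : 0 < κ) : ∃ S : ℝ, 0 < S ∧ ∑' j : ℤ, ENNReal.ofReal ((2:ℝ)^(-(κ * |(j:ℝ)|))) ≤ ENNReal.ofReal S := by
  have hs : Summable fun j : ℤ => (2:ℝ)^(-(κ * |(j:ℝ)|)) := by
    have hg : Summable fun n : ℕ => ((2:ℝ)^(-κ))^n := summable_geometric_of_lt_one (by positivity) (Real.rpow_lt_one_of_one_lt_of_neg (by norm_num) (by linarith))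
    have e : ∀ n : ℕ, (2:ℝ)^(-(κ * n)) = ((2:ℝ)^(-κ))^n := by
      intro n; rw [← Real.rpow_natCast, ← Real.rpow_mul (by norm_num)]; congr 1; ring
    rw [summable_int_iff_summable_nat_and_neg]
    constructor
    · refine hg.congr fun n => ?_
      rw [← e]; simp
    · refine hg.congr fun n => ?_
      rw [← e]; simp
  refine ⟨∑' j : ℤ, (2:ℝ)^(-(κ * |(j:ℝ)|)), hs.tsum_pos (fun j => by positivity) 0 (by positivity), ?_⟩
  rw [ENNReal.ofReal_tsum_of_nonneg (fun j => by positivity) hs]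

lemma level_sum {r p q : ℝ} (hr : 0 < r) (hp : 0 < p) (hpq : p < q) : ∃ S : ℝ, 0 < S ∧ ∀ M : ℝ, 0 ≤ M →
    ∑' n : ℤ, ENNReal.ofReal ((2:ℝ)^((n:ℝ) * r)) * ENNReal.ofReal ((min (M / (2:ℝ)^((n:ℝ) * (r / p))) 1)^q) ≤ ENNReal.ofReal S * ENNReal.ofReal (M^p) := by
  set κ := min r (r / p * q - r) with hκ
  have hκ0 : 0 < κ := by
    refine lt_min hr ?_
    have : r / p * p < r / p * q := by gcongr
    rw [div_mul_cancel₀ _ hp.ne'] at this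
    linarith
  obtain ⟨S, hS, hsum⟩ := int_sum hκ0
  refine ⟨S * 2^κ, by positivity, fun M hM => ?_⟩
  rcases hM.eq_or_lt with rfl | hM
  · have : ∀ n : ℤ, ENNReal.ofReal ((2:ℝ)^((n:ℝ) * r)) * ENNReal.ofReal ((min (0 / (2:ℝ)^((n:ℝ) * (r / p))) 1)^q) = 0 := by
      intro n
      rw [zero_div, min_eq_left zero_le_one, Real.zero_rpow (by linarith)]; simp
    rw [tsum_congr this, tsum_zero]; exact zero_le
  set y := Real.logb 2 M * (p / r) with hy
  have hMy : M = 2^(y * (r / p)) := by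
    rw [hy, show Real.logb 2 M * (p / r) * (r / p) = Real.logb 2 M by field_simp, Real.rpow_logb (by norm_num) (by norm_num) hM]
  have hMp : M^p = 2^(y * r) := by
    rw [hMy, ← Real.rpow_mul (by norm_num)]; congr 1; field_simp
  set N : ℤ := ⌊y⌋ with hN
  have hN1 : (N:ℝ) ≤ y := Int.floor_le y
  have hN2 : y < N + 1 := Int.lt_floor_add_one y
  have two : (1:ℝ) ≤ 2 := by norm_num
  have term : ∀ n : ℤ, (2:ℝ)^((n:ℝ) * r) * (min (M / (2:ℝ)^((n:ℝ) * (r / p))) 1)^q ≤ 2^κ * M^p * 2^(-(κ * |((n - N : ℤ):ℝ)|)) := by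
    intro n
    have hMn : M / (2:ℝ)^((n:ℝ) * (r / p)) = 2^((y - n) * (r / p)) := by
      rw [hMy, ← Real.rpow_sub (by norm_num)]; congr 1; ring
    have b1 : (2:ℝ)^((n:ℝ) * r) * (min (M / (2:ℝ)^((n:ℝ) * (r / p))) 1)^q ≤ 2^(y * r) * 2^(-(κ * |n - y|)) := by
      rw [← Real.rpow_add (by norm_num), hMn]
      rcases le_total (n:ℝ) y with h | h
      · calc _ ≤ (2:ℝ)^((n:ℝ) * r) * 1 := by
              gcongr
              exact Real.rpow_le_one (by positivity) (min_le_right _ _) (by linarith)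
          _ ≤ _ := by
              rw [mul_one]
              refine Real.rpow_le_rpow_of_exponent_le two ?_
              rw [abs_of_nonpos (by linarith)]
              have : κ * (y - n) ≤ r * (y - n) := mul_le_mul_of_nonneg_right (min_le_left _ _) (by linarith)
              linarith
      · calc _ ≤ (2:ℝ)^((n:ℝ) * r) * (2^((y - n) * (r / p)))^q := by
              gcongr
              · linarith
              · exact min_le_left _ _
          _ ≤ _ := by
              rw [← Real.rpow_mul (by norm_num), ← Real.rpow_add (by norm_num)]
              refine Real.rpow_le_rpow_of_exponent_le two ?_
              rw [abs_of_nonneg (by linarith)]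
              have : κ * (n - y) ≤ (r / p * q - r) * (n - y) := mul_le_mul_of_nonneg_right (min_le_right _ _) (by linarith)
              linarith
    refine b1.trans ?_
    rw [← hMp, mul_comm (2^κ) (M^p), mul_assoc, ← Real.rpow_add (by norm_num)]
    refine mul_le_mul_of_nonneg_left (Real.rpow_le_rpow_of_exponent_le two ?_) (by positivity)
    have : |((n - N : ℤ):ℝ)| ≤ |n - y| + 1 := by
      push_cast
      calc |(n:ℝ) - N| = |(n - y) + (y - N)| := by ring_nf
        _ ≤ |n - y| + |y - N| := abs_add_le _ _
        _ ≤ _ := by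
          gcongr
          rw [abs_le]; constructor <;> linarith
    nlinarith
  calc _ ≤ ∑' n : ℤ, ENNReal.ofReal (2^κ * M^p) * ENNReal.ofReal (2^(-(κ * |((n - N : ℤ):ℝ)|))) := by
        refine ENNReal.tsum_le_tsum fun n => ?_
        rw [← ENNReal.ofReal_mul (by positivity), ← ENNReal.ofReal_mul (by positivity)]
        exact ENNReal.ofReal_le_ofReal (term n)
    _ = ENNReal.ofReal (2^κ * M^p) * ∑' j : ℤ, ENNReal.ofReal (2^(-(κ * |(j:ℝ)|))) := by
        rw [ENNReal.tsum_mul_left]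
        congr 1
        exact (Equiv.subRight N).tsum_eq (fun j : ℤ => ENNReal.ofReal ((2:ℝ)^(-(κ * |(j:ℝ)|))))
    _ ≤ ENNReal.ofReal (2^κ * M^p) * ENNReal.ofReal S := by gcongr
    _ = _ := by
        rw [← ENNReal.ofReal_mul (by positivity), ← ENNReal.ofReal_mul (by positivity)]
        congr 1; ring

lemma layer {r : ℝ} (hr : 0 < r) {T : ℝ → ℂ} (hT : Measurable T) :
    ∫⁻ x, ENNReal.ofReal (‖T x‖^r) ≤ ENNReal.ofReal (2^r) * ∑' n : ℤ, ENNReal.ofReal ((2:ℝ)^((n:ℝ) * r)) * volume {x | (2:ℝ)^(n:ℝ) < ‖T x‖} := by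
  have hS : ∀ n : ℤ, MeasurableSet {x | (2:ℝ)^(n:ℝ) < ‖T x‖} := fun n => measurableSet_lt measurable_const hT.norm
  calc _ ≤ ∫⁻ x, ENNReal.ofReal (2^r) * ∑' n : ℤ, ENNReal.ofReal ((2:ℝ)^((n:ℝ) * r)) * {x | (2:ℝ)^(n:ℝ) < ‖T x‖}.indicator 1 x := by
        refine lintegral_mono fun x => ?_
        rcases (norm_nonneg (T x)).eq_or_lt with h | h
        · rw [← h, Real.zero_rpow hr.ne']; simp
        obtain ⟨n, h1, h2⟩ := exists_mem_Ioc_zpow h (by norm_num : (1:ℝ) < 2)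
        refine le_trans ?_ (mul_le_mul_right (ENNReal.le_tsum n) _)
        rw [indicator_of_mem (by rw [mem_ofPred_eq, Real.rpow_intCast]; exact h1), Pi.one_apply, mul_one, ← ENNReal.ofReal_mul (by positivity)]
        refine ENNReal.ofReal_le_ofReal ?_
        rw [← Real.rpow_add (by norm_num)]
        calc ‖T x‖^r ≤ ((2:ℝ)^(n+1))^r := by gcongr
          _ = _ := by
            rw [← Real.rpow_intCast, ← Real.rpow_mul (by norm_num)]; congr 1; push_cast; ring
    _ = _ := by
        rw [lintegral_const_mul' _ _ ENNReal.ofReal_ne_top, lintegral_tsum]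
        · congr 2
          ext n
          rw [lintegral_const_mul' _ _ ENNReal.ofReal_ne_top, lintegral_indicator_one (hS n)]
        · intro n
          exact ((measurable_one.indicator (hS n)).const_mul _).aemeasurable

end BHT



namespace BHT

lemma exps {b₂ b₃ : ℝ} (h20 : 0 ≤ b₂) (h30 : 0 ≤ b₃) (h21 : b₂ < 1) (h31 : b₃ < 1) (h0 : 0 < b₂ + b₃) (h1 : b₂ + b₃ < 3/2) :
    ∃ (a : ℕ) (s θ : Fin 3 → ℝ) (q q' : ℝ), 12 ≤ a ∧ (∀ i, 1 < s i) ∧ (∀ i, s i ≤ 2) ∧ (∀ i, 0 < θ i) ∧ (∀ i, θ i < 1) ∧ ∑ i, θ i < 1 ∧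
      (∀ i, 0 < (s i - 1) * θ i - (2 - s i + (12:ℕ) / a) / 2 * (1 - θ i)) ∧ s 0 < q ∧ q.HolderConjugate q' ∧ 1 < q' * (b₂ + b₃) ∧
      b₂ * s 1 < 1 ∧ b₃ * s 2 < 1 := by
  obtain ⟨m2, hm2a, hm2b, hm2c, hm2d⟩ : ∃ m, b₂ ≤ m ∧ 1/2 ≤ m ∧ m < 1 ∧ (m = b₂ ∨ m = 1/2) := by
    rcases le_total b₂ (1/2) with h | h
    · exact ⟨1/2, h, le_rfl, by norm_num, Or.inr rfl⟩
    · exact ⟨b₂, le_rfl, h, h21, Or.inl rfl⟩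
  obtain ⟨m3, hm3a, hm3b, hm3c, hm3d⟩ : ∃ m, b₃ ≤ m ∧ 1/2 ≤ m ∧ m < 1 ∧ (m = b₃ ∨ m = 1/2) := by
    rcases le_total b₃ (1/2) with h | h
    · exact ⟨1/2, h, le_rfl, by norm_num, Or.inr rfl⟩
    · exact ⟨b₃, le_rfl, h, h31, Or.inl rfl⟩
  have hA : 0 < 3/2 - m2 - m3 := by
    rcases hm2d with h | h <;> rcases hm3d with h' | h' <;> linarith
  have hB : 0 < 1 + b₂ + b₃ - m2 - m3 := by
    rcases hm2d with h | h <;> rcases hm3d with h' | h' <;> linarith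
  obtain ⟨ε, hε, e1, e2, e3, e4⟩ : ∃ ε : ℝ, 0 < ε ∧ 4 * ε < 3/2 - m2 - m3 ∧ 4 * ε < 1 + b₂ + b₃ - m2 - m3 ∧ 4 * ε < 1 - m2 ∧ 4 * ε < 1 - m3 := by
    have hc : 0 < min (min (3/2 - m2 - m3) (1 + b₂ + b₃ - m2 - m3)) (min (1 - m2) (1 - m3)) :=
      lt_min (lt_min hA hB) (lt_min (by linarith) (by linarith))
    set c := min (min (3/2 - m2 - m3) (1 + b₂ + b₃ - m2 - m3)) (min (1 - m2) (1 - m3))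
    have c1 : c ≤ 3/2 - m2 - m3 := (min_le_left _ _).trans (min_le_left _ _)
    have c2 : c ≤ 1 + b₂ + b₃ - m2 - m3 := (min_le_left _ _).trans (min_le_right _ _)
    have c3 : c ≤ 1 - m2 := (min_le_right _ _).trans (min_le_left _ _)
    have c4 : c ≤ 1 - m3 := (min_le_right _ _).trans (min_le_right _ _)
    exact ⟨c / 8, by positivity, by linarith, by linarith, by linarith, by linarith⟩
  obtain ⟨a, ha⟩ := exists_nat_gt (36 / ε + 12)
  have ha12 : (12:ℝ) < a := by
    have : 0 < 36 / ε := by positivity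
    linarith
  have haε : 36 < a * ε := by
    have : 36 / ε < a := by linarith
    rwa [div_lt_iff₀ hε] at this
  set x : Fin 3 → ℝ := ![2 - m2 - m3 - 3 * ε, m2 + ε, m3 + ε] with hx
  have hx1 : ∀ i, 1/2 ≤ x i ∧ x i + 2 * ε < 1 := by
    intro i
    fin_cases i
    · show 1/2 ≤ 2 - m2 - m3 - 3 * ε ∧ 2 - m2 - m3 - 3 * ε + 2 * ε < 1
      constructor <;> linarith
    · show 1/2 ≤ m2 + ε ∧ m2 + ε + 2 * ε < 1
      constructor <;> linarith
    · show 1/2 ≤ m3 + ε ∧ m3 + ε + 2 * ε < 1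
      constructor <;> linarith
  have hxs : x 0 + x 1 + x 2 = 2 - ε := by
    show 2 - m2 - m3 - 3 * ε + (m2 + ε) + (m3 + ε) = _
    ring
  obtain ⟨w, hw0, hw1, hw2⟩ : ∃ w : ℝ, 0 < w ∧ 1 - b₂ - b₃ < w ∧ w < x 0 := by
    have h : max 0 (1 - b₂ - b₃) < x 0 := by
      show _ < 2 - m2 - m3 - 3 * ε
      refine max_lt ?_ ?_ <;> linarith
    obtain ⟨w, h1, h2⟩ := exists_between h
    exact ⟨w, (le_max_left _ _).trans_lt h1, (le_max_right _ _).trans_lt h1, h2⟩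
  have hw3 : w < 1 := by linarith [(hx1 0).2]
  refine ⟨a, fun i => (x i)⁻¹, fun i => 2 * x i - 1 + ε / 3, w⁻¹, (1 - w)⁻¹, ?_, ?_, ?_, ?_, ?_, ?_, ?_, ?_, ?_, ?_, ?_, ?_⟩
  · exact_mod_cast ha12.le
  · intro i
    have := hx1 i
    exact (one_lt_inv₀ (by linarith)).2 (by linarith)
  · intro i
    have := hx1 i
    rw [inv_le_comm₀ (by linarith) (by norm_num)]
    linarith
  · intro i
    have := hx1 i
    simp only
    linarith
  · intro i
    have := hx1 i
    simp only
    linarith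
  · rw [Fin.sum_univ_three]
    linarith
  · intro i
    obtain ⟨k1, k2⟩ := hx1 i
    simp only
    generalize x i = X at *
    have hX : 0 < X := by linarith
    have hapos : (0:ℝ) < a := by linarith
    have e : ((X⁻¹ - 1) * (2 * X - 1 + ε / 3) - (2 - X⁻¹ + ((12:ℕ):ℝ) / a) / 2 * (1 - (2 * X - 1 + ε / 3))) =
        (ε / 6 - 6 / a * X * (2 - 2 * X - ε / 3)) / X := by
      push_cast
      field_simp
      ring
    rw [e]
    refine div_pos ?_ hX
    have i1 : 6 / (a:ℝ) < ε / 6 := by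
      rw [div_lt_div_iff₀ hapos (by norm_num)]; linarith
    have i2 : X * (2 - 2 * X - ε / 3) ≤ 1 := by
      have : X * (2 - 2 * X - ε / 3) ≤ 1 * 1 := mul_le_mul (by linarith) (by linarith) (by linarith) zero_le_one
      linarith
    have i3 : 0 < 6 / (a:ℝ) := by positivity
    have i4 : 6 / (a:ℝ) * (X * (2 - 2 * X - ε / 3)) ≤ 6 / (a:ℝ) * 1 := mul_le_mul_of_nonneg_left i2 i3.le
    rw [mul_assoc]
    linarith
  · simp only
    have := hx1 0
    exact inv_strictAnti₀ hw0 hw2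
  · rw [Real.holderConjugate_iff]
    refine ⟨(one_lt_inv₀ hw0).2 hw3, ?_⟩
    rw [inv_inv, inv_inv]; ring
  · rw [inv_mul_eq_div, lt_div_iff₀ (by linarith)]; linarith
  · show b₂ * (m2 + ε)⁻¹ < 1
    rw [← div_eq_mul_inv, div_lt_one (by linarith)]; linarith
  · show b₃ * (m3 + ε)⁻¹ < 1
    rw [← div_eq_mul_inv, div_lt_one (by linarith)]; linarith

def Ctl (r q' κ s S : ℝ) (f : ℝ → ℂ) (a : ℝ) : Prop := ∃ M : ℝ → ℝ, Measurable M ∧ Dom f s M ∧ ∃ I : ℤ → ℝ≥0∞,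
  ∑' n : ℤ, ENNReal.ofReal ((2:ℝ)^((n:ℝ) * r)) * I n ≤ ENNReal.ofReal S ∧
  (∀ n : ℤ, volume {x | a * 2^((n:ℝ) * κ) < M x} ≤ I n) ∧
  (0 < κ → ∀ n : ℤ, ∫⁻ x, ENNReal.ofReal ((min (M x / (a * 2^((n:ℝ) * κ))) 1)^(q'/κ)) ≤ I n)

lemma ctl_fin {r q' s p : ℝ} (hr : 0 < r) (hq : r < q') (hs : 1 ≤ s) (hp : s < p) : ∃ S, 0 < S ∧ ∀ f : ℝ → ℂ, Nice f → ∀ a : ℝ, 0 < a →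
    ∫⁻ x, ENNReal.ofReal (‖f x‖^p) ≤ ENNReal.ofReal (a^p) → Ctl r q' (r/p) s S f a := by
  have hp0 : 0 < p := by linarith
  have hκ : 0 < r / p := by positivity
  have hQ : p < q' / (r / p) := by
    rw [lt_div_iff₀ hκ, mul_div_cancel₀ _ hp0.ne']; exact hq
  obtain ⟨S, hS, hls⟩ := level_sum hr hp0 hQ
  set A := 3^(p/s) * (p/s) * 8 / (p/s-1) with hA
  have hA0 : 0 < A := by
    have hqs : 1 < p / s := by rw [lt_div_iff₀ (by linarith)]; linarith
    have : 0 < p/s - 1 := by linarith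
    have : 0 < p / s := by linarith
    positivity
  refine ⟨S * A, by positivity, fun f hf a ha hfa => ⟨MM f s, MM_meas f s, MM_dom hf hs,
    fun n => ∫⁻ x, ENNReal.ofReal ((min (MM f s x / (a * 2^((n:ℝ) * (r / p)))) 1)^(q'/(r / p))), ?_, ?_, fun _ n => le_rfl⟩⟩
  · have hm := MM_meas f s
    have hM0 : ∀ x, 0 ≤ MM f s x := fun x => (MM_dom hf hs x).1
    calc _ = ∫⁻ x, ∑' n : ℤ, ENNReal.ofReal ((2:ℝ)^((n:ℝ) * r)) * ENNReal.ofReal ((min (MM f s x / a / 2^((n:ℝ) * (r / p))) 1)^(q'/(r / p))) := by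
          rw [lintegral_tsum]
          · congr 1; ext n
            rw [lintegral_const_mul' _ _ ENNReal.ofReal_ne_top]
            simp only [div_div]
          · intro n
            refine Measurable.aemeasurable ?_
            fun_prop
      _ ≤ ∫⁻ x, ENNReal.ofReal S * (ENNReal.ofReal (a^p)⁻¹ * ENNReal.ofReal (MM f s x^p)) := by
          refine lintegral_mono fun x => ?_
          refine (hls (MM f s x / a) (div_nonneg (hM0 x) ha.le)).trans (le_of_eq ?_)
          rw [Real.div_rpow (hM0 x) ha.le, div_eq_inv_mul, ENNReal.ofReal_mul (by positivity)]
      _ = ENNReal.ofReal S * (ENNReal.ofReal (a^p)⁻¹ * ∫⁻ x, ENNReal.ofReal (MM f s x^p)) := by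
          rw [lintegral_const_mul' _ _ ENNReal.ofReal_ne_top, lintegral_const_mul' _ _ ENNReal.ofReal_ne_top]
      _ ≤ ENNReal.ofReal S * (ENNReal.ofReal (a^p)⁻¹ * (ENNReal.ofReal A * ENNReal.ofReal (a^p))) := by
          have := (MM_strong hf hs hp).trans (mul_le_mul_right hfa _)
          gcongr
      _ = _ := by
          have : 0 < a^p := by positivity
          rw [← ENNReal.ofReal_mul hA0.le, ← ENNReal.ofReal_mul (by positivity), ← ENNReal.ofReal_mul hS.le]
          congr 1; field_simp
  · intro n
    have hm := MM_meas f s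
    have hset : MeasurableSet {x | a * 2^((n:ℝ) * (r / p)) < MM f s x} := measurableSet_lt measurable_const hm
    rw [← lintegral_indicator_one hset]
    refine lintegral_mono fun x => ?_
    by_cases hx : a * 2^((n:ℝ) * (r / p)) < MM f s x
    · have : (1:ℝ) ≤ MM f s x / (a * 2^((n:ℝ) * (r / p))) := by
        rw [one_le_div (by positivity)]; exact hx.le
      rw [min_eq_right this, Real.one_rpow, ENNReal.ofReal_one]
      exact indicator_le_self' (fun _ _ => zero_le) x
    · rw [indicator_of_notMem (by exact hx)]; exact zero_le

lemma ctl_inf (r q' : ℝ) {s S : ℝ} (hs : 1 ≤ s) {f : ℝ → ℂ} (hf : Nice f) {b : ℝ} (hb : ∀ x, ‖f x‖ ≤ b) :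
    Ctl r q' 0 s S f (2 * b) := by
  refine ⟨fun _ => 2 * b, measurable_const, dom_const hf hs hb, fun _ => 0, by simp, fun n => ?_, fun h => absurd h (lt_irrefl _)⟩
  simp

lemma comb_V {q' κ₂ κ₃ m₂ m₃ : ℝ} (hq : 1 < q') (h2 : 0 ≤ κ₂) (h3 : 0 ≤ κ₃) (h : κ₂ + κ₃ = 1) (hm2 : 0 ≤ m₂) (hm3 : 0 ≤ m₃) (hm2' : m₂ ≤ 1) (hm3' : m₃ ≤ 1) :
    (0 < κ₂ ∧ 0 < κ₃ ∧ (m₂ * m₃)^q' ≤ m₂^(q'/κ₂) + m₃^(q'/κ₃)) ∨ (0 < κ₂ ∧ (m₂ * m₃)^q' ≤ m₂^(q'/κ₂)) ∨ (0 < κ₃ ∧ (m₂ * m₃)^q' ≤ m₃^(q'/κ₃)) := by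
  rcases h2.eq_or_lt with rfl | h2
  · right; right
    have : κ₃ = 1 := by linarith
    subst this
    refine ⟨one_pos, ?_⟩
    rw [div_one]
    exact Real.rpow_le_rpow (by positivity) (mul_le_of_le_one_left hm3 hm2') (by linarith)
  rcases h3.eq_or_lt with rfl | h3
  · right; left
    have : κ₂ = 1 := by linarith
    subst this
    refine ⟨one_pos, ?_⟩
    rw [div_one]
    exact Real.rpow_le_rpow (by positivity) (mul_le_of_le_one_right hm2 hm3') (by linarith)
  left
  refine ⟨h2, h3, ?_⟩
  have hc : (κ₂⁻¹).HolderConjugate κ₃⁻¹ := by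
    rw [Real.holderConjugate_iff]
    exact ⟨(one_lt_inv₀ h2).2 (by linarith), by rw [inv_inv, inv_inv]; exact h⟩
  have := Real.young_inequality_of_nonneg (a := m₂^q') (b := m₃^q') (by positivity) (by positivity) hc
  rw [← Real.rpow_mul hm2, ← Real.rpow_mul hm3, ← div_eq_mul_inv, ← div_eq_mul_inv] at this
  rw [Real.mul_rpow hm2 hm3]
  refine this.trans (add_le_add (div_le_self (by positivity) hc.lt.le) (div_le_self (by positivity) hc.symm.lt.le))

theorem unif_real (β : ℝ) (hβ0 : β ≠ 0) (hβ1 : β ≠ 1) {g : ℝ → ℂ} (hg : BL g) (L : ℝ) (hL : Lok β L)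
    (a : ℕ) (s θ : Fin 3 → ℝ) (ha : 12 ≤ a) (hs1 : ∀ i, 1 < s i) (hs2 : ∀ i, s i ≤ 2)
    (hθ0 : ∀ i, 0 < θ i) (hθ1 : ∀ i, θ i < 1) (hθ : ∑ i, θ i < 1)
    (hσ : ∀ i, 0 < (s i - 1) * θ i - (2 - s i + (12:ℕ) / a) / 2 * (1 - θ i))
    {q q' r κ₂ κ₃ S₂ S₃ : ℝ} (hsq : s 0 < q) (hq : q.HolderConjugate q') (hr : 0 < r) (hκ2 : 0 ≤ κ₂) (hκ3 : 0 ≤ κ₃) (hκ : κ₂ + κ₃ = 1)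
    (hS2 : 0 < S₂) (hS3 : 0 < S₃) :
    ∃ K, 0 < K ∧ ∀ (f₂ f₃ : SchwartzMap ℝ ℂ) (A B δ : ℝ), 0 < A → 0 < B → 0 < δ → Ctl r q' κ₂ (s 1) S₂ f₂ A → Ctl r q' κ₃ (s 2) S₃ f₃ B →
      ∫⁻ x, ENNReal.ofReal (‖Td g β L δ f₂ f₃ x‖^r) ≤ ENNReal.ofReal (K * (A * B)^r) := by
  obtain ⟨Cst, hCst, hform⟩ := form_bound β hβ0 hβ1 hg L hL a s θ ha hs1 hs2 hθ0 hθ1 hθ hσ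
  obtain ⟨K, hK, hlev⟩ := level (hs1 0).le hsq hq hCst
  refine ⟨2^r * ((K + 1) * (S₂ + S₃)), by positivity, ?_⟩
  intro f₂ f₃ A B δ hA hB hδ ⟨M₂, hM2, hD2, I₂, hI2, hv2, hw2⟩ ⟨M₃, hM3, hD3, I₃, hI3, hv3, hw3⟩
  have hM20 : ∀ x, 0 ≤ M₂ x := fun x => (hD2 x).1
  have hM30 : ∀ x, 0 ≤ M₃ x := fun x => (hD3 x).1
  have hP2 := prof_schwartz f₂
  have hP3 := prof_schwartz f₃
  set T : ℝ → ℂ := fun x => Td g β L δ f₂ f₃ x / ((A * B : ℝ) : ℂ) with hT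
  have hAB : 0 < A * B := by positivity
  have hABc : ((A * B : ℝ) : ℂ) ≠ 0 := by exact_mod_cast hAB.ne'
  have hTm : Measurable T := (Td_meas hg.toProf β L δ hP2 hP3).div_const _
  have hTb : ∃ B, ∀ x, ‖T x‖ ≤ B := by
    obtain ⟨C, hC⟩ := Td_bdd hg.toProf β L hδ hP2 hP3
    refine ⟨C / (A * B), fun x => ?_⟩
    rw [hT]; simp only
    rw [norm_div, Complex.norm_real, Real.norm_eq_abs, abs_of_pos hAB]
    gcongr
    exact hC x
  have hlevel : ∀ n : ℤ, volume {x | (2:ℝ)^(n:ℝ) < ‖T x‖} ≤ ENNReal.ofReal (K + 1) * (I₂ n + I₃ n) := by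
    intro n
    set τ₂ := A * 2^((n:ℝ) * κ₂) with hτ2
    set τ₃ := B * 2^((n:ℝ) * κ₃) with hτ3
    have ht2 : 0 < τ₂ := by positivity
    have ht3 : 0 < τ₃ := by positivity
    have hττ : τ₂ * τ₃ = A * B * 2^(n:ℝ) := by
      rw [hτ2, hτ3]
      have : (2:ℝ)^(n:ℝ) = 2^((n:ℝ) * κ₂) * 2^((n:ℝ) * κ₃) := by
        rw [← Real.rpow_add (by norm_num), ← mul_add, hκ, mul_one]
      rw [this]; ring
    set V : ℝ → ℝ := fun x => min (M₂ x / τ₂) 1 * min (M₃ x / τ₃) 1 with hV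
    have hm2 : ∀ x, 0 ≤ min (M₂ x / τ₂) 1 := fun x => le_min (div_nonneg (hM20 x) ht2.le) zero_le_one
    have hm3 : ∀ x, 0 ≤ min (M₃ x / τ₃) 1 := fun x => le_min (div_nonneg (hM30 x) ht3.le) zero_le_one
    set Z : Set ℝ := {x | M₂ x ≤ τ₂ ∧ M₃ x ≤ τ₃} with hZ
    have hZm : MeasurableSet Z := (measurableSet_le hM2 measurable_const).inter (measurableSet_le hM3 measurable_const)
    have h1 := hlev T hTm hTb V (fun x => mul_nonneg (hm2 x) (hm3 x)) (2^(n:ℝ)) (by positivity) Z hZm (by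
      intro f hf hfz
      have := hform f f₂ f₃ hf (MM f (s 0)) M₂ M₃ τ₂ τ₃ Z (MM_dom hf (hs1 0).le) hD2 hD3 hfz (fun x hx => hx.1) (fun x hx => hx.2) δ hδ
      have e1 : ∫ x, f x * T x = (∫ x, f x * Td g β L δ f₂ f₃ x) * ((A * B : ℝ) : ℂ)⁻¹ := by
        rw [← integral_mul_const]
        refine integral_congr_ae (Eventually.of_forall fun x => ?_)
        simp only [hT, div_eq_mul_inv, mul_assoc]
      have e2 : ‖((A * B : ℝ) : ℂ)⁻¹‖ₑ = ENNReal.ofReal (A * B)⁻¹ := by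
        rw [← ofReal_norm, norm_inv, Complex.norm_real, Real.norm_eq_abs, abs_of_pos hAB]
      rw [e1, enorm_mul, e2]
      refine (mul_le_mul_left this _).trans (le_of_eq ?_)
      rw [mul_assoc, ← lintegral_mul_const' _ _ ENNReal.ofReal_ne_top]
      congr 1
      refine lintegral_congr fun x => ?_
      have hM1 := (MM_dom hf (hs1 0).le x).1
      have k2 := le_min (hM20 x) ht2.le
      have k3 := le_min (hM30 x) ht3.le
      rw [← ENNReal.ofReal_mul (by positivity)]
      congr 1
      have e3 : min (M₂ x) τ₂ = τ₂ * min (M₂ x / τ₂) 1 := by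
        rw [mul_min_of_nonneg _ _ ht2.le, mul_div_cancel₀ _ ht2.ne', mul_one]
      have e4 : min (M₃ x) τ₃ = τ₃ * min (M₃ x / τ₃) 1 := by
        rw [mul_min_of_nonneg _ _ ht3.le, mul_div_cancel₀ _ ht3.ne', mul_one]
      rw [e3, e4, hV]
      simp only
      have : MM f (s 0) x * (τ₂ * min (M₂ x / τ₂) 1) * (τ₃ * min (M₃ x / τ₃) 1) * (A * B)⁻¹ = MM f (s 0) x * ((τ₂ * τ₃ * (A * B)⁻¹) * (min (M₂ x / τ₂) 1 * min (M₃ x / τ₃) 1)) := by ring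
      rw [this, hττ]
      congr 2
      field_simp)
    have h2 : ∫⁻ x, ENNReal.ofReal (V x^q') ≤ I₂ n + I₃ n := by
      have hcomb := fun x => comb_V (q' := q') hq.symm.lt hκ2 hκ3 hκ (hm2 x) (hm3 x) (min_le_right _ _) (min_le_right _ _)
      rcases hκ2.eq_or_lt with h | h2
      · subst h
        have h3 : 0 < κ₃ := by linarith
        refine le_trans ?_ ((hw3 h3 n).trans le_add_self)
        refine lintegral_mono fun x => ENNReal.ofReal_le_ofReal ?_
        rcases hcomb x with h | h | h
        · exact absurd h.1 (lt_irrefl _)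
        · exact absurd h.1 (lt_irrefl _)
        · exact h.2
      rcases hκ3.eq_or_lt with h | h3
      · subst h
        refine le_trans ?_ ((hw2 h2 n).trans le_self_add)
        refine lintegral_mono fun x => ENNReal.ofReal_le_ofReal ?_
        rcases hcomb x with h | h | h
        · exact absurd h.2.1 (lt_irrefl _)
        · exact h.2
        · exact absurd h.1 (lt_irrefl _)
      refine le_trans ?_ (add_le_add (hw2 h2 n) (hw3 h3 n))
      rw [← lintegral_add_left (by fun_prop)]
      refine lintegral_mono fun x => ?_
      have g2 : 0 ≤ min (M₂ x / τ₂) 1 ^ (q'/κ₂) := Real.rpow_nonneg (hm2 x) _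
      have g3 : 0 ≤ min (M₃ x / τ₃) 1 ^ (q'/κ₃) := Real.rpow_nonneg (hm3 x) _
      rw [← ENNReal.ofReal_add g2 g3]
      refine ENNReal.ofReal_le_ofReal ?_
      rcases hcomb x with h | h | h
      · exact h.2.2
      · exact h.2.trans (le_add_of_nonneg_right g3)
      · exact h.2.trans (le_add_of_nonneg_left g2)
    have hsub : {x | (2:ℝ)^(n:ℝ) < ‖T x‖} ⊆ ({x | (2:ℝ)^(n:ℝ) < ‖T x‖} ∩ Z) ∪ ({x | τ₂ < M₂ x} ∪ {x | τ₃ < M₃ x}) := by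
      intro x hx
      by_cases hz : x ∈ Z
      · exact Or.inl ⟨hx, hz⟩
      · right
        by_cases hz2 : M₂ x ≤ τ₂
        · right
          by_contra hz3
          exact hz ⟨hz2, not_lt.1 hz3⟩
        · left; exact not_le.1 hz2
    calc _ ≤ _ := measure_mono hsub
      _ ≤ _ := measure_union_le _ _
      _ ≤ ENNReal.ofReal K * (I₂ n + I₃ n) + (I₂ n + I₃ n) := by
          refine add_le_add (h1.trans (mul_le_mul_right h2 _)) ((measure_union_le _ _).trans (add_le_add (hv2 n) (hv3 n)))
      _ = _ := by rw [ENNReal.ofReal_add hK.le zero_le_one, ENNReal.ofReal_one, add_mul, one_mul]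
  have e : ∀ x, ENNReal.ofReal (‖Td g β L δ f₂ f₃ x‖^r) = ENNReal.ofReal ((A * B)^r) * ENNReal.ofReal (‖T x‖^r) := by
    intro x
    rw [← ENNReal.ofReal_mul (by positivity), ← Real.mul_rpow hAB.le (norm_nonneg _)]
    congr 2
    simp only [hT]
    rw [norm_div, Complex.norm_real, Real.norm_eq_abs, abs_of_pos hAB]
    field_simp
  simp_rw [e]
  rw [lintegral_const_mul' _ _ ENNReal.ofReal_ne_top, mul_comm _ ((A * B)^r), ENNReal.ofReal_mul (by positivity)]
  refine mul_le_mul_right ((layer hr hTm).trans ?_) _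
  rw [ENNReal.ofReal_mul (by positivity), ENNReal.ofReal_mul (by positivity)]
  refine mul_le_mul_right ?_ _
  calc _ ≤ ∑' n : ℤ, ENNReal.ofReal (K + 1) * (ENNReal.ofReal ((2:ℝ)^((n:ℝ) * r)) * I₂ n + ENNReal.ofReal ((2:ℝ)^((n:ℝ) * r)) * I₃ n) := by
        refine ENNReal.tsum_le_tsum fun n => (mul_le_mul_right (hlevel n) _).trans (le_of_eq ?_)
        ring
    _ ≤ _ := by
        rw [ENNReal.tsum_mul_left, ENNReal.tsum_add, ENNReal.ofReal_add hS2.le hS3.le]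
        exact mul_le_mul_right (add_le_add hI2 hI3) _

end BHT


namespace BHT

lemma schw_fin (f : SchwartzMap ℝ ℂ) (p : ℝ≥0∞) : eLpNorm f p (volume : Measure ℝ) ≠ ⊤ := (f.eLpNorm_lt_top p volume).ne

lemma schw_bdd_of_top (f : SchwartzMap ℝ ℂ) (x : ℝ) : ‖f x‖ ≤ (eLpNorm f ⊤ volume).toReal := by
  have hfin : eLpNorm f ⊤ volume ≠ ⊤ := schw_fin f ⊤
  set a := (eLpNorm f ⊤ volume).toReal with ha
  have h1 : ∀ᵐ y, ‖f y‖ ≤ a := by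
    filter_upwards [enorm_ae_le_eLpNormEssSup (f : ℝ → ℂ) volume] with y hy
    rw [← eLpNorm_exponent_top] at hy
    have := ENNReal.toReal_mono hfin hy
    rwa [toReal_enorm] at this
  have ho : IsOpen {y | a < ‖f y‖} := isOpen_lt continuous_const f.continuous.norm
  have hz : volume {y | a < ‖f y‖} = 0 := by
    rw [ae_iff] at h1
    simpa [not_le] using h1
  by_contra hx
  have : x ∈ {y | a < ‖f y‖} := not_le.1 hx
  rw [ho.eq_empty_of_measure_zero hz] at this
  exact this

lemma elp_pow {p : ℝ≥0∞} (hp0 : p ≠ 0) (hp : p ≠ ⊤) (F : ℝ → ℂ) :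
    ∫⁻ x, ENNReal.ofReal (‖F x‖^p.toReal) = (eLpNorm F p volume)^p.toReal := by
  have h0 : 0 < p.toReal := ENNReal.toReal_pos hp0 hp
  rw [eLpNorm_eq_lintegral_rpow_enorm_toReal hp0 hp, ← ENNReal.rpow_mul, one_div, inv_mul_cancel₀ h0.ne', ENNReal.rpow_one]
  refine lintegral_congr fun x => ?_
  rw [← ENNReal.ofReal_rpow_of_nonneg (norm_nonneg _) h0.le, ofReal_norm]

lemma ctl_enn {p : ℝ≥0∞} (hp1 : 1 < p) {r q' s : ℝ} (hr : 0 < r) (hq : r < q') (hs : 1 ≤ s) (hps : (p⁻¹).toReal * s < 1) :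
    ∃ S, 0 < S ∧ ∀ f : SchwartzMap ℝ ℂ, 0 < (eLpNorm f p volume).toReal →
      Ctl r q' (r * (p⁻¹).toReal) s S f (2 * (eLpNorm f p volume).toReal) := by
  by_cases hp : p = ⊤
  · subst hp
    refine ⟨1, one_pos, fun f _ => ?_⟩
    simp only [ENNReal.inv_top, ENNReal.toReal_zero, mul_zero]
    exact ctl_inf r q' hs (Nice_schwartz f) (schw_bdd_of_top f)
  · have hp0 : p ≠ 0 := (zero_lt_one.trans hp1).ne'
    have h0 : 0 < p.toReal := ENNReal.toReal_pos hp0 hp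
    rw [ENNReal.toReal_inv] at hps ⊢
    have hsp : s < p.toReal := by
      rwa [inv_mul_lt_iff₀ h0, mul_one] at hps
    obtain ⟨S, hS, h⟩ := ctl_fin (p := p.toReal) hr hq hs hsp
    refine ⟨S, hS, fun f hf => ?_⟩
    rw [← div_eq_mul_inv]
    refine h f (Nice_schwartz f) _ (by positivity) ?_
    rw [elp_pow hp0 hp, ← ENNReal.ofReal_rpow_of_nonneg (by positivity) h0.le]
    refine ENNReal.rpow_le_rpow ?_ h0.le
    rw [← ENNReal.ofReal_toReal (schw_fin f p)]
    exact ENNReal.ofReal_le_ofReal (by simp only [ENNReal.toReal_ofReal ENNReal.toReal_nonneg]; linarith)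

lemma schw_zero {p : ℝ≥0∞} (hp0 : p ≠ 0) (f : SchwartzMap ℝ ℂ) (h : eLpNorm f p volume = 0) (x : ℝ) : f x = 0 := by
  rw [eLpNorm_eq_zero_iff f.continuous.aestronglyMeasurable hp0] at h
  have := (f.continuous.ae_eq_iff_eq volume continuous_zero).1 h
  exact congrFun this x

theorem unif_elp (β : ℝ) (hβ0 : β ≠ 0) (hβ1 : β ≠ 1) {g : ℝ → ℂ} (hg : BL g) (L : ℝ) (hL : Lok β L)
    (p₂ p₃ r : ℝ≥0∞) (hp₂ : 1 < p₂) (hp₃ : 1 < p₃)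
    (hr1 : (2:ℝ≥0∞)/3 < r) (hr2 : r < ⊤)
    (hr : p₂⁻¹ + p₃⁻¹ = r⁻¹) :
    ∃ C : ℝ, 0 < C ∧ ∀ (f₂ f₃ : SchwartzMap ℝ ℂ) (δ : ℝ), 0 < δ →
      eLpNorm (Td g β L δ f₂ f₃) r volume ≤ ENNReal.ofReal C * (eLpNorm f₂ p₂ volume * eLpNorm f₃ p₃ volume) := by
  have hr0 : r ≠ 0 := (zero_le.trans_lt hr1).ne'
  set R := r.toReal with hR
  have hR0 : 0 < R := ENNReal.toReal_pos hr0 hr2.ne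
  have hi : ∀ p : ℝ≥0∞, 1 < p → p⁻¹ ≠ ⊤ ∧ (p⁻¹).toReal < 1 := by
    intro p hp
    have h1 : p⁻¹ < 1 := ENNReal.inv_lt_one.2 hp
    exact ⟨h1.ne_top, by simpa using (ENNReal.toReal_lt_toReal h1.ne_top ENNReal.one_ne_top).2 h1⟩
  have hsum : (p₂⁻¹).toReal + (p₃⁻¹).toReal = R⁻¹ := by
    rw [← ENNReal.toReal_add (hi _ hp₂).1 (hi _ hp₃).1, hr, ENNReal.toReal_inv]
  have hR1 : 2/3 < R := by
    have := (ENNReal.toReal_lt_toReal hr1.ne_top hr2.ne).2 hr1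
    simpa using this
  have hlt : R⁻¹ < 3/2 := by
    rw [inv_lt_comm₀ hR0 (by norm_num)]; linarith
  have hRi : 0 < R⁻¹ := by positivity
  obtain ⟨a, s, θ, q, q', ha, hs1, hs2, hθ0, hθ1, hθ, hσ, hsq, hq, hq', hb2, hb3⟩ := exps (b₂ := (p₂⁻¹).toReal) (b₃ := (p₃⁻¹).toReal)
    ENNReal.toReal_nonneg ENNReal.toReal_nonneg (hi _ hp₂).2 (hi _ hp₃).2 (by rw [hsum]; exact hRi) (by rw [hsum]; exact hlt)
  have hRq : R < q' := by
    rw [hsum, ← div_eq_mul_inv, lt_div_iff₀ hR0, one_mul] at hq'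
    exact hq'
  obtain ⟨S₂, hS2, hc2⟩ := ctl_enn hp₂ hR0 hRq (hs1 1).le hb2
  obtain ⟨S₃, hS3, hc3⟩ := ctl_enn hp₃ hR0 hRq (hs1 2).le hb3
  obtain ⟨K, hK, hu⟩ := unif_real β hβ0 hβ1 hg L hL a s θ ha hs1 hs2 hθ0 hθ1 hθ hσ hsq hq hR0
    (κ₂ := R * (p₂⁻¹).toReal) (κ₃ := R * (p₃⁻¹).toReal) (by positivity) (by positivity)
    (by rw [← mul_add, hsum, mul_inv_cancel₀ hR0.ne']) hS2 hS3
  refine ⟨K^R⁻¹ * 4, by positivity, fun f₂ f₃ δ hδ => ?_⟩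
  have hp20 : p₂ ≠ 0 := (zero_lt_one.trans hp₂).ne'
  have hp30 : p₃ ≠ 0 := (zero_lt_one.trans hp₃).ne'
  by_cases h2 : eLpNorm f₂ p₂ volume = 0
  · have : Td g β L δ f₂ f₃ = 0 := by
      funext x
      simp [Td, schw_zero hp20 f₂ h2]
    rw [this]; simp
  by_cases h3 : eLpNorm f₃ p₃ volume = 0
  · have : Td g β L δ f₂ f₃ = 0 := by
      funext x
      simp [Td, schw_zero hp30 f₃ h3]
    rw [this]; simp
  have t2 := schw_fin f₂ p₂
  have t3 := schw_fin f₃ p₃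
  have a2 := ENNReal.toReal_pos h2 t2
  have a3 := ENNReal.toReal_pos h3 t3
  have := hu f₂ f₃ _ _ δ (by positivity) (by positivity) hδ (hc2 f₂ a2) (hc3 f₃ a3)
  rw [elp_pow hr0 hr2.ne, ← hR] at this
  rw [← ENNReal.ofReal_toReal t2, ← ENNReal.ofReal_toReal t3, ← ENNReal.ofReal_mul a2.le, ← ENNReal.ofReal_mul (by positivity)]
  set A := (eLpNorm f₂ p₂ volume).toReal
  set B := (eLpNorm f₃ p₃ volume).toReal
  rw [← ENNReal.rpow_le_rpow_iff hR0]
  refine this.trans (le_of_eq ?_)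
  rw [ENNReal.ofReal_rpow_of_nonneg (by positivity) hR0.le]
  congr 1
  rw [show K^R⁻¹ * 4 * (A * B) = K^R⁻¹ * (2 * A * (2 * B)) by ring, Real.mul_rpow (x := K^R⁻¹) (by positivity) (by positivity),
    ← Real.rpow_mul hK.le, inv_mul_cancel₀ hR0.ne', Real.rpow_one]

theorem main (β : ℝ) (hβ0 : β ≠ 0) (hβ1 : β ≠ 1)
    (p₂ p₃ r : ℝ≥0∞) (hp₂ : 1 < p₂) (hp₃ : 1 < p₃)
    (hr1 : (2:ℝ≥0∞)/3 < r) (hr2 : r < ⊤)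
    (hr : p₂⁻¹ + p₃⁻¹ = r⁻¹) :
    ∃ C : ℝ, 0 < C ∧ ∀ f₂ f₃ : SchwartzMap ℝ ℂ,
      ∃ T : ℝ → ℂ,
        (∀ x : ℝ, Filter.Tendsto
          (fun ε : ℝ => ∫ t in {t : ℝ | ε < |t|},
            f₂ (x + β * t) * f₃ (x + t) / (t : ℂ))
          (𝓝[>] (0:ℝ)) (𝓝 (T x))) ∧
        eLpNorm T r volume ≤ ENNReal.ofReal C *
          (eLpNorm (⇑f₂) p₂ volume * eLpNorm (⇑f₃) p₃ volume) := by
  obtain ⟨g, hg, hg3⟩ := exists_g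
  obtain ⟨L, hL, hc⟩ := exists_L β hβ0 hβ1 hg.toProf hg3
  set c := ∫ u, (sg u : ℂ) * Psi g β L u with hcdef
  obtain ⟨C, hC, hu⟩ := unif_elp β hβ0 hβ1 hg L hL p₂ p₃ r hp₂ hp₃ hr1 hr2 hr
  have hA : ENNReal.LpAddConst r ≠ ⊤ := (ENNReal.LpAddConst_lt_top r).ne
  set Q := (ENNReal.LpAddConst r).toReal with hQ
  have hc0 : 0 < ‖c‖ := norm_pos_iff.2 hc
  refine ⟨‖c‖⁻¹ * (Q * (C + C)) + 1, by positivity, fun f₂ f₃ => ⟨fun x => ∫ t in Ioi 0, kx f₂ f₃ β x t,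
    fun x => pv_tendsto (prof_schwartz f₂) (prof_schwartz f₃) β x, ?_⟩⟩
  set T : ℝ → ℂ := fun x => ∫ t in Ioi 0, kx f₂ f₃ β x t with hT
  let N := SchwartzMap.compCLMOfContinuousLinearEquiv (F := ℂ) ℝ (ContinuousLinearEquiv.neg ℝ (M := ℝ))
  have hN : ∀ (f : SchwartzMap ℝ ℂ), (N f : ℝ → ℂ) = fun y => f (-y) := fun f => rfl
  have mpn : MeasurePreserving (fun y : ℝ => -y) volume volume := Measure.measurePreserving_neg volume
  have hNn : ∀ (f : SchwartzMap ℝ ℂ) (p : ℝ≥0∞), eLpNorm (N f) p volume = eLpNorm f p volume := by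
    intro f p
    exact eLpNorm_comp_measurePreserving f.continuous.aestronglyMeasurable mpn
  have hm : ∀ (f f' : SchwartzMap ℝ ℂ) n, Measurable (Td g β L (dl n) f f') := fun f f' n =>
    Td_meas hg.toProf β L _ (prof_schwartz f) (prof_schwartz f')
  let D : ℕ → ℝ → ℂ := fun n => Td g β L (dl n) f₂ f₃ - (Td g β L (dl n) (N f₂) (N f₃)) ∘ (fun y : ℝ => -y)
  have hDlim : ∀ x, Tendsto (fun n => D n x) atTop (𝓝 ((c • T) x)) := fun x =>
    Td_tendsto hg.toProf β L (prof_schwartz f₂) (prof_schwartz f₃) x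
  have hDm : ∀ n, AEStronglyMeasurable (D n) volume := fun n =>
    ((hm f₂ f₃ n).sub ((hm (N f₂) (N f₃) n).comp measurable_neg)).aestronglyMeasurable
  have hDb : ∀ n, eLpNorm (D n) r volume ≤ ENNReal.ofReal (Q * (C + C)) * (eLpNorm f₂ p₂ volume * eLpNorm f₃ p₃ volume) := by
    intro n
    have e1 := hu f₂ f₃ (dl n) (dl_pos n)
    have e2 := hu (N f₂) (N f₃) (dl n) (dl_pos n)
    rw [hNn, hNn, ← eLpNorm_comp_measurePreserving (hm (N f₂) (N f₃) n).aestronglyMeasurable mpn] at e2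
    refine (eLpNorm_sub_le' (hm f₂ f₃ n).aestronglyMeasurable ((hm (N f₂) (N f₃) n).comp measurable_neg).aestronglyMeasurable r).trans ?_
    rw [ENNReal.ofReal_mul ENNReal.toReal_nonneg, ENNReal.ofReal_toReal hA, ENNReal.ofReal_add hC.le hC.le, mul_assoc, add_mul]
    exact mul_le_mul_right (add_le_add e1 e2) _
  have hlim := Lp.eLpNorm_lim_le_liminf_eLpNorm (p := r) hDm (c • T) (Eventually.of_forall hDlim)
  have h2 : eLpNorm (c • T) r volume ≤ ENNReal.ofReal (Q * (C + C)) * (eLpNorm f₂ p₂ volume * eLpNorm f₃ p₃ volume) :=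
    hlim.trans (liminf_le_of_frequently_le' (Frequently.of_forall hDb))
  have h3 : eLpNorm T r volume = ENNReal.ofReal (‖c‖⁻¹) * eLpNorm (c • T) r volume := by
    rw [eLpNorm_const_smul, ← mul_assoc, ← ofReal_norm, ← ENNReal.ofReal_mul (by positivity), inv_mul_cancel₀ hc0.ne', ENNReal.ofReal_one, one_mul]
  rw [h3]
  refine (mul_le_mul_right h2 _).trans ?_
  rw [← mul_assoc, ← ENNReal.ofReal_mul (by positivity)]
  exact mul_le_mul_left (ENNReal.ofReal_le_ofReal (by linarith)) _

end BHT

/-- **Bilinear Hilbert transform bounds.** For `β ∉ {0,1}`,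
`1 < p₂,p₃ ≤ ∞` and `2/3 < r < ∞` with `1/p₂ + 1/p₃ = 1/r`, there is a constant `C`
such that for all Schwartz `f₂,f₃` the principal value defining `BHT_β(f₂,f₃)(x)` exists
for every `x` and `‖BHT_β(f₂,f₃)‖_r ≤ C ‖f₂‖_{p₂} ‖f₃‖_{p₃}`. -/
theorem stmt_17 (β : ℝ) (hβ0 : β ≠ 0) (hβ1 : β ≠ 1)
    (p₂ p₃ r : ℝ≥0∞) (hp₂ : 1 < p₂) (hp₃ : 1 < p₃)
    (hr1 : (2:ℝ≥0∞)/3 < r) (hr2 : r < ⊤)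
    (hr : p₂⁻¹ + p₃⁻¹ = r⁻¹) :
    ∃ C : ℝ, 0 < C ∧ ∀ f₂ f₃ : SchwartzMap ℝ ℂ,
      ∃ T : ℝ → ℂ,
        (∀ x : ℝ, Filter.Tendsto
          (fun ε : ℝ => ∫ t in {t : ℝ | ε < |t|},
            f₂ (x + β * t) * f₃ (x + t) / (t : ℂ))
          (𝓝[>] (0:ℝ)) (𝓝 (T x))) ∧
        eLpNorm T r volume ≤ ENNReal.ofReal C *
          (eLpNorm (⇑f₂) p₂ volume * eLpNorm (⇑f₃) p₃ volume) :=
  BHT.main β hβ0 hβ1 p₂ p₃ r hp₂ hp₃ hr1 hr2 hr
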